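/- For every finite field k and every integer n with 2 ≤ n ≤ 5, the rational number h(GL_n(k)) is an integer. -/

import Mathlib

/-- The set of pairs (χ, d) where χ is the character of an irreducible (simple) complex
representation of `G` and `d` is its degree. Distinct irreducible characters correspond to
distinct isomorphism classes, so this set is in bijection with `Irr(G)`. -/
noncomputable def irrCharDegSet (G : Type) [Group G] : Set ((G → ℂ) × ℕ) :=
  {p | ∃ V : FDRep ℂ G, CategoryTheory.Simple V ∧ p.1 = V.character ∧ p.2 = Module.finrank ℂ V}

/-- `h(G)`: the product of the sizes of all conjugacy classes of `G` divided by the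
product of the degrees of all irreducible complex characters of `G`. -/
noncomputable def groupH (G : Type) [Group G] : ℚ :=
  (∏ᶠ c : ConjClasses G, (c.carrier.ncard : ℚ)) / (∏ᶠ p ∈ irrCharDegSet G, (p.2 : ℚ))

set_option linter.unusedSectionVars false

namespace GLSmall

section Characters

variable {G : Type} [Group G]

/-- The set of irreducible complex characters of `G`. -/
def irr (G : Type) [Group G] : Set (G → ℂ) :=
  {f | ∃ V : FDRep ℂ G, CategoryTheory.Simple V ∧ V.character = f}

/-- Functions which are characters of finite-dimensional complex representations. -/
def IsChar (f : G → ℂ) : Prop := ∃ V : FDRep ℂ G, V.character = f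

/-- Class functions. -/
def IsClass (f : G → ℂ) : Prop := ∀ x y, f (x * y) = f (y * x)

theorem IsClass.conj {f : G → ℂ} (hf : IsClass f) (x g : G) : f (x * g * x⁻¹) = f g := by
  rw [hf, inv_mul_cancel_left]

theorem isClass_of_conj {f : G → ℂ} (hf : ∀ x g, f (x * g * x⁻¹) = f g) : IsClass f := by
  intro x y
  have := hf x (y * x)
  rwa [← mul_assoc, mul_inv_cancel_right] at this

theorem IsClass.of_isConj {f : G → ℂ} (hf : IsClass f) {x y : G} (h : IsConj x y) :
    f x = f y := by
  obtain ⟨c, rfl⟩ := isConj_iff.1 h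
  rw [hf.conj]

theorem irr_subset_isChar {f : G → ℂ} (hf : f ∈ irr G) : IsChar f :=
  let ⟨V, _, h⟩ := hf; ⟨V, h⟩

theorem IsChar.isClass {f : G → ℂ} (hf : IsChar f) : IsClass f := by
  obtain ⟨V, rfl⟩ := hf
  intro x y
  exact V.char_mul_comm y x

theorem isChar_of_rep {V : Type} [AddCommGroup V] [Module ℂ V] [Module.Finite ℂ V]
    (ρ : Representation ℂ G V) : IsChar (fun g => LinearMap.trace ℂ V (ρ g)) :=
  ⟨FDRep.of ρ, rfl⟩

theorem IsChar.mul {f h : G → ℂ} (hf : IsChar f) (hh : IsChar h) : IsChar (f * h) := by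
  obtain ⟨V, rfl⟩ := hf
  obtain ⟨W, rfl⟩ := hh
  exact ⟨_, FDRep.char_tensor V W⟩

theorem IsChar.comp {H : Type} [Group H] {f : G → ℂ} (hf : IsChar f) (φ : H →* G) :
    IsChar (fun x => f (φ x)) := by
  obtain ⟨V, rfl⟩ := hf
  exact isChar_of_rep (V.ρ.comp φ)

theorem IsChar.inv {f : G → ℂ} (hf : IsChar f) : IsChar (fun x => f x⁻¹) := by
  obtain ⟨V, rfl⟩ := hf
  refine ⟨FDRep.of (Representation.dual V.ρ), ?_⟩
  ext g
  exact FDRep.char_dual V g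

theorem isChar_hom (φ : G →* ℂ) : IsChar (fun x => φ x) := by
  have := isChar_of_rep (V := ℂ)
    (((Algebra.lmul ℂ ℂ : ℂ →ₐ[ℂ] Module.End ℂ ℂ) : ℂ →* Module.End ℂ ℂ).comp φ)
  convert this using 2 with g
  simp [LinearMap.trace_eq_matrix_trace ℂ (Module.Basis.singleton Unit ℂ), Matrix.trace,
    LinearMap.toMatrix_apply]

variable [Fintype G]

/-- The standard pairing of complex functions on a finite group. -/
noncomputable def pair (f h : G → ℂ) : ℂ := (Nat.card G : ℂ)⁻¹ * ∑ g, f g * h g⁻¹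

theorem pair_comm (f h : G → ℂ) : pair f h = pair h f := by
  unfold pair
  congr 1
  rw [← Equiv.sum_comp (Equiv.inv G)]
  simp [mul_comm]

theorem IsChar.pair_nat {f h : G → ℂ} (hf : IsChar f) (hh : IsChar h) :
    ∃ n : ℕ, pair f h = n := by
  obtain ⟨V, rfl⟩ := hf
  obtain ⟨W, rfl⟩ := hh
  have := invertibleOfNonzero (NeZero.ne (Nat.card G : ℂ))
  exact ⟨_, FDRep.scalar_product_char_eq_finrank_equivariant W V⟩

theorem IsChar.mem_irr_of_pair {f : G → ℂ} (hf : IsChar f) (h : pair f f = 1) : f ∈ irr G := by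
  obtain ⟨V, rfl⟩ := hf
  refine ⟨V, (FDRep.simple_iff_char_is_norm_one V).2 ?_, rfl⟩
  have h0 : (Nat.card G : ℂ) ≠ 0 := NeZero.ne _
  unfold pair at h
  field_simp at h
  exact h

theorem pair_irr_self {f : G → ℂ} (hf : f ∈ irr G) : pair f f = 1 := by
  obtain ⟨V, hV, rfl⟩ := hf
  have := (FDRep.simple_iff_char_is_norm_one V).1 hV
  have h0 : (Nat.card G : ℂ) ≠ 0 := NeZero.ne _
  unfold pair
  rw [this, inv_mul_cancel₀ h0]

theorem pair_irr_ne {f h : G → ℂ} (hf : f ∈ irr G) (hh : h ∈ irr G) (hne : f ≠ h) :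
    pair f h = 0 := by
  obtain ⟨V, hV, rfl⟩ := hf
  obtain ⟨W, hW, rfl⟩ := hh
  have := invertibleOfNonzero (NeZero.ne (Nat.card G : ℂ))
  have := FDRep.char_orthonormal V W
  rw [if_neg] at this
  · exact this
  · rintro ⟨i⟩
    exact hne (FDRep.char_iso i)

theorem irr_inv {f : G → ℂ} (hf : f ∈ irr G) : (fun x => f x⁻¹) ∈ irr G := by
  refine (irr_subset_isChar hf).inv.mem_irr_of_pair ?_
  rw [← pair_irr_self hf]
  unfold pair
  congr 1
  rw [← Equiv.sum_comp (Equiv.inv G)]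
  simp

open MonoidAlgebra in
/-- A class function orthogonal to every irreducible character vanishes. -/
theorem eq_zero_of_forall_irr (f : G → ℂ) (hf : IsClass f)
    (h : ∀ χ ∈ irr G, ∑ g, f g * χ g = 0) : f = 0 := by
  classical
  set e : MonoidAlgebra ℂ G := ∑ g, f g • of ℂ G g with he
  have hcent : ∀ a : MonoidAlgebra ℂ G, e * a = a * e := by
    intro a
    induction a using MonoidAlgebra.induction_on with
    | of x =>
      rw [he, Finset.sum_mul, Finset.mul_sum]
      rw [← Equiv.sum_comp (MulAut.conj x).toEquiv]
      refine Finset.sum_congr rfl fun g _ => ?_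
      have : f (x * g * x⁻¹) = f g := hf.conj x g
      simp only [MulEquiv.toEquiv_eq_coe, EquivLike.coe_coe, MulAut.conj_apply, this,
        smul_mul_assoc, mul_smul_comm, ← map_mul]
      simp
    | add a b ha hb => rw [mul_add, add_mul, ha, hb]
    | smul r a ha => rw [mul_smul_comm, smul_mul_assoc, ha]
  have key : ∀ S : Submodule (MonoidAlgebra ℂ G) (MonoidAlgebra ℂ G),
      IsSimpleModule (MonoidAlgebra ℂ G) S → ∀ s ∈ S, e * s = 0 := by
    intro S hS
    let L : MonoidAlgebra ℂ G →ₐ[ℂ] Module.End ℂ S := Algebra.lsmul ℂ ℂ S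
    let ρ : Representation ℂ G S := (L : MonoidAlgebra ℂ G →* Module.End ℂ S).comp (of ℂ G)
    have hρ : ∀ g (s : S), ρ g s = of ℂ G g • s := fun g s => rfl
    have hbij := IsSimpleModule.algebraMap_end_bijective_of_isAlgClosed ℂ
      (A := MonoidAlgebra ℂ G) (V := S)
    have hscal : ∀ T : S →ₗ[ℂ] S, (∀ g s, T (of ℂ G g • s) = of ℂ G g • T s) →
        ∃ c : ℂ, ∀ s, T s = c • s := by
      intro T hT
      let T' : Module.End (MonoidAlgebra ℂ G) S :=
        { toFun := T
          map_add' := T.map_add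
          map_smul' := by
            intro a s
            induction a using MonoidAlgebra.induction_on with
            | of x => exact hT x s
            | add a b ha hb => rw [add_smul, map_add, ha, hb, RingHom.id_apply, RingHom.id_apply,
                RingHom.id_apply, add_smul]
            | smul r a ha =>
              rw [smul_assoc, map_smul, ha, RingHom.id_apply, RingHom.id_apply, smul_assoc] }
      obtain ⟨c, hc⟩ := hbij.2 T'
      refine ⟨c, fun s => ?_⟩
      have := congrArg (fun F : Module.End (MonoidAlgebra ℂ G) S => F s) hc
      exact this.symm
    have : Nontrivial S := IsSimpleModule.nontrivial (MonoidAlgebra ℂ G) S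
    have hχ : (fun g => LinearMap.trace ℂ S (ρ g)) ∈ irr G := by
      refine (isChar_of_rep ρ).mem_irr_of_pair ?_
      have := invertibleOfNonzero (NeZero.ne (Nat.card G : ℂ))
      have hp := Representation.card_inv_mul_sum_char_mul_char_eq_finrank ρ ρ
      refine hp.trans ?_
      have h1 : Module.finrank ℂ (ρ.IntertwiningMap ρ) = 1 := by
        rw [finrank_eq_one_iff_of_nonzero' (Representation.IntertwiningMap.id ρ)]
        · intro T
          obtain ⟨c, hc⟩ := hscal T.toLinearMap (fun g s => by
            exact Representation.IntertwiningMap.isIntertwining _ _ T g s)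
          refine ⟨c, ?_⟩
          ext s
          simp [hc s]
        · intro h0
          obtain ⟨s, hs⟩ := exists_ne (0 : S)
          apply hs
          have := congrArg (fun F : ρ.IntertwiningMap ρ => F s) h0
          exact this
      rw [h1, Nat.cast_one]
    intro s hs
    obtain ⟨c, hc⟩ := hscal (L e) (fun g s => by
      change e • (of ℂ G g • s) = of ℂ G g • (e • s)
      rw [smul_smul, smul_smul, hcent])
    have htr : LinearMap.trace ℂ S (L e) = 0 := by
      rw [he, map_sum, map_sum, ← h _ hχ]
      simp only [map_smul, smul_eq_mul]
      rfl
    have hLe : L e = c • LinearMap.id := by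
      ext s; simp [hc s]
    rw [hLe, map_smul, LinearMap.trace_id, smul_eq_mul, mul_eq_zero] at htr
    have hc0 : c = 0 := by
      refine htr.resolve_right ?_
      exact_mod_cast (Module.finrank_pos (R := ℂ) (M := S)).ne'
    have := hc ⟨s, hs⟩
    rw [hc0, zero_smul] at this
    exact congrArg Subtype.val this
  have htop : ∀ s : MonoidAlgebra ℂ G, e * s = 0 := by
    intro s
    have : s ∈ sSup {m : Submodule (MonoidAlgebra ℂ G) (MonoidAlgebra ℂ G) |
        IsSimpleModule (MonoidAlgebra ℂ G) m} := by
      rw [IsSemisimpleModule.sSup_simples_eq_top]; trivial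
    rw [sSup_eq_iSup'] at this
    refine Submodule.iSup_induction _ (motive := fun s => e * s = 0) this ?_ (mul_zero _) ?_
    · intro S s hs
      exact key S.1 S.2 s hs
    · intro x y hx hy
      rw [mul_add, hx, hy, add_zero]
  have h1 := htop 1
  rw [mul_one] at h1
  ext g
  have := congrArg (fun a : MonoidAlgebra ℂ G => a.coeff g) h1
  simpa [he, Finsupp.finsetSum_apply, Finsupp.single_apply] using this

theorem linearIndependent_irr : LinearIndependent ℂ (fun χ : irr G => (χ : G → ℂ)) := by
  rw [linearIndependent_iff']
  intro s a ha i hi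
  have : ∑ j ∈ s, a j * pair (j : G → ℂ) i = 0 := by
    have h1 : pair (∑ j ∈ s, a j • (j : G → ℂ)) i = 0 := by
      rw [ha]; simp [pair]
    rw [← h1]
    simp only [pair, Finset.sum_apply, Pi.smul_apply, smul_eq_mul, Finset.sum_mul,
      Finset.mul_sum]
    rw [Finset.sum_comm]
    refine Finset.sum_congr rfl fun _ _ => Finset.sum_congr rfl fun _ _ => by ring
  rw [Finset.sum_eq_single i] at this
  · rwa [pair_irr_self i.2, mul_one] at this
  · intro j _ hj
    rw [pair_irr_ne j.2 i.2 (fun h => hj (Subtype.ext h)), mul_zero]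
  · intro h; exact absurd hi h

instance : Finite (irr G) := linearIndependent_irr.finite

noncomputable instance : Fintype (irr G) := Fintype.ofFinite _

theorem irr_isClass (χ : irr G) : IsClass (χ : G → ℂ) := (irr_subset_isChar χ.2).isClass

theorem pair_irr [DecidableEq (irr G)] (χ φ : irr G) :
    pair (χ : G → ℂ) φ = if χ = φ then 1 else 0 := by
  split_ifs with h
  · rw [h, pair_irr_self φ.2]
  · exact pair_irr_ne χ.2 φ.2 fun h' => h (Subtype.ext h')

theorem pair_sum_left {ι : Type*} (s : Finset ι) (f : ι → G → ℂ) (h : G → ℂ) :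
    pair (fun x => ∑ i ∈ s, f i x) h = ∑ i ∈ s, pair (f i) h := by
  simp only [pair, Finset.sum_mul, Finset.mul_sum]
  rw [Finset.sum_comm]

theorem pair_const_mul_left (a : ℂ) (f h : G → ℂ) :
    pair (fun x => a * f x) h = a * pair f h := by
  simp only [pair, Finset.mul_sum]
  refine Finset.sum_congr rfl fun _ _ => by ring

theorem eq_sum_irr {f : G → ℂ} (hf : IsClass f) (x : G) :
    f x = ∑ χ : irr G, pair f χ * (χ : G → ℂ) x := by
  classical
  have := eq_zero_of_forall_irr (fun x => f x - ∑ χ : irr G, pair f χ * (χ : G → ℂ) x) ?_ ?_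
  · exact sub_eq_zero.1 (congrFun this x)
  · intro x y
    change f _ - _ = f _ - _
    rw [hf x y]
    congr 1
    exact Finset.sum_congr rfl fun χ _ => by rw [irr_isClass χ x y]
  · intro χ hχ
    have hχ' := irr_inv hχ
    have h1 : pair f (fun x => χ x⁻¹) =
        pair (fun x => ∑ χ : irr G, pair f χ * (χ : G → ℂ) x) (fun x => χ x⁻¹) := by
      rw [pair_sum_left]
      simp only [pair_const_mul_left]
      have h2 : ∀ φ : irr G, pair (φ : G → ℂ) (fun x => χ x⁻¹) =
        if φ = ⟨_, hχ'⟩ then 1 else 0 := fun φ => pair_irr φ ⟨_, hχ'⟩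
      simp [h2]
    have h0 : (Nat.card G : ℂ) ≠ 0 := NeZero.ne _
    unfold pair at h1
    rw [mul_right_inj' (inv_ne_zero h0)] at h1
    simp only [inv_inv] at h1
    simp only [sub_mul, Finset.sum_sub_distrib, h1]
    exact sub_self _

theorem card_irr : Fintype.card (irr G) = Nat.card (ConjClasses G) := by
  classical
  let C : Submodule ℂ (G → ℂ) :=
    { carrier := {f | IsClass f}
      add_mem' := fun {f h} hf hh x y => by simp [hf x y, hh x y]
      zero_mem' := fun _ _ => rfl
      smul_mem' := fun a f hf x y => by simp [hf x y] }
  let e : (ConjClasses G → ℂ) ≃ₗ[ℂ] C :=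
    { toFun := fun f => ⟨fun g => f (ConjClasses.mk g), fun x y => by
        apply congrArg f
        rw [ConjClasses.mk_eq_mk_iff_isConj, isConj_iff]
        exact ⟨y, by group⟩⟩
      map_add' := fun _ _ => rfl
      map_smul' := fun _ _ => rfl
      invFun := fun f c => Quotient.liftOn c f.1 (fun a b h => IsClass.of_isConj f.2 h)
      left_inv := fun f => by
        ext c
        induction c using Quotient.inductionOn with
        | h a => rfl
      right_inv := fun f => rfl }
  have hC : Submodule.span ℂ (Set.range (fun χ : irr G => (χ : G → ℂ))) = C := by
    apply le_antisymm
    · rw [Submodule.span_le]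
      rintro _ ⟨χ, rfl⟩
      exact irr_isClass χ
    · intro f hf
      have : f = ∑ χ : irr G, pair f χ • (χ : G → ℂ) := by
        ext x
        rw [eq_sum_irr hf x]
        simp
      rw [this]
      exact Submodule.sum_mem _ fun χ _ =>
        Submodule.smul_mem _ _ (Submodule.subset_span ⟨χ, rfl⟩)
  have h1 := finrank_span_eq_card (linearIndependent_irr (G := G))
  rw [hC, ← e.finrank_eq, Module.finrank_fintype_fun_eq_card] at h1
  rw [← h1, Nat.card_eq_fintype_card]

open Classical in
/-- Column orthogonality. -/
theorem sum_irr_mul (g h : G) :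
    ∑ χ : irr G, (χ : G → ℂ) g * (χ : G → ℂ) h⁻¹ =
      ∑ x : G, if x * g * x⁻¹ = h then 1 else 0 := by
  have hf : IsClass (fun g : G => ∑ x : G, if x * g * x⁻¹ = h then (1 : ℂ) else 0) := by
    apply isClass_of_conj
    intro y g
    rw [← Equiv.sum_comp (Equiv.mulRight y⁻¹)]
    refine Finset.sum_congr rfl fun x _ => ?_
    simp [mul_assoc]
  rw [eq_sum_irr hf g]
  refine Finset.sum_congr rfl fun χ _ => ?_
  rw [mul_comm]
  congr 1
  have h0 : (Nat.card G : ℂ) ≠ 0 := NeZero.ne _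
  rw [pair, eq_comm, inv_mul_eq_iff_eq_mul₀ h0]
  simp only [Finset.sum_mul]
  rw [Finset.sum_comm]
  have : ∀ x : G, ∑ g : G, (if x * g * x⁻¹ = h then (1 : ℂ) else 0) * (χ : G → ℂ) g⁻¹ =
      (χ : G → ℂ) h⁻¹ := by
    intro x
    rw [Finset.sum_eq_single (x⁻¹ * h * x)]
    · rw [if_pos (by group), one_mul]
      have := (irr_isClass χ).conj x⁻¹ h⁻¹
      rw [← this]
      group
    · intro g _ hg
      rw [if_neg, zero_mul]
      rintro rfl
      exact hg (by group)
    · simp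
  rw [Finset.sum_congr rfl fun x _ => this x]
  simp

theorem irr_one_nat (χ : irr G) : ∃ n : ℕ, 0 < n ∧ (χ : G → ℂ) 1 = n := by
  obtain ⟨f, V, hV, rfl⟩ := χ
  refine ⟨_, ?_, FDRep.char_one V⟩
  by_contra h0
  have h0 : Module.finrank ℂ V = 0 := by omega
  have hs := Module.finrank_zero_iff.1 h0
  have h1 := pair_irr_self (G := G) ⟨V, hV, rfl⟩
  have h2 : V.character = 0 := by
    ext g
    have : V.ρ g = 0 := by ext v; exact Subsingleton.elim _ _
    simp [FDRep.character, this]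
  rw [h2] at h1
  simp [pair] at h1

open Classical in
/-- The bilinear form of two restriction functionals, as a sum over the group. -/
theorem sum_pair_mul_pair {P Q : Type} [Group P] [Group Q] [Fintype P] [Fintype Q]
    (i : P → G) (j : Q →* G) (F : P → ℂ) (H : Q → ℂ) :
    ∑ χ : irr G, pair (fun t => (χ : G → ℂ) (i t)) F * pair (fun t => (χ : G → ℂ) (j t)) H =
      (Nat.card P : ℂ)⁻¹ * (Nat.card Q : ℂ)⁻¹ * ∑ x : G, ∑ t : P, ∑ u : Q,
        if x * i t * x⁻¹ = j u then F t⁻¹ * H u else 0 := by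
  simp only [fun χ : irr G => pair_comm (fun t => (χ : G → ℂ) (j t)) H]
  simp only [pair]
  have : ∀ χ : irr G, ((Nat.card P : ℂ)⁻¹ * ∑ g, (χ : G → ℂ) (i g) * F g⁻¹) *
      ((Nat.card Q : ℂ)⁻¹ * ∑ g, H g * (χ : G → ℂ) (j g⁻¹)) =
      (Nat.card P : ℂ)⁻¹ * (Nat.card Q : ℂ)⁻¹ * ∑ t : P, ∑ u : Q,
        ((χ : G → ℂ) (i t) * (χ : G → ℂ) (j u)⁻¹) * (F t⁻¹ * H u) := by
    intro χ
    rw [mul_mul_mul_comm, Finset.sum_mul_sum]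
    congr 1
    refine Finset.sum_congr rfl fun t _ => Finset.sum_congr rfl fun u _ => ?_
    rw [map_inv]; ring
  simp only [this]
  rw [← Finset.mul_sum]
  congr 1
  rw [Finset.sum_comm, Finset.sum_comm (s := (Finset.univ : Finset G))]
  refine Finset.sum_congr rfl fun t _ => ?_
  rw [Finset.sum_comm, Finset.sum_comm (s := (Finset.univ : Finset G))]
  refine Finset.sum_congr rfl fun u _ => ?_
  rw [← Finset.sum_mul, sum_irr_mul, Finset.sum_mul]
  refine Finset.sum_congr rfl fun x _ => ?_
  split_ifs <;> simp

end Characters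

section DoubleCosets

open scoped BigOperators

theorem pair_eq_expect {G : Type} [Group G] [Fintype G] (f h : G → ℂ) :
    pair f h = 𝔼 g, f g * h g⁻¹ := by
  rw [Fintype.expect_eq_sum_div_card, pair, Nat.card_eq_fintype_card, div_eq_inv_mul]

variable {G P Q : Type} [Group G] [Group P] [Group Q] [Fintype G] [Fintype P] [Fintype Q]

open Classical in
/-- The contribution of `x` to the pairing of two functions induced from `P` and `Q`. -/
noncomputable def contrib (i : P →* G) (j : Q →* G) (F : P → ℂ) (H : Q → ℂ) (x : G) : ℂ :=
  ∑ t : P, ∑ u : Q, if x * i t * x⁻¹ = j u then F t⁻¹ * H u else 0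

theorem contrib_mul {i : P →* G} {j : Q →* G} {F : P → ℂ} {H : Q → ℂ} (hF : IsClass F)
    (hH : IsClass H) (x : G) (p : P) (v : Q) :
    contrib i j F H (j v * x * i p) = contrib i j F H x := by
  unfold contrib
  rw [← Equiv.sum_comp (MulAut.conj p⁻¹).toEquiv]
  refine Finset.sum_congr rfl fun t _ => ?_
  rw [← Equiv.sum_comp (MulAut.conj v).toEquiv]
  refine Finset.sum_congr rfl fun u _ => ?_
  have h1 : F (p⁻¹ * t * p⁻¹⁻¹)⁻¹ = F t⁻¹ := by
    rw [← hF.conj p⁻¹ t⁻¹]; congr 1; group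
  have h2 : H (v * u * v⁻¹) = H u := hH.conj _ _
  simp only [MulEquiv.toEquiv_eq_coe, EquivLike.coe_coe, MulAut.conj_apply, h1, h2]
  congr 1
  rw [eq_iff_iff]
  simp only [map_mul, map_inv]
  constructor
  · intro h
    have := congrArg (fun y => (j v)⁻¹ * y * j v) h
    simpa [mul_assoc] using this
  · intro h
    rw [← h]; group

open Classical in
theorem card_orbit_fiber (i : P →* G) (j : Q →* G) (w x : G) :
    (Finset.univ.filter fun z : P × Q => j z.2 * w * i z.1 = x).card =
      if ∃ p v, j v * w * i p = x then
        (Finset.univ.filter fun z : P × Q => w * i z.1 = j z.2 * w).card else 0 := by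
  split_ifs with h
  · obtain ⟨p, v, rfl⟩ := h
    symm
    refine Finset.card_bij (fun z _ => (z.1 * p, v * z.2⁻¹)) ?_ ?_ ?_
    · rintro ⟨a, b⟩ h
      simp only [Finset.mem_filter, Finset.mem_univ, true_and] at h ⊢
      rw [map_mul, map_mul, map_inv, mul_assoc _ w, ← mul_assoc w, h]
      group
    · rintro ⟨a, b⟩ _ ⟨a', b'⟩ _ h
      simpa using h
    · rintro ⟨a, b⟩ h
      simp only [Finset.mem_filter, Finset.mem_univ, true_and] at h
      refine ⟨(a * p⁻¹, b⁻¹ * v), ?_, by simp⟩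
      simp only [Finset.mem_filter, Finset.mem_univ, true_and, map_mul, map_inv]
      rw [← mul_assoc, mul_inv_eq_iff_eq_mul, mul_assoc (_ * _) _ (i p), mul_assoc _ (j v),
        eq_inv_mul_iff_mul_eq, ← mul_assoc, ← mul_assoc]
      exact h
  · rw [Finset.card_eq_zero, Finset.filter_eq_empty_iff]
    rintro ⟨a, b⟩ _ h'
    exact h ⟨a, b, h'⟩

theorem sum_contrib {E : Type} [Fintype E] (i : P →* G) (j : Q →* G) {F : P → ℂ} {H : Q → ℂ}
    (hF : IsClass F) (hH : IsClass H) (w : E → G) (R : E → Type) [∀ e, Fintype (R e)]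
    (p : ∀ e, R e → P) (v : ∀ e, R e → Q)
    (hinj : ∀ e, Function.Injective fun r => (p e r, v e r))
    (hR : ∀ e a b, w e * i a = j b * w e ↔ ∃ r, p e r = a ∧ v e r = b)
    (hE : ∀ x, contrib i j F H x ≠ 0 → ∃! e, ∃ a b, j b * w e * i a = x) :
    ∑ x, contrib i j F H x = Fintype.card P * Fintype.card Q *
      ∑ e, 𝔼 r, F (p e r)⁻¹ * H (v e r) := by
  classical
  have hcard : ∀ e, (Finset.univ.filter fun z : P × Q => w e * i z.1 = j z.2 * w e) =
      Finset.univ.image fun r => (p e r, v e r) := by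
    intro e
    ext ⟨a, b⟩
    simp [hR]
  have hw : ∀ e, contrib i j F H (w e) = ∑ r, F (p e r)⁻¹ * H (v e r) := by
    intro e
    unfold contrib
    rw [← Finset.sum_product' (f := fun t u => if w e * i t * (w e)⁻¹ = j u
      then F t⁻¹ * H u else 0), ← Finset.sum_filter]
    rw [show (Finset.univ ×ˢ Finset.univ).filter (fun z : P × Q => w e * i z.1 * (w e)⁻¹ = j z.2) =
      Finset.univ.image fun r => (p e r, v e r) from ?_, Finset.sum_image]
    · intro a _ b _ h; exact hinj e h
    · rw [← hcard]
      ext z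
      simp [mul_inv_eq_iff_eq_mul]
  have hpos : ∀ e, (Fintype.card (R e) : ℂ) ≠ 0 := by
    intro e
    obtain ⟨r, -⟩ := (hR e 1 1).1 (by simp)
    have : Nonempty (R e) := ⟨r⟩
    exact_mod_cast Fintype.card_ne_zero
  have hfib : ∀ e, ∑ z : P × Q, contrib i j F H (j z.2 * w e * i z.1) =
      ∑ x, if ∃ a b, j b * w e * i a = x then
        (Fintype.card (R e) : ℂ) * contrib i j F H x else 0 := by
    intro e
    rw [← Finset.sum_fiberwise (s := Finset.univ) (g := fun z : P × Q => j z.2 * w e * i z.1)]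
    refine Finset.sum_congr rfl fun x _ => ?_
    rw [Finset.sum_congr rfl (g := fun _ => contrib i j F H x)]
    · rw [Finset.sum_const, card_orbit_fiber, hcard, Finset.card_image_of_injective _ (hinj e)]
      split_ifs <;> simp
    · intro z hz
      rw [(Finset.mem_filter.1 hz).2]
  have hconst : ∀ e, ∑ z : P × Q, contrib i j F H (j z.2 * w e * i z.1) =
      Fintype.card P * Fintype.card Q * ∑ r, F (p e r)⁻¹ * H (v e r) := by
    intro e
    simp only [contrib_mul hF hH, hw]
    simp
  have h1 : ∀ e, Fintype.card P * Fintype.card Q * (𝔼 r, F (p e r)⁻¹ * H (v e r)) =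
      ∑ x, if ∃ a b, j b * w e * i a = x then contrib i j F H x else 0 := by
    intro e
    rw [Fintype.expect_eq_sum_div_card, ← mul_div_assoc, ← hconst, hfib, div_eq_iff (hpos e),
      Finset.sum_mul]
    refine Finset.sum_congr rfl fun x _ => ?_
    split_ifs <;> ring
  rw [Finset.mul_sum, Finset.sum_congr rfl fun e _ => h1 e, Finset.sum_comm]
  refine Finset.sum_congr rfl fun x _ => ?_
  by_cases hx : contrib i j F H x = 0
  · simp [hx]
  · obtain ⟨e, he, hu⟩ := hE x hx
    rw [Finset.sum_eq_single e, if_pos he]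
    · intro e' _ hne
      rw [if_neg]
      exact fun h => hne (hu e' h)
    · simp

/-- Mackey formula for a sum over irreducible characters. -/
theorem mackey {E : Type} [Fintype E] (i : P →* G) (j : Q →* G) {F : P → ℂ} {H : Q → ℂ}
    (hF : IsClass F) (hH : IsClass H) (w : E → G) (R : E → Type) [∀ e, Fintype (R e)]
    (p : ∀ e, R e → P) (v : ∀ e, R e → Q)
    (hinj : ∀ e, Function.Injective fun r => (p e r, v e r))
    (hR : ∀ e a b, w e * i a = j b * w e ↔ ∃ r, p e r = a ∧ v e r = b)
    (hE : ∀ x, contrib i j F H x ≠ 0 → ∃! e, ∃ a b, j b * w e * i a = x) :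
    ∑ χ : irr G, pair (fun t => (χ : G → ℂ) (i t)) F * pair (fun t => (χ : G → ℂ) (j t)) H =
      ∑ e, 𝔼 r, F (p e r)⁻¹ * H (v e r) := by
  rw [sum_pair_mul_pair]
  have := sum_contrib i j hF hH w R p v hinj hR hE
  unfold contrib at this
  rw [this, Nat.card_eq_fintype_card, Nat.card_eq_fintype_card]
  have h1 : (Fintype.card P : ℂ) ≠ 0 := by exact_mod_cast Fintype.card_ne_zero
  have h2 : (Fintype.card Q : ℂ) ≠ 0 := by exact_mod_cast Fintype.card_ne_zero
  field_simp

end DoubleCosets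

end GLSmall

namespace GLSmall

open scoped BigOperators
open Matrix

section Parabolic

variable (k : Type) [Field k]

/-- The block upper triangular subgroup of `GL (ι ⊕ κ) k`. -/
@[ext]
structure Par (ι κ : Type) [Fintype ι] [DecidableEq ι] [Fintype κ] [DecidableEq κ] where
  a : GL ι k
  u : Matrix ι κ k
  d : GL κ k

variable {k} {ι κ lam : Type} [Fintype ι] [DecidableEq ι] [Fintype κ] [DecidableEq κ]
  [Fintype lam] [DecidableEq lam]

namespace Par

instance : Mul (Par k ι κ) := ⟨fun s t => ⟨s.a * t.a, s.a.1 * t.u + s.u * t.d.1, s.d * t.d⟩⟩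
instance : One (Par k ι κ) := ⟨⟨1, 0, 1⟩⟩
instance : Inv (Par k ι κ) := ⟨fun s => ⟨s.a⁻¹, -((s.a⁻¹).1 * s.u * (s.d⁻¹).1), s.d⁻¹⟩⟩

@[simp] theorem mul_a (s t : Par k ι κ) : (s * t).a = s.a * t.a := rfl
@[simp] theorem mul_u (s t : Par k ι κ) : (s * t).u = s.a.1 * t.u + s.u * t.d.1 := rfl
@[simp] theorem mul_d (s t : Par k ι κ) : (s * t).d = s.d * t.d := rfl
@[simp] theorem one_a : (1 : Par k ι κ).a = 1 := rfl
@[simp] theorem one_u : (1 : Par k ι κ).u = 0 := rfl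
@[simp] theorem one_d : (1 : Par k ι κ).d = 1 := rfl
@[simp] theorem inv_a (s : Par k ι κ) : (s⁻¹).a = s.a⁻¹ := rfl
@[simp] theorem inv_d (s : Par k ι κ) : (s⁻¹).d = s.d⁻¹ := rfl
@[simp] theorem inv_u (s : Par k ι κ) : (s⁻¹).u = -((s.a⁻¹).1 * s.u * (s.d⁻¹).1) := rfl

instance : Group (Par k ι κ) := Group.ofLeftAxioms
  (fun s t v => by
    ext1
    · simp [mul_assoc]
    · simp [Matrix.mul_add, Matrix.add_mul, Matrix.mul_assoc, add_assoc]
    · simp [mul_assoc])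
  (fun s => by ext1 <;> simp)
  (fun s => by
    ext1
    · simp
    · simp only [mul_u, inv_u, inv_a, one_u, Matrix.neg_mul, Matrix.mul_assoc]
      rw [← Units.val_mul, inv_mul_cancel]
      simp
    · simp)

/-- The equivalence of a block triangular group with triples of blocks. -/
def equivProd : Par k ι κ ≃ GL ι k × Matrix ι κ k × GL κ k where
  toFun s := (s.a, s.u, s.d)
  invFun t := ⟨t.1, t.2.1, t.2.2⟩
  left_inv _ := rfl
  right_inv _ := rfl

instance [Fintype k] [DecidableEq k] : Fintype (Par k ι κ) := Fintype.ofEquiv _ equivProd.symm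

/-- Projection to the first diagonal block. -/
def homA : Par k ι κ →* GL ι k where
  toFun s := s.a
  map_one' := rfl
  map_mul' _ _ := rfl

/-- Projection to the second diagonal block. -/
def homD : Par k ι κ →* GL κ k where
  toFun s := s.d
  map_one' := rfl
  map_mul' _ _ := rfl

/-- Inclusion in the general linear group. -/
def emb : Par k ι κ →* GL (ι ⊕ κ) k :=
  MonoidHom.toHomUnits
    { toFun := fun s => fromBlocks s.a.1 s.u 0 s.d.1
      map_one' := by simp
      map_mul' := fun s t => by simp [fromBlocks_multiply] }

@[simp] theorem emb_val (s : Par k ι κ) : (emb s).1 = fromBlocks s.a.1 s.u 0 s.d.1 := rfl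

theorem emb_injective : Function.Injective (emb : Par k ι κ → _) := by
  intro s t h
  have := congrArg Units.val h
  simp only [emb_val] at this
  obtain ⟨h1, h2, -, h3⟩ := fromBlocks_inj.1 this
  exact Par.ext (Units.ext h1) h2 (Units.ext h3)

theorem mem_range_emb (g : GL (ι ⊕ κ) k) : (∃ s : Par k ι κ, emb s = g) ↔ g.1.toBlocks₂₁ = 0 := by
  constructor
  · rintro ⟨s, rfl⟩
    simp
  · intro h
    have hg : g.1 = fromBlocks g.1.toBlocks₁₁ g.1.toBlocks₁₂ 0 g.1.toBlocks₂₂ := by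
      rw [← h, fromBlocks_toBlocks]
    have hdet : IsUnit g.1.det := (Matrix.isUnit_iff_isUnit_det _).1 g.isUnit
    rw [hg, det_fromBlocks_zero₂₁, IsUnit.mul_iff] at hdet
    refine ⟨⟨GeneralLinearGroup.mk'' _ hdet.1, g.1.toBlocks₁₂,
      GeneralLinearGroup.mk'' _ hdet.2⟩, Units.ext ?_⟩
    rw [emb_val]
    exact hg.symm

end Par

/-- Relabelling of the index set of a general linear group. -/
def rel (e : ι ≃ κ) : GL ι k ≃* GL κ k :=
  Units.mapEquiv (Matrix.reindexAlgEquiv k k e).toMulEquiv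

@[simp] theorem rel_val (e : ι ≃ κ) (g : GL ι k) : (rel e g).1 = g.1.submatrix e.symm e.symm := rfl

theorem rel_rel (e : ι ≃ κ) (e' : κ ≃ lam) (g : GL ι k) :
    rel e' (rel e g) = rel (e.trans e') g := Units.ext rfl

/-- Permutation matrices. -/
def perm (e : ι ≃ ι) : GL ι k where
  val := (1 : Matrix ι ι k).submatrix e.symm id
  inv := (1 : Matrix ι ι k).submatrix id e.symm
  val_inv := by
    ext i j
    simp [Matrix.mul_apply, Matrix.one_apply]
  inv_val := by
    rw [Matrix.submatrix_mul_equiv]; simp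

theorem perm_mul_rel (e : ι ≃ ι) (g : GL ι k) : perm e * g * (perm e)⁻¹ = rel e g := by
  rw [mul_inv_eq_iff_eq_mul]
  apply Units.ext
  ext i j
  simp [perm, Matrix.mul_apply, Matrix.one_apply]
  rw [Finset.sum_eq_single (e j)]
  · simp
  · intro b _ hb
    rw [if_neg]
    rintro rfl
    simp at hb
  · simp

theorem IsClass.rel_eq {f : GL κ k → ℂ} (hf : IsClass f) (e e' : ι ≃ κ) (g : GL ι k) :
    f (rel e g) = f (rel e' g) := by
  have : rel e g = rel (e'.symm.trans e) (rel e' g) := by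
    rw [rel_rel, ← Equiv.trans_assoc, Equiv.self_trans_symm, Equiv.refl_trans]
  rw [this, ← perm_mul_rel, hf.conj]

end Parabolic

section Mackey

variable {k : Type} [Field k]
variable {ι κ ν ι' κ' A B C D : Type} [Fintype ι] [DecidableEq ι] [Fintype κ] [DecidableEq κ]
  [Fintype ν] [DecidableEq ν] [Fintype ι'] [DecidableEq ι'] [Fintype κ'] [DecidableEq κ']
  [Fintype A] [DecidableEq A] [Fintype B] [DecidableEq B] [Fintype C] [DecidableEq C]
  [Fintype D] [DecidableEq D]

/-- A parabolic subgroup of `GL ν k` attached to a decomposition of `ν`. -/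
def pe (e : ι ⊕ κ ≃ ν) : Par k ι κ →* GL ν k := (rel e).toMonoidHom.comp Par.emb

theorem pe_apply (e : ι ⊕ κ ≃ ν) (s : Par k ι κ) : pe e s = rel e s.emb := rfl

theorem pe_injective (e : ι ⊕ κ ≃ ν) : Function.Injective (pe e : Par k ι κ → _) :=
  (rel e).injective.comp Par.emb_injective

theorem mem_range_pe (e : ι ⊕ κ ≃ ν) (g : GL ν k) :
    (∃ s : Par k ι κ, pe e s = g) ↔ ∀ p q, g.1 (e (.inr p)) (e (.inl q)) = 0 := by
  have h1 : (∃ s : Par k ι κ, pe e s = g) ↔ ∃ s : Par k ι κ, s.emb = rel e.symm g := by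
    refine exists_congr fun s => ?_
    rw [pe_apply]
    constructor
    · rintro rfl
      rw [rel_rel]
      exact Units.ext (by simp)
    · intro h
      rw [h, rel_rel]
      exact Units.ext (by simp)
  rw [h1, Par.mem_range_emb]
  constructor
  · intro h p q
    exact congrFun (congrFun h p) q
  · intro h
    ext p q
    exact h p q

/-- Relative position data for two decompositions of an index set. -/
structure Pos (ι κ ι' κ' A B C D : Type) where
  e1 : A ⊕ B ≃ ι
  e2 : C ⊕ D ≃ κ
  e3 : A ⊕ C ≃ ι'
  e4 : B ⊕ D ≃ κ'

namespace Pos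

/-- The permutation representing a double coset. -/
def sig (z : Pos ι κ ι' κ' A B C D) (e : ι ⊕ κ ≃ ν) (e' : ι' ⊕ κ' ≃ ν) : ν ≃ ν :=
  ((e.symm.trans (z.e1.sumCongr z.e2).symm).trans (Equiv.sumSumSumComm A B C D)).trans
    ((z.e3.sumCongr z.e4).trans e')

/-- Parameters of the intersection of two parabolic subgroups. -/
abbrev R (k : Type) [Field k] (A B C D : Type) [Fintype A] [DecidableEq A] [Fintype B]
    [DecidableEq B] [Fintype C] [DecidableEq C] [Fintype D] [DecidableEq D] :=
  (GL A k × GL B k × GL C k × GL D k) ×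
    (Matrix A B k × Matrix C D k × Matrix A C k × Matrix B D k × Matrix A D k)

/-- The intersection as a subset of the first parabolic. -/
def r1 (z : Pos ι κ ι' κ' A B C D) (r : R k A B C D) : Par k ι κ :=
  ⟨pe z.e1 ⟨r.1.1, r.2.1, r.1.2.1⟩,
    (fromBlocks r.2.2.2.1 r.2.2.2.2.2 0 r.2.2.2.2.1).submatrix z.e1.symm z.e2.symm,
    pe z.e2 ⟨r.1.2.2.1, r.2.2.1, r.1.2.2.2⟩⟩

/-- The intersection as a subset of the second parabolic. -/
def r2 (z : Pos ι κ ι' κ' A B C D) (r : R k A B C D) : Par k ι' κ' :=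
  ⟨pe z.e3 ⟨r.1.1, r.2.2.2.1, r.1.2.2.1⟩,
    (fromBlocks r.2.1 r.2.2.2.2.2 0 r.2.2.1).submatrix z.e3.symm z.e4.symm,
    pe z.e4 ⟨r.1.2.1, r.2.2.2.2.1, r.1.2.2.2⟩⟩

theorem rel_sig (z : Pos ι κ ι' κ' A B C D) (e : ι ⊕ κ ≃ ν) (e' : ι' ⊕ κ' ≃ ν)
    (r : R k A B C D) : rel (z.sig e e') (pe e (z.r1 r)) = pe e' (z.r2 r) := by
  apply Units.ext
  ext p q
  obtain ⟨p, rfl⟩ := ((z.e3.sumCongr z.e4).trans e').surjective p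
  obtain ⟨q, rfl⟩ := ((z.e3.sumCongr z.e4).trans e').surjective q
  rcases p with (p | p) | (p | p) <;> rcases q with (q | q) | (q | q) <;>
    simp [sig, pe_apply, r1, r2]

theorem r_injective (z : Pos ι κ ι' κ' A B C D) :
    Function.Injective fun r : R k A B C D => (z.r1 r, z.r2 r) := by
  rintro ⟨⟨a, b, c, d⟩, ab, cd, ac, bd, ad⟩ ⟨⟨a', b', c', d'⟩, ab', cd', ac', bd', ad'⟩ h
  simp only [Prod.mk.injEq, r1, r2, Par.mk.injEq, (pe_injective _).eq_iff] at h ⊢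
  obtain ⟨⟨⟨h1, h2, h3⟩, h4, ⟨h5, h6, h7⟩⟩, -⟩ := h
  have h8 := congrArg (fun M => M.submatrix z.e1 z.e2) h4
  simp only [submatrix_submatrix, Equiv.symm_comp_self, submatrix_id_id] at h8
  obtain ⟨h9, h10, -, h11⟩ := fromBlocks_inj.1 h8
  exact ⟨⟨h1, h3, h5, h7⟩, h2, h6, h9, h11, h10⟩

theorem rel_sig_iff (z : Pos ι κ ι' κ' A B C D) (e : ι ⊕ κ ≃ ν) (e' : ι' ⊕ κ' ≃ ν)
    (a : Par k ι κ) (b : Par k ι' κ') :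
    rel (z.sig e e') (pe e a) = pe e' b ↔ ∃ r : R k A B C D, z.r1 r = a ∧ z.r2 r = b := by
  constructor
  · intro h
    have h0 : ∀ p q, (a.emb).1 (z.e1.sumCongr z.e2 ((Equiv.sumSumSumComm A B C D).symm p))
        (z.e1.sumCongr z.e2 ((Equiv.sumSumSumComm A B C D).symm q)) =
        (b.emb).1 (z.e3.sumCongr z.e4 p) (z.e3.sumCongr z.e4 q) := by
      intro p q
      have := congrArg (fun g : GL ν k => g.1 (e' (z.e3.sumCongr z.e4 p))
        (e' (z.e3.sumCongr z.e4 q))) h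
      simpa [sig, pe_apply] using this
    obtain ⟨s, hs⟩ := (mem_range_pe z.e1 a.a).2 fun p q => by
      simpa using h0 (.inr (.inl p)) (.inl (.inl q))
    obtain ⟨t, ht⟩ := (mem_range_pe z.e2 a.d).2 fun p q => by
      simpa using h0 (.inr (.inr p)) (.inl (.inr q))
    let U := a.u.submatrix z.e1 z.e2
    have hU : U.toBlocks₂₁ = 0 := by
      ext p q
      simpa [U, toBlocks₂₁] using h0 (.inr (.inl p)) (.inl (.inr q))
    let r : R k A B C D := ((s.a, s.d, t.a, t.d), s.u, t.u, U.toBlocks₁₁, U.toBlocks₂₂,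
      U.toBlocks₁₂)
    have hr : z.r1 r = a := by
      apply Par.ext hs ?_ ht
      change (fromBlocks U.toBlocks₁₁ U.toBlocks₁₂ 0 U.toBlocks₂₂).submatrix _ _ = _
      rw [← hU, fromBlocks_toBlocks]
      simp [U]
    refine ⟨r, hr, pe_injective e' ?_⟩
    rw [← rel_sig z e, hr, h]
  · rintro ⟨r, rfl, rfl⟩
    exact rel_sig z e e' r

theorem perm_sig_iff (z : Pos ι κ ι' κ' A B C D) (e : ι ⊕ κ ≃ ν) (e' : ι' ⊕ κ' ≃ ν)
    (a : Par k ι κ) (b : Par k ι' κ') :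
    perm (z.sig e e') * pe e a = pe e' b * perm (z.sig e e') ↔
      ∃ r : R k A B C D, z.r1 r = a ∧ z.r2 r = b := by
  rw [← z.rel_sig_iff e e', ← perm_mul_rel, mul_inv_eq_iff_eq_mul]

end Pos

theorem exists_linearIndependent_span {V : Type} [AddCommGroup V] [Module k V]
    [FiniteDimensional k V] (W : Submodule k V) : ∃ (a : ℕ) (v : Fin a → V),
      LinearIndependent k v ∧ Submodule.span k (Set.range v) = W := by
  refine ⟨_, fun i => (Module.finBasis k W i : V), ?_, ?_⟩
  · exact (Module.finBasis k W).linearIndependent.map' W.subtype (Submodule.ker_subtype W)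
  · have := congrArg (Submodule.map W.subtype) (Module.finBasis k W).span_eq
    rw [Submodule.map_span, ← Set.range_comp, Submodule.map_top, Submodule.range_subtype] at this
    exact this

theorem linearIndependent_sumElim {V α β : Type} [AddCommGroup V] [Module k V]
    {P Q : Submodule k V} (hPQ : Disjoint P Q) {v : α → V} {w : β → V}
    (hv : LinearIndependent k v) (hw : LinearIndependent k w)
    (hv' : Submodule.span k (Set.range v) = P) (hw' : Submodule.span k (Set.range w) = Q) :
    LinearIndependent k (Sum.elim v w) ∧
      Submodule.span k (Set.range (Sum.elim v w)) = P ⊔ Q := by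
  refine ⟨hv.sum_type hw (by rwa [hv', hw']), ?_⟩
  rw [Set.Sum.elim_range, Submodule.span_union, hv', hw']

/-- A basis of a vector space adapted to two subspaces. -/
theorem exists_adapted {V : Type} [AddCommGroup V] [Module k V] [FiniteDimensional k V]
    (W W' : Submodule k V) : ∃ (a b c d : ℕ) (v : (Fin a ⊕ Fin b) ⊕ (Fin c ⊕ Fin d) → V),
      LinearIndependent k v ∧ (∀ x, v (.inl x) ∈ W) ∧ (∀ x, v (.inl (.inl x)) ∈ W') ∧
      (∀ x, v (.inr (.inl x)) ∈ W') ∧ a + b = Module.finrank k W ∧ a + c = Module.finrank k W' ∧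
      a + b + c + d = Module.finrank k V := by
  obtain ⟨X, hX⟩ := exists_isCompl (W ⊓ W')
  obtain ⟨Z, hZ⟩ := exists_isCompl (W ⊔ W')
  have hW : (W ⊓ W') ⊔ (X ⊓ W) = W := by
    rw [← sup_inf_assoc_of_le X (inf_le_left : W ⊓ W' ≤ W), hX.sup_eq_top, top_inf_eq]
  have hW' : (W ⊓ W') ⊔ (X ⊓ W') = W' := by
    rw [← sup_inf_assoc_of_le X (inf_le_right : W ⊓ W' ≤ W'), hX.sup_eq_top, top_inf_eq]
  obtain ⟨a, va, ha, ha'⟩ := exists_linearIndependent_span (W ⊓ W')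
  obtain ⟨b, vb, hb, hb'⟩ := exists_linearIndependent_span (X ⊓ W)
  obtain ⟨c, vc, hc, hc'⟩ := exists_linearIndependent_span (X ⊓ W')
  obtain ⟨d, vd, hd, hd'⟩ := exists_linearIndependent_span Z
  have hab := linearIndependent_sumElim (hX.disjoint.mono_right inf_le_left) ha hb ha' hb'
  have hac := linearIndependent_sumElim (hX.disjoint.mono_right inf_le_left) ha hc ha' hc'
  rw [hW] at hab
  rw [hW'] at hac
  have hWW' : W ⊔ (X ⊓ W') = W ⊔ W' := by
    conv_rhs => rw [← hW']
    rw [← sup_assoc, sup_eq_left.2 (inf_le_left : W ⊓ W' ≤ W)]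
  have hcW : Disjoint W (X ⊓ W') := by
    rw [disjoint_iff, ← inf_assoc, inf_comm W X, inf_assoc, inf_comm X, hX.inf_eq_bot]
  have hcd := linearIndependent_sumElim (hZ.disjoint.mono_left
    (inf_le_right.trans le_sup_right : X ⊓ W' ≤ W ⊔ W')) hc hd hc' hd'
  have hdis : Disjoint W ((X ⊓ W') ⊔ Z) := by
    refine hcW.disjoint_sup_right_of_disjoint_sup_left ?_
    rw [hWW']; exact hZ.disjoint
  have hall := linearIndependent_sumElim hdis hab.1 hcd.1 hab.2 hcd.2
  rw [← sup_assoc, hWW', hZ.sup_eq_top] at hall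
  refine ⟨a, b, c, d, _, hall.1, ?_, ?_, ?_, ?_, ?_, ?_⟩
  · intro x
    rw [← hab.2]
    exact Submodule.subset_span ⟨x, rfl⟩
  · intro x
    rw [← hac.2]
    exact Submodule.subset_span ⟨.inl x, rfl⟩
  · intro x
    rw [← hac.2]
    exact Submodule.subset_span ⟨.inr x, rfl⟩
  · have := finrank_span_eq_card hab.1
    rw [hab.2] at this
    simpa using this.symm
  · have := finrank_span_eq_card hac.1
    rw [hac.2] at this
    simpa using this.symm
  · have := finrank_span_eq_card hall.1
    rw [hall.2, finrank_top] at this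
    simp at this
    omega

theorem finrank_coord (e : ι ⊕ κ ≃ ν) (g : GL ν k) :
    ∃ W : Submodule k (ν → k), (∀ x, x ∈ W ↔ ∀ p, (g.1 *ᵥ x) (e (.inr p)) = 0) ∧
      Module.finrank k W = Fintype.card ι := by
  let f : (ν → k) →ₗ[k] (κ → k) :=
    (LinearMap.funLeft k k fun p => e (.inr p)) ∘ₗ Matrix.mulVecLin g.1
  have hf : Function.Surjective f := by
    intro y
    refine ⟨(g⁻¹).1 *ᵥ fun q => Sum.elim 0 y (e.symm q), ?_⟩
    ext p
    simp [f, LinearMap.funLeft_apply, Matrix.mulVec_mulVec]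
  refine ⟨LinearMap.ker f, fun x => ?_, ?_⟩
  · rw [LinearMap.mem_ker, funext_iff]
    rfl
  · have := LinearMap.finrank_range_add_finrank_ker f
    rw [LinearMap.range_eq_top.2 hf, finrank_top, Module.finrank_fintype_fun_eq_card,
      Module.finrank_fintype_fun_eq_card, ← Fintype.card_congr e, Fintype.card_sum] at this
    omega

/-- Every element lies in one of the double cosets of the standard permutations. -/
theorem exists_doubleCoset (e : ι ⊕ κ ≃ ν) (e' : ι' ⊕ κ' ≃ ν) (x : GL ν k) :
    ∃ a b c d : ℕ, a + b = Fintype.card ι ∧ c + d = Fintype.card κ ∧ a + c = Fintype.card ι' ∧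
      b + d = Fintype.card κ' ∧ ∀ z : Pos ι κ ι' κ' (Fin a) (Fin b) (Fin c) (Fin d),
        ∃ (p : Par k ι κ) (v : Par k ι' κ'), pe e' v * perm (z.sig e e') * pe e p = x := by
  obtain ⟨W, hW, hWi⟩ := finrank_coord e (1 : GL ν k)
  obtain ⟨W', hW', hWi'⟩ := finrank_coord e' x
  obtain ⟨a, b, c, d, v, hv, h1, h2, h3, h4, h5, h6⟩ := exists_adapted W W'
  rw [hWi] at h4
  rw [hWi'] at h5
  rw [Module.finrank_fintype_fun_eq_card] at h6
  have c1 := Fintype.card_congr e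
  have c2 := Fintype.card_congr e'
  rw [Fintype.card_sum] at c1 c2
  refine ⟨a, b, c, d, h4, by omega, h5, by omega, fun z => ?_⟩
  let f : ν ≃ (Fin a ⊕ Fin b) ⊕ (Fin c ⊕ Fin d) := (e.symm.trans (z.e1.sumCongr z.e2).symm)
  let M : Matrix ν ν k := Matrix.of fun r q => v (f q) r
  have hM : IsUnit M := by
    rw [← Matrix.linearIndependent_cols_iff_isUnit]
    exact hv.comp f f.injective
  obtain ⟨g, hg⟩ := hM
  obtain ⟨p, hp⟩ := (mem_range_pe e g).2 fun r q => by
    have := (hW (v (f (e (.inl q))))).1 (by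
      simp only [f, Equiv.trans_apply, Equiv.symm_apply_apply]; exact h1 _) r
    rw [Units.val_one, Matrix.one_mulVec] at this
    rw [hg]
    exact this
  obtain ⟨w, hw⟩ := (mem_range_pe e' (x * g * (perm (z.sig e e'))⁻¹)).2 fun r q => by
    have hcol : ∀ q s, (x * g * (perm (z.sig e e'))⁻¹).1 s q =
        (x.1 *ᵥ v (f ((z.sig e e').symm q))) s := by
      intro q s
      rw [Units.val_mul, Matrix.mul_apply, Finset.sum_eq_single ((z.sig e e').symm q)]
      · have h1 : ((perm (z.sig e e'))⁻¹ : GL ν k).1 ((z.sig e e').symm q) q = 1 := by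
          simp only [perm]
          exact (Matrix.one_apply_eq _)
        rw [h1, mul_one, Units.val_mul, hg]
        rfl
      · intro t _ ht
        simp [perm, ht]
      · simp
    rw [hcol]
    refine (hW' _).1 ?_ r
    obtain ⟨q, rfl⟩ := z.e3.surjective q
    rcases q with q | q <;> simp only [f, Pos.sig, Equiv.symm_trans_apply, Equiv.trans_apply,
      Equiv.symm_apply_apply, Equiv.symm_symm, Equiv.sumCongr_symm, Equiv.sumCongr_apply,
      Sum.map_inl]
    · simpa using h2 q
    · simpa using h3 q
  refine ⟨p⁻¹, w, ?_⟩
  rw [map_inv, hw, hp]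
  group

theorem rank_fromBlocks_zero_one_zero_zero :
    (fromBlocks (0 : Matrix B A k) (1 : Matrix B B k) (0 : Matrix D A k) 0).rank =
      Fintype.card B := by
  apply le_antisymm
  · have : fromBlocks (0 : Matrix B A k) (1 : Matrix B B k) (0 : Matrix D A k) 0 =
        fromRows (1 : Matrix B B k) 0 * fromCols (0 : Matrix B A k) (1 : Matrix B B k) := by
      rw [Matrix.fromRows_mul_fromCols]
      simp
    rw [this]
    refine (rank_mul_le_left _ _).trans ?_
    simpa using rank_le_card_width (fromRows (1 : Matrix B B k) (0 : Matrix D B k))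
  · have : (1 : Matrix B B k) = fromCols (1 : Matrix B B k) (0 : Matrix B D k) *
        fromBlocks (0 : Matrix B A k) (1 : Matrix B B k) (0 : Matrix D A k) 0 *
        fromRows (0 : Matrix A B k) (1 : Matrix B B k) := by
      rw [Matrix.fromCols_mul_fromBlocks, Matrix.fromCols_mul_fromRows]
      simp
    have h2 := rank_one (R := k) (n := B)
    rw [this] at h2
    rw [← h2]
    exact (rank_mul_le_left _ _).trans (rank_mul_le_right _ _)

/-- The rank of the lower left block determines the double coset. -/
theorem rank_block (e : ι ⊕ κ ≃ ν) (e' : ι' ⊕ κ' ≃ ν) (z : Pos ι κ ι' κ' A B C D)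
    (p : Par k ι κ) (v : Par k ι' κ') :
    ((pe e' v * perm (z.sig e e') * pe e p).1.submatrix (fun r => e' (.inr r))
      (fun q => e (.inl q))).rank = Fintype.card B := by
  have h1 : (pe e' v * perm (z.sig e e') * pe e p).1.submatrix (fun r => e' (.inr r))
      (fun q => e (.inl q)) =
      (v.d.1 : Matrix κ' κ' k) * ((perm (z.sig e e') : GL ν k).1.submatrix
        (fun r => e' (.inr r)) (fun q => e (.inl q)) : Matrix κ' ι k) * (p.a.1 : Matrix ι ι k) := by
    ext r q
    simp only [Units.val_mul, submatrix_apply, Matrix.mul_apply, pe_apply, rel_val,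
      Par.emb_val, Equiv.symm_apply_apply]
    rw [← Equiv.sum_comp e, Fintype.sum_sum_type]
    simp only [Equiv.symm_apply_apply, fromBlocks_apply₁₁, fromBlocks_apply₂₁, Matrix.zero_apply,
      mul_zero, Finset.sum_const_zero, add_zero]
    refine Finset.sum_congr rfl fun s _ => ?_
    congr 1
    rw [← Equiv.sum_comp e', Fintype.sum_sum_type]
    simp
  have hv : IsUnit v.d.1.det := (Matrix.isUnit_iff_isUnit_det _).1 v.d.isUnit
  have hp : IsUnit p.a.1.det := (Matrix.isUnit_iff_isUnit_det _).1 p.a.isUnit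
  rw [h1, rank_mul_eq_left_of_isUnit_det _ _ hp, rank_mul_eq_right_of_isUnit_det _ _ hv]
  rw [← rank_fromBlocks_zero_one_zero_zero (A := A) (B := B) (D := D) (k := k)]
  rw [← Matrix.rank_submatrix _ z.e4 z.e1]
  congr 1
  ext r q
  rcases r with r | r <;> rcases q with q | q <;>
    simp [perm, Pos.sig, Matrix.one_apply]

end Mackey

section Averages

theorem expect_prod {X Y : Type} [Fintype X] [Fintype Y] (f : X × Y → ℂ) :
    𝔼 z, f z = 𝔼 x, 𝔼 y, f (x, y) := by
  rw [← Finset.univ_product_univ, Finset.expect_product]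

theorem expect_expect_comm {X Y : Type} [Fintype X] [Fintype Y] (f : X → Y → ℂ) :
    𝔼 x, 𝔼 y, f x y = 𝔼 y, 𝔼 x, f x y := Finset.expect_comm _ _ _

theorem sum_expect {X Y : Type} [Fintype X] (s : Finset Y) (f : X → Y → ℂ) :
    𝔼 x, ∑ y ∈ s, f x y = ∑ y ∈ s, 𝔼 x, f x y := Finset.expect_sum_comm _ _ _

/-- Expansion of a class function of two variables in irreducible characters. -/
theorem eq_sum_irr_irr {X Y : Type} [Group X] [Group Y] [Fintype X] [Fintype Y] {F : X → Y → ℂ}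
    (hX : ∀ y, IsClass fun x => F x y) (hY : ∀ x, IsClass fun y => F x y) (x : X) (y : Y) :
    F x y = ∑ σ : irr X, ∑ τ : irr Y,
      (𝔼 a, 𝔼 d, F a d * ((σ : X → ℂ) a⁻¹ * (τ : Y → ℂ) d⁻¹)) *
        ((σ : X → ℂ) x * (τ : Y → ℂ) y) := by
  rw [eq_sum_irr (hX y) x]
  refine Finset.sum_congr rfl fun σ _ => ?_
  have h : IsClass fun y => pair (fun x => F x y) (σ : X → ℂ) := by
    intro a b
    simp only [pair]
    congr 1
    exact Finset.sum_congr rfl fun g _ => by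
      rw [show F g (a * b) = F g (b * a) from hY g a b]
  rw [eq_sum_irr h y, Finset.sum_mul]
  refine Finset.sum_congr rfl fun τ _ => ?_
  rw [mul_assoc, mul_comm ((τ : Y → ℂ) y)]
  congr 1
  simp only [pair_eq_expect]
  rw [expect_expect_comm]
  refine Finset.expect_congr rfl fun d _ => ?_
  rw [Finset.expect_mul]
  refine Finset.expect_congr rfl fun a _ => ?_
  ring

end Averages

section Structure

variable {k : Type} [Field k] [Fintype k] [DecidableEq k]
variable {ι κ ν ι' κ' A B C D : Type} [Fintype ι] [DecidableEq ι] [Fintype κ] [DecidableEq κ]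
  [Fintype ν] [DecidableEq ν] [Fintype ι'] [DecidableEq ι'] [Fintype κ'] [DecidableEq κ']
  [Fintype A] [DecidableEq A] [Fintype B] [DecidableEq B] [Fintype C] [DecidableEq C]
  [Fintype D] [DecidableEq D]

theorem expect_par (f : Par k ι κ → ℂ) : 𝔼 t, f t = 𝔼 a, 𝔼 d, 𝔼 u, f ⟨a, u, d⟩ := by
  rw [Fintype.expect_equiv Par.equivProd f (fun z => f (Par.equivProd.symm z)) fun x => by simp,
    expect_prod]
  refine Finset.expect_congr rfl fun a _ => ?_
  rw [expect_prod, expect_expect_comm]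
  rfl

/-- The constant term of a function along a parabolic subgroup. -/
noncomputable def del (e : ι ⊕ κ ≃ ν) (f : GL ν k → ℂ) (x : GL ι k) (y : GL κ k) : ℂ :=
  𝔼 u, f (pe e ⟨x, u, y⟩)

/-- Structure constants of parabolic induction. -/
noncomputable def cc (e : ι ⊕ κ ≃ ν) (σ : GL ι k → ℂ) (τ : GL κ k → ℂ) (v : GL ν k → ℂ) : ℂ :=
  pair (fun t : Par k ι κ => v (pe e t)) fun t => σ t.a * τ t.d

theorem cc_eq (e : ι ⊕ κ ≃ ν) (σ : GL ι k → ℂ) (τ : GL κ k → ℂ) (v : GL ν k → ℂ) :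
    cc e σ τ v = 𝔼 a, 𝔼 d, del e v a d * (σ a⁻¹ * τ d⁻¹) := by
  rw [cc, pair_eq_expect, expect_par]
  refine Finset.expect_congr rfl fun a _ => Finset.expect_congr rfl fun d _ => ?_
  rw [del, Finset.expect_mul]
  rfl

theorem cc_nat (e : ι ⊕ κ ≃ ν) (σ : irr (GL ι k)) (τ : irr (GL κ k)) (v : irr (GL ν k)) :
    ∃ n : ℕ, cc e (σ : GL ι k → ℂ) (τ : GL κ k → ℂ) (v : GL ν k → ℂ) = n :=
  ((irr_subset_isChar v.2).comp (pe e)).pair_nat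
    (((irr_subset_isChar σ.2).comp Par.homA).mul ((irr_subset_isChar τ.2).comp Par.homD))

theorem del_class_left (e : ι ⊕ κ ≃ ν) {f : GL ν k → ℂ} (hf : IsClass f) (y : GL κ k) :
    IsClass fun x => del e f x y := by
  apply isClass_of_conj
  intro x g
  unfold del
  let E : Matrix ι κ k ≃ Matrix ι κ k :=
    { toFun := fun u => x.1 * u
      invFun := fun u => (x⁻¹).1 * u
      left_inv := fun u => by beta_reduce; rw [← Matrix.mul_assoc, ← Units.val_mul]; simp
      right_inv := fun u => by beta_reduce; rw [← Matrix.mul_assoc, ← Units.val_mul]; simp }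
  rw [eq_comm]
  refine Fintype.expect_equiv E _ _ fun u => ?_
  rw [← hf.conj (pe e (⟨x, 0, 1⟩ : Par k ι κ)), ← map_inv, ← map_mul, ← map_mul]
  congr 2
  ext1 <;> simp [E]

theorem del_class_right (e : ι ⊕ κ ≃ ν) {f : GL ν k → ℂ} (hf : IsClass f) (x : GL ι k) :
    IsClass fun y => del e f x y := by
  apply isClass_of_conj
  intro y g
  unfold del
  let E : Matrix ι κ k ≃ Matrix ι κ k :=
    { toFun := fun u => u * (y⁻¹).1
      invFun := fun u => u * y.1
      left_inv := fun u => by beta_reduce; rw [Matrix.mul_assoc, ← Units.val_mul]; simp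
      right_inv := fun u => by beta_reduce; rw [Matrix.mul_assoc, ← Units.val_mul]; simp }
  rw [eq_comm]
  refine Fintype.expect_equiv E _ _ fun u => ?_
  rw [← hf.conj (pe e (⟨1, 0, y⟩ : Par k ι κ)), ← map_inv, ← map_mul, ← map_mul]
  congr 2
  ext1 <;> simp [E]

theorem del_eq_sum (e : ι ⊕ κ ≃ ν) {f : GL ν k → ℂ} (hf : IsClass f) (x : GL ι k) (y : GL κ k) :
    del e f x y = ∑ σ : irr (GL ι k), ∑ τ : irr (GL κ k),
      cc e (σ : GL ι k → ℂ) (τ : GL κ k → ℂ) f * ((σ : GL ι k → ℂ) x * (τ : GL κ k → ℂ) y) := by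
  simp only [cc_eq]
  exact eq_sum_irr_irr (del_class_left e hf) (del_class_right e hf) x y

theorem del_inv (e : ι ⊕ κ ≃ ν) (f : GL ν k → ℂ) (x : GL ι k) (y : GL κ k) :
    𝔼 u, f (pe e (⟨x, u, y⟩ : Par k ι κ))⁻¹ = del e f x⁻¹ y⁻¹ := by
  unfold del
  let E : Matrix ι κ k ≃ Matrix ι κ k :=
    { toFun := fun u => -((x⁻¹).1 * u * (y⁻¹).1)
      invFun := fun u => -(x.1 * u * y.1)
      left_inv := fun u => by
        simp only [Matrix.mul_neg, Matrix.neg_mul, neg_neg, Matrix.mul_assoc]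
        rw [← Units.val_mul, inv_mul_cancel, ← Matrix.mul_assoc, ← Units.val_mul]
        simp
      right_inv := fun u => by
        simp only [Matrix.mul_neg, Matrix.neg_mul, neg_neg, Matrix.mul_assoc]
        rw [← Units.val_mul, mul_inv_cancel, ← Matrix.mul_assoc, ← Units.val_mul]
        simp }
  refine Fintype.expect_equiv E _ _ fun u => ?_
  rw [← map_inv]
  rfl

/-- A single double coset contribution. -/
theorem expect_pos (z : Pos ι κ ι' κ' A B C D) {α : GL ι k → ℂ} {β : GL κ k → ℂ}
    {γ : GL ι' k → ℂ} {δ : GL κ' k → ℂ} (hα : IsClass α) (hβ : IsClass β) :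
    𝔼 r : Pos.R k A B C D, (α (z.r1 r)⁻¹.a * β (z.r1 r)⁻¹.d) * (γ (z.r2 r).a * δ (z.r2 r).d) =
    ∑ p : irr (GL A k), ∑ q : irr (GL B k), ∑ r : irr (GL C k), ∑ s : irr (GL D k),
      cc z.e1 (p : GL A k → ℂ) (q : GL B k → ℂ) α * cc z.e2 (r : GL C k → ℂ) (s : GL D k → ℂ) β *
      (cc z.e3 (p : GL A k → ℂ) (r : GL C k → ℂ) γ *
        cc z.e4 (q : GL B k → ℂ) (s : GL D k → ℂ) δ) := by
  have h1 : 𝔼 r : Pos.R k A B C D, (α (z.r1 r)⁻¹.a * β (z.r1 r)⁻¹.d) *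
      (γ (z.r2 r).a * δ (z.r2 r).d) = 𝔼 a, 𝔼 b, 𝔼 c, 𝔼 d,
      del z.e1 α a⁻¹ b⁻¹ * del z.e2 β c⁻¹ d⁻¹ * (del z.e3 γ a c * del z.e4 δ b d) := by
    rw [expect_prod, expect_prod]
    refine Finset.expect_congr rfl fun a _ => ?_
    rw [expect_prod]
    refine Finset.expect_congr rfl fun b _ => ?_
    rw [expect_prod]
    refine Finset.expect_congr rfl fun c _ => ?_
    refine Finset.expect_congr rfl fun d _ => ?_
    simp only [expect_prod, Pos.r1, Pos.r2, Par.inv_a, Par.inv_d]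
    simp only [Finset.expect_const
      (Finset.univ_nonempty : (Finset.univ : Finset (Matrix A D k)).Nonempty)]
    simp only [← Finset.mul_expect, ← Finset.expect_mul, del_inv]
    rfl
  rw [h1]
  simp only [del_eq_sum z.e1 hα, del_eq_sum z.e2 hβ]
  have h2 : ∀ (p : irr (GL A k)) (q : irr (GL B k)) (r : irr (GL C k)) (s : irr (GL D k)),
      cc z.e3 (p : GL A k → ℂ) (r : GL C k → ℂ) γ * cc z.e4 (q : GL B k → ℂ) (s : GL D k → ℂ) δ =
      𝔼 a, 𝔼 b, 𝔼 c, 𝔼 d, ((p : GL A k → ℂ) a⁻¹ * (q : GL B k → ℂ) b⁻¹) *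
        ((r : GL C k → ℂ) c⁻¹ * (s : GL D k → ℂ) d⁻¹) * (del z.e3 γ a c * del z.e4 δ b d) := by
    intro p q r s
    rw [cc_eq, cc_eq, Finset.expect_mul]
    refine Finset.expect_congr rfl fun a _ => ?_
    rw [Finset.mul_expect]
    refine Finset.expect_congr rfl fun b _ => ?_
    rw [Finset.expect_mul]
    refine Finset.expect_congr rfl fun c _ => ?_
    rw [Finset.mul_expect]
    refine Finset.expect_congr rfl fun d _ => ?_
    ring
  simp only [h2, Finset.mul_expect, ← sum_expect]
  refine Finset.expect_congr rfl fun a _ => Finset.expect_congr rfl fun b _ =>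
    Finset.expect_congr rfl fun c _ => Finset.expect_congr rfl fun d _ => ?_
  rw [Fintype.sum_mul_sum, Finset.sum_mul]
  refine Finset.sum_congr rfl fun p _ => ?_
  simp only [Finset.sum_mul]
  rw [Finset.sum_comm]
  refine Finset.sum_congr rfl fun q _ => Finset.sum_congr rfl fun r _ => ?_
  rw [Finset.mul_sum, Finset.sum_mul]
  refine Finset.sum_congr rfl fun s _ => ?_
  ring

end Structure

/-- The standard decomposition of `Fin n`. -/
def sumE {a b n : ℕ} (h : a + b = n) : Fin a ⊕ Fin b ≃ Fin n := finSumFinEquiv.trans (finCongr h)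

section Hopf

variable {k : Type} [Field k] [Fintype k] [DecidableEq k]

/-- Two by two matrices of small natural numbers with given margins. -/
abbrev Quad (i j i' j' : ℕ) :=
  {x : Fin 6 × Fin 6 × Fin 6 × Fin 6 // x.1.1 + x.2.1.1 = i ∧ x.2.2.1.1 + x.2.2.2.1 = j ∧
    x.1.1 + x.2.2.1.1 = i' ∧ x.2.1.1 + x.2.2.2.1 = j'}

/-- The relative position attached to a matrix of block sizes. -/
def Quad.pos {i j i' j' : ℕ} (x : Quad i j i' j') :
    Pos (Fin i) (Fin j) (Fin i') (Fin j') (Fin x.1.1.1) (Fin x.1.2.1.1) (Fin x.1.2.2.1.1)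
      (Fin x.1.2.2.2.1) :=
  ⟨sumE x.2.1, sumE x.2.2.1, sumE x.2.2.2.1, sumE x.2.2.2.2⟩

theorem Quad.ext_of {i j i' j' : ℕ} {x y : Quad i j i' j'} (h : x.1.2.1.1 = y.1.2.1.1) :
    x = y := by
  obtain ⟨⟨⟨a, _⟩, ⟨b, _⟩, ⟨c, _⟩, ⟨d, _⟩⟩, h1, h2, h3, h4⟩ := x
  obtain ⟨⟨⟨a', _⟩, ⟨b', _⟩, ⟨c', _⟩, ⟨d', _⟩⟩, h1', h2', h3', h4'⟩ := y
  dsimp only at h h1 h2 h3 h4 h1' h2' h3' h4'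
  simp only [Subtype.mk.injEq, Prod.mk.injEq, Fin.mk.injEq]
  omega

/-- The geometric lemma in terms of structure constants. -/
theorem hopf_fun {i j i' j' n : ℕ} (h : i + j = n) (h' : i' + j' = n) (hn : n ≤ 5)
    {α : GL (Fin i) k → ℂ} {β : GL (Fin j) k → ℂ} {γ : GL (Fin i') k → ℂ}
    {δ : GL (Fin j') k → ℂ} (hα : IsClass α) (hβ : IsClass β) (hγ : IsClass γ)
    (hδ : IsClass δ) :
    ∑ χ : irr (GL (Fin n) k), cc (sumE h) α β (χ : GL (Fin n) k → ℂ) *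
      cc (sumE h') γ δ (χ : GL (Fin n) k → ℂ) =
    ∑ x : Quad i j i' j', ∑ p : irr (GL (Fin x.1.1.1) k), ∑ q : irr (GL (Fin x.1.2.1.1) k),
      ∑ r : irr (GL (Fin x.1.2.2.1.1) k), ∑ s : irr (GL (Fin x.1.2.2.2.1) k),
      cc x.pos.e1 (p : _ → ℂ) (q : _ → ℂ) α * cc x.pos.e2 (r : _ → ℂ) (s : _ → ℂ) β *
      (cc x.pos.e3 (p : _ → ℂ) (r : _ → ℂ) γ * cc x.pos.e4 (q : _ → ℂ) (s : _ → ℂ) δ) := by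
  have hF : IsClass fun t : Par k (Fin i) (Fin j) => α t.a * β t.d := fun s t => by
    simp only [Par.mul_a, Par.mul_d]
    rw [hα, hβ]
  have hH : IsClass fun t : Par k (Fin i') (Fin j') => γ t.a * δ t.d := fun s t => by
    simp only [Par.mul_a, Par.mul_d]
    rw [hγ, hδ]
  have := mackey (pe (sumE h)) (pe (sumE h')) hF hH
    (fun x : Quad i j i' j' => perm (x.pos.sig (sumE h) (sumE h')))
    (fun x => Pos.R k (Fin x.1.1.1) (Fin x.1.2.1.1) (Fin x.1.2.2.1.1) (Fin x.1.2.2.2.1))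
    (fun x r => x.pos.r1 r) (fun x r => x.pos.r2 r) (fun x => x.pos.r_injective)
    (fun x a b => x.pos.perm_sig_iff _ _ a b) ?_
  · unfold cc at this ⊢
    rw [this]
    refine Finset.sum_congr rfl fun x _ => ?_
    exact expect_pos x.pos hα hβ
  · intro g _
    obtain ⟨a, b, c, d, h1, h2, h3, h4, h5⟩ := exists_doubleCoset (sumE h) (sumE h') g
    simp only [Fintype.card_fin] at h1 h2 h3 h4
    let x : Quad i j i' j' := ⟨(⟨a, by omega⟩, ⟨b, by omega⟩, ⟨c, by omega⟩, ⟨d, by omega⟩),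
      h1, h2, h3, h4⟩
    refine ⟨x, h5 x.pos, ?_⟩
    rintro y ⟨p, v, hy⟩
    obtain ⟨p', v', hx⟩ := h5 x.pos
    apply Quad.ext_of
    have r1 := rank_block (sumE h) (sumE h') y.pos p v
    have r2 := rank_block (sumE h) (sumE h') x.pos p' v'
    rw [hy, Fintype.card_fin] at r1
    rw [hx, Fintype.card_fin] at r2
    exact r1.symm.trans r2

end Hopf

section Assoc

variable {k : Type} [Field k] [Fintype k] [DecidableEq k]
variable {ι κ lam μ ρ ν : Type} [Fintype ι] [DecidableEq ι] [Fintype κ] [DecidableEq κ]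
  [Fintype ν] [DecidableEq ν] [Fintype lam] [DecidableEq lam] [Fintype μ] [DecidableEq μ]
  [Fintype ρ] [DecidableEq ρ]

/-- Regrouping of the strictly upper triangular part for three blocks. -/
def regroup (e : ι ⊕ κ ≃ μ) (f' : κ ⊕ lam ≃ ρ) :
    Matrix ι κ k × Matrix μ lam k ≃ Matrix ι ρ k × Matrix κ lam k where
  toFun z := ((fromCols z.1 (z.2.submatrix (fun p => e (.inl p)) id)).submatrix id f'.symm,
    z.2.submatrix (fun p => e (.inr p)) id)
  invFun z := (z.1.submatrix id (fun p => f' (.inl p)),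
    (fromRows (z.1.submatrix id (fun p => f' (.inr p))) z.2).submatrix e.symm id)
  left_inv z := by
    refine Prod.ext ?_ ?_
    · ext p q
      simp
    · ext p q
      obtain ⟨p, rfl⟩ := e.surjective p
      rcases p with p | p <;> simp
  right_inv z := by
    refine Prod.ext ?_ ?_
    · ext p q
      obtain ⟨q, rfl⟩ := f'.surjective q
      rcases q with q | q <;> simp
    · ext p q
      simp

theorem rel_regroup (e : ι ⊕ κ ≃ μ) (e' : μ ⊕ lam ≃ ν) (f : ι ⊕ ρ ≃ ν) (f' : κ ⊕ lam ≃ ρ)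
    (a : GL ι k) (b : GL κ k) (c : GL lam k) (z : Matrix ι κ k × Matrix μ lam k) :
    rel (e'.symm.trans (((e.symm.sumCongr (Equiv.refl lam)).trans (Equiv.sumAssoc ι κ lam)).trans
      (((Equiv.refl ι).sumCongr f').trans f))) (pe e' ⟨pe e ⟨a, z.1, b⟩, z.2, c⟩) =
      pe f ⟨a, (regroup e f' z).1, pe f' ⟨b, (regroup e f' z).2, c⟩⟩ := by
  apply Units.ext
  ext p q
  obtain ⟨p, rfl⟩ := ((Equiv.sumAssoc ι κ lam).trans
    (((Equiv.refl ι).sumCongr f').trans f)).surjective p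
  obtain ⟨q, rfl⟩ := ((Equiv.sumAssoc ι κ lam).trans
    (((Equiv.refl ι).sumCongr f').trans f)).surjective q
  rcases p with (p | p) | p <;> rcases q with (q | q) | q <;>
    simp [pe_apply, regroup]

theorem expect_regroup (e : ι ⊕ κ ≃ μ) (e' : μ ⊕ lam ≃ ν) (f : ι ⊕ ρ ≃ ν) (f' : κ ⊕ lam ≃ ρ)
    {v : GL ν k → ℂ} (hv : IsClass v) (a : GL ι k) (b : GL κ k) (c : GL lam k) :
    𝔼 u : Matrix ι κ k, 𝔼 w : Matrix μ lam k, v (pe e' ⟨pe e ⟨a, u, b⟩, w, c⟩) =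
      𝔼 u' : Matrix ι ρ k, 𝔼 w' : Matrix κ lam k, v (pe f ⟨a, u', pe f' ⟨b, w', c⟩⟩) := by
  rw [← expect_prod (fun z : Matrix ι κ k × Matrix μ lam k =>
    v (pe e' ⟨pe e ⟨a, z.1, b⟩, z.2, c⟩)), ← expect_prod (fun z : Matrix ι ρ k × Matrix κ lam k =>
    v (pe f ⟨a, z.1, pe f' ⟨b, z.2, c⟩⟩))]
  refine Fintype.expect_equiv (regroup e f') _ _ fun z => ?_
  rw [← rel_regroup e e' f f', hv.rel_eq _ (Equiv.refl ν)]
  congr 1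

theorem cc_sum (e : ι ⊕ κ ≃ ν) (σ : GL ι k → ℂ) (τ : GL κ k → ℂ) {f : GL ν k → ℂ}
    (hf : IsClass f) : cc e σ τ f = ∑ m : irr (GL ν k), pair f (m : GL ν k → ℂ) * cc e σ τ m := by
  have : cc e σ τ f = pair (fun t : Par k ι κ => ∑ m : irr (GL ν k),
      pair f (m : GL ν k → ℂ) * (m : GL ν k → ℂ) (pe e t)) fun t => σ t.a * τ t.d := by
    unfold cc
    congr 1
    ext t
    exact eq_sum_irr hf _
  rw [this, pair_sum_left]
  exact Finset.sum_congr rfl fun m _ => pair_const_mul_left _ _ _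

theorem sum_cc_left (e : ι ⊕ κ ≃ μ) (e' : μ ⊕ lam ≃ ν) (α : GL ι k → ℂ) (β : GL κ k → ℂ)
    (γ : GL lam k → ℂ) {v : GL ν k → ℂ} (hv : IsClass v) :
    ∑ m : irr (GL μ k), cc e α β (m : GL μ k → ℂ) * cc e' (m : GL μ k → ℂ) γ v =
      𝔼 a, 𝔼 b, 𝔼 c, (𝔼 u : Matrix ι κ k, 𝔼 w : Matrix μ lam k,
        v (pe e' ⟨pe e ⟨a, u, b⟩, w, c⟩)) * (α a⁻¹ * β b⁻¹ * γ c⁻¹) := by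
  have hF : IsClass fun x => 𝔼 c, del e' v x c * γ c⁻¹ := fun x y =>
    Finset.expect_congr rfl fun c _ => by
      rw [show del e' v (x * y) c = del e' v (y * x) c from del_class_left e' hv c x y]
  have h := cc_sum e α β hF
  have h2 : ∀ m : irr (GL μ k), pair (fun x => 𝔼 c, del e' v x c * γ c⁻¹) (m : GL μ k → ℂ) =
      cc e' (m : GL μ k → ℂ) γ v := by
    intro m
    rw [pair_eq_expect, cc_eq]
    refine Finset.expect_congr rfl fun a _ => ?_
    rw [Finset.expect_mul]
    refine Finset.expect_congr rfl fun b _ => ?_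
    ring
  simp only [h2] at h
  rw [Finset.sum_congr rfl fun m _ => mul_comm _ _, ← h, cc_eq]
  refine Finset.expect_congr rfl fun a _ => Finset.expect_congr rfl fun b _ => ?_
  rw [del, expect_expect_comm, Finset.expect_mul]
  refine Finset.expect_congr rfl fun c _ => ?_
  rw [← Finset.expect_mul]
  unfold del
  ring

theorem sum_cc_right (f : ι ⊕ ρ ≃ ν) (f' : κ ⊕ lam ≃ ρ) (α : GL ι k → ℂ) (β : GL κ k → ℂ)
    (γ : GL lam k → ℂ) {v : GL ν k → ℂ} (hv : IsClass v) :
    ∑ m : irr (GL ρ k), cc f' β γ (m : GL ρ k → ℂ) * cc f α (m : GL ρ k → ℂ) v =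
      𝔼 a, 𝔼 b, 𝔼 c, (𝔼 u : Matrix ι ρ k, 𝔼 w : Matrix κ lam k,
        v (pe f ⟨a, u, pe f' ⟨b, w, c⟩⟩)) * (α a⁻¹ * β b⁻¹ * γ c⁻¹) := by
  have hF : IsClass fun x => 𝔼 a, del f v a x * α a⁻¹ := fun x y =>
    Finset.expect_congr rfl fun a _ => by
      rw [show del f v a (x * y) = del f v a (y * x) from del_class_right f hv a x y]
  have h := cc_sum f' β γ hF
  have h2 : ∀ m : irr (GL ρ k), pair (fun x => 𝔼 a, del f v a x * α a⁻¹) (m : GL ρ k → ℂ) =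
      cc f α (m : GL ρ k → ℂ) v := by
    intro m
    rw [pair_eq_expect, cc_eq, expect_expect_comm]
    refine Finset.expect_congr rfl fun a _ => ?_
    rw [Finset.expect_mul]
    refine Finset.expect_congr rfl fun b _ => ?_
    ring
  simp only [h2] at h
  rw [Finset.sum_congr rfl fun m _ => mul_comm _ _, ← h, cc_eq]
  have h3 : ∀ b c, del f' (fun x => 𝔼 a, del f v a x * α a⁻¹) b c =
      𝔼 a, (𝔼 u : Matrix ι ρ k, 𝔼 w : Matrix κ lam k,
        v (pe f ⟨a, u, pe f' ⟨b, w, c⟩⟩)) * α a⁻¹ := by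
    intro b c
    rw [del, expect_expect_comm]
    refine Finset.expect_congr rfl fun a _ => ?_
    rw [← Finset.expect_mul, expect_expect_comm (X := Matrix ι ρ k)]
    rfl
  simp only [h3, Finset.expect_mul]
  have h4 : ∀ F : GL κ k → GL lam k → GL ι k → ℂ, 𝔼 b, 𝔼 c, 𝔼 a, F b c a =
      𝔼 a, 𝔼 b, 𝔼 c, F b c a := by
    intro F
    rw [expect_expect_comm (X := GL ι k)]
    exact Finset.expect_congr rfl fun b _ => expect_expect_comm _
  rw [h4]
  refine Finset.expect_congr rfl fun a _ => Finset.expect_congr rfl fun b _ =>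
    Finset.expect_congr rfl fun c _ => ?_
  simp only [← Finset.expect_mul]
  ring

theorem assoc_fun (e : ι ⊕ κ ≃ μ) (e' : μ ⊕ lam ≃ ν) (f : ι ⊕ ρ ≃ ν) (f' : κ ⊕ lam ≃ ρ)
    (α : GL ι k → ℂ) (β : GL κ k → ℂ) (γ : GL lam k → ℂ) {v : GL ν k → ℂ} (hv : IsClass v) :
    ∑ m : irr (GL μ k), cc e α β (m : GL μ k → ℂ) * cc e' (m : GL μ k → ℂ) γ v =
      ∑ m : irr (GL ρ k), cc f' β γ (m : GL ρ k → ℂ) * cc f α (m : GL ρ k → ℂ) v := by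
  rw [sum_cc_left e e' α β γ hv, sum_cc_right f f' α β γ hv]
  simp only [expect_regroup e e' f f' hv]

end Assoc

section Whittaker

variable {k : Type} [Field k] [Fintype k] [DecidableEq k]

theorem exists_vecMul_eq {ι : Type} [Fintype ι] [DecidableEq ι] {w w' : ι → k} (hw : w ≠ 0)
    (hw' : w' ≠ 0) : ∃ g : GL ι k, w ᵥ* g.1 = w' := by
  obtain ⟨f, hf⟩ := Submodule.exists_linearEquiv_restrict_eq
    ((LinearEquiv.toSpanNonzeroSingleton k (ι → k) w hw).symm ≪≫ₗ
      LinearEquiv.toSpanNonzeroSingleton k (ι → k) w' hw')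
  have h1 := hf (LinearEquiv.toSpanNonzeroSingleton k (ι → k) w hw 1)
  rw [LinearEquiv.trans_apply, LinearEquiv.symm_apply_apply] at h1
  simp only [LinearEquiv.toSpanNonzeroSingleton_apply, one_smul] at h1
  have h2 : ∀ f : (ι → k) ≃ₗ[k] (ι → k), (LinearMap.toMatrix' (f : (ι → k) →ₗ[k] (ι → k)))ᵀ *
      (LinearMap.toMatrix' (f.symm : (ι → k) →ₗ[k] (ι → k)))ᵀ = 1 := by
    intro f
    rw [← Matrix.transpose_mul, ← LinearMap.toMatrix'_comp]
    simp
  refine ⟨⟨_, _, h2 f, by simpa using h2 f.symm⟩, ?_⟩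
  rw [Matrix.vecMul_transpose]
  simp [LinearMap.toMatrix'_mulVec, h1]

variable (k) in
/-- The group of upper unitriangular matrices. -/
def uni : ∀ l : ℕ, Subgroup (GL (Fin l) k)
  | 0 => ⊤
  | l + 1 => ((Par.homA (ι := Fin 1) (κ := Fin l)).ker ⊓ (uni l).comap Par.homD).map
      (pe (sumE (add_comm 1 l)))

theorem pe_mem_uni {l : ℕ} (u : Matrix (Fin 1) (Fin l) k) (d : GL (Fin l) k) :
    pe (sumE (add_comm 1 l)) ⟨1, u, d⟩ ∈ uni k (l + 1) ↔ d ∈ uni k l := by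
  rw [uni, Subgroup.mem_map_iff_mem (pe_injective _)]
  simp [Par.homA, Par.homD, MonoidHom.mem_ker]

/-- Block decomposition of unitriangular matrices. -/
noncomputable def uniEquiv (l : ℕ) : Matrix (Fin 1) (Fin l) k × uni k l ≃ uni k (l + 1) :=
  Equiv.ofBijective (fun z => ⟨pe (sumE (add_comm 1 l)) ⟨1, z.1, z.2⟩, (pe_mem_uni _ _).2 z.2.2⟩)
    ⟨fun z z' h => by
      have := pe_injective _ (congrArg Subtype.val h)
      simp only [Par.mk.injEq] at this
      exact Prod.ext this.2.1 (Subtype.ext this.2.2), fun g => by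
      obtain ⟨g, t, ⟨h1, h2⟩, rfl⟩ := g
      refine ⟨(t.u, ⟨t.d, h2⟩), Subtype.ext ?_⟩
      have h3 : t.a = 1 := h1
      dsimp only
      rw [← h3]⟩

theorem card_uni (l : ℕ) : Nat.card (uni k l) = Fintype.card k ^ (l.choose 2) := by
  induction l with
  | zero =>
    have : Subsingleton (uni k 0) := ⟨fun a b => Subtype.ext (Units.ext (Subsingleton.elim _ _))⟩
    simp
  | succ l ih =>
    rw [← Nat.card_congr (uniEquiv l), Nat.card_prod, ih, Nat.choose_succ_succ' l 1,
      Nat.card_eq_fintype_card, pow_add]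
    congr 1
    change Fintype.card (Fin 1 → Fin l → k) = _
    rw [Fintype.card_fun, Fintype.card_fun]
    simp

/-- The nondegenerate character of the unitriangular group. -/
noncomputable def theta (ψ : AddChar k ℂ) (l : ℕ) (g : GL (Fin l) k) : ℂ :=
  ψ (∑ i : Fin l, ∑ j : Fin l, if i.1 + 1 = j.1 then g.1 i j else 0)

theorem sumE_symm_zero (l : ℕ) : (sumE (add_comm 1 l)).symm 0 = Sum.inl 0 := by
  rw [Equiv.symm_apply_eq]
  ext
  simp [sumE]

theorem sumE_symm_succ (l : ℕ) (j : Fin l) :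
    (sumE (add_comm 1 l)).symm j.succ = Sum.inr j := by
  rw [Equiv.symm_apply_eq]
  ext
  simp [sumE]

theorem theta_pe (ψ : AddChar k ℂ) {l : ℕ} (u : Matrix (Fin 1) (Fin l) k) (d : GL (Fin l) k) :
    theta ψ (l + 1) (pe (sumE (add_comm 1 l)) ⟨1, u, d⟩) =
      ψ (∑ j : Fin l, if j.1 = 0 then u 0 j else 0) * theta ψ l d := by
  unfold theta
  rw [← AddChar.map_add_eq_mul]
  congr 1
  rw [Fin.sum_univ_succ]
  congr 1
  · rw [Fin.sum_univ_succ]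
    simp [pe_apply, sumE_symm_zero, sumE_symm_succ]
  · refine Finset.sum_congr rfl fun i _ => ?_
    rw [Fin.sum_univ_succ]
    simp [pe_apply, sumE_symm_succ]

theorem uni_apply_of_zero {l : ℕ} {d : GL (Fin l) k} (hd : d ∈ uni k l) (i j : Fin l)
    (hj : j.1 = 0) : d.1 i j = if i = j then 1 else 0 := by
  cases l with
  | zero => exact i.elim0
  | succ l =>
    obtain ⟨⟨u, d'⟩, h⟩ := (uniEquiv l).surjective ⟨d, hd⟩
    have h2 : pe (sumE (add_comm 1 l)) ⟨1, u, d'⟩ = d := congrArg Subtype.val h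
    obtain rfl : j = 0 := Fin.ext hj
    rw [← h2]
    refine Fin.cases ?_ (fun i => ?_) i <;> simp [pe_apply, sumE_symm_zero, sumE_symm_succ]

theorem theta_mul (ψ : AddChar k ℂ) (l : ℕ) {g h : GL (Fin l) k} (hg : g ∈ uni k l)
    (hh : h ∈ uni k l) : theta ψ l (g * h) = theta ψ l g * theta ψ l h := by
  induction l with
  | zero => simp [theta]
  | succ l ih =>
    obtain ⟨⟨u, d⟩, hd⟩ := (uniEquiv l).surjective ⟨g, hg⟩
    obtain ⟨⟨u', d'⟩, hd'⟩ := (uniEquiv l).surjective ⟨h, hh⟩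
    have h2 : pe (sumE (add_comm 1 l)) ⟨1, u, d⟩ = g := congrArg Subtype.val hd
    have h3 : pe (sumE (add_comm 1 l)) ⟨1, u', d'⟩ = h := congrArg Subtype.val hd'
    have h4 : g * h = pe (sumE (add_comm 1 l)) ⟨1, u' + u * d'.1.1, d * d'⟩ := by
      rw [← h2, ← h3, ← map_mul]
      congr 1
      ext1 <;> simp
    rw [h4, ← h2, ← h3, theta_pe, theta_pe, theta_pe, ih d.2 d'.2]
    have h5 : (∑ j : Fin l, if j.1 = 0 then (u' + u * d'.1.1) 0 j else 0) =
        (∑ j : Fin l, if j.1 = 0 then u 0 j else 0) +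
          ∑ j : Fin l, if j.1 = 0 then u' 0 j else 0 := by
      rw [← Finset.sum_add_distrib]
      refine Finset.sum_congr rfl fun j _ => ?_
      split_ifs with hj
      · rw [Matrix.add_apply, Matrix.mul_apply, add_comm]
        congr 1
        rw [Finset.sum_eq_single j]
        · rw [uni_apply_of_zero d'.2 _ _ hj, if_pos rfl, mul_one]
        · intro i _ hi
          rw [uni_apply_of_zero d'.2 _ _ hj, if_neg hi, mul_zero]
        · simp
      · simp
    rw [h5, AddChar.map_add_eq_mul]
    ring

noncomputable instance (l : ℕ) : Fintype (uni k l) := Fintype.ofFinite _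

/-- The multiplicity of the nondegenerate character in the restriction of a class function to the
unitriangular group. -/
noncomputable def whit (ψ : AddChar k ℂ) (l : ℕ) (f : GL (Fin l) k → ℂ) : ℂ :=
  𝔼 g : uni k l, theta ψ l g * f g

theorem theta_one (ψ : AddChar k ℂ) (l : ℕ) : theta ψ l (1 : GL (Fin l) k) = 1 := by
  unfold theta
  convert ψ.map_zero_eq_one using 2
  refine Finset.sum_eq_zero fun i _ => Finset.sum_eq_zero fun j _ => ?_
  split_ifs with h
  · rw [Units.val_one, Matrix.one_apply_ne]
    rintro rfl
    omega
  · rfl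

theorem whit_nat (ψ : AddChar k ℂ) (l : ℕ) {f : GL (Fin l) k → ℂ} (hf : IsChar f) :
    ∃ n : ℕ, whit ψ l f = n := by
  let φ : uni k l →* ℂ :=
    { toFun := fun g => theta ψ l g
      map_one' := theta_one ψ l
      map_mul' := fun g h => theta_mul ψ l g.2 h.2 }
  obtain ⟨n, hn⟩ := (hf.comp (uni k l).subtype).pair_nat (isChar_hom φ).inv
  refine ⟨n, ?_⟩
  rw [← hn, pair_eq_expect]
  refine Finset.expect_congr rfl fun g _ => ?_
  rw [inv_inv, mul_comm]
  rfl

theorem whit_succ (ψ : AddChar k ℂ) (l : ℕ) (f : GL (Fin (l + 1)) k → ℂ) :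
    whit ψ (l + 1) f = 𝔼 u : Matrix (Fin 1) (Fin l) k,
      ψ (∑ j : Fin l, if j.1 = 0 then u 0 j else 0) *
        whit ψ l fun d => f (pe (sumE (add_comm 1 l)) ⟨1, u, d⟩) := by
  unfold whit
  rw [← Fintype.expect_equiv (uniEquiv l) (fun z => theta ψ (l + 1) (uniEquiv l z) *
    f (uniEquiv l z)) _ fun z => rfl, expect_prod]
  refine Finset.expect_congr rfl fun u _ => ?_
  rw [Finset.mul_expect]
  refine Finset.expect_congr rfl fun d _ => ?_
  rw [show ((uniEquiv l (u, d)).1 : GL (Fin (l + 1)) k) =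
    pe (sumE (add_comm 1 l)) ⟨1, u, d⟩ from rfl, theta_pe, mul_assoc]

theorem whit_zero (ψ : AddChar k ℂ) (f : GL (Fin 0) k → ℂ) : whit ψ 0 f = f 1 := by
  unfold whit
  have h : ∀ g : uni k 0, theta ψ 0 g * f g = f 1 := by
    intro g
    have : g.1 = 1 := Units.ext (Subsingleton.elim _ _)
    rw [this, theta_one, one_mul]
  simp only [h]
  exact Fintype.expect_const _

/-- The sum of multiplicities of the nondegenerate character, weighted by degrees. -/
theorem sum_whit (ψ : AddChar k ℂ) (l : ℕ) :
    ∑ χ : irr (GL (Fin l) k), whit ψ l (χ : GL (Fin l) k → ℂ) * (χ : GL (Fin l) k → ℂ) 1 =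
      Nat.card (GL (Fin l) k) / (Fintype.card k : ℂ) ^ (l.choose 2) := by
  unfold whit
  simp only [Finset.expect_mul]
  rw [← sum_expect, Fintype.expect_eq_sum_div_card, ← Nat.card_eq_fintype_card (α := uni k l),
    card_uni, Nat.cast_pow]
  congr 1
  rw [Finset.sum_eq_single (1 : uni k l)]
  · have := sum_irr_mul (1 : GL (Fin l) k) 1
    simp only [inv_one, mul_one, mul_inv_cancel, if_true] at this
    simp only [OneMemClass.coe_one, theta_one, one_mul]
    rw [this]
    simp
  · intro g _ hg
    have := sum_irr_mul (g : GL (Fin l) k) 1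
    simp only [inv_one] at this
    simp only [mul_assoc, ← Finset.mul_sum, this]
    rw [Finset.sum_eq_zero, mul_zero]
    intro x _
    rw [if_neg]
    intro h
    apply hg
    apply Subtype.ext
    rwa [← mul_assoc, conj_eq_one_iff] at h
  · simp

end Whittaker

section Dimension

variable {k : Type} [Field k] [Fintype k] [DecidableEq k]
variable {ι ν : Type} [Fintype ι] [DecidableEq ι] [Fintype ν] [DecidableEq ν]

/-- Partially twisted averages over a parabolic subgroup. -/
noncomputable def tw (ψ : AddChar k ℂ) {l : ℕ} (e : ι ⊕ Fin l ≃ ν) (f : GL ν k → ℂ) (w : ι → k) :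
    ℂ :=
  𝔼 U : Matrix ι (Fin l) k, ψ (∑ i, ∑ j : Fin l, if j.1 = 0 then w i * U i j else 0) *
    whit ψ l fun d => f (pe e ⟨1, U, d⟩)

theorem tw_zero (ψ : AddChar k ℂ) {l : ℕ} (e : ι ⊕ Fin l ≃ ν) (f : GL ν k → ℂ) :
    tw ψ e f 0 = whit ψ l fun d => del e f 1 d := by
  unfold tw whit del
  simp only [Finset.mul_expect]
  rw [expect_expect_comm]
  simp

theorem tw_vecMul (ψ : AddChar k ℂ) {l : ℕ} (e : ι ⊕ Fin l ≃ ν) {f : GL ν k → ℂ}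
    (hf : IsClass f) (w : ι → k) (g : GL ι k) : tw ψ e f (w ᵥ* g.1) = tw ψ e f w := by
  unfold tw
  let E : Matrix ι (Fin l) k ≃ Matrix ι (Fin l) k :=
    { toFun := fun u => g.1 * u
      invFun := fun u => (g⁻¹).1 * u
      left_inv := fun u => by beta_reduce; rw [← Matrix.mul_assoc, ← Units.val_mul]; simp
      right_inv := fun u => by beta_reduce; rw [← Matrix.mul_assoc, ← Units.val_mul]; simp }
  refine Fintype.expect_equiv E _ _ fun u => ?_
  congr 2
  · rw [Finset.sum_comm, Finset.sum_comm (s := (Finset.univ : Finset ι))]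
    refine Finset.sum_congr rfl fun j _ => ?_
    by_cases hj : j.1 = 0
    · simp only [hj, if_true]
      have := congrFun (Matrix.vecMul_vecMul w g.1 u) j
      simpa [vecMul, dotProduct, E] using this
    · simp [hj]
  · ext d
    rw [← hf.conj (pe e (⟨g, 0, 1⟩ : Par k ι (Fin l))), ← map_inv, ← map_mul, ← map_mul]
    congr 2
    ext1 <;> simp [E]

theorem tw_eq (ψ : AddChar k ℂ) {l : ℕ} (e : ι ⊕ Fin l ≃ ν) {f : GL ν k → ℂ}
    (hf : IsClass f) {w w' : ι → k} (hw : w ≠ 0) (hw' : w' ≠ 0) : tw ψ e f w = tw ψ e f w' := by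
  obtain ⟨g, rfl⟩ := exists_vecMul_eq hw hw'
  rw [tw_vecMul ψ e hf]

/-- Moving one index from the second block to the first block. -/
def shiftE {l : ℕ} (e : ι ⊕ Fin (l + 1) ≃ ν) : (ι ⊕ Fin 1) ⊕ Fin l ≃ ν :=
  (Equiv.sumAssoc ι (Fin 1) (Fin l)).trans
    (((Equiv.refl ι).sumCongr (sumE (add_comm 1 l))).trans e)

theorem sum_addChar_ite {ψ : AddChar k ℂ} (hψ : ψ ≠ 0) (x : ι → k) :
    ∑ w : ι → k, ψ (∑ i, w i * x i) =
      if x = 0 then (Fintype.card k : ℂ) ^ Fintype.card ι else 0 := by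
  split_ifs with h
  · subst h
    simp
  · let φ : AddChar (ι → k) ℂ :=
      { toFun := fun w => ψ (∑ i, w i * x i)
        map_zero_eq_one' := by simp
        map_add_eq_mul' := fun a b => by
          rw [← AddChar.map_add_eq_mul, ← Finset.sum_add_distrib]
          simp [add_mul] }
    have hφ : φ ≠ 0 := by
      obtain ⟨i, hi⟩ := Function.ne_iff.1 h
      obtain ⟨y, hy⟩ := AddChar.ne_zero_iff.1 hψ
      refine AddChar.ne_zero_iff.2 ⟨Pi.single i (y * (x i)⁻¹), ?_⟩
      have : φ (Pi.single i (y * (x i)⁻¹)) = ψ y := by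
        change ψ (∑ j, (Pi.single i (y * (x i)⁻¹) : ι → k) j * x j) = ψ y
        rw [Finset.sum_eq_single i]
        · rw [Pi.single_eq_same, mul_assoc, inv_mul_cancel₀ hi, mul_one]
        · intro j _ hj
          rw [Pi.single_eq_of_ne hj, zero_mul]
        · simp
      rwa [this]
    exact AddChar.sum_eq_zero_iff_ne_zero.2 hφ

theorem sum_tw {ψ : AddChar k ℂ} (hψ : ψ ≠ 0) {l : ℕ} (e : ι ⊕ Fin (l + 1) ≃ ν)
    {f : GL ν k → ℂ} (hf : IsClass f) :
    ∑ w, tw ψ e f w = tw ψ (shiftE e) f (Sum.elim 0 1) := by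
  have h1 : ∀ w : ι → k, tw ψ e f w = 𝔼 u : Matrix ι (Fin 1) k,
      ψ (∑ i, w i * u i 0) * 𝔼 W : Matrix (ι ⊕ Fin 1) (Fin l) k,
        ψ (∑ j : Fin l, if j.1 = 0 then W (.inr 0) j else 0) *
          whit ψ l fun d => f (pe (shiftE e) ⟨pe (Equiv.refl _) ⟨1, u, 1⟩, W, d⟩) := by
    intro w
    unfold tw
    simp only [whit_succ, Finset.mul_expect]
    rw [← expect_prod (fun z : Matrix ι (Fin (l + 1)) k × Matrix (Fin 1) (Fin l) k =>
      ψ (∑ i, ∑ j : Fin (l + 1), if j.1 = 0 then w i * z.1 i j else 0) *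
        (ψ (∑ j : Fin l, if j.1 = 0 then z.2 0 j else 0) *
          whit ψ l fun d => f (pe e ⟨1, z.1, pe (sumE (add_comm 1 l)) ⟨1, z.2, d⟩⟩))),
      ← expect_prod (fun z : Matrix ι (Fin 1) k × Matrix (ι ⊕ Fin 1) (Fin l) k =>
      ψ (∑ i, w i * z.1 i 0) * (ψ (∑ j : Fin l, if j.1 = 0 then z.2 (.inr 0) j else 0) *
          whit ψ l fun d => f (pe (shiftE e) ⟨pe (Equiv.refl _) ⟨1, z.1, 1⟩, z.2, d⟩)))]
    symm
    refine Fintype.expect_equiv (regroup (Equiv.refl _) (sumE (add_comm 1 l))) _ _ fun z => ?_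
    congr 2
    · congr 1
      ext i
      rw [Fin.sum_univ_succ]
      simp [regroup, sumE_symm_zero]
    · congr 1
      ext d
      rw [← rel_regroup (Equiv.refl _) (shiftE e), hf.rel_eq _ (Equiv.refl ν)]
      congr 1
  simp only [h1]
  rw [← sum_expect]
  simp only [← Finset.sum_mul, sum_addChar_ite hψ]
  rw [Fintype.expect_eq_sum_div_card, Finset.sum_eq_single 0]
  · rw [if_pos (by rfl)]
    have hc : Fintype.card (Matrix ι (Fin 1) k) = Fintype.card k ^ Fintype.card ι := by
      change Fintype.card (ι → Fin 1 → k) = _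
      rw [Fintype.card_fun, Fintype.card_fun]
      simp
    rw [hc, Nat.cast_pow, mul_div_right_comm, div_self, one_mul]
    · unfold tw
      refine Finset.expect_congr rfl fun W _ => ?_
      congr 2
      · simp [Fintype.sum_sum_type]
      · have : (⟨1, 0, 1⟩ : Par k ι (Fin 1)) = 1 := rfl
        rw [this, map_one]
    · have : (Fintype.card k : ℂ) ≠ 0 := by exact_mod_cast Fintype.card_ne_zero
      exact pow_ne_zero _ this
  · intro u _ hu
    rw [if_neg, zero_mul]
    intro h
    apply hu
    ext i j
    rw [Subsingleton.elim j 0]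
    exact congrFun h i
  · simp

/-- The order of the group of invertible matrices, up to a power of the order of the field. -/
noncomputable def gnum (q : ℂ) (n : ℕ) : ℂ := ∏ j ∈ Finset.range n, (q ^ (j + 1) - 1)

theorem del_reindex {ι' : Type} [Fintype ι'] [DecidableEq ι'] {l : ℕ} (e : ι ⊕ Fin l ≃ ν)
    (e' : ι' ⊕ Fin l ≃ ν) (φ : ι ≃ ι') {f : GL ν k → ℂ} (hf : IsClass f) (d : GL (Fin l) k) :
    del e f 1 d = del e' f 1 d := by
  unfold del
  refine Fintype.expect_equiv (Matrix.reindex φ (Equiv.refl (Fin l))) _ _ fun U => ?_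
  have : pe e' ⟨1, Matrix.reindex φ (Equiv.refl (Fin l)) U, d⟩ =
      rel (e.symm.trans ((φ.sumCongr (Equiv.refl _)).trans e')) (pe e ⟨1, U, d⟩) := by
    apply Units.ext
    ext p q
    obtain ⟨p, rfl⟩ := ((φ.sumCongr (Equiv.refl _)).trans e').surjective p
    obtain ⟨q, rfl⟩ := ((φ.sumCongr (Equiv.refl _)).trans e').surjective q
    rcases p with p | p <;> rcases q with q | q <;>
      simp [pe_apply, Matrix.one_apply]
  rw [this, hf.rel_eq _ (Equiv.refl ν)]
  congr 1

theorem gnum_succ (q : ℂ) (n : ℕ) : gnum q (n + 1) = gnum q n * (q ^ (n + 1) - 1) :=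
  Finset.prod_range_succ _ _

theorem card_pow_sub_one_ne (n : ℕ) : (Fintype.card k : ℂ) ^ (n + 1) - 1 ≠ 0 := by
  have h : 1 < Fintype.card k ^ (n + 1) := Nat.one_lt_pow (by omega) Fintype.one_lt_card
  rw [sub_ne_zero]
  exact_mod_cast h.ne'

theorem gnum_ne_zero (n : ℕ) : gnum (Fintype.card k : ℂ) n ≠ 0 :=
  Finset.prod_ne_zero_iff.2 fun j _ => card_pow_sub_one_ne j

theorem tw_fin_zero (ψ : AddChar k ℂ) (e : ι ⊕ Fin 0 ≃ ν) (f : GL ν k → ℂ) (w : ι → k) :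
    tw ψ e f w = f 1 := by
  unfold tw
  have : ∀ U : Matrix ι (Fin 0) k,
      ψ (∑ i, ∑ j : Fin 0, if j.1 = 0 then w i * U i j else 0) *
        whit ψ 0 (fun d => f (pe e ⟨1, U, d⟩)) = f 1 := by
    intro U
    rw [whit_zero]
    have h : (⟨1, U, 1⟩ : Par k ι (Fin 0)) = 1 := by
      ext1
      · rfl
      · ext i j
        exact j.elim0
      · rfl
    simp [h]
  simp only [this]
  exact Fintype.expect_const _

theorem degree_aux {ψ : AddChar k ℂ} (hψ : ψ ≠ 0) {n : ℕ} {f : GL (Fin n) k → ℂ} (hf : IsClass f)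
    (a : ℕ → ℂ) (ha : ∀ j l (h : j + l = n), a j = whit ψ l fun d => del (sumE h) f 1 d) (l : ℕ) :
    ∀ (ι : Type) [Fintype ι] [DecidableEq ι] (m : ℕ) (_ : Fintype.card ι = m + 1)
      (_ : m + 1 + l = n) (e : ι ⊕ Fin l ≃ Fin n) (w : ι → k) (_ : w ≠ 0),
      f 1 / gnum (Fintype.card k) (n - 1) =
        ∑ j ∈ Finset.Ico (m + 1) n, a j / gnum (Fintype.card k) j +
          tw ψ e f w / gnum (Fintype.card k) m := by
  induction l with
  | zero =>
    intro ι _ _ m hι hm e w hw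
    subst hm
    simp [tw_fin_zero]
  | succ l ih =>
    intro ι _ _ m hι hm e w hw
    rw [ih (ι ⊕ Fin 1) (m + 1) (by simp [hι]) (by omega) (shiftE e) (Sum.elim 0 1)
      (fun h => one_ne_zero (congrFun h (.inr 0))), ← sum_tw hψ e hf,
      Finset.sum_eq_sum_Ico_succ_bot (by omega : m + 1 < n)]
    have h1 : ∑ w', tw ψ e f w' =
        a (m + 1) + ((Fintype.card k : ℂ) ^ (m + 1) - 1) * tw ψ e f w := by
      rw [← Finset.add_sum_erase _ _ (Finset.mem_univ (0 : ι → k))]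
      congr 1
      · rw [tw_zero, ha (m + 1) (l + 1) hm]
        congr 1
        ext d
        exact del_reindex e _ (Fintype.equivFinOfCardEq hι) hf d
      · rw [Finset.sum_congr rfl fun w' hw' => tw_eq ψ e hf (Finset.ne_of_mem_erase hw') hw,
          Finset.sum_const, Finset.card_erase_of_mem (Finset.mem_univ _), nsmul_eq_mul,
          Finset.card_univ, Fintype.card_fun, hι,
          Nat.cast_sub (Nat.one_le_pow _ _ Fintype.card_pos)]
        simp
    rw [h1, gnum_succ]
    have h2 := gnum_ne_zero (k := k) m
    have h3 := card_pow_sub_one_ne (k := k) m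
    field_simp
    ring

theorem degree_formula {ψ : AddChar k ℂ} (hψ : ψ ≠ 0) {n : ℕ} {f : GL (Fin n) k → ℂ}
    (hf : IsClass f) (a : ℕ → ℂ)
    (ha : ∀ j l (h : j + l = n), a j = whit ψ l fun d => del (sumE h) f 1 d) :
    (Fintype.card k : ℂ) ^ n * (f 1 / gnum (Fintype.card k) n) =
      ∑ j ∈ Finset.range (n + 1), a j / gnum (Fintype.card k) j := by
  have h0 : a n = f 1 := by
    rw [ha n 0 rfl, whit_zero]
    have := tw_zero ψ (sumE (add_zero n)) f
    rw [tw_fin_zero, whit_zero] at this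
    exact this.symm
  rw [Finset.sum_range_succ, h0]
  rcases n with _ | l
  · simp
  suffices h : f 1 / gnum (Fintype.card k) l =
      ∑ j ∈ Finset.range (l + 1), a j / gnum (Fintype.card k) j by
    rw [← h, gnum_succ]
    have h2 := gnum_ne_zero (k := k) l
    have h3 := card_pow_sub_one_ne (k := k) l
    field_simp
    ring
  have := degree_aux hψ hf a ha l (Fin 0 ⊕ Fin 1) 0 (by simp) (by omega)
    (shiftE (sumE (zero_add (l + 1)))) (Sum.elim 0 1)
    (fun h => one_ne_zero (congrFun h (.inr 0)))
  rw [← sum_tw hψ _ hf, Fintype.sum_unique, Subsingleton.elim default 0, tw_zero,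
    ← ha 0 (l + 1)] at this
  rw [Finset.range_eq_Ico, Finset.sum_eq_sum_Ico_succ_bot (by omega), add_comm (a 0 / _)]
  exact this

end Dimension

end GLSmall

namespace GLSmall

open scoped BigOperators

/-- A positive self-adjoint Hopf algebra with distinguished basis `I`, truncated at degree five,
with a degree function. -/
structure Psh (I : Type) [Fintype I] [DecidableEq I] where
  q : ℕ
  two_le_q : 2 ≤ q
  deg : I → ℕ
  c : I → I → I → ℕ
  one : I
  D : I → ℚ
  δ : I → ℕ
  deg_le : ∀ a, deg a ≤ 5
  c_deg : ∀ a b v, c a b v ≠ 0 → deg a + deg b = deg v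
  deg_one : ∀ a, deg a = 0 ↔ a = one
  one_c : ∀ a v, c one a v = if a = v then 1 else 0
  c_one : ∀ a v, c a one v = if a = v then 1 else 0
  assoc : ∀ a b g v, ∑ m, c a b m * c m g v = ∑ m, c b g m * c a m v
  hopf : ∀ a b g d, deg a + deg b ≤ 5 → ∑ v, c a b v * c g d v =
    ∑ p, ∑ q, ∑ r, ∑ s, c p q a * c r s b * (c p r g * c q s d)
  D_pos : ∀ a, 0 < D a
  D_mul : ∀ a b, deg a + deg b ≤ 5 → D a * D b = ∑ v, c a b v * D v
  dim : ∀ v, (q : ℚ) ^ deg v * D v = ∑ a, ∑ b, (c a b v * (D a * δ b) : ℚ)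
  lin : ∀ a, deg a = 1 → ∃ x : ℕ → I, x 1 = a ∧ ∀ m ≤ 5, deg (x m) = m ∧
    D (x m) = (∏ j ∈ Finset.range m, ((q : ℚ) ^ (j + 1) - 1))⁻¹ ∧
    ∀ α β, c α β (x m) = if deg α + deg β = m ∧ α = x (deg α) ∧ β = x (deg β) then 1 else 0

namespace Psh

variable {I : Type} [Fintype I] [DecidableEq I] (P : Psh I)

/-- Primitive basis elements. -/
def IsAtom (a : I) : Prop := a ≠ P.one ∧ ∀ r s, P.c r s a ≠ 0 → r = P.one ∨ s = P.one

/-- Constituents of products of elements of `S`. -/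
inductive W (S : Finset I) : I → Prop
  | one : W S P.one
  | step (a ρ v : I) : W S a → ρ ∈ S → P.c a ρ v ≠ 0 → W S v

variable {P}

theorem deg_pos {a : I} (h : a ≠ P.one) : 1 ≤ P.deg a :=
  Nat.one_le_iff_ne_zero.2 fun h' => h ((P.deg_one a).1 h')

theorem deg_of_one : P.deg P.one = 0 := (P.deg_one _).2 rfl

theorem eq_of_one_c {a v : I} (h : P.c P.one a v ≠ 0) : a = v := by
  by_contra hn
  exact h (by rw [P.one_c, if_neg hn])

theorem eq_of_c_one {a v : I} (h : P.c a P.one v ≠ 0) : a = v := by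
  by_contra hn
  exact h (by rw [P.c_one, if_neg hn])

theorem one_c_self (a : I) : P.c P.one a a = 1 := by rw [P.one_c, if_pos rfl]

theorem c_one_self (a : I) : P.c a P.one a = 1 := by rw [P.c_one, if_pos rfl]

theorem IsAtom.cases {ρ r s : I} (h : P.IsAtom ρ) (hc : P.c r s ρ ≠ 0) :
    r = P.one ∧ s = ρ ∨ r = ρ ∧ s = P.one := by
  rcases h.2 r s hc with rfl | rfl
  · exact .inl ⟨rfl, eq_of_one_c hc⟩
  · exact .inr ⟨eq_of_c_one hc, rfl⟩

theorem exists_assoc {a b g v m : I} (h1 : P.c a b m ≠ 0) (h2 : P.c m g v ≠ 0) :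
    ∃ m', P.c b g m' ≠ 0 ∧ P.c a m' v ≠ 0 := by
  have h := P.assoc a b g v
  by_contra! hn
  rw [Finset.sum_eq_zero (s := Finset.univ) (f := fun m => P.c b g m * P.c a m v)] at h
  · exact mul_ne_zero h1 h2 (Finset.sum_eq_zero_iff.1 h m (Finset.mem_univ _))
  · intro m _
    by_cases hm : P.c b g m = 0
    · rw [hm, zero_mul]
    · rw [hn m hm, mul_zero]

theorem exists_assoc' {a b g v m : I} (h1 : P.c b g m ≠ 0) (h2 : P.c a m v ≠ 0) :
    ∃ m', P.c a b m' ≠ 0 ∧ P.c m' g v ≠ 0 := by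
  have h := P.assoc a b g v
  by_contra! hn
  rw [Finset.sum_eq_zero (s := Finset.univ) (f := fun m => P.c a b m * P.c m g v)] at h
  · exact mul_ne_zero h1 h2 (Finset.sum_eq_zero_iff.1 h.symm m (Finset.mem_univ _))
  · intro m _
    by_cases hm : P.c a b m = 0
    · rw [hm, zero_mul]
    · rw [hn m hm, mul_zero]

theorem exists_hopf {a b g d v : I} (h1 : P.c a b v ≠ 0) (h2 : P.c g d v ≠ 0) :
    ∃ p q r s, P.c p q a ≠ 0 ∧ P.c r s b ≠ 0 ∧ P.c p r g ≠ 0 ∧ P.c q s d ≠ 0 := by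
  have h := P.hopf a b g d ((P.c_deg a b v h1).trans_le (P.deg_le v))
  by_contra! hn
  rw [Finset.sum_eq_zero (s := Finset.univ) (f := fun p => ∑ q, ∑ r, ∑ s,
    P.c p q a * P.c r s b * (P.c p r g * P.c q s d))] at h
  · exact mul_ne_zero h1 h2 (Finset.sum_eq_zero_iff.1 h v (Finset.mem_univ _))
  · refine fun p _ => Finset.sum_eq_zero fun q _ => Finset.sum_eq_zero fun r _ =>
      Finset.sum_eq_zero fun s _ => ?_
    by_cases h1 : P.c p q a = 0
    · simp [h1]
    by_cases h2 : P.c r s b = 0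
    · simp [h2]
    by_cases h3 : P.c p r g = 0
    · simp [h3]
    simp [hn p q r s h1 h2 h3]

variable {S T : Finset I}

theorem W.mul {a b v : I} (ha : P.W S a) (hb : P.W S b) (h : P.c a b v ≠ 0) : P.W S v := by
  induction hb generalizing v with
  | one => exact eq_of_c_one h ▸ ha
  | step b ρ m _ hρ hc ih =>
    obtain ⟨m', h1, h2⟩ := exists_assoc' hc h
    exact .step _ _ _ (ih h1) hρ h2

theorem W.of_mem {ρ : I} (h : ρ ∈ S) : P.W S ρ :=
  .step _ _ _ .one h (by rw [one_c_self]; exact one_ne_zero)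

theorem W.mono {v : I} (h : P.W S v) (hST : S ⊆ T) : P.W T v := by
  induction h with
  | one => exact .one
  | step a ρ v _ hρ hc ih => exact .step _ _ _ ih (hST hρ) hc

theorem W.factor (hS : ∀ ρ ∈ S, P.IsAtom ρ) {v α β : I} (hv : P.W S v) (h : P.c α β v ≠ 0) :
    P.W S α ∧ P.W S β := by
  induction hv generalizing α β with
  | one =>
    have := P.c_deg _ _ _ h
    rw [deg_of_one] at this
    rw [(P.deg_one α).1 (by omega), (P.deg_one β).1 (by omega)]
    exact ⟨.one, .one⟩
  | step a ρ v ha hρ hc ih =>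
    obtain ⟨p, q, r, s, h1, h2, h3, h4⟩ := exists_hopf hc h
    obtain ⟨hp, hq⟩ := ih h1
    rcases (hS ρ hρ).cases h2 with ⟨rfl, rfl⟩ | ⟨rfl, rfl⟩
    · exact ⟨eq_of_c_one h3 ▸ hp, .step _ _ _ hq hρ h4⟩
    · exact ⟨.step _ _ _ hp hρ h3, eq_of_c_one h4 ▸ hq⟩

theorem W.mem_of_isAtom (hS : ∀ ρ ∈ S, P.IsAtom ρ) {v : I} (hv : P.W S v) (h : P.IsAtom v) :
    v ∈ S := by
  cases hv with
  | one => exact absurd rfl h.1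
  | step a ρ v ha hρ hc =>
    rcases h.cases hc with ⟨_, rfl⟩ | ⟨_, h2⟩
    · exact hρ
    · exact absurd h2 (hS ρ hρ).1

theorem W.eq_one (hS : ∀ ρ ∈ S, P.IsAtom ρ) (hT : ∀ ρ ∈ T, P.IsAtom ρ) (hST : Disjoint S T)
    {v : I} (hv : P.W S v) (hv' : P.W T v) : v = P.one := by
  cases hv with
  | one => rfl
  | step a ρ v ha hρ hc =>
    have := (hv'.factor hT hc).2.mem_of_isAtom hT (hS ρ hρ)
    exact absurd this (Finset.disjoint_left.1 hST hρ)

theorem W.of_all (hS : ∀ ρ, P.IsAtom ρ → ρ ∈ S) (v : I) : P.W S v := by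
  induction hn : P.deg v using Nat.strong_induction_on generalizing v with
  | _ n ih =>
    subst hn
    by_cases h1 : v = P.one
    · exact h1 ▸ .one
    by_cases h2 : P.IsAtom v
    · exact .of_mem (hS v h2)
    unfold IsAtom at h2
    push Not at h2
    obtain ⟨r, s, hc, hr, hs⟩ := h2 h1
    have := P.c_deg _ _ _ hc
    have hr' := deg_pos hr
    have hs' := deg_pos hs
    exact (ih _ (by omega) r rfl).mul (ih _ (by omega) s rfl) hc

/-- A basis element occurring in a product. -/
noncomputable def pr (P : Psh I) (a b : I) : I :=
  open Classical in if h : ∃ v, P.c a b v ≠ 0 then h.choose else P.one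

section Disjoint

variable (hS : ∀ ρ ∈ S, P.IsAtom ρ) (hT : ∀ ρ ∈ T, P.IsAtom ρ) (hST : Disjoint S T)
include hS hT hST

theorem sum_c_mul_c {a a' b b' : I} (ha : P.W S a) (ha' : P.W S a') (hb : P.W T b)
    (hb' : P.W T b') (hd : P.deg a + P.deg b ≤ 5) :
    ∑ v, P.c a b v * P.c a' b' v = if a = a' ∧ b = b' then 1 else 0 := by
  rw [P.hopf _ _ _ _ hd, Finset.sum_eq_single a, Finset.sum_eq_single P.one,
    Finset.sum_eq_single P.one, Finset.sum_eq_single b]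
  · rw [c_one_self, one_c_self, P.c_one, P.one_c]
    by_cases h1 : a = a' <;> by_cases h2 : b = b' <;> simp [h1, h2]
  · intro s _ hs
    rw [P.one_c s b, if_neg hs]
    simp
  · simp
  · intro r _ hr
    refine Finset.sum_eq_zero fun s _ => ?_
    by_contra hn
    rw [← ne_eq, mul_ne_zero_iff, mul_ne_zero_iff, mul_ne_zero_iff] at hn
    exact hr ((ha'.factor hS hn.2.1).2.eq_one hS hT hST (hb.factor hT hn.1.2).1)
  · simp
  · intro q _ hq
    refine Finset.sum_eq_zero fun r _ => Finset.sum_eq_zero fun s _ => ?_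
    by_contra hn
    rw [← ne_eq, mul_ne_zero_iff, mul_ne_zero_iff, mul_ne_zero_iff] at hn
    exact hq ((ha.factor hS hn.1.1).2.eq_one hS hT hST (hb'.factor hT hn.2.2).1)
  · simp
  · intro p _ hp
    refine Finset.sum_eq_zero fun q _ => Finset.sum_eq_zero fun r _ =>
      Finset.sum_eq_zero fun s _ => ?_
    by_contra hn
    rw [← ne_eq, mul_ne_zero_iff, mul_ne_zero_iff, mul_ne_zero_iff] at hn
    have := (ha.factor hS hn.1.1).2.eq_one hS hT hST (hb'.factor hT hn.2.2).1
    subst this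
    exact hp (eq_of_c_one hn.1.1)
  · simp

theorem exists_c_eq {a b : I} (ha : P.W S a) (hb : P.W T b) (hd : P.deg a + P.deg b ≤ 5) :
    ∃ v, ∀ w, P.c a b w = if w = v then 1 else 0 := by
  have h := sum_c_mul_c hS hT hST ha ha hb hb hd
  rw [if_pos ⟨rfl, rfl⟩] at h
  have h0 : ∃ v, P.c a b v ≠ 0 := by
    by_contra! hn
    simp [hn] at h
  obtain ⟨v, hv⟩ := h0
  have h1 := Finset.add_sum_erase Finset.univ (fun v => P.c a b v * P.c a b v) (Finset.mem_univ v)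
  rw [h] at h1
  have h2 : 1 ≤ P.c a b v * P.c a b v := Nat.one_le_iff_ne_zero.2 (mul_ne_zero hv hv)
  have h3 : ∑ v ∈ Finset.univ.erase v, P.c a b v * P.c a b v = 0 := by
    omega
  refine ⟨v, fun w => ?_⟩
  split_ifs with hw
  · subst hw
    rw [h3, add_zero] at h1
    exact Nat.eq_one_of_mul_eq_one_right h1
  · have := Finset.sum_eq_zero_iff.1 h3 w (Finset.mem_erase.2 ⟨hw, Finset.mem_univ _⟩)
    exact (mul_self_eq_zero.1 this)

theorem c_eq_pr {a b : I} (ha : P.W S a) (hb : P.W T b) (hd : P.deg a + P.deg b ≤ 5) (w : I) :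
    P.c a b w = if w = P.pr a b then 1 else 0 := by
  obtain ⟨v, hv⟩ := exists_c_eq hS hT hST ha hb hd
  have h : ∃ v, P.c a b v ≠ 0 := ⟨v, by rw [hv, if_pos rfl]; exact one_ne_zero⟩
  have : P.pr a b = v := by
    unfold pr
    rw [dif_pos h]
    by_contra hn
    exact h.choose_spec (by rw [hv, if_neg hn])
  rw [this, hv]

theorem c_comm_ne_zero {a b v : I} (ha : P.W S a) (hb : P.W T b) (h : P.c a b v ≠ 0) :
    P.c b a v ≠ 0 := by
  have hd : P.deg a + P.deg b ≤ 5 := (P.c_deg a b v h).trans_le (P.deg_le v)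
  rw [c_eq_pr hS hT hST ha hb hd] at h
  have hv : v = P.pr a b := by
    by_contra hn
    exact h (if_neg hn)
  have h1 : ∑ v, P.c a b v * P.c b a v = 1 := by
    rw [P.hopf _ _ _ _ hd, Finset.sum_eq_single P.one, Finset.sum_eq_single a,
      Finset.sum_eq_single b, Finset.sum_eq_single P.one]
    · simp [c_one_self, one_c_self]
    · intro s _ hs
      rw [one_c_self]
      by_contra hn
      rw [← ne_eq, mul_ne_zero_iff, mul_ne_zero_iff, mul_ne_zero_iff] at hn
      have := P.c_deg _ _ _ hn.1.2
      have := (P.deg_one s).1 (by omega)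
      exact hs this
    · simp
    · intro r _ hr
      refine Finset.sum_eq_zero fun s _ => ?_
      rw [P.one_c r b, if_neg hr]
      simp
    · simp
    · intro q _ hq
      refine Finset.sum_eq_zero fun r _ => Finset.sum_eq_zero fun s _ => ?_
      rw [P.one_c q a, if_neg hq]
      simp
    · simp
    · intro p _ hp
      refine Finset.sum_eq_zero fun q _ => Finset.sum_eq_zero fun r _ =>
        Finset.sum_eq_zero fun s _ => ?_
      by_contra hn
      rw [← ne_eq, mul_ne_zero_iff, mul_ne_zero_iff, mul_ne_zero_iff] at hn
      exact hp ((ha.factor hS hn.1.1).1.eq_one hS hT hST (hb.factor hT hn.2.1).1)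
    · simp
  simp only [c_eq_pr hS hT hST ha hb hd, ite_mul, one_mul, zero_mul, Finset.sum_ite_eq',
    Finset.mem_univ, if_true] at h1
  rw [hv, h1]
  exact one_ne_zero

theorem exists_factor {v : I} (hv : P.W (S ∪ T) v) :
    ∃ a b, P.W S a ∧ P.W T b ∧ P.c a b v ≠ 0 := by
  induction hv with
  | one => exact ⟨P.one, P.one, .one, .one, by rw [one_c_self]; exact one_ne_zero⟩
  | step m ρ v _ hρ hc ih =>
    obtain ⟨a, b, ha, hb, hab⟩ := ih
    obtain ⟨m', h1, h2⟩ := exists_assoc hab hc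
    rcases Finset.mem_union.1 hρ with hρ | hρ
    · have h3 := c_comm_ne_zero hT hS hST.symm hb (.of_mem hρ) h1
      obtain ⟨m'', h4, h5⟩ := exists_assoc' h3 h2
      exact ⟨m'', b, .step _ _ _ ha hρ h4, hb, h5⟩
    · exact ⟨a, m', ha, .step _ _ _ hb hρ h1, h2⟩

end Disjoint

/-- Constituents of degree `n` of products of elements of `S`. -/
noncomputable def Wn (P : Psh I) (S : Finset I) (n : ℕ) : Finset I :=
  open Classical in Finset.univ.filter fun v => P.W S v ∧ P.deg v = n

theorem mem_Wn {n : ℕ} {v : I} : v ∈ P.Wn S n ↔ P.W S v ∧ P.deg v = n := by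
  simp [Wn]

theorem prod_Wn_union (hS : ∀ ρ ∈ S, P.IsAtom ρ) (hT : ∀ ρ ∈ T, P.IsAtom ρ)
    (hST : Disjoint S T) {M : Type} [CommMonoid M] (F : I → M) {n : ℕ} (hn : n ≤ 5) :
    ∏ v ∈ P.Wn (S ∪ T) n, F v = ∏ x ∈ Finset.HasAntidiagonal.antidiagonal n,
      ∏ a ∈ P.Wn S x.1, ∏ b ∈ P.Wn T x.2, F (P.pr a b) := by
  simp only [← Finset.prod_product', Finset.prod_sigma']
  symm
  refine Finset.prod_bij (fun x _ => P.pr x.2.1 x.2.2) ?_ ?_ ?_ fun _ _ => rfl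
  · rintro ⟨⟨i, j⟩, a, b⟩ h
    simp only [Finset.mem_sigma, Finset.mem_product, Finset.HasAntidiagonal.mem_antidiagonal,
      mem_Wn] at h ⊢
    obtain ⟨hij, ⟨ha, rfl⟩, hb, rfl⟩ := h
    have h := c_eq_pr hS hT hST ha hb (hij.trans_le hn) (P.pr a b)
    have h' : P.c a b (P.pr a b) ≠ 0 := by
      rw [h, if_pos rfl]
      exact one_ne_zero
    exact ⟨(ha.mono Finset.subset_union_left).mul (hb.mono Finset.subset_union_right) h',
      by rw [← P.c_deg _ _ _ h', hij]⟩
  · rintro ⟨⟨i, j⟩, a, b⟩ h ⟨⟨i', j'⟩, a', b'⟩ h' heq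
    simp only [Finset.mem_sigma, Finset.mem_product, Finset.HasAntidiagonal.mem_antidiagonal,
      mem_Wn] at h h' heq
    obtain ⟨hij, ⟨ha, rfl⟩, hb, rfl⟩ := h
    obtain ⟨hij', ⟨ha', rfl⟩, hb', rfl⟩ := h'
    have h := sum_c_mul_c hS hT hST ha ha' hb hb' (hij.trans_le hn)
    simp only [c_eq_pr hS hT hST ha hb (hij.trans_le hn),
      c_eq_pr hS hT hST ha' hb' (hij'.trans_le hn), heq, ite_mul, one_mul, zero_mul,
      Finset.sum_ite_eq', Finset.mem_univ, if_true] at h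
    have : a = a' ∧ b = b' := by
      by_contra hn
      rw [if_neg hn] at h
      exact one_ne_zero h
    obtain ⟨rfl, rfl⟩ := this
    rfl
  · intro v hv
    rw [mem_Wn] at hv
    obtain ⟨a, b, ha, hb, hc⟩ := exists_factor hS hT hST hv.1
    have hd := P.c_deg _ _ _ hc
    refine ⟨⟨(P.deg a, P.deg b), a, b⟩, ?_, ?_⟩
    · simp only [Finset.mem_sigma, Finset.mem_product, Finset.HasAntidiagonal.mem_antidiagonal,
        mem_Wn]
      exact ⟨by omega, ⟨ha, trivial⟩, hb, trivial⟩
    · by_contra hne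
      rw [c_eq_pr hS hT hST ha hb (by omega), if_neg (Ne.symm hne)] at hc
      exact hc rfl

theorem D_pr (hS : ∀ ρ ∈ S, P.IsAtom ρ) (hT : ∀ ρ ∈ T, P.IsAtom ρ)
    (hST : Disjoint S T) {a b : I} (ha : P.W S a) (hb : P.W T b) (hd : P.deg a + P.deg b ≤ 5) :
    P.D (P.pr a b) = P.D a * P.D b := by
  rw [P.D_mul a b hd]
  simp [c_eq_pr hS hT hST ha hb hd]

theorem D_one : P.D P.one = 1 := by
  have h := P.D_mul P.one P.one (by simp [deg_of_one])
  have h0 := P.D_pos P.one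
  have h1 : ∑ v, (P.c P.one P.one v : ℚ) * P.D v = P.D P.one := by simp [P.one_c]
  rw [h1] at h
  exact mul_left_cancel₀ h0.ne' (h.trans (mul_one _).symm)

theorem δ_one : P.δ P.one = 1 := by
  have h := P.dim P.one
  rw [deg_of_one, Finset.sum_eq_single P.one, Finset.sum_eq_single P.one, one_c_self, D_one] at h
  · simp at h
    exact_mod_cast h.symm
  · intro b _ hb
    rw [P.one_c, if_neg hb]
    simp
  · simp
  · intro a _ ha
    refine Finset.sum_eq_zero fun b _ => ?_
    by_cases hc : P.c a b P.one = 0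
    · simp [hc]
    · have := P.c_deg _ _ _ hc
      rw [deg_of_one] at this
      exact absurd ((P.deg_one a).1 (by omega)) ha
  · simp

end Psh

end GLSmall

namespace GLSmall

open scoped BigOperators
open Matrix

namespace Psh

variable {I : Type} [Fintype I] [DecidableEq I] {P : Psh I}

theorem dim_mul (a b : I) (hd : P.deg a + P.deg b ≤ 5) :
    ∑ p, ∑ q, ∑ r, ∑ s, (P.c p q a * P.c r s b : ℚ) * (P.D p * P.D r) *
      (P.δ q * P.δ s) = ∑ p, ∑ q, ∑ r, ∑ s, (P.c p q a * P.c r s b : ℚ) * (P.D p * P.D r) *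
      ∑ t, (P.c q s t * P.δ t : ℚ) := by
  have h1 : ((P.q : ℚ) ^ P.deg a * P.D a) * ((P.q : ℚ) ^ P.deg b * P.D b) =
      ∑ v, (P.c a b v : ℚ) * ((P.q : ℚ) ^ P.deg v * P.D v) := by
    rw [mul_mul_mul_comm, ← pow_add, P.D_mul a b hd, Finset.mul_sum]
    refine Finset.sum_congr rfl fun v _ => ?_
    by_cases hc : P.c a b v = 0
    · simp [hc]
    · rw [P.c_deg _ _ _ hc]
      ring
  have h2 : ∀ v, (P.c a b v : ℚ) * ((P.q : ℚ) ^ P.deg v * P.D v) =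
      ∑ g, ∑ d, (P.D g * P.δ d) * ((P.c a b v * P.c g d v : ℕ) : ℚ) := by
    intro v
    rw [P.dim, Finset.mul_sum]
    refine Finset.sum_congr rfl fun g _ => ?_
    rw [Finset.mul_sum]
    refine Finset.sum_congr rfl fun d _ => ?_
    push_cast
    ring
  rw [P.dim a, P.dim b] at h1
  simp only [h2] at h1
  replace h1 := h1.trans Finset.sum_comm
  have h3 : ∀ g, ∑ v, ∑ d, (P.D g * P.δ d) * ((P.c a b v * P.c g d v : ℕ) : ℚ) =
      ∑ d, ∑ p, ∑ q, ∑ r, ∑ s, (P.D g * P.δ d) *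
        ((P.c p q a * P.c r s b * (P.c p r g * P.c q s d) : ℕ) : ℚ) := by
    intro g
    rw [Finset.sum_comm]
    refine Finset.sum_congr rfl fun d _ => ?_
    rw [← Finset.mul_sum, ← Nat.cast_sum, P.hopf a b g d hd]
    simp only [Nat.cast_sum, Finset.mul_sum]
  simp only [h3] at h1
  have h4 : ∑ g, ∑ d, ∑ p, ∑ q, ∑ r, ∑ s, (P.D g * P.δ d) *
        ((P.c p q a * P.c r s b * (P.c p r g * P.c q s d) : ℕ) : ℚ) =
      ∑ p, ∑ q, ∑ r, ∑ s, ∑ g, ∑ d, (P.D g * P.δ d) *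
        ((P.c p q a * P.c r s b * (P.c p r g * P.c q s d) : ℕ) : ℚ) := by
    simp only [← Fintype.sum_prod_type']
    exact Fintype.sum_equiv
      { toFun := fun x : I × I × I × I × I × I =>
          (x.2.2.1, x.2.2.2.1, x.2.2.2.2.1, x.2.2.2.2.2, x.1, x.2.1)
        invFun := fun x => (x.2.2.2.2.1, x.2.2.2.2.2, x.1, x.2.1, x.2.2.1, x.2.2.2.1)
        left_inv := fun x => rfl
        right_inv := fun x => rfl } _ _ fun x => rfl
  rw [h4] at h1
  have h5 : ∀ p q r s, ∑ g, ∑ d, (P.D g * P.δ d) *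
        ((P.c p q a * P.c r s b * (P.c p r g * P.c q s d) : ℕ) : ℚ) =
      (P.c p q a * P.c r s b : ℚ) * (P.D p * P.D r) * ∑ t, (P.c q s t * P.δ t : ℚ) := by
    intro p q r s
    by_cases hp : P.c p q a = 0
    · simp [hp]
    by_cases hr : P.c r s b = 0
    · simp [hr]
    rw [P.D_mul p r (by have := P.c_deg _ _ _ hp; have := P.c_deg _ _ _ hr; omega),
      mul_assoc, Finset.sum_mul_sum, Finset.mul_sum]
    refine Finset.sum_congr rfl fun g _ => ?_
    rw [Finset.mul_sum]
    refine Finset.sum_congr rfl fun d _ => ?_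
    push_cast
    ring
  simp only [h5] at h1
  rw [← h1, Finset.sum_mul]
  refine Finset.sum_congr rfl fun p _ => ?_
  rw [Finset.sum_mul]
  refine Finset.sum_congr rfl fun q _ => ?_
  rw [Finset.mul_sum]
  refine Finset.sum_congr rfl fun r _ => ?_
  rw [Finset.mul_sum]
  refine Finset.sum_congr rfl fun s _ => ?_
  ring

theorem δ_mul (a b : I) (hd : P.deg a + P.deg b ≤ 5) :
    (P.δ a * P.δ b : ℚ) = ∑ t, (P.c a b t * P.δ t : ℚ) := by
  induction hn : P.deg a + P.deg b using Nat.strong_induction_on generalizing a b with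
  | _ n ih =>
    subst hn
    have h := dim_mul a b hd
    rw [← sub_eq_zero] at h
    simp only [← Finset.sum_sub_distrib, ← mul_sub] at h
    have key : ∀ p q r s, ¬(p = P.one ∧ q = a ∧ r = P.one ∧ s = b) →
        (P.c p q a * P.c r s b : ℚ) * (P.D p * P.D r) *
          (P.δ q * P.δ s - ∑ t, (P.c q s t * P.δ t : ℚ)) = 0 := by
      intro p q r s hne
      by_cases hp : P.c p q a = 0
      · simp [hp]
      by_cases hr : P.c r s b = 0
      · simp [hr]
      have h1 := P.c_deg _ _ _ hp
      have h2 := P.c_deg _ _ _ hr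
      rw [ih (P.deg q + P.deg s) ?_ q s (by omega) rfl, sub_self, mul_zero]
      by_contra hlt
      have hp1 := (P.deg_one p).1 (by omega)
      have hr1 := (P.deg_one r).1 (by omega)
      subst hp1
      subst hr1
      exact hne ⟨rfl, eq_of_one_c hp, rfl, eq_of_one_c hr⟩
    rw [Finset.sum_eq_single P.one, Finset.sum_eq_single a, Finset.sum_eq_single P.one,
      Finset.sum_eq_single b] at h
    · rw [one_c_self, one_c_self, D_one] at h
      push_cast at h
      linarith
    · exact fun s _ hs => key _ _ _ _ fun h => hs h.2.2.2
    · simp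
    · exact fun r _ hr => Finset.sum_eq_zero fun s _ => key _ _ _ _ fun h => hr h.2.2.1
    · simp
    · exact fun q _ hq => Finset.sum_eq_zero fun r _ => Finset.sum_eq_zero fun s _ =>
        key _ _ _ _ fun h => hq h.2.1
    · simp
    · exact fun p _ hp => Finset.sum_eq_zero fun q _ => Finset.sum_eq_zero fun r _ =>
        Finset.sum_eq_zero fun s _ => key _ _ _ _ fun h => hp h.1
    · simp

theorem δ_pr {S T : Finset I} (hS : ∀ ρ ∈ S, P.IsAtom ρ) (hT : ∀ ρ ∈ T, P.IsAtom ρ)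
    (hST : Disjoint S T) {a b : I} (ha : P.W S a) (hb : P.W T b) (hd : P.deg a + P.deg b ≤ 5) :
    P.δ (P.pr a b) = P.δ a * P.δ b := by
  have := P.δ_mul a b hd
  simp only [c_eq_pr hS hT hST ha hb hd] at this
  simp at this
  exact_mod_cast this.symm

/-- The basis vector of a basis element. -/
def e (a : I) : I → ℤ := Pi.single a 1

theorem e_apply (a b : I) : e a b = if b = a then 1 else 0 := Pi.single_apply a 1 b

theorem e_self (a : I) : e a a = 1 := by rw [e_apply, if_pos rfl]

theorem dotProduct_e (f : I → ℤ) (a : I) : f ⬝ᵥ e a = f a := by simp [e]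

theorem e_dotProduct (f : I → ℤ) (a : I) : e a ⬝ᵥ f = f a := by simp [e]

/-- The product of two basis elements. -/
def mu (P : Psh I) (a b : I) : I → ℤ := fun v => P.c a b v

theorem mu_nonneg (a b : I) : 0 ≤ P.mu a b := fun _ => Int.natCast_nonneg _

/-- Right multiplication by a basis element. -/
def X (P : Psh I) (ρ : I) : (I → ℤ) →ₗ[ℤ] (I → ℤ) where
  toFun f v := ∑ a, f a * P.c a ρ v
  map_add' f g := by ext v; simp [add_mul, Finset.sum_add_distrib]
  map_smul' m f := by ext v; simp [mul_assoc, Finset.mul_sum]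

/-- The adjoint of right multiplication by a basis element. -/
def Y (P : Psh I) (ρ : I) : (I → ℤ) →ₗ[ℤ] (I → ℤ) where
  toFun f a := ∑ v, P.c a ρ v * f v
  map_add' f g := by ext v; simp [mul_add, Finset.sum_add_distrib]
  map_smul' m f := by ext v; simp [mul_left_comm, Finset.mul_sum]

theorem X_e (ρ a : I) : P.X ρ (e a) = P.mu a ρ := by
  ext v
  simp [X, mu, e_apply]

theorem Y_e (ρ a v : I) : P.Y ρ (e a) v = P.c v ρ a := by
  simp [Y, e_apply]

theorem Y_apply (ρ v : I) (f : I → ℤ) : P.Y ρ f v = P.mu v ρ ⬝ᵥ f := rfl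

theorem adj (ρ : I) (f g : I → ℤ) : P.X ρ f ⬝ᵥ g = f ⬝ᵥ P.Y ρ g := by
  simp only [X, Y, LinearMap.coe_mk, AddHom.coe_mk, dotProduct, Finset.sum_mul, Finset.mul_sum]
  rw [Finset.sum_comm]
  simp only [mul_assoc]

theorem sum_c_atom {ρ : I} (hρ : P.IsAtom ρ) (a b : I) (hd : P.deg a + P.deg ρ ≤ 5) :
    ∑ v, P.c a ρ v * P.c b ρ v = (if a = b then 1 else 0) + ∑ p, P.c p ρ a * P.c p ρ b := by
  rw [P.hopf _ _ _ _ hd]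
  have h : ∀ p q, ∑ r, ∑ s, P.c p q a * P.c r s ρ * (P.c p r b * P.c q s ρ) =
      P.c p q a * (P.c p P.one b * P.c q ρ ρ) + P.c p q a * (P.c p ρ b * P.c q P.one ρ) := by
    intro p q
    rw [← Finset.add_sum_erase _ _ (Finset.mem_univ P.one)]
    congr 1
    · rw [Finset.sum_eq_single ρ, one_c_self, mul_one]
      · intro s _ hs
        rw [P.one_c s ρ, if_neg hs]
        simp
      · simp
    · rw [Finset.sum_eq_single ρ, Finset.sum_eq_single P.one, c_one_self, mul_one]
      · intro s _ hs
        by_cases hc : P.c ρ s ρ = 0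
        · simp [hc]
        · rcases hρ.cases hc with h | h
          · exact absurd h.1 hρ.1
          · exact absurd h.2 hs
      · simp
      · intro r hr hr'
        refine Finset.sum_eq_zero fun s _ => ?_
        by_cases hc : P.c r s ρ = 0
        · simp [hc]
        · rcases hρ.cases hc with h | h
          · exact absurd h.1 (Finset.ne_of_mem_erase hr)
          · exact absurd h.1 hr'
      · intro h
        exact absurd (Finset.mem_erase.2 ⟨hρ.1, Finset.mem_univ ρ⟩) h
  simp only [h, Finset.sum_add_distrib]
  congr 1
  · rw [Finset.sum_eq_single a, Finset.sum_eq_single P.one, c_one_self, one_c_self, P.c_one]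
    · simp
    · intro q _ hq
      by_cases hc : P.c q ρ ρ = 0
      · simp [hc]
      · rcases hρ.cases hc with h | h
        · exact absurd h.1 hq
        · exact absurd h.2 hρ.1
    · simp
    · intro p _ hp
      refine Finset.sum_eq_zero fun q _ => ?_
      by_cases hc : P.c q ρ ρ = 0
      · simp [hc]
      · rcases hρ.cases hc with h | h
        · rw [h.1, P.c_one p a, if_neg hp]
          simp
        · exact absurd h.2 hρ.1
    · simp
  · refine Finset.sum_congr rfl fun p _ => ?_
    rw [Finset.sum_eq_single ρ, c_one_self, mul_one]
    · intro q _ hq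
      rw [P.c_one, if_neg hq]
      simp
    · simp

theorem Y_X_e {ρ : I} (hρ : P.IsAtom ρ) (a : I) (hd : P.deg a + P.deg ρ ≤ 5) :
    P.Y ρ (P.X ρ (e a)) = e a + P.X ρ (P.Y ρ (e a)) := by
  ext b
  rw [X_e, Y_apply, dotProduct_comm]
  have := sum_c_atom hρ a b hd
  rw [Pi.add_apply, e_apply]
  simp only [mu, dotProduct, X, LinearMap.coe_mk, AddHom.coe_mk, Y_e]
  rw [show (if b = a then (1 : ℤ) else 0) = if a = b then 1 else 0 by simp only [eq_comm]]
  exact_mod_cast this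

theorem X_dot {ρ : I} (hρ : P.IsAtom ρ) (a : I) (hd : P.deg a + P.deg ρ ≤ 5) :
    P.mu a ρ ⬝ᵥ P.mu a ρ = 1 + P.Y ρ (e a) ⬝ᵥ P.Y ρ (e a) := by
  rw [← X_e, adj, Y_X_e hρ a hd, dotProduct_add, e_dotProduct, e_self, dotProduct_comm (e a), adj]

theorem exists_eq_of_dot_one {f : I → ℤ} (h0 : 0 ≤ f) (h : f ⬝ᵥ f = 1) : ∃ a, f = e a := by
  have hne : ∃ a, f a ≠ 0 := by
    by_contra! hn
    have : f = 0 := funext hn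
    simp [this] at h
  obtain ⟨a, ha⟩ := hne
  have h1 := Finset.add_sum_erase Finset.univ (fun v => f v * f v) (Finset.mem_univ a)
  have h2 : ∀ v ∈ Finset.univ.erase a, 0 ≤ f v * f v := fun v _ => mul_self_nonneg _
  have h3 := Finset.sum_nonneg h2
  have h4 : ∑ v, f v * f v = 1 := h
  have h5 : 1 ≤ f a * f a := Int.add_one_le_iff.2 (mul_self_pos.2 ha)
  have h6 : ∑ v ∈ Finset.univ.erase a, f v * f v = 0 := by linarith
  have h7 := (Finset.sum_eq_zero_iff_of_nonneg h2).1 h6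
  have h8 : f a * f a = 1 := by linarith
  refine ⟨a, funext fun b => ?_⟩
  rw [e_apply]
  split_ifs with hb
  · subst hb
    have := h0 b
    rcases mul_self_eq_one_iff.1 h8 with h | h
    · exact h
    · rw [h] at this
      exact absurd this (by simp)
  · exact mul_self_eq_zero.1 (h7 b (Finset.mem_erase.2 ⟨hb, Finset.mem_univ _⟩))

theorem sub_e_nonneg {f : I → ℤ} (h0 : 0 ≤ f) {a : I} (ha : f a ≠ 0) : 0 ≤ f - e a := by
  intro b
  rw [Pi.sub_apply, e_apply]
  have := h0 b
  simp only [Pi.zero_apply] at this ⊢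
  split_ifs with hb
  · subst hb
    omega
  · simpa using this

theorem sub_e_dot (f : I → ℤ) (a : I) : (f - e a) ⬝ᵥ (f - e a) = f ⬝ᵥ f - 2 * f a + 1 := by
  rw [dotProduct_sub, sub_dotProduct, sub_dotProduct, dotProduct_e, dotProduct_e, e_dotProduct,
    e_self]
  ring

theorem split_two {f : I → ℤ} (h0 : 0 ≤ f) (h : f ⬝ᵥ f = 2) {a : I} (ha : f a ≠ 0) :
    ∃ b, f = e a + e b ∧ b ≠ a := by
  have h1 : f a * f a ≤ f ⬝ᵥ f := Finset.single_le_sum (f := fun v => f v * f v)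
    (fun v _ => mul_self_nonneg _) (Finset.mem_univ a)
  have h2 := h0 a
  have h3 : f a = 1 := by
    simp only [Pi.zero_apply] at h2
    have : 1 ≤ f a := by omega
    nlinarith
  obtain ⟨b, hb⟩ := exists_eq_of_dot_one (sub_e_nonneg h0 ha) (by rw [sub_e_dot, h, h3]; norm_num)
  refine ⟨b, by rw [← hb]; abel, fun hba => ?_⟩
  subst hba
  have := congrFun hb b
  rw [Pi.sub_apply, e_self, h3] at this
  norm_num at this

theorem split_three {f : I → ℤ} (h0 : 0 ≤ f) (h : f ⬝ᵥ f = 3) {a b : I} (hab : a ≠ b)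
    (ha : f a ≠ 0) (hb : f b ≠ 0) : ∃ v, f = e a + e b + e v ∧ v ≠ a ∧ v ≠ b := by
  have h1 : f a * f a ≤ f ⬝ᵥ f := Finset.single_le_sum (f := fun v => f v * f v)
    (fun v _ => mul_self_nonneg _) (Finset.mem_univ a)
  have h2 := h0 a
  have h3 : f a = 1 := by
    simp only [Pi.zero_apply] at h2
    have : 1 ≤ f a := by omega
    nlinarith
  obtain ⟨v, hv, hvb⟩ :=
    split_two (sub_e_nonneg h0 ha) (by rw [sub_e_dot, h, h3]; norm_num) (a := b)
    (by rw [Pi.sub_apply, e_apply, if_neg hab.symm, sub_zero]; exact hb)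
  refine ⟨v, by rw [add_assoc, ← hv]; abel, fun hba => ?_, hvb⟩
  subst hba
  have := congrFun hv v
  rw [Pi.sub_apply, Pi.add_apply, e_self, h3, e_apply, if_neg hab] at this
  norm_num at this

/-- The linear extension of a weight. -/
def lift (w : I → ℚ) : (I → ℤ) →ₗ[ℤ] ℚ where
  toFun f := ∑ v, f v * w v
  map_add' f g := by simp [add_mul, Finset.sum_add_distrib]
  map_smul' m f := by simp [mul_assoc, Finset.mul_sum]

theorem lift_e (w : I → ℚ) (a : I) : lift w (e a) = w a := by
  simp [lift, e_apply]

theorem lift_D_mu (a b : I) (hd : P.deg a + P.deg b ≤ 5) : lift P.D (P.mu a b) = P.D a * P.D b := by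
  rw [P.D_mul a b hd]
  simp [lift, mu]

theorem lift_δ_mu (a b : I) (hd : P.deg a + P.deg b ≤ 5) :
    lift (fun v => (P.δ v : ℚ)) (P.mu a b) = P.δ a * P.δ b := by
  rw [P.δ_mul a b hd]
  simp [lift, mu]

end Psh

end GLSmall

namespace GLSmall

open scoped BigOperators
open Matrix
open Finset.HasAntidiagonal (antidiagonal)

namespace Psh

variable {I : Type} [Fintype I] [DecidableEq I] {P : Psh I}

/-- A family of basis elements behaving like one-dimensional representations. -/
def IsLin (P : Psh I) (x : ℕ → I) : Prop := ∀ m ≤ 5, P.deg (x m) = m ∧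
    P.D (x m) = (∏ j ∈ Finset.range m, ((P.q : ℚ) ^ (j + 1) - 1))⁻¹ ∧
    ∀ α β, P.c α β (x m) = if P.deg α + P.deg β = m ∧ α = x (P.deg α) ∧ β = x (P.deg β)
      then 1 else 0

namespace IsLin

variable {x : ℕ → I} (hx : P.IsLin x)
include hx

theorem c_eq {i j m : ℕ} (hi : i ≤ 5) (hj : j ≤ 5) (hm : m ≤ 5) :
    P.c (x i) (x j) (x m) = if i + j = m then 1 else 0 := by
  rw [(hx m hm).2.2, (hx i hi).1, (hx j hj).1]
  simp

theorem sum_c {R : Type} [CommSemiring R] {m : ℕ} (hm : m ≤ 5) (F : I → I → R) :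
    ∑ p, ∑ q, (P.c p q (x m) : R) * F p q = ∑ y ∈ antidiagonal m, F (x y.1) (x y.2) := by
  rw [← Finset.sum_product' (f := fun p q => (P.c p q (x m) : R) * F p q)]
  symm
  refine Finset.sum_of_injOn (fun y => (x y.1, x y.2)) ?_ ?_ ?_ ?_
  · rintro ⟨i, j⟩ h ⟨i', j'⟩ h' heq
    simp only [Finset.mem_coe, Finset.HasAntidiagonal.mem_antidiagonal,
      Prod.mk.injEq] at h h' heq ⊢
    constructor
    · rw [← (hx i (by omega)).1, heq.1, (hx i' (by omega)).1]
    · rw [← (hx j (by omega)).1, heq.2, (hx j' (by omega)).1]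
  · intro y _
    simp
  · rintro ⟨p, q⟩ _ h
    dsimp only
    rw [(hx m hm).2.2, if_neg, Nat.cast_zero, zero_mul]
    rintro ⟨h1, h2, h3⟩
    exact h ⟨(P.deg p, P.deg q), by simpa using h1, Prod.ext h2.symm h3.symm⟩
  · rintro ⟨i, j⟩ h
    rw [Finset.HasAntidiagonal.mem_antidiagonal] at h
    dsimp only at h ⊢
    rw [hx.c_eq (by omega) (by omega) hm, if_pos h, Nat.cast_one, one_mul]

theorem sum_c_mul {a b : ℕ} (hab : a + b ≤ 5) (g d : I) :
    ∑ v, P.c (x a) (x b) v * P.c g d v = ∑ y ∈ antidiagonal a, ∑ z ∈ antidiagonal b,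
      P.c (x y.1) (x z.1) g * P.c (x y.2) (x z.2) d := by
  rw [P.hopf _ _ _ _ (by rw [(hx a (by omega)).1, (hx b (by omega)).1]; exact hab)]
  simp only [mul_assoc, ← Finset.mul_sum]
  refine (hx.sum_c (by omega) fun p q => ∑ r, ∑ s, P.c r s (x b) * (P.c p r g * P.c q s d)).trans ?_
  refine Finset.sum_congr rfl fun y _ => ?_
  exact hx.sum_c (by omega) fun r s => P.c (x y.1) r g * P.c (x y.2) s d

theorem mu_dot_mu {a b c d : ℕ} (hab : a + b ≤ 5) (hc : c ≤ 5) (hd : d ≤ 5) :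
    P.mu (x a) (x b) ⬝ᵥ P.mu (x c) (x d) = ((∑ y ∈ antidiagonal a, ∑ z ∈ antidiagonal b,
      if y.1 + z.1 = c ∧ y.2 + z.2 = d then 1 else 0 : ℕ) : ℤ) := by
  simp only [mu, dotProduct, ← Nat.cast_mul, ← Nat.cast_sum]
  rw [hx.sum_c_mul hab]
  congr 1
  refine Finset.sum_congr rfl fun y hy => Finset.sum_congr rfl fun z hz => ?_
  rw [Finset.HasAntidiagonal.mem_antidiagonal] at hy hz
  rw [hx.c_eq (by omega) (by omega) hc, hx.c_eq (by omega) (by omega) hd]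
  split_ifs <;> simp_all

theorem one_eq : x 0 = P.one := (P.deg_one _).1 (hx 0 (by omega)).1

theorem Y_e_succ {m : ℕ} (hm : m + 1 ≤ 5) : P.Y (x 1) (e (x (m + 1))) = e (x m) := by
  ext v
  rw [Y_e, (hx _ hm).2.2, (hx 1 (by omega)).1, e_apply]
  have : (P.deg v + 1 = m + 1 ∧ v = x (P.deg v) ∧ x 1 = x 1) ↔ v = x m := by
    constructor
    · rintro ⟨h1, h2, -⟩
      rwa [Nat.succ_injective h1] at h2
    · rintro rfl
      rw [(hx m (by omega)).1]
      simp
  by_cases hv : v = x m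
  · rw [if_pos (this.2 hv), if_pos hv]
    rfl
  · rw [if_neg (mt this.1 hv), if_neg hv]
    rfl

theorem mu_one_two : P.mu (x 1) (x 2) = P.mu (x 2) (x 1) := by
  rw [← sub_eq_zero, ← dotProduct_self_eq_zero]
  simp only [dotProduct_sub, sub_dotProduct]
  rw [hx.mu_dot_mu, hx.mu_dot_mu, hx.mu_dot_mu, hx.mu_dot_mu] <;> first | omega | decide

theorem Y_mu_two_two : P.Y (x 1) (P.mu (x 2) (x 2)) = 2 * P.mu (x 2) (x 1) := by
  ext v
  rw [two_mul]
  nth_rw 1 [← hx.mu_one_two]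
  rw [Y_apply, dotProduct_comm]
  simp only [mu, dotProduct, ← Nat.cast_mul, ← Nat.cast_sum, Pi.add_apply, ← Nat.cast_add]
  rw [hx.sum_c_mul (by norm_num)]
  congr 1
  simp [Finset.Nat.antidiagonal_succ, hx.c_eq]

theorem Y_mu_three_two :
    P.Y (x 1) (P.mu (x 3) (x 2)) = P.mu (x 2) (x 2) + P.mu (x 3) (x 1) := by
  ext v
  rw [Y_apply, dotProduct_comm]
  simp only [mu, dotProduct, ← Nat.cast_mul, ← Nat.cast_sum, Pi.add_apply, ← Nat.cast_add]
  rw [hx.sum_c_mul (by norm_num)]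
  congr 1
  simp [Finset.Nat.antidiagonal_succ, hx.c_eq]

theorem deg_eq {m : ℕ} (hm : m ≤ 5) : P.deg (x m) = m := (hx m hm).1

theorem mu_apply_ne {i j m : ℕ} (hm : m ≤ 5) (h : i + j = m) : P.mu (x i) (x j) (x m) ≠ 0 := by
  unfold mu
  rw [hx.c_eq (by omega) (by omega) hm, if_pos h]
  norm_num

variable (hρ : P.IsAtom (x 1))
include hρ

theorem Y_mu (a : I) (ha : P.deg a ≤ 4) :
    P.Y (x 1) (P.mu a (x 1)) = e a + P.X (x 1) (P.Y (x 1) (e a)) := by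
  rw [← X_e, Y_X_e hρ a (by rw [hx.deg_eq (by norm_num)]; omega)]

theorem mu_dot_self (a : I) (ha : P.deg a ≤ 4) {f : I → ℤ} (hf : P.Y (x 1) (e a) = f) :
    P.mu a (x 1) ⬝ᵥ P.mu a (x 1) = 1 + f ⬝ᵥ f := by
  rw [X_dot hρ a (by rw [hx.deg_eq (by norm_num)]; omega), hf]

omit hρ in
theorem mu_apply (a v : I) : P.mu a (x 1) v = P.Y (x 1) (e v) a := by
  rw [Y_e]
  rfl

omit hρ in
theorem deg_of_mu {a v : I} (h : P.mu a (x 1) v ≠ 0) : P.deg v = P.deg a + 1 := by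
  have := P.c_deg a (x 1) v (fun h' => h (by unfold mu; rw [h']; rfl))
  rw [hx.deg_eq (by norm_num)] at this
  exact this.symm

theorem step_two {a v : I} {f : I → ℤ} (ha : P.deg a ≤ 4) (hf : P.Y (x 1) (e a) = f)
    (hff : f ⬝ᵥ f = 1) (hv : P.Y (x 1) (e v) a ≠ 0) :
    ∃ w, P.mu a (x 1) = e v + e w ∧ w ≠ v ∧ P.deg w = P.deg a + 1 ∧
      P.Y (x 1) (e w) = e a + P.X (x 1) f - P.Y (x 1) (e v) := by
  have h1 := hx.mu_dot_self hρ a ha hf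
  rw [hff] at h1
  rw [← hx.mu_apply] at hv
  obtain ⟨w, hw, hw'⟩ := split_two (mu_nonneg _ _) h1 hv
  refine ⟨w, hw, hw', ?_, ?_⟩
  · apply hx.deg_of_mu
    rw [hw, Pi.add_apply, e_self, e_apply, if_neg hw']
    norm_num
  · rw [← hf, ← hx.Y_mu hρ a ha, hw, map_add]
    abel

theorem step_three {a u v : I} {f : I → ℤ} (ha : P.deg a ≤ 4) (hf : P.Y (x 1) (e a) = f)
    (hff : f ⬝ᵥ f = 2) (huv : u ≠ v) (hu : P.Y (x 1) (e u) a ≠ 0) (hv : P.Y (x 1) (e v) a ≠ 0) :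
    ∃ w, P.mu a (x 1) = e u + e v + e w ∧ w ≠ u ∧ w ≠ v ∧ P.deg w = P.deg a + 1 ∧
      P.Y (x 1) (e w) = e a + P.X (x 1) f - P.Y (x 1) (e u) - P.Y (x 1) (e v) := by
  have h1 := hx.mu_dot_self hρ a ha hf
  rw [hff] at h1
  rw [← hx.mu_apply] at hu hv
  obtain ⟨w, hw, hw', hw''⟩ := split_three (mu_nonneg _ _) h1 huv hu hv
  refine ⟨w, hw, hw', hw'', ?_, ?_⟩
  · apply hx.deg_of_mu
    rw [hw, Pi.add_apply, Pi.add_apply, e_self, e_apply, e_apply, if_neg hw', if_neg hw'']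
    norm_num
  · rw [← hf, ← hx.Y_mu hρ a ha, hw, map_add, map_add]
    abel

theorem rank_two : ∃ b, P.mu (x 1) (x 1) = e (x 2) + e b ∧ P.Y (x 1) (e b) = e (x 1) ∧
    P.deg b = 2 ∧ b ≠ x 2 := by
  have h1 := hx.mu_dot_self hρ (x 1) (by rw [hx.deg_eq] <;> norm_num) (hx.Y_e_succ (by norm_num))
  rw [e_dotProduct, e_self] at h1
  obtain ⟨b, hb, hb'⟩ := split_two (mu_nonneg _ _) h1 (hx.mu_apply_ne (by norm_num) rfl)
  refine ⟨b, hb, ?_, ?_, hb'⟩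
  · have h2 := hx.Y_mu hρ (x 1) (by rw [hx.deg_eq] <;> norm_num)
    rw [hb, map_add, hx.Y_e_succ (by norm_num), hx.Y_e_succ (by norm_num), X_e, hx.one_eq] at h2
    have h3 : P.mu P.one (x 1) = e (x 1) := by
      ext v
      simp [mu, P.one_c, e_apply, eq_comm]
    rw [h3] at h2
    exact add_left_cancel h2
  · rw [hx.deg_of_mu (a := x 1), hx.deg_eq (by norm_num)]
    rw [hb, Pi.add_apply, e_self, e_apply, if_neg hb']
    norm_num

theorem rank_three {b : I} (hb : P.mu (x 1) (x 1) = e (x 2) + e b) (Yb : P.Y (x 1) (e b) = e (x 1))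
    (db : P.deg b = 2) (nb : b ≠ x 2) :
    ∃ E G, P.mu (x 2) (x 1) = e (x 3) + e E ∧ P.mu b (x 1) = e E + e G ∧
      P.Y (x 1) (e E) = e (x 2) + e b ∧ P.Y (x 1) (e G) = e b ∧ P.deg E = 3 ∧ P.deg G = 3 := by
  have Y2 := hx.Y_e_succ (m := 1) (by norm_num)
  have Y3 := hx.Y_e_succ (m := 2) (by norm_num)
  obtain ⟨E, hE, -, dE, YE⟩ := hx.step_two hρ (a := x 2) (v := x 3)
    (by rw [hx.deg_eq] <;> norm_num) Y2 (by rw [e_dotProduct, e_self])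
    (by rw [Y3, e_self]; norm_num)
  rw [X_e, hb, Y3] at YE
  replace YE : P.Y (x 1) (e E) = e (x 2) + e b := by rw [YE]; abel
  obtain ⟨G, hG, -, dG, YG⟩ := hx.step_two hρ (a := b) (v := E) (by omega) Yb
    (by rw [e_dotProduct, e_self]) (by
      rw [YE]
      simp [e_apply, nb])
  rw [X_e, hb, YE] at YG
  refine ⟨E, G, hE, hG, YE, by rw [YG]; abel, ?_, by omega⟩
  rw [dE, hx.deg_eq (by norm_num)]

theorem rank_four {b E G : I} (nb : b ≠ x 2)
    (hE : P.mu (x 2) (x 1) = e (x 3) + e E) (hG : P.mu b (x 1) = e E + e G)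
    (YE : P.Y (x 1) (e E) = e (x 2) + e b) (YG : P.Y (x 1) (e G) = e b) (dE : P.deg E = 3)
    (dG : P.deg G = 3) (n1 : E ≠ x 3) (n3 : G ≠ E) :
    ∃ A Q S T, P.mu (x 3) (x 1) = e (x 4) + e A ∧ P.mu (x 2) (x 2) = e (x 4) + e A + e Q ∧
      P.mu E (x 1) = e A + e Q + e S ∧ P.mu G (x 1) = e S + e T ∧
      P.Y (x 1) (e A) = e (x 3) + e E ∧ P.Y (x 1) (e Q) = e E ∧ P.Y (x 1) (e S) = e E + e G ∧
      P.Y (x 1) (e T) = e G ∧ P.deg A = 4 ∧ P.deg Q = 4 ∧ P.deg S = 4 ∧ P.deg T = 4 := by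
  have Y3 := hx.Y_e_succ (m := 2) (by norm_num)
  have Y4 := hx.Y_e_succ (m := 3) (by norm_num)
  have d3 := hx.deg_eq (m := 3) (by norm_num)
  obtain ⟨A, hA, nA, dA, YA⟩ := hx.step_two hρ (a := x 3) (v := x 4)
    (by omega) Y3 (by rw [e_dotProduct, e_self]) (by rw [Y4, e_self]; norm_num)
  rw [X_e, hE, Y4] at YA
  replace YA : P.Y (x 1) (e A) = e (x 3) + e E := by rw [YA]; abel
  have h22 : P.mu (x 2) (x 2) ⬝ᵥ P.mu (x 2) (x 2) = 3 := by
    rw [hx.mu_dot_mu (by norm_num) (by norm_num) (by norm_num)]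
    decide
  have h22A : P.mu (x 2) (x 2) A ≠ 0 := by
    have h1 : P.mu (x 2) (x 2) ⬝ᵥ P.mu (x 3) (x 1) = 2 := by
      rw [hx.mu_dot_mu (by norm_num) (by norm_num) (by norm_num)]
      decide
    have h2 : P.mu (x 2) (x 2) (x 4) = 1 := by
      unfold mu
      rw [hx.c_eq (by norm_num) (by norm_num) (by norm_num)]
      norm_num
    rw [hA, dotProduct_add, dotProduct_e, dotProduct_e, h2] at h1
    omega
  obtain ⟨Q, hQ, nQ, nQ'⟩ := split_three (mu_nonneg _ _) h22 nA.symm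
    (hx.mu_apply_ne (by norm_num) rfl) h22A
  have YQ := hx.Y_mu_two_two
  rw [hQ, map_add, map_add, YA, Y4, hE] at YQ
  replace YQ : P.Y (x 1) (e Q) = e E := by
    rw [← sub_eq_zero] at YQ ⊢
    rw [← YQ]
    ring
  obtain ⟨S, hS, nS, nS', dS, YS⟩ := hx.step_three hρ (a := E) (u := A) (v := Q) (by omega) YE
    (by
      simp [dotProduct_add, dotProduct_e, e_apply, nb, nb.symm])
    nQ'.symm (by rw [YA]; simp [e_apply, n1]) (by rw [YQ, e_self]; norm_num)
  rw [map_add, X_e, X_e, hE, hG, YA, YQ] at YS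
  replace YS : P.Y (x 1) (e S) = e E + e G := by rw [YS]; abel
  obtain ⟨T, hT, nT, dT, YT⟩ := hx.step_two hρ (a := G) (v := S) (by omega) YG
    (by rw [e_dotProduct, e_self]) (by rw [YS]; simp [e_apply, n3])
  rw [X_e, hG, YS] at YT
  replace YT : P.Y (x 1) (e T) = e G := by rw [YT]; abel
  refine ⟨A, Q, S, T, hA, hQ, hS, hT, YA, YQ, YS, YT, by omega, ?_, by omega, by omega⟩
  rw [hx.deg_of_mu (a := E), dE]
  rw [hx.mu_apply, YQ, e_self]
  norm_num

theorem rank_five {E G A Q S T : I} (n1 : E ≠ x 3) (n3 : G ≠ E)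
    (hA : P.mu (x 3) (x 1) = e (x 4) + e A)
    (hQ : P.mu (x 2) (x 2) = e (x 4) + e A + e Q) (hS : P.mu E (x 1) = e A + e Q + e S)
    (hT : P.mu G (x 1) = e S + e T) (YA : P.Y (x 1) (e A) = e (x 3) + e E)
    (YQ : P.Y (x 1) (e Q) = e E) (YS : P.Y (x 1) (e S) = e E + e G) (YT : P.Y (x 1) (e T) = e G)
    (dA : P.deg A = 4) (dQ : P.deg Q = 4) (dS : P.deg S = 4) (dT : P.deg T = 4)
    (m1 : A ≠ x 4) (m4 : Q ≠ A) (m5 : S ≠ A) (m6 : S ≠ Q) (m7 : T ≠ S) :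
    ∃ B C R Z U V, P.mu (x 4) (x 1) = e (x 5) + e B ∧
      P.mu (x 3) (x 2) = e (x 5) + e B + e C ∧ P.mu Q (x 1) = e C + e Z ∧
      P.mu A (x 1) = e B + e C + e R ∧ P.mu S (x 1) = e Z + e R + e U ∧
      P.mu T (x 1) = e U + e V ∧ P.Y (x 1) (e B) = e (x 4) + e A ∧
      P.Y (x 1) (e C) = e A + e Q ∧ P.Y (x 1) (e R) = e A + e S ∧
      P.Y (x 1) (e Z) = e Q + e S ∧ P.Y (x 1) (e U) = e S + e T ∧ P.Y (x 1) (e V) = e T := by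
  have Y4 := hx.Y_e_succ (m := 3) (by norm_num)
  have Y5 := hx.Y_e_succ (m := 4) (by norm_num)
  have d4 := hx.deg_eq (m := 4) (by norm_num)
  obtain ⟨B, hB, nB, dB, YB⟩ := hx.step_two hρ (a := x 4) (v := x 5)
    (by omega) Y4 (by rw [e_dotProduct, e_self]) (by rw [Y5, e_self]; norm_num)
  rw [X_e, hA, Y5] at YB
  replace YB : P.Y (x 1) (e B) = e (x 4) + e A := by rw [YB]; abel
  have h32 : P.mu (x 3) (x 2) ⬝ᵥ P.mu (x 3) (x 2) = 3 := by
    rw [hx.mu_dot_mu (by norm_num) (by norm_num) (by norm_num)]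
    decide
  have h32B : P.mu (x 3) (x 2) B ≠ 0 := by
    have h1 : P.mu (x 3) (x 2) ⬝ᵥ P.mu (x 4) (x 1) = 2 := by
      rw [hx.mu_dot_mu (by norm_num) (by norm_num) (by norm_num)]
      decide
    have h2 : P.mu (x 3) (x 2) (x 5) = 1 := by
      unfold mu
      rw [hx.c_eq (by norm_num) (by norm_num) (by norm_num)]
      norm_num
    rw [hB, dotProduct_add, dotProduct_e, dotProduct_e, h2] at h1
    omega
  obtain ⟨C, hC, nC, nC'⟩ := split_three (mu_nonneg _ _) h32 nB.symm
    (hx.mu_apply_ne (by norm_num) rfl) h32B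
  have YC := hx.Y_mu_three_two
  rw [hC, map_add, map_add, YB, Y5, hQ, hA] at YC
  replace YC : P.Y (x 1) (e C) = e A + e Q := by
    rw [← sub_eq_zero] at YC ⊢
    rw [← YC]
    abel
  obtain ⟨Z, hZ, -, -, YZ⟩ := hx.step_two hρ (a := Q) (v := C) (by omega) YQ
    (by rw [e_dotProduct, e_self]) (by rw [YC]; simp [e_apply, m4])
  rw [X_e, hS, YC] at YZ
  replace YZ : P.Y (x 1) (e Z) = e Q + e S := by rw [YZ]; abel
  obtain ⟨R, hR, -, -, -, YR⟩ := hx.step_three hρ (a := A) (u := B) (v := C) (by omega) YA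
    (by simp [dotProduct_add, dotProduct_e, e_apply, n1, n1.symm])
    nC'.symm (by rw [YB]; simp [e_apply, m1]) (by rw [YC]; simp [e_apply, m4.symm])
  rw [map_add, X_e, X_e, hA, hS, YB, YC] at YR
  replace YR : P.Y (x 1) (e R) = e A + e S := by rw [YR]; abel
  have hZR : Z ≠ R := by
    rintro rfl
    rw [YZ] at YR
    have := congrFun YR Q
    simp [e_apply, m4, m6.symm] at this
  obtain ⟨U, hU, -, -, -, YU⟩ := hx.step_three hρ (a := S) (u := Z) (v := R) (by omega) YS
    (by simp [dotProduct_add, dotProduct_e, e_apply, n3, n3.symm])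
    hZR (by rw [YZ]; simp [e_apply, m6]) (by rw [YR]; simp [e_apply, m5])
  rw [map_add, X_e, X_e, hS, hT, YZ, YR] at YU
  replace YU : P.Y (x 1) (e U) = e S + e T := by rw [YU]; abel
  obtain ⟨V, hV, -, -, YV⟩ := hx.step_two hρ (a := T) (v := U) (by omega) YT
    (by rw [e_dotProduct, e_self]) (by rw [YU]; simp [e_apply, m7])
  rw [X_e, hT, YU] at YV
  exact ⟨B, C, R, Z, U, V, hB, hC, hZ, hR, hU, hV, YB, YC, YR, YZ, YU, by rw [YV]; abel⟩

end IsLin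

end Psh

/-- The number of partitions of `m`. -/
def nt : ℕ → ℕ
  | 0 => 1
  | 1 => 1
  | 2 => 2
  | 3 => 3
  | 4 => 5
  | 5 => 7
  | _ => 0

/-- The product over partitions of `m` of the normalized unipotent degrees. -/
def pt (m : ℕ) (Q : ℚ) : ℚ :=
  match m with
  | 1 => (Q - 1)⁻¹
  | 2 => Q / ((Q - 1) * (Q ^ 2 - 1)) ^ 2
  | 3 => Q ^ 4 / (((Q - 1) * (Q ^ 2 - 1) * (Q ^ 3 - 1)) ^ 2 * ((Q - 1) ^ 2 * (Q ^ 3 - 1)))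
  | 4 => Q ^ 12 / (((Q - 1) * (Q ^ 2 - 1) * (Q ^ 3 - 1) * (Q ^ 4 - 1)) ^ 2 *
      ((Q - 1) ^ 2 * (Q ^ 2 - 1) * (Q ^ 4 - 1)) ^ 2 *
      ((Q - 1) * (Q ^ 2 - 1) ^ 2 * (Q ^ 3 - 1)))
  | 5 => Q ^ 26 / (((Q - 1) * (Q ^ 2 - 1) * (Q ^ 3 - 1) * (Q ^ 4 - 1) * (Q ^ 5 - 1)) ^ 2 *
      ((Q - 1) ^ 2 * (Q ^ 2 - 1) * (Q ^ 3 - 1) * (Q ^ 5 - 1)) ^ 2 *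
      ((Q - 1) ^ 2 * (Q ^ 2 - 1) * (Q ^ 3 - 1) * (Q ^ 4 - 1)) ^ 2 *
      ((Q - 1) ^ 2 * (Q ^ 2 - 1) ^ 2 * (Q ^ 5 - 1)))
  | _ => 1

/-- The normalized degree of the Steinberg representation. -/
def et (m : ℕ) (Q : ℚ) : ℚ :=
  Q ^ m.choose 2 / ∏ j ∈ Finset.range m, (Q ^ (j + 1) - 1)

namespace Psh

variable {I : Type} [Fintype I] [DecidableEq I] {P : Psh I}

theorem Wn_zero (S : Finset I) : P.Wn S 0 = {P.one} := by
  ext v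
  rw [mem_Wn, P.deg_one, Finset.mem_singleton]
  constructor
  · exact fun h => h.2
  · rintro rfl
    exact ⟨.one, rfl⟩

theorem mem_Wn_add {ρ : I} (n : ℕ) (v : I) (h0 : 0 < n) : v ∈ P.Wn {ρ} n ↔
    ∃ m, m + P.deg ρ = n ∧ ∃ a ∈ P.Wn {ρ} m, P.mu a ρ v ≠ 0 := by
  simp only [mem_Wn, mu, Nat.cast_ne_zero]
  constructor
  · rintro ⟨h1, h2⟩
    cases h1 with
    | one => rw [deg_of_one] at h2; omega
    | step a ρ' v ha hρ hc =>
      rw [Finset.mem_singleton] at hρ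
      subst hρ
      exact ⟨P.deg a, (P.c_deg _ _ _ hc).trans h2, a, ⟨ha, rfl⟩, hc⟩
  · rintro ⟨m, h1, a, ⟨ha, rfl⟩, hc⟩
    exact ⟨.step _ _ _ ha (Finset.mem_singleton_self _) hc, (P.c_deg _ _ _ hc).symm.trans h1⟩

theorem mu_one (ρ : I) : P.mu P.one ρ = e ρ := by
  ext v
  simp [mu, P.one_c, e_apply, eq_comm]

/-- The number of constituents, the product of normalized degrees, and the sum of degrees weighted
by the multiplicity of the nondegenerate character, for a finite set of basis elements. -/
structure Loc (P : Psh I) (s : Finset I) (n : ℕ) (p t : ℚ) : Prop where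
  card : s.card = n
  prod : ∏ v ∈ s, P.D v = p
  sum : ∑ v ∈ s, (P.δ v : ℚ) * P.D v = t

theorem loc_zero (S : Finset I) : P.Loc (P.Wn S 0) 1 1 1 := by
  rw [Wn_zero]
  exact ⟨rfl, by simp [D_one], by simp [D_one, δ_one]⟩

namespace IsLin

variable {x : ℕ → I} (hx : P.IsLin x)
include hx

theorem q_pow_sub_one_ne (P : Psh I) (n : ℕ) : (P.q : ℚ) ^ (n + 1) - 1 ≠ 0 := by
  have h : 1 < P.q ^ (n + 1) := Nat.one_lt_pow (by omega) P.two_le_q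
  rw [sub_ne_zero]
  exact_mod_cast h.ne'

theorem δ_one_two_three : P.δ (x 1) = 1 ∧ P.δ (x 2) = 0 ∧ P.δ (x 3) = 0 ∧ P.δ (x 4) = 0 ∧
    P.δ (x 5) = 0 := by
  have h : ∀ m ≤ 5, (P.q : ℚ) ^ m * P.D (x m) =
      ∑ y ∈ antidiagonal m, P.D (x y.1) * P.δ (x y.2) := by
    intro m hm
    have := P.dim (x m)
    rwa [hx.sum_c hm fun a b => P.D a * (P.δ b : ℚ), hx.deg_eq hm] at this
  have hD := fun m hm => (hx m hm).2.1
  have n1 := q_pow_sub_one_ne hx P 0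
  have n2 := q_pow_sub_one_ne hx P 1
  have n3 := q_pow_sub_one_ne hx P 2
  have n4 := q_pow_sub_one_ne hx P 3
  have n5 := q_pow_sub_one_ne hx P 4
  norm_num at n1 n2 n3 n4 n5
  have h0 : (P.δ (x 0) : ℚ) = 1 := by
    rw [hx.one_eq, δ_one]
    norm_num
  have e1 : (P.δ (x 1) : ℚ) = 1 := by
    have := h 1 (by norm_num)
    simp [Finset.Nat.antidiagonal_succ, hD, h0] at this
    rw [eq_sub_of_add_eq this.symm]
    field_simp
  have e2 : (P.δ (x 2) : ℚ) = 0 := by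
    have := h 2 (by norm_num)
    simp [Finset.Nat.antidiagonal_succ, hD, h0, e1, Finset.prod_range_succ] at this
    rw [eq_sub_of_add_eq this.symm]
    field_simp
    ring
  have e3 : (P.δ (x 3) : ℚ) = 0 := by
    have := h 3 (by norm_num)
    simp [Finset.Nat.antidiagonal_succ, hD, h0, e1, e2, Finset.prod_range_succ] at this
    rw [eq_sub_of_add_eq this.symm]
    field_simp
    ring
  have e4 : (P.δ (x 4) : ℚ) = 0 := by
    have := h 4 (by norm_num)
    simp [Finset.Nat.antidiagonal_succ, hD, h0, e1, e2, e3, Finset.prod_range_succ] at this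
    rw [eq_sub_of_add_eq this.symm]
    field_simp
    ring
  have e5 : (P.δ (x 5) : ℚ) = 0 := by
    have := h 5 (by norm_num)
    simp [Finset.Nat.antidiagonal_succ, hD, h0, e1, e2, e3, e4, Finset.prod_range_succ] at this
    rw [eq_sub_of_add_eq this.symm]
    field_simp
    ring
  exact ⟨by exact_mod_cast e1, by exact_mod_cast e2, by exact_mod_cast e3, by exact_mod_cast e4,
    by exact_mod_cast e5⟩

theorem mem_Wn_succ (n : ℕ) (v : I) : v ∈ P.Wn {x 1} (n + 1) ↔
    ∃ a ∈ P.Wn {x 1} n, P.mu a (x 1) v ≠ 0 := by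
  rw [mem_Wn_add _ _ n.succ_pos, hx.deg_eq (by norm_num)]
  simp

theorem inj_of_rows {n n' : ℕ} {g : Fin n → I} {g' : Fin n' → I} (hg : Function.Injective g)
    (M : Fin n' → Fin n → ℤ) (hM : Function.Injective M)
    (h : ∀ i, P.Y (x 1) (e (g' i)) = ∑ k, M i k • e (g k)) : Function.Injective g' := by
  intro i j hij
  apply hM
  have h1 := (h i).symm.trans ((congrArg (fun v => P.Y (x 1) (e v)) hij).trans (h j))
  ext k
  have h2 := congrFun h1 (g k)
  simpa [Finset.sum_apply, e_apply, hg.eq_iff] using h2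

theorem Wn_step {m n n' : ℕ} {g : Fin n → I} {g' : Fin n' → I}
    (hW : P.Wn {x 1} m = Finset.univ.image g) (hg' : Function.Injective g')
    (M : Fin n' → Fin n → ℤ) (hM : ∀ i, ∃ k, M i k ≠ 0)
    (h : ∀ k, P.mu (g k) (x 1) = ∑ i, M i k • e (g' i)) :
    P.Wn {x 1} (m + 1) = Finset.univ.image g' := by
  ext v
  rw [hx.mem_Wn_succ, hW]
  simp only [Finset.mem_image, Finset.mem_univ, true_and]
  constructor
  · rintro ⟨_, ⟨k, rfl⟩, hv⟩
    by_contra! hn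
    apply hv
    rw [h, Finset.sum_apply]
    refine Finset.sum_eq_zero fun i _ => ?_
    rw [Pi.smul_apply, e_apply, if_neg (hn i).symm, smul_zero]
  · rintro ⟨i, rfl⟩
    obtain ⟨k, hk⟩ := hM i
    refine ⟨g k, ⟨k, rfl⟩, ?_⟩
    rw [h]
    simpa [Finset.sum_apply, e_apply, hg'.eq_iff] using hk

theorem loc_of_image {m n : ℕ} {g : Fin n → I} (hg : Function.Injective g)
    (hW : P.Wn {x 1} m = Finset.univ.image g) {p t : ℚ} (hp : ∏ i, P.D (g i) = p)
    (ht : ∑ i, (P.δ (g i) : ℚ) * P.D (g i) = t) : P.Loc (P.Wn {x 1} m) n p t := by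
  rw [hW]
  refine ⟨?_, ?_, ?_⟩
  · rw [Finset.card_image_of_injective _ hg, Finset.card_univ, Fintype.card_fin]
  · rwa [Finset.prod_image fun a _ b _ h => hg h]
  · rwa [Finset.sum_image fun a _ b _ h => hg h]

theorem isAtom : P.IsAtom (x 1) := by
  have h1 := hx.deg_eq (m := 1) (by norm_num)
  refine ⟨fun h => ?_, fun r s h => ?_⟩
  · rw [h, deg_of_one] at h1
    omega
  · have h2 := P.c_deg _ _ _ h
    rw [← P.deg_one, ← P.deg_one]
    omega

theorem Wn_one : P.Wn {x 1} 1 = Finset.univ.image ![x 1] := by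
  ext v
  rw [hx.mem_Wn_succ, Wn_zero]
  simp [mu_one, e_apply, eq_comm]

theorem D_mu {a b : I} {f : I → ℤ} (h : P.mu a b = f) (hd : P.deg a + P.deg b ≤ 5) :
    P.D a * P.D b = lift P.D f := by
  rw [← h, lift_D_mu a b hd]

theorem δ_mu {a b : I} {f : I → ℤ} (h : P.mu a b = f) (hd : P.deg a + P.deg b ≤ 5) :
    (P.δ a * P.δ b : ℚ) = lift (fun v => (P.δ v : ℚ)) f := by
  rw [← h, lift_δ_mu a b hd]

theorem local_one (m : ℕ) (hm : m ≤ 5) :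
    P.Loc (P.Wn {x 1} m) (nt m) (pt m P.q) (et m P.q) := by
  have hρ := hx.isAtom
  have hD := fun m hm => (hx m hm).2.1
  have hd := fun m (hm : m ≤ 5) => hx.deg_eq hm
  obtain ⟨s1, s2, s3, s4, s5⟩ := hx.δ_one_two_three
  have n1 := q_pow_sub_one_ne hx P 0
  have n2 := q_pow_sub_one_ne hx P 1
  have n3 := q_pow_sub_one_ne hx P 2
  have n4 := q_pow_sub_one_ne hx P 3
  have n5 := q_pow_sub_one_ne hx P 4
  norm_num at n1 n2 n3 n4 n5
  have D1 := hD 1 (by norm_num)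
  have D2 := hD 2 (by norm_num)
  have D3 := hD 3 (by norm_num)
  have D4 := hD 4 (by norm_num)
  have D5 := hD 5 (by norm_num)
  simp only [Finset.prod_range_succ, Finset.prod_range_zero, one_mul, zero_add,
    pow_one] at D1 D2 D3 D4 D5
  norm_num at D1 D2 D3 D4 D5
  have d1 := hd 1 (by norm_num)
  have d2 := hd 2 (by norm_num)
  have d3 := hd 3 (by norm_num)
  have d4 := hd 4 (by norm_num)
  have Y2 := hx.Y_e_succ (m := 1) (by norm_num)
  have Y3 := hx.Y_e_succ (m := 2) (by norm_num)
  have Y4 := hx.Y_e_succ (m := 3) (by norm_num)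
  have Y5 := hx.Y_e_succ (m := 4) (by norm_num)
  norm_num at Y2 Y3 Y4 Y5
  obtain ⟨b, hb, Yb, db, nb⟩ := hx.rank_two hρ
  obtain ⟨E, G, hE, hG, YE, YG, dE, dG⟩ := hx.rank_three hρ hb Yb db nb
  set Q : ℚ := (P.q : ℚ) with hQdef
  have Db := D_mu hx hb (by omega)
  have δb := δ_mu hx hb (by omega)
  have DE := D_mu hx hE (by omega)
  have δE := δ_mu hx hE (by omega)
  have DG := D_mu hx hG (by omega)
  have δG := δ_mu hx hG (by omega)
  rw [map_add, lift_e, lift_e] at Db δb DE δE DG δG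
  rw [s1, s2] at δb
  rw [s1, s2, s3] at δE
  have Db' : P.D b = Q / ((Q - 1) * (Q ^ 2 - 1)) := by
    rw [eq_sub_of_add_eq' Db.symm, D1, D2]
    field_simp
    ring
  have DE' : P.D E = Q / ((Q - 1) ^ 2 * (Q ^ 3 - 1)) := by
    rw [eq_sub_of_add_eq' DE.symm, D1, D2, D3]
    field_simp
    ring
  have DG' : P.D G = Q ^ 3 / ((Q - 1) * (Q ^ 2 - 1) * (Q ^ 3 - 1)) := by
    rw [eq_sub_of_add_eq' DG.symm, Db', D1, DE']
    field_simp
    ring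
  have δb' : P.δ b = 1 := by exact_mod_cast (show (P.δ b : ℚ) = 1 by push_cast at δb; linarith)
  have δE' : P.δ E = 0 := by exact_mod_cast (show (P.δ E : ℚ) = 0 by push_cast at δE; linarith)
  have δG' : P.δ G = 1 := by
    rw [δE', δb', s1] at δG
    exact_mod_cast (show (P.δ G : ℚ) = 1 by push_cast at δG; linarith)
  have i1 : Function.Injective ![x 1] := Function.injective_of_subsingleton _
  have i2 : Function.Injective ![x 2, b] := by
    intro i j h
    fin_cases i <;> fin_cases j <;> simp_all
  have w2 := hx.Wn_step hx.Wn_one i2 ![![1], ![1]] (by decide) (by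
    intro k; fin_cases k; simp [Fin.sum_univ_succ, hb])
  have i3 := hx.inj_of_rows (g' := ![x 3, E, G]) i2 ![![1, 0], ![1, 1], ![0, 1]] (by decide) (by
    intro i; fin_cases i <;> simp [Fin.sum_univ_succ, Y3, YE, YG])
  have w3 := hx.Wn_step w2 i3 ![![1, 0], ![1, 1], ![0, 1]] (by decide) (by
    intro k; fin_cases k <;> simp [Fin.sum_univ_succ, hE, hG])
  obtain ⟨A, K, S, T, hA, hK, hS, hT, YA, YK, YS, YT, dA, dK, dS, dT⟩ :=
    hx.rank_four hρ nb hE hG YE YG dE dG (i3.ne (a₁ := 1) (a₂ := 0) (by decide))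
      (i3.ne (a₁ := 2) (a₂ := 1) (by decide))
  have i4 := hx.inj_of_rows (g' := ![x 4, A, K, S, T]) i3
    ![![1, 0, 0], ![1, 1, 0], ![0, 1, 0], ![0, 1, 1], ![0, 0, 1]] (by decide) (by
    intro i; fin_cases i <;> simp [Fin.sum_univ_succ, Y4, YA, YK, YS, YT])
  have w4 := hx.Wn_step w3 i4
    ![![1, 0, 0], ![1, 1, 0], ![0, 1, 0], ![0, 1, 1], ![0, 0, 1]] (by decide) (by
    intro k; fin_cases k <;> simp [Fin.sum_univ_succ, hA, hS, hT, add_assoc])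
  obtain ⟨B, C, R, Z, U, V, hB, hC, hZ, hR, hU, hV, YB, YC, YR, YZ, YU, YV⟩ :=
    hx.rank_five hρ (i3.ne (a₁ := 1) (a₂ := 0) (by decide)) (i3.ne (a₁ := 2) (a₂ := 1) (by decide))
      hA hK hS hT YA YK YS YT dA dK dS dT (i4.ne (a₁ := 1) (a₂ := 0) (by decide))
      (i4.ne (a₁ := 2) (a₂ := 1) (by decide)) (i4.ne (a₁ := 3) (a₂ := 1) (by decide))
      (i4.ne (a₁ := 3) (a₂ := 2) (by decide)) (i4.ne (a₁ := 4) (a₂ := 3) (by decide))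
  have i5 := hx.inj_of_rows (g' := ![x 5, B, C, R, Z, U, V]) i4
    ![![1, 0, 0, 0, 0], ![1, 1, 0, 0, 0], ![0, 1, 1, 0, 0], ![0, 1, 0, 1, 0], ![0, 0, 1, 1, 0],
      ![0, 0, 0, 1, 1], ![0, 0, 0, 0, 1]] (by decide) (by
    intro i; fin_cases i <;> simp [Fin.sum_univ_succ, Y5, YB, YC, YR, YZ, YU, YV])
  have w5 := hx.Wn_step w4 i5 ![![1, 0, 0, 0, 0], ![1, 1, 0, 0, 0], ![0, 1, 1, 0, 0],
      ![0, 1, 0, 1, 0], ![0, 0, 1, 1, 0], ![0, 0, 0, 1, 1], ![0, 0, 0, 0, 1]] (by decide) (by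
    intro k; fin_cases k <;> simp [Fin.sum_univ_succ, hB, hZ, hR, hU, hV, add_assoc, add_left_comm])
  have DA := D_mu hx hA (by omega)
  have δA := δ_mu hx hA (by omega)
  have DK := D_mu hx hK (by omega)
  have δK := δ_mu hx hK (by omega)
  have DS := D_mu hx hS (by omega)
  have δS := δ_mu hx hS (by omega)
  have DT := D_mu hx hT (by omega)
  have δT := δ_mu hx hT (by omega)
  have DB := D_mu hx hB (by omega)
  have δB := δ_mu hx hB (by omega)
  have DC := D_mu hx hC (by omega)
  have δC := δ_mu hx hC (by omega)
  have DR := D_mu hx hR (by omega)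
  have δR := δ_mu hx hR (by omega)
  have DZ := D_mu hx hZ (by omega)
  have δZ := δ_mu hx hZ (by omega)
  have DU := D_mu hx hU (by omega)
  have δU := δ_mu hx hU (by omega)
  have DV := D_mu hx hV (by omega)
  have δV := δ_mu hx hV (by omega)
  simp only [map_add, lift_e, s1, s2, s3, s4, s5, δE', δG', Nat.cast_zero, Nat.cast_one,
    mul_zero, mul_one,
    zero_add] at DA δA DK δK DS δS DT δT DB δB DC δC DR δR DZ δZ DU δU DV δV
  have zA : P.δ A = 0 := by exact_mod_cast δA.symm
  simp only [zA, Nat.cast_zero, zero_add] at δK δS δT δB δC δR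
  have zK : P.δ K = 0 := by exact_mod_cast δK.symm
  simp only [zK, Nat.cast_zero, zero_add] at δS δZ
  have zS : P.δ S = 0 := by exact_mod_cast δS.symm
  simp only [zS, Nat.cast_zero, zero_add] at δT δU
  have zT : P.δ T = 1 := by exact_mod_cast δT.symm
  have zB : P.δ B = 0 := by exact_mod_cast δB.symm
  simp only [zB, Nat.cast_zero, zero_add] at δC δR
  have zC : P.δ C = 0 := by exact_mod_cast δC.symm
  simp only [zC, Nat.cast_zero, zero_add] at δR δZ
  have zR : P.δ R = 0 := by exact_mod_cast δR.symm
  have zZ : P.δ Z = 0 := by exact_mod_cast δZ.symm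
  simp only [zR, zZ, Nat.cast_zero, zero_add] at δU
  have zU : P.δ U = 0 := by exact_mod_cast δU.symm
  simp only [zU, zT, Nat.cast_zero, zero_add, Nat.cast_one] at δV
  have zV : P.δ V = 1 := by exact_mod_cast δV.symm
  have DA' : P.D A = Q / ((Q - 1) ^ 2 * (Q ^ 2 - 1) * (Q ^ 4 - 1)) := by
    rw [eq_sub_of_add_eq' DA.symm, D1, D3, D4]
    field_simp
    ring
  have DK' : P.D K = Q ^ 2 / ((Q - 1) * (Q ^ 2 - 1) ^ 2 * (Q ^ 3 - 1)) := by
    rw [eq_sub_of_add_eq' DK.symm, D2, D4, DA']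
    field_simp
    ring
  have DS' : P.D S = Q ^ 3 / ((Q - 1) ^ 2 * (Q ^ 2 - 1) * (Q ^ 4 - 1)) := by
    rw [eq_sub_of_add_eq' DS.symm, DE', D1, DA', DK']
    field_simp
    ring
  have DT' : P.D T = Q ^ 6 / ((Q - 1) * (Q ^ 2 - 1) * (Q ^ 3 - 1) * (Q ^ 4 - 1)) := by
    rw [eq_sub_of_add_eq' DT.symm, DG', D1, DS']
    field_simp
    ring
  have DB' : P.D B = Q / ((Q - 1) ^ 2 * (Q ^ 2 - 1) * (Q ^ 3 - 1) * (Q ^ 5 - 1)) := by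
    rw [eq_sub_of_add_eq' DB.symm, D4, D1, D5]
    field_simp
    ring
  have DC' : P.D C = Q ^ 2 / ((Q - 1) ^ 2 * (Q ^ 2 - 1) * (Q ^ 3 - 1) * (Q ^ 4 - 1)) := by
    rw [eq_sub_of_add_eq' DC.symm, D3, D2, D5, DB']
    field_simp
    ring
  have DR' : P.D R = Q ^ 3 / ((Q - 1) ^ 2 * (Q ^ 2 - 1) ^ 2 * (Q ^ 5 - 1)) := by
    rw [eq_sub_of_add_eq' DR.symm, DA', D1, DB', DC']
    field_simp
    ring
  have DZ' : P.D Z = Q ^ 4 / ((Q - 1) ^ 2 * (Q ^ 2 - 1) * (Q ^ 3 - 1) * (Q ^ 4 - 1)) := by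
    rw [eq_sub_of_add_eq' DZ.symm, DK', D1, DC']
    field_simp
    ring
  have DU' : P.D U = Q ^ 6 / ((Q - 1) ^ 2 * (Q ^ 2 - 1) * (Q ^ 3 - 1) * (Q ^ 5 - 1)) := by
    rw [eq_sub_of_add_eq' DU.symm, DS', D1, DZ', DR']
    field_simp
    ring
  have DV' : P.D V =
      Q ^ 10 / ((Q - 1) * (Q ^ 2 - 1) * (Q ^ 3 - 1) * (Q ^ 4 - 1) * (Q ^ 5 - 1)) := by
    rw [eq_sub_of_add_eq' DV.symm, DT', D1, DU']
    field_simp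
    ring
  clear_value Q
  interval_cases m
  · simpa [nt, pt, et] using loc_zero {x 1}
  · refine hx.loc_of_image i1 hx.Wn_one ?_ ?_
    · simp [pt, D1]
    · simp [et, D1, s1]
  · refine hx.loc_of_image i2 w2 ?_ ?_
    · simp only [Fin.prod_univ_succ, pt]
      simp [D2, Db']
      field_simp
    · simp [Fin.sum_univ_succ, et, Finset.prod_range_succ, s2, δb', Db']
  · refine hx.loc_of_image i3 w3 ?_ ?_
    · simp [Fin.prod_univ_succ, pt, D3, DE', DG']
      field_simp
    · simp [Fin.sum_univ_succ, et, Finset.prod_range_succ, s3, δE', δG', DG', Nat.choose]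
  · refine hx.loc_of_image i4 w4 ?_ ?_
    · simp [Fin.prod_univ_succ, pt, D4, DA', DK', DS', DT']
      field_simp
    · simp [Fin.sum_univ_succ, et, Finset.prod_range_succ, s4, zA, zK, zS, zT, DT', Nat.choose]
  · refine hx.loc_of_image i5 w5 ?_ ?_
    · simp [Fin.prod_univ_succ, pt, D5, DB', DC', DR', DZ', DU', DV']
      field_simp
    · simp [Fin.sum_univ_succ, et, Finset.prod_range_succ, s5, zB, zC, zR, zZ, zU, zV, DV',
        Nat.choose]

end IsLin

end Psh

/-- A function supported on the multiples of `d`, extended by `z` elsewhere. -/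
def spread {R : Type} (z : R) (f : ℕ → R) (d n : ℕ) : R := if d ∣ n then f (n / d) else z

namespace Psh

variable {I : Type} [Fintype I] [DecidableEq I] {P : Psh I}

theorem q_pow_ne (P : Psh I) {n : ℕ} (hn : n ≠ 0) : (P.q : ℚ) ^ n - 1 ≠ 0 := by
  have h : 1 < P.q ^ n := Nat.one_lt_pow hn P.two_le_q
  rw [sub_ne_zero]
  exact_mod_cast h.ne'

theorem dim_of_subset (v : I) (s : Finset (I × I))
    (hs : ∀ a b, P.c a b v ≠ 0 → (a, b) ∈ s) :
    (P.q : ℚ) ^ P.deg v * P.D v = ∑ y ∈ s, (P.c y.1 y.2 v : ℚ) * (P.D y.1 * P.δ y.2) := by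
  rw [P.dim, ← Fintype.sum_prod_type' (f := fun a b => (P.c a b v : ℚ) * (P.D a * P.δ b))]
  symm
  refine Finset.sum_subset (Finset.subset_univ _) fun y _ hy => ?_
  have : P.c y.1 y.2 v = 0 := by
    by_contra h
    exact hy (hs _ _ h)
  rw [this, Nat.cast_zero, zero_mul]

variable {ρ : I} (hρ : P.IsAtom ρ)
include hρ

theorem IsAtom.deg_ne_zero : P.deg ρ ≠ 0 := fun h => hρ.1 ((P.deg_one _).1 h)

theorem IsAtom.dim : ((P.q : ℚ) ^ P.deg ρ - 1) * P.D ρ = P.δ ρ := by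
  have h := P.dim_of_subset ρ {(P.one, ρ), (ρ, P.one)} (by
    intro a b h
    rcases hρ.cases h with ⟨rfl, rfl⟩ | ⟨rfl, rfl⟩ <;> simp)
  rw [Finset.sum_pair (fun h => hρ.1 (Prod.ext_iff.1 h).2)] at h
  simp only [one_c_self, c_one_self, D_one, δ_one] at h
  push_cast at h
  linarith

theorem IsAtom.D_eq (hδ : P.δ ρ = 1) : P.D ρ = ((P.q : ℚ) ^ P.deg ρ - 1)⁻¹ := by
  have h := hρ.dim
  rw [hδ, Nat.cast_one] at h
  exact eq_inv_of_mul_eq_one_right h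

theorem IsAtom.Wn_self : P.Wn {ρ} (P.deg ρ) = {ρ} := by
  ext v
  rw [mem_Wn_add _ _ (Nat.pos_of_ne_zero hρ.deg_ne_zero)]
  simp only [Nat.add_eq_right, exists_eq_left, Wn_zero, Finset.mem_singleton, mu_one, e_apply]
  simp

theorem IsAtom.exists_mu_self (hd : P.deg ρ + P.deg ρ ≤ 5) :
    ∃ a b, P.mu ρ ρ = e a + e b ∧ b ≠ a := by
  have h := X_dot hρ ρ hd
  have h1 : P.Y ρ (e ρ) = e P.one := by
    ext v
    rw [Y_e, e_apply]
    by_cases hv : v = P.one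
    · subst hv
      simp [one_c_self]
    · rw [if_neg hv]
      by_contra hc
      rcases hρ.cases (fun h' => hc (by rw [h', Nat.cast_zero])) with ⟨h', -⟩ | ⟨-, h'⟩
      · exact hv h'
      · exact hρ.1 h'
  rw [h1, e_dotProduct, e_self] at h
  have : ∃ a, P.mu ρ ρ a ≠ 0 := by
    by_contra! hn
    rw [show P.mu ρ ρ = 0 from funext hn] at h
    simp at h
  obtain ⟨a, ha⟩ := this
  obtain ⟨b, hb⟩ := split_two (mu_nonneg _ _) h ha
  exact ⟨a, b, hb⟩

theorem IsAtom.Wn_two {a b : I} (h : P.mu ρ ρ = e a + e b) (hab : b ≠ a) :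
    P.Wn {ρ} (P.deg ρ + P.deg ρ) = {a, b} := by
  ext v
  rw [mem_Wn_add _ _ (by have := hρ.deg_ne_zero; omega)]
  simp only [Nat.add_right_cancel_iff, exists_eq_left, hρ.Wn_self, Finset.mem_singleton, h,
    Finset.mem_insert, Pi.add_apply, e_apply]
  split_ifs with h1 h2 h2
  · simp_all
  · simp [h1]
  · simp [h2]
  · simp [h1, h2]

theorem IsAtom.dim_two {v : I} (h : P.c ρ ρ v = 1) :
    ((P.q : ℚ) ^ (P.deg ρ + P.deg ρ) - 1) * P.D v = P.δ v + P.D ρ * P.δ ρ := by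
  have hd := P.c_deg ρ ρ v (by omega)
  have hρ0 := hρ.deg_ne_zero
  have hv1 : v ≠ P.one := fun h' => by rw [h', deg_of_one] at hd; omega
  have hvρ : v ≠ ρ := fun h' => by rw [h'] at hd; omega
  have h' := P.dim_of_subset v {(P.one, v), (v, P.one), (ρ, ρ)} (by
    intro a b hab
    obtain ⟨p, q, r, s, h1, h2, h3, h4⟩ := exists_hopf (a := ρ) (b := ρ) (by omega) hab
    rcases hρ.cases h1 with ⟨rfl, rfl⟩ | ⟨rfl, rfl⟩ <;>
    rcases hρ.cases h2 with ⟨rfl, rfl⟩ | ⟨rfl, rfl⟩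
    · obtain rfl := eq_of_one_c h3
      obtain rfl := eq_of_one_c hab
      simp
    · obtain rfl := eq_of_one_c h3
      obtain rfl := eq_of_c_one h4
      simp
    · obtain rfl := eq_of_one_c h4
      obtain rfl := eq_of_c_one h3
      simp
    · obtain rfl := eq_of_one_c h4
      obtain rfl := eq_of_c_one hab
      simp)
  rw [Finset.sum_insert (by simp [hv1.symm, hρ.1.symm]), Finset.sum_pair (by simp [hvρ])] at h'
  simp only [one_c_self, c_one_self, D_one, δ_one, h, ← hd] at h'
  push_cast at h'
  linarith

theorem IsAtom.Wn_of_not_dvd {n : ℕ} (h : ¬ P.deg ρ ∣ n) : P.Wn {ρ} n = ∅ := by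
  ext v
  simp only [Finset.notMem_empty, iff_false, mem_Wn]
  rintro ⟨h1, rfl⟩
  apply h
  induction h1 with
  | one => simp [deg_of_one]
  | step a ρ' v ha hr hc ih =>
    rw [Finset.mem_singleton] at hr
    subst hr
    rw [← P.c_deg _ _ _ hc]
    exact dvd_add (ih (fun h' => h (by
      rw [← P.c_deg _ _ _ hc]
      exact dvd_add h' dvd_rfl))) dvd_rfl

theorem IsAtom.eq_lin (hd : P.deg ρ = 1) : ∃ x : ℕ → I, x 1 = ρ ∧ P.IsLin x := P.lin ρ hd

theorem IsAtom.degree_cases {n : ℕ} (hn : n ≤ 5) : P.deg ρ = 1 ∨ ¬ P.deg ρ ∣ n ∨ n = 0 ∨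
    P.deg ρ = n ∨ P.deg ρ = 2 ∧ n = 4 := by
  have h0 := hρ.deg_ne_zero
  by_cases h : P.deg ρ ∣ n
  · obtain ⟨m, rfl⟩ := h
    generalize P.deg ρ = d at *
    have : d ≤ 5 ∨ m = 0 := by
      rcases Nat.eq_zero_or_pos m with h | h
      · exact .inr h
      · exact .inl (by nlinarith)
    rcases this with h | rfl
    · have : m ≤ 5 := by nlinarith [Nat.pos_of_ne_zero h0]
      interval_cases d <;> interval_cases m <;> simp_all
    · simp
  · exact .inr (.inl h)

theorem IsAtom.card_Wn {n : ℕ} (hn : n ≤ 5) : (P.Wn {ρ} n).card = spread 0 nt (P.deg ρ) n := by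
  have h0 := hρ.deg_ne_zero
  rcases hρ.degree_cases hn with h | h | h | h | h
  · obtain ⟨x, rfl, hx⟩ := hρ.eq_lin h
    rw [(hx.local_one n hn).card, spread, h, if_pos (one_dvd _), Nat.div_one]
  · rw [hρ.Wn_of_not_dvd h, spread, if_neg h, Finset.card_empty]
  · rw [h, Wn_zero, spread, if_pos (dvd_zero _), Nat.zero_div]
    rfl
  · rw [← h, hρ.Wn_self, spread, if_pos dvd_rfl, Nat.div_self (Nat.pos_of_ne_zero h0)]
    rfl
  · obtain ⟨a, b, hab, hne⟩ := hρ.exists_mu_self (by omega)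
    have := hρ.Wn_two hab hne
    rw [h.2, show 4 = P.deg ρ + P.deg ρ by omega, this, Finset.card_pair hne.symm, h.1]
    rfl

theorem IsAtom.loc_two (hd : P.deg ρ = 2) (hδ : P.δ ρ = 1) :
    ∏ v ∈ P.Wn {ρ} 4, P.D v = pt 2 ((P.q : ℚ) ^ 2) ∧
      ∑ v ∈ P.Wn {ρ} 4, (P.δ v : ℚ) * P.D v = et 2 ((P.q : ℚ) ^ 2) := by
  obtain ⟨a, b, hab, hne⟩ := hρ.exists_mu_self (by omega)
  have hW := hρ.Wn_two hab hne
  rw [hd] at hW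
  have ha : P.c ρ ρ a = 1 := by
    have h := congrFun hab a
    simp only [mu, Pi.add_apply, e_self, e_apply, if_neg hne.symm, add_zero] at h
    exact_mod_cast h
  have hb : P.c ρ ρ b = 1 := by
    have h := congrFun hab b
    simp only [mu, Pi.add_apply, e_self, e_apply, if_neg hne, zero_add] at h
    exact_mod_cast h
  have h1 := hρ.dim_two ha
  have h2 := hρ.dim_two hb
  have h3 := lift_δ_mu (P := P) ρ ρ (by omega)
  rw [hab, map_add, lift_e, lift_e, hδ] at h3
  have h4 : P.δ a + P.δ b = 1 := by exact_mod_cast h3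
  have h5 := hρ.D_eq hδ
  have n4 := P.q_pow_ne (n := 4) (by norm_num)
  have n2 := P.q_pow_ne (n := 2) (by norm_num)
  rw [hd] at h1 h2 h5
  rw [h5, hδ, mul_comm, ← eq_div_iff n4] at h1 h2
  norm_num at h1 h2
  rw [show 4 = 2 + 2 by norm_num, hW, Finset.prod_pair hne.symm, Finset.sum_pair hne.symm, h1, h2]
  have n4' : ((P.q : ℚ) ^ 2) ^ 2 - 1 ≠ 0 := by rwa [← pow_mul]
  have h6 : (P.q : ℚ) ^ 4 = ((P.q : ℚ) ^ 2) ^ 2 := by rw [← pow_mul]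
  rw [h6]
  generalize (P.q : ℚ) ^ 2 = Q at *
  have h7 : P.δ a = 0 ∧ P.δ b = 1 ∨ P.δ a = 1 ∧ P.δ b = 0 := by omega
  rcases h7 with ⟨h7, h8⟩ | ⟨h7, h8⟩
  all_goals
    rw [h7, h8]
    constructor
    · simp only [pt, Nat.cast_zero, Nat.cast_one]
      field_simp
      ring
    · simp [et, Finset.prod_range_succ]
      field_simp
      ring

theorem IsAtom.loc {n : ℕ} (hn : n ≤ 5) (hδ : P.δ ρ = 1) :
    P.Loc (P.Wn {ρ} n) (spread 0 nt (P.deg ρ) n)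
      (spread 1 (fun m => pt m ((P.q : ℚ) ^ P.deg ρ)) (P.deg ρ) n)
      (spread 0 (fun m => et m ((P.q : ℚ) ^ P.deg ρ)) (P.deg ρ) n) := by
  refine ⟨hρ.card_Wn hn, ?_, ?_⟩
  all_goals have h0 := hρ.deg_ne_zero
  all_goals rcases hρ.degree_cases hn with h | h | h | h | h
  · obtain ⟨x, rfl, hx⟩ := hρ.eq_lin h
    rw [(hx.local_one n hn).prod, spread, h, if_pos (one_dvd _), Nat.div_one, pow_one]
  · rw [hρ.Wn_of_not_dvd h, spread, if_neg h, Finset.prod_empty]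
  · rw [h, (loc_zero _).prod, spread, if_pos (dvd_zero _), Nat.zero_div]
    rfl
  · rw [← h, hρ.Wn_self, spread, if_pos dvd_rfl, Nat.div_self (Nat.pos_of_ne_zero h0),
      Finset.prod_singleton, hρ.D_eq hδ]
    rfl
  · rw [h.2, (hρ.loc_two h.1 hδ).1, h.1]
    rfl
  · obtain ⟨x, rfl, hx⟩ := hρ.eq_lin h
    rw [(hx.local_one n hn).sum, spread, h, if_pos (one_dvd _), Nat.div_one, pow_one]
  · rw [hρ.Wn_of_not_dvd h, spread, if_neg h, Finset.sum_empty]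
  · rw [h, (loc_zero _).sum, spread, if_pos (dvd_zero _), Nat.zero_div]
    simp [et]
  · rw [← h, hρ.Wn_self, spread, if_pos dvd_rfl, Nat.div_self (Nat.pos_of_ne_zero h0),
      Finset.sum_singleton, hρ.D_eq hδ, hδ]
    simp [et]
  · rw [h.2, (hρ.loc_two h.1 hδ).2, h.1]
    rfl

end Psh

end GLSmall

namespace GLSmall

open scoped BigOperators
open Finset.HasAntidiagonal (antidiagonal)

/-- Objects graded by degree with unique factorization over a finite set `A` of atoms. For a set of
atoms `S`, the number of objects of degree `n` composed of atoms of `S` is `N S n`; the product and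
the sum of multiplicative weights over these objects are `pi S n` and `E S n`. -/
structure Count (A : Type) [DecidableEq A] where
  deg : A → ℕ
  deg_pos : ∀ a, 0 < deg a
  deg_le : ∀ a, deg a ≤ 5
  N : Finset A → ℕ → ℕ
  pi : Finset A → ℕ → ℚ
  E : Finset A → ℕ → ℚ
  N_empty : ∀ n, N ∅ n = if n = 0 then 1 else 0
  pi_empty : ∀ n, pi ∅ n = 1
  E_empty : ∀ n, E ∅ n = if n = 0 then 1 else 0
  N_insert : ∀ a S n, n ≤ 5 → a ∉ S →
    N (insert a S) n = ∑ x ∈ antidiagonal n, N S x.1 * N {a} x.2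
  pi_insert : ∀ a S n, n ≤ 5 → a ∉ S →
    pi (insert a S) n = ∏ x ∈ antidiagonal n, pi S x.1 ^ N {a} x.2 * pi {a} x.2 ^ N S x.1
  E_insert : ∀ a S n, n ≤ 5 → a ∉ S →
    E (insert a S) n = ∑ x ∈ antidiagonal n, E S x.1 * E {a} x.2
  N_single : ∀ a n, n ≤ 5 → N {a} n = spread 0 nt (deg a) n
  E_single : ∀ a n, n < deg a → E {a} n = if n = 0 then 1 else 0

namespace Count

section Coeff

variable {A R : Type} [DecidableEq A] [CommSemiring R]

theorem coeff_of_insert (u : Finset A → ℕ → R) (g : A → ℕ → R)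
    (h0 : ∀ n, u ∅ n = if n = 0 then 1 else 0)
    (h1 : ∀ a S n, n ≤ 5 → a ∉ S →
      u (insert a S) n = ∑ x ∈ antidiagonal n, u S x.1 * u {a} x.2) {S : Finset A}
    (hg : ∀ a ∈ S, ∀ n ≤ 5, u {a} n = g a n) {n : ℕ} (hn : n ≤ 5) :
    u S n = PowerSeries.coeff n (∏ a ∈ S, PowerSeries.mk (g a)) := by
  induction S using Finset.induction_on generalizing n with
  | empty => rw [h0, Finset.prod_empty, PowerSeries.coeff_one]
  | insert a S ha ih =>
    rw [h1 a S n hn ha, Finset.prod_insert ha, mul_comm, PowerSeries.coeff_mul]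
    refine Finset.sum_congr rfl fun x hx => ?_
    have := Finset.HasAntidiagonal.mem_antidiagonal.1 hx
    rw [ih (fun a ha => hg a (Finset.mem_insert_of_mem ha)) (by omega), PowerSeries.coeff_mk,
      hg a (Finset.mem_insert_self _ _) _ (by omega)]

theorem add_of_insert (u : Finset A → ℕ → R)
    (h1 : ∀ a S n, n ≤ 5 → a ∉ S →
      u (insert a S) n = ∑ x ∈ antidiagonal n, u S x.1 * u {a} x.2) {S T : Finset A} {n : ℕ}
    (hn : n ≤ 5) (hn0 : n ≠ 0) (hST : Disjoint S T) (hS : u S 0 = 1)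
    (hT : ∀ a ∈ T, ∀ j < n, u {a} j = if j = 0 then 1 else 0) :
    u (S ∪ T) n = u S n + ∑ a ∈ T, u {a} n ∧ u (S ∪ T) 0 = 1 := by
  induction T using Finset.induction_on with
  | empty => simp [hS]
  | insert a T ha ih =>
    rw [Finset.disjoint_insert_right] at hST
    obtain ⟨h2, h3⟩ := ih hST.2 (fun b hb => hT b (Finset.mem_insert_of_mem hb))
    have h4 := hT a (Finset.mem_insert_self _ _)
    have h5 : a ∉ S ∪ T := by simp [hST.1, ha]
    rw [Finset.union_insert, h1 _ _ _ hn h5, h1 _ _ _ (by norm_num) h5, Finset.sum_insert ha]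
    constructor
    · obtain ⟨m, rfl⟩ := Nat.exists_eq_succ_of_ne_zero hn0
      rw [Finset.Nat.sum_antidiagonal_succ, Finset.sum_eq_single (m, 0), h3, h2,
        h4 0 (Nat.succ_pos m)]
      · rw [if_pos rfl]
        ring
      · rintro ⟨i, j⟩ hx hne
        rw [Finset.HasAntidiagonal.mem_antidiagonal] at hx
        dsimp only at hx ⊢
        rw [h4 j (by omega), if_neg, mul_zero]
        rintro rfl
        exact hne (Prod.ext (by simpa using hx) rfl)
      · simp
    · simp [h3, h4 0 (Nat.pos_of_ne_zero hn0)]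

end Coeff

theorem spread_zero {R : Type} (z : R) (f : ℕ → R) (d : ℕ) : spread z f d 0 = f 0 := by
  simp [spread]

theorem spread_self {R : Type} (z : R) (f : ℕ → R) {d : ℕ} (h : 0 < d) : spread z f d d = f 1 := by
  simp [spread, Nat.div_self h]

theorem spread_lt {R : Type} (z : R) (f : ℕ → R) {d n : ℕ} (h : n < d) :
    spread z f d n = if n = 0 then f 0 else z := by
  by_cases hn : n = 0
  · rw [hn, spread_zero, if_pos rfl]
  · rw [if_neg hn, spread, if_neg]
    exact Nat.not_dvd_of_pos_of_lt (Nat.pos_of_ne_zero hn) h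

section Total

variable {A : Type} [DecidableEq A] [Fintype A] (C : Count A)

/-- The atoms of a given degree. -/
def atoms (d : ℕ) : Finset A := Finset.univ.filter fun a => C.deg a = d

theorem mem_atoms {a : A} {d : ℕ} : a ∈ C.atoms d ↔ C.deg a = d := by simp [atoms]

/-- The atoms of degree less than a given one. -/
def below (d : ℕ) : Finset A := Finset.univ.filter fun a => C.deg a < d

theorem mem_below {a : A} {d : ℕ} : a ∈ C.below d ↔ C.deg a < d := by simp [below]

theorem prod_below {R : Type} [CommMonoid R] (g : ℕ → R) (n : ℕ) :
    ∏ a ∈ C.below n, g (C.deg a) = ∏ d ∈ Finset.range n, g d ^ (C.atoms d).card := by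
  rw [← Finset.prod_fiberwise_of_maps_to (s := C.below n) (t := Finset.range n) (g := C.deg)
    (fun a ha => Finset.mem_range.2 (C.mem_below.1 ha))]
  refine Finset.prod_congr rfl fun d hd => ?_
  rw [Finset.mem_range] at hd
  have : (C.below n).filter (fun a => C.deg a = d) = C.atoms d := by
    ext a
    simp only [Finset.mem_filter, mem_below, mem_atoms]
    constructor
    · exact fun h => h.2
    · exact fun h => ⟨by omega, h⟩
  rw [this, ← Finset.prod_const]
  exact Finset.prod_congr rfl fun a ha => by rw [C.mem_atoms.1 ha]

theorem N_single_lt (a : A) {n : ℕ} (hn : n < C.deg a) : C.N {a} n = if n = 0 then 1 else 0 := by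
  have := C.deg_le a
  rw [C.N_single a n (by omega), spread_lt _ _ hn]
  rfl

theorem total {R : Type} [CommSemiring R] (u : Finset A → ℕ → R) (g : ℕ → ℕ → R)
    (h0 : ∀ n, u ∅ n = if n = 0 then 1 else 0)
    (h1 : ∀ a S n, n ≤ 5 → a ∉ S →
      u (insert a S) n = ∑ x ∈ antidiagonal n, u S x.1 * u {a} x.2)
    (h2 : ∀ a n, n < C.deg a → u {a} n = if n = 0 then 1 else 0) {n : ℕ} (hn : n ≤ 5)
    (hn0 : n ≠ 0) (hg : ∀ a, C.deg a < n → ∀ m ≤ 5, u {a} m = g (C.deg a) m)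
    (hg0 : ∀ d, g d 0 = 1) :
    u Finset.univ n = PowerSeries.coeff n
      (∏ d ∈ Finset.range n, PowerSeries.mk (g d) ^ (C.atoms d).card) +
      ∑ a ∈ C.atoms n, u {a} n := by
  have h3 : ∀ m ≤ 5, u (C.below n) m = PowerSeries.coeff m
      (∏ d ∈ Finset.range n, PowerSeries.mk (g d) ^ (C.atoms d).card) := by
    intro m hm
    rw [coeff_of_insert u (fun a => g (C.deg a)) h0 h1 (fun a ha => hg a (C.mem_below.1 ha)) hm,
      C.prod_below fun d => PowerSeries.mk (g d)]
  have h4 : Disjoint (C.below n) (Finset.univ.filter fun a => n ≤ C.deg a) := by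
    rw [Finset.disjoint_left]
    intro a ha
    rw [mem_below] at ha
    simpa using ha
  have h5 := (add_of_insert u h1 hn hn0 h4 (by
    rw [h3 0 (by norm_num)]
    simp [PowerSeries.coeff_zero_eq_constantCoeff, hg0]) (by
    intro a ha j hj
    rw [Finset.mem_filter] at ha
    exact h2 a j (by omega))).1
  have h6 : C.below n ∪ (Finset.univ.filter fun a => n ≤ C.deg a) = Finset.univ := by
    ext a
    simpa [mem_below] using lt_or_ge _ _
  rw [h6, h3 n hn] at h5
  rw [h5]
  congr 1
  symm
  refine Finset.sum_subset (fun a ha => ?_) fun a ha hna => ?_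
  · rw [mem_atoms] at ha
    simp [ha]
  · rw [Finset.mem_filter] at ha
    rw [mem_atoms] at hna
    rw [h2 a n (by omega), if_neg hn0]

theorem N_univ {n : ℕ} (hn : n ≤ 5) (hn0 : n ≠ 0) :
    C.N Finset.univ n = PowerSeries.coeff n
      (∏ d ∈ Finset.range n, PowerSeries.mk (spread 0 nt d) ^ (C.atoms d).card) +
      (C.atoms n).card := by
  have := C.total C.N (spread 0 nt) C.N_empty C.N_insert (fun a n h => C.N_single_lt a h) hn hn0
    (fun a _ m hm => C.N_single a m hm) (fun d => by rw [spread_zero]; rfl)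
  rw [this, Finset.card_eq_sum_ones]
  congr 1
  refine Finset.sum_congr rfl fun a ha => ?_
  have h := C.mem_atoms.1 ha
  rw [C.N_single a n hn, h, spread_self _ _ (by omega)]
  rfl

end Total

section Match

variable {A B : Type} [DecidableEq A] [Fintype A] [DecidableEq B] [Fintype B]

theorem match_atoms (R : Count A) (K : Count B) (q : ℚ) (hq : ∀ n ≠ 0, q ^ n - 1 ≠ 0)
    (hN : ∀ n ≤ 5, R.N Finset.univ n = K.N Finset.univ n)
    (hE : ∀ n ≤ 5, R.E Finset.univ n = K.E Finset.univ n)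
    (hK : ∀ b, ∀ n ≤ 5, K.E {b} n = spread 0 (fun m => et m (q ^ K.deg b)) (K.deg b) n)
    (δ : A → ℕ) (h0 : ∀ a, 0 < δ a) (h1 : ∀ a, (q ^ R.deg a - 1) * R.E {a} (R.deg a) = δ a ^ 2)
    (h2 : ∀ a, δ a = 1 → ∀ n ≤ 5,
      R.E {a} n = spread 0 (fun m => et m (q ^ R.deg a)) (R.deg a) n) (n : ℕ) :
    (R.atoms n).card = (K.atoms n).card ∧ ∀ a, R.deg a = n → δ a = 1 := by
  induction n using Nat.strong_induction_on with
  | _ n ih =>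
  have e0 : n = 0 ∨ 5 < n → (R.atoms n).card = (K.atoms n).card ∧ ∀ a, R.deg a = n → δ a = 1 := by
    intro h
    have h3 : ∀ a, R.deg a ≠ n := fun a ha => by
      have := R.deg_pos a
      have := R.deg_le a
      omega
    have h4 : ∀ a, K.deg a ≠ n := fun a ha => by
      have := K.deg_pos a
      have := K.deg_le a
      omega
    refine ⟨?_, fun a ha => absurd ha (h3 a)⟩
    rw [Finset.card_eq_zero.2, Finset.card_eq_zero.2]
    · exact Finset.filter_eq_empty_iff.2 fun a _ => h4 a
    · exact Finset.filter_eq_empty_iff.2 fun a _ => h3 a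
  by_cases hn0 : n = 0
  · exact e0 (.inl hn0)
  by_cases hn : n ≤ 5
  swap
  · exact e0 (.inr (by omega))
  have hc : (R.atoms n).card = (K.atoms n).card := by
    have h3 := hN n hn
    rw [R.N_univ hn hn0, K.N_univ hn hn0] at h3
    rw [Finset.prod_congr rfl fun d hd => by rw [(ih d (Finset.mem_range.1 hd)).1]] at h3
    exact Nat.add_left_cancel h3
  refine ⟨hc, ?_⟩
  have h3 := hE n hn
  have h4 : ∀ d, spread (0 : ℚ) (fun m => et m (q ^ d)) d 0 = 1 := fun d => by
    rw [spread_zero]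
    simp [et]
  rw [R.total R.E (fun d => spread 0 (fun m => et m (q ^ d)) d) R.E_empty R.E_insert R.E_single hn
    hn0 (fun a ha => h2 a ((ih _ ha).2 a rfl)) h4, K.total K.E
    (fun d => spread 0 (fun m => et m (q ^ d)) d) K.E_empty K.E_insert K.E_single hn
    hn0 (fun a ha => hK a) h4, Finset.prod_congr rfl fun d hd => by
      rw [(ih d (Finset.mem_range.1 hd)).1]] at h3
  have h5 : ∑ a ∈ R.atoms n, ((δ a : ℚ) ^ 2) = ∑ a ∈ R.atoms n, 1 := by
    have h6 : ∀ a ∈ R.atoms n, (δ a : ℚ) ^ 2 = (q ^ n - 1) * R.E {a} n := by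
      intro a ha
      have := h1 a
      rw [R.mem_atoms.1 ha] at this
      exact this.symm
    rw [Finset.sum_congr rfl h6, ← Finset.mul_sum, add_left_cancel h3, Finset.mul_sum,
      Finset.sum_const, nsmul_one, hc, ← nsmul_one, ← Finset.sum_const]
    refine Finset.sum_congr rfl fun b hb => ?_
    have := K.mem_atoms.1 hb
    rw [hK b n hn, this, spread_self _ _ (by omega)]
    have := hq n hn0
    simp [et, this]
  intro a ha
  by_contra hne
  have h7 : ∑ a ∈ R.atoms n, 1 < ∑ a ∈ R.atoms n, ((δ a : ℚ) ^ 2) := by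
    refine Finset.sum_lt_sum (fun a _ => ?_) ⟨a, R.mem_atoms.2 ha, ?_⟩
    · have : 1 ≤ δ a ^ 2 := Nat.pos_of_ne_zero (pow_ne_zero _ (h0 a).ne')
      exact_mod_cast this
    · have h8 := h0 a
      have : 1 < δ a ^ 2 := Nat.one_lt_pow (by norm_num) (by omega)
      exact_mod_cast this
  exact h7.ne' h5

theorem exists_equiv (R : Count A) (K : Count B)
    (h : ∀ n, (R.atoms n).card = (K.atoms n).card) : ∃ φ : A ≃ B, ∀ a, K.deg (φ a) = R.deg a := by
  have e : ∀ n, Nonempty ({a // R.deg a = n} ≃ {b // K.deg b = n}) := fun n => by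
    rw [← Fintype.card_eq, Fintype.card_subtype, Fintype.card_subtype]
    exact h n
  refine ⟨(Equiv.sigmaFiberEquiv R.deg).symm.trans
    ((Equiv.sigmaCongrRight fun n => (e n).some).trans (Equiv.sigmaFiberEquiv K.deg)), fun a => ?_⟩
  exact ((e (R.deg a)).some ⟨a, rfl⟩).2

end Match

end Count

/-- The inverse of the product over partitions of `m` of the orders of the automorphism groups of
the corresponding modules over a discrete valuation ring with residue field of order `Q`. -/
def ct (m : ℕ) (Q : ℚ) : ℚ :=
  match m with
  | 1 => (Q - 1)⁻¹
  | 2 => (Q * (Q - 1) * (Q * (Q - 1) * (Q ^ 2 - 1)))⁻¹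
  | 3 => (Q ^ 2 * (Q - 1) * (Q ^ 3 * (Q - 1) ^ 2) *
      (Q ^ 3 * (Q - 1) * (Q ^ 2 - 1) * (Q ^ 3 - 1)))⁻¹
  | 4 => (Q ^ 3 * (Q - 1) * (Q ^ 4 * (Q - 1) ^ 2) * (Q ^ 5 * (Q - 1) * (Q ^ 2 - 1)) *
      (Q ^ 6 * (Q - 1) ^ 2 * (Q ^ 2 - 1)) *
      (Q ^ 6 * (Q - 1) * (Q ^ 2 - 1) * (Q ^ 3 - 1) * (Q ^ 4 - 1)))⁻¹
  | 5 => (Q ^ 4 * (Q - 1) * (Q ^ 5 * (Q - 1) ^ 2) * (Q ^ 7 * (Q - 1) ^ 2) *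
      (Q ^ 7 * (Q - 1) ^ 2 * (Q ^ 2 - 1)) * (Q ^ 9 * (Q - 1) ^ 2 * (Q ^ 2 - 1)) *
      (Q ^ 10 * (Q - 1) ^ 2 * (Q ^ 2 - 1) * (Q ^ 3 - 1)) *
      (Q ^ 10 * (Q - 1) * (Q ^ 2 - 1) * (Q ^ 3 - 1) * (Q ^ 4 - 1) * (Q ^ 5 - 1)))⁻¹
  | _ => 1

/-- The exponent of the prime power in the ratio of `pt` and `ct`. -/
def bt : ℕ → ℕ
  | 2 => 3
  | 3 => 12
  | 4 => 36
  | 5 => 78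
  | _ => 0

theorem sum_antidiagonal_add_two (m : ℕ) (f : ℕ × ℕ → ℕ) :
    ∑ x ∈ antidiagonal (m + 2), f x =
      f (0, m + 2) + ∑ x ∈ antidiagonal m, f (x.1 + 1, x.2 + 1) + f (m + 2, 0) := by
  rw [Finset.Nat.sum_antidiagonal_succ, Finset.Nat.sum_antidiagonal_succ']
  ring

/-- `x` is an integral multiple of `y`. -/
def IntMul (x y : ℚ) : Prop := ∃ z : ℤ, x = z * y

theorem IntMul.refl (x : ℚ) : IntMul x x := ⟨1, by simp⟩

theorem IntMul.mul {x y x' y' : ℚ} (h : IntMul x y) (h' : IntMul x' y') :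
    IntMul (x * x') (y * y') := by
  obtain ⟨z, rfl⟩ := h
  obtain ⟨z', rfl⟩ := h'
  exact ⟨z * z', by push_cast; ring⟩

theorem IntMul.pow {x y : ℚ} (h : IntMul x y) (n : ℕ) : IntMul (x ^ n) (y ^ n) := by
  obtain ⟨z, rfl⟩ := h
  exact ⟨z ^ n, by push_cast; ring⟩

theorem IntMul.prod {ι : Type} (s : Finset ι) {f g : ι → ℚ} (h : ∀ i ∈ s, IntMul (f i) (g i)) :
    IntMul (∏ i ∈ s, f i) (∏ i ∈ s, g i) := by
  classical
  induction s using Finset.induction_on with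
  | empty => exact .refl _
  | insert a s ha ih =>
    rw [Finset.prod_insert ha, Finset.prod_insert ha]
    exact (h a (Finset.mem_insert_self _ _)).mul (ih fun i hi => h i (Finset.mem_insert_of_mem hi))

theorem intMul_ct (Q : ℤ) (hQ : ∀ n ≠ 0, (Q : ℚ) ^ n - 1 ≠ 0) (hQ0 : (Q : ℚ) ≠ 0) (m : ℕ)
    (hm : m ≤ 5) : IntMul (ct m Q * (Q : ℚ) ^ bt m) (pt m Q) := by
  have n1 := hQ 1 (by norm_num)
  have n2 := hQ 2 (by norm_num)
  have n3 := hQ 3 (by norm_num)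
  have n4 := hQ 4 (by norm_num)
  have n5 := hQ 5 (by norm_num)
  rw [pow_one] at n1
  interval_cases m
  · exact ⟨1, by simp [ct, pt, bt]⟩
  · exact ⟨1, by simp [ct, pt, bt]⟩
  · refine ⟨Q ^ 2 - 1, ?_⟩
    simp only [ct, pt, bt]
    push_cast
    field_simp
  · refine ⟨(Q ^ 2 - 1) * (Q ^ 3 - 1) ^ 2, ?_⟩
    simp only [ct, pt, bt]
    push_cast
    field_simp
  · refine ⟨(Q ^ 2 - 1) ^ 3 * (Q ^ 3 - 1) ^ 2 * (Q ^ 4 - 1) ^ 3, ?_⟩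
    simp only [ct, pt, bt]
    push_cast
    field_simp
  · refine ⟨(Q ^ 2 - 1) ^ 4 * (Q ^ 3 - 1) ^ 4 * (Q ^ 4 - 1) ^ 3 * (Q ^ 5 - 1) ^ 4, ?_⟩
    simp only [ct, pt, bt]
    push_cast
    field_simp

/-- Coefficients of a superadditive upper bound for the exponents. -/
def kap : ℕ → ℕ
  | 2 => 2
  | 3 => 4
  | 4 => 8
  | 5 => 12
  | _ => 0

/-- The defects of the linear atoms. -/
def dft : ℕ → ℕ
  | 2 => 1
  | 3 => 3
  | 4 => 6
  | 5 => 8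
  | _ => 0

theorem kap_add {i j : ℕ} (h : i + j ≤ 5) : kap i + kap j ≤ kap (i + j) := by
  have hi : i ≤ 5 := by omega
  have hj : j ≤ 5 := by omega
  interval_cases i <;> interval_cases j <;> first | omega | decide

theorem kap_choose {i j : ℕ} (h : i + 1 + (j + 1) ≤ 5) :
    kap (i + 1) + kap (j + 1) ≤ (i + 1 + (j + 1)).choose 2 := by
  have hi : i ≤ 5 := by omega
  have hj : j ≤ 5 := by omega
  interval_cases i <;> interval_cases j <;> first | omega | decide

theorem spread_bt_le {d n : ℕ} (hd : 0 < d) (hd5 : d ≤ 5) (hn : n ≤ 5) :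
    spread 0 (fun m => d * bt m) d n ≤ kap n * spread 0 nt d n := by
  interval_cases d <;> interval_cases n <;> decide

theorem spread_bt_le' {d n : ℕ} (hd : 0 < d) (hd5 : d ≤ 5) (hn2 : 2 ≤ n) (hn : n ≤ 5) :
    spread 0 (fun m => d * bt m) d n + n.choose 2 * (if d = n then 1 else 0) ≤
      n.choose 2 * spread 0 nt d n + dft n * (if d = 1 then 1 else 0) := by
  interval_cases d <;> interval_cases n <;> decide

namespace Count

variable {A B : Type} [DecidableEq A] [DecidableEq B]

theorem exists_ratio (R : Count A) (K : Count B) (q : ℤ) (hq : ∀ n ≠ 0, (q : ℚ) ^ n - 1 ≠ 0)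
    (hq0 : (q : ℚ) ≠ 0) (φ : A ≃ B) (hφ : ∀ a, K.deg (φ a) = R.deg a)
    (hR : ∀ a, ∀ n ≤ 5, R.pi {a} n = spread 1 (fun m => pt m ((q : ℚ) ^ R.deg a)) (R.deg a) n)
    (hK : ∀ b, ∀ n ≤ 5, K.pi {b} n = spread 1 (fun m => ct m ((q : ℚ) ^ K.deg b)) (K.deg b) n)
    (T : Finset A) : ∃ b : ℕ → ℕ, R.N T 0 = 1 ∧ ∀ n ≤ 5, K.N (T.map φ.toEmbedding) n = R.N T n ∧
      IntMul (K.pi (T.map φ.toEmbedding) n * (q : ℚ) ^ b n) (R.pi T n) ∧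
      b n ≤ kap n * R.N T n ∧ (2 ≤ n →
      b n + n.choose 2 * ∑ a ∈ T, (if R.deg a = n then 1 else 0) ≤
        n.choose 2 * R.N T n + dft n * ∑ a ∈ T, (if R.deg a = 1 then 1 else 0)) := by
  induction T using Finset.induction_on with
  | empty =>
    refine ⟨fun _ => 0, by rw [R.N_empty, if_pos rfl], fun n _ => ⟨?_, ?_, ?_, ?_⟩⟩
    · rw [Finset.map_empty, K.N_empty, R.N_empty]
    · rw [Finset.map_empty, K.pi_empty, R.pi_empty]
      simpa using IntMul.refl 1
    · simp
    · simp
  | insert a T ha ih =>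
    obtain ⟨b, h0, h⟩ := ih
    have hd0 := R.deg_pos a
    have hd5 := R.deg_le a
    have ha' : φ a ∉ T.map φ.toEmbedding := by simpa using ha
    have hNK : ∀ n ≤ 5, K.N {φ a} n = R.N {a} n := fun n hn => by
      rw [K.N_single _ n hn, R.N_single _ n hn, hφ]
    set l : ℕ → ℕ := spread 0 (fun m => R.deg a * bt m) (R.deg a) with hl
    have hl0 : l 0 = 0 := by
      rw [hl, spread_zero]
      rfl
    have hb0 : b 0 = 0 := by
      have := (h 0 (by norm_num)).2.2.1
      rw [show kap 0 = 0 from rfl, zero_mul] at this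
      omega
    have hNa : R.N {a} 0 = 1 := by
      rw [R.N_single _ _ (by norm_num), spread_zero]
      rfl
    have hloc : ∀ n ≤ 5, IntMul (K.pi {φ a} n * (q : ℚ) ^ l n) (R.pi {a} n) := by
      intro n hn
      rw [hR a n hn, hK _ n hn, hφ, hl]
      unfold spread
      by_cases hdn : R.deg a ∣ n
      · rw [if_pos hdn, if_pos hdn, if_pos hdn, pow_mul]
        have := intMul_ct (q ^ R.deg a) (by
          intro k hk
          push_cast
          rw [← pow_mul]
          exact hq _ (mul_ne_zero hd0.ne' hk)) (by
          push_cast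
          exact pow_ne_zero _ hq0) (n / R.deg a) ((Nat.div_le_self _ _).trans hn)
        push_cast at this
        exact this
      · rw [if_neg hdn, if_neg hdn, if_neg hdn]
        simpa using IntMul.refl 1
    refine ⟨fun n => ∑ x ∈ antidiagonal n, (b x.1 * R.N {a} x.2 + l x.2 * R.N T x.1), ?_,
      fun n hn => ?_⟩
    · rw [R.N_insert _ _ _ (by norm_num) ha]
      simp [h0, hNa]
    have hx : ∀ x ∈ antidiagonal n, x.1 ≤ 5 ∧ x.2 ≤ 5 ∧ x.1 + x.2 = n := by
      intro x hx
      rw [Finset.HasAntidiagonal.mem_antidiagonal] at hx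
      omega
    have hκ : ∀ i j, i ≤ 5 → j ≤ 5 → b i * R.N {a} j + l j * R.N T i ≤
        (kap i + kap j) * (R.N T i * R.N {a} j) := by
      intro i j hi hj
      have h1 := (h i hi).2.2.1
      have h2 := spread_bt_le hd0 hd5 hj
      rw [← R.N_single a j hj] at h2
      calc _ ≤ kap i * R.N T i * R.N {a} j + kap j * R.N {a} j * R.N T i := by gcongr
        _ = _ := by ring
    refine ⟨?_, ?_, ?_, ?_⟩
    · rw [Finset.map_insert, Equiv.coe_toEmbedding, K.N_insert _ _ _ hn ha', R.N_insert _ _ _ hn ha]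
      exact Finset.sum_congr rfl fun x hxm => by
        rw [(h _ (hx x hxm).1).1, hNK _ (hx x hxm).2.1]
    · rw [Finset.map_insert, Equiv.coe_toEmbedding, K.pi_insert _ _ _ hn ha',
        R.pi_insert _ _ _ hn ha, ← Finset.prod_pow_eq_pow_sum, ← Finset.prod_mul_distrib]
      refine IntMul.prod _ fun x hxm => ?_
      rw [(h _ (hx x hxm).1).1, hNK _ (hx x hxm).2.1]
      have := (((h _ (hx x hxm).1).2.1).pow (R.N {a} x.2)).mul
        ((hloc _ (hx x hxm).2.1).pow (R.N T x.1))
      convert this using 1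
      ring
    · rw [R.N_insert _ _ _ hn ha, Finset.mul_sum]
      refine Finset.sum_le_sum fun x hxm => (hκ _ _ (hx x hxm).1 (hx x hxm).2.1).trans ?_
      rw [← (hx x hxm).2.2] at hn ⊢
      exact Nat.mul_le_mul_right _ (kap_add hn)
    · intro hn2
      have h3 := (h n hn).2.2.2 hn2
      have h4 := spread_bt_le' hd0 hd5 hn2 hn
      rw [← R.N_single a n hn] at h4
      change l n + _ ≤ _ at h4
      rw [Finset.sum_insert ha, Finset.sum_insert ha, R.N_insert _ _ _ hn ha]
      obtain ⟨m, rfl⟩ : ∃ m, n = m + 2 := ⟨n - 2, by omega⟩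
      beta_reduce
      rw [sum_antidiagonal_add_two, sum_antidiagonal_add_two]
      have h5 : ∑ x ∈ antidiagonal m, (b (x.1 + 1) * R.N {a} (x.2 + 1) +
          l (x.2 + 1) * R.N T (x.1 + 1)) ≤
          (m + 2).choose 2 * ∑ x ∈ antidiagonal m, R.N T (x.1 + 1) * R.N {a} (x.2 + 1) := by
        rw [Finset.mul_sum]
        refine Finset.sum_le_sum fun x hxm => ?_
        rw [Finset.HasAntidiagonal.mem_antidiagonal] at hxm
        refine (hκ _ _ (by omega) (by omega)).trans (Nat.mul_le_mul_right _ ?_)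
        refine (kap_choose (by omega)).trans_eq ?_
        congr 1
        omega
      simp only [hl0, hb0, h0, hNa]
      linarith

end Count

/-- The counting data of a family of finite sets of objects which multiply uniquely. -/
noncomputable def Count.ofWn {A V : Type} [DecidableEq A] (deg : A → ℕ)
    (Wn : Finset A → ℕ → Finset V)
    (w e : V → ℚ) (deg_pos : ∀ a, 0 < deg a) (deg_le : ∀ a, deg a ≤ 5)
    (h0 : ∃ v, Wn ∅ 0 = {v} ∧ w v = 1 ∧ e v = 1) (h1 : ∀ n ≠ 0, Wn ∅ n = ∅)
    (h2 : ∀ a S n, n ≤ 5 → a ∉ S → ∃ pr : V → V → V,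
      (∀ {M : Type} [CommMonoid M] (F : V → M), ∏ v ∈ Wn (insert a S) n, F v =
        ∏ x ∈ antidiagonal n, ∏ u ∈ Wn S x.1, ∏ v ∈ Wn {a} x.2, F (pr u v)) ∧
      ∀ i j, i + j = n → ∀ u ∈ Wn S i, ∀ v ∈ Wn {a} j,
        w (pr u v) = w u * w v ∧ e (pr u v) = e u * e v)
    (h3 : ∀ a n, n ≤ 5 → (Wn {a} n).card = spread 0 nt (deg a) n)
    (h4 : ∀ a n, n < deg a → ∑ v ∈ Wn {a} n, e v = if n = 0 then 1 else 0) : Count A where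
  deg := deg
  deg_pos := deg_pos
  deg_le := deg_le
  N S n := (Wn S n).card
  pi S n := ∏ v ∈ Wn S n, w v
  E S n := ∑ v ∈ Wn S n, e v
  N_empty n := by
    obtain ⟨v, hv, -⟩ := h0
    split_ifs with h
    · rw [h, hv, Finset.card_singleton]
    · rw [h1 n h, Finset.card_empty]
  pi_empty n := by
    obtain ⟨v, hv, hw, -⟩ := h0
    by_cases h : n = 0
    · rw [h, hv, Finset.prod_singleton, hw]
    · rw [h1 n h, Finset.prod_empty]
  E_empty n := by
    obtain ⟨v, hv, -, he⟩ := h0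
    split_ifs with h
    · rw [h, hv, Finset.sum_singleton, he]
    · rw [h1 n h, Finset.sum_empty]
  N_insert a S n hn ha := by
    obtain ⟨pr, h, -⟩ := h2 a S n hn ha
    have := congrArg Multiplicative.toAdd (h fun _ => Multiplicative.ofAdd 1)
    simpa [toAdd_prod] using this
  pi_insert a S n hn ha := by
    obtain ⟨pr, h, hw⟩ := h2 a S n hn ha
    rw [h w]
    refine Finset.prod_congr rfl fun x hx => ?_
    rw [Finset.HasAntidiagonal.mem_antidiagonal] at hx
    rw [Finset.prod_congr rfl fun u hu => Finset.prod_congr rfl fun v hv => (hw _ _ hx u hu v hv).1]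
    simp only [Finset.prod_mul_distrib, Finset.prod_const, Finset.prod_pow]
  E_insert a S n hn ha := by
    obtain ⟨pr, h, hw⟩ := h2 a S n hn ha
    have := congrArg Multiplicative.toAdd (h fun v => Multiplicative.ofAdd (e v))
    simp only [toAdd_prod, toAdd_ofAdd] at this
    rw [this]
    refine Finset.sum_congr rfl fun x hx => ?_
    rw [Finset.HasAntidiagonal.mem_antidiagonal] at hx
    rw [Finset.sum_congr rfl fun u hu => Finset.sum_congr rfl fun v hv => (hw _ _ hx u hu v hv).2,
      Finset.sum_mul_sum]
  N_single := h3
  E_single := h4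

namespace Psh

variable {I : Type} [Fintype I] [DecidableEq I] (P : Psh I)

/-- The finite set of basis elements underlying a set of atoms. -/
def under (S : Finset {a : I // P.IsAtom a}) : Finset I := S.map (Function.Embedding.subtype _)

variable {P}

theorem isAtom_of_mem_under {S : Finset {a : I // P.IsAtom a}} : ∀ ρ ∈ P.under S, P.IsAtom ρ := by
  intro ρ h
  simp only [under, Finset.mem_map, Function.Embedding.coe_subtype] at h
  obtain ⟨a, -, rfl⟩ := h
  exact a.2

theorem under_singleton (a : {a : I // P.IsAtom a}) : P.under {a} = {a.1} := by
  simp [under]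

theorem W_empty {v : I} (h : P.W ∅ v) : v = P.one := by
  cases h with
  | one => rfl
  | step a ρ v _ h _ => simp at h

variable (P)

/-- The counting data of a positive self-adjoint Hopf algebra. -/
noncomputable def count : Count {a : I // P.IsAtom a} :=
  Count.ofWn (fun a => P.deg a.1) (fun S n => P.Wn (P.under S) n) P.D (fun v => P.δ v * P.D v)
    (fun a => deg_pos a.2.1) (fun a => P.deg_le a.1)
    ⟨P.one, by
      ext v
      simp only [mem_Wn, Finset.mem_singleton, under, Finset.map_empty]
      exact ⟨fun h => W_empty h.1, fun h => h ▸ ⟨.one, deg_of_one⟩⟩, D_one, by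
        simp [D_one, δ_one]⟩
    (fun n hn => by
      ext v
      simp only [mem_Wn, under, Finset.map_empty, Finset.notMem_empty, iff_false]
      rintro ⟨h, h'⟩
      rw [W_empty h, deg_of_one] at h'
      exact hn h'.symm)
    (fun a S n hn ha => by
      have hd : Disjoint (P.under S) (P.under {a}) := by
        rw [under, under, Finset.disjoint_map, Finset.disjoint_singleton_right]
        exact ha
      refine ⟨P.pr, fun {M} _ F => ?_, fun i j hij u hu v hv => ?_⟩
      · rw [← prod_Wn_union isAtom_of_mem_under isAtom_of_mem_under hd F hn]
        congr 2
        rw [under, under, under, ← Finset.map_union]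
        congr 1
        ext
        simp
      · rw [mem_Wn] at hu hv
        have hle : P.deg u + P.deg v ≤ 5 := by omega
        have h1 := D_pr isAtom_of_mem_under isAtom_of_mem_under hd hu.1 hv.1 hle
        have h2 := δ_pr isAtom_of_mem_under isAtom_of_mem_under hd hu.1 hv.1 hle
        refine ⟨h1, ?_⟩
        rw [h1, h2]
        push_cast
        ring)
    (fun a n hn => by rw [under_singleton, a.2.card_Wn hn])
    (fun a n hn => by
      rw [under_singleton]
      split_ifs with h
      · subst h
        rw [Wn_zero]
        simp [D_one, δ_one]
      · rw [a.2.Wn_of_not_dvd, Finset.sum_empty]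
        exact fun hd => absurd (Nat.le_of_dvd (Nat.pos_of_ne_zero h) hd) (by omega))

variable {P}

theorem Wn_univ [Fintype {a : I // P.IsAtom a}] (n : ℕ) :
    P.Wn (P.under Finset.univ) n = Finset.univ.filter fun v => P.deg v = n := by
  ext v
  simp only [mem_Wn, Finset.mem_filter, Finset.mem_univ, true_and, and_iff_right_iff_imp]
  exact fun _ => .of_all (fun ρ hρ => by simpa [under] using hρ) v

theorem δ_pos_of_isAtom {a : I} (ha : P.IsAtom a) : 0 < P.δ a := by
  have h := ha.dim
  have h1 : 0 < ((P.q : ℚ) ^ P.deg a - 1) * P.D a := by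
    refine mul_pos ?_ (P.D_pos a)
    have : 1 < P.q ^ P.deg a := Nat.one_lt_pow ha.deg_ne_zero P.two_le_q
    rw [sub_pos]
    exact_mod_cast this
  rw [h] at h1
  exact_mod_cast h1

theorem exists_intMul {B : Type} [DecidableEq B] [Fintype B] (K : Count B)
    (hN : ∀ n ≤ 5, (Finset.univ.filter fun v => P.deg v = n).card = K.N Finset.univ n)
    (hE : ∀ n ≤ 5, ∑ v with P.deg v = n, (P.δ v : ℚ) * P.D v = K.E Finset.univ n)
    (hKE : ∀ b, ∀ n ≤ 5,
      K.E {b} n = spread 0 (fun m => et m ((P.q : ℚ) ^ K.deg b)) (K.deg b) n)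
    (hKpi : ∀ b, ∀ n ≤ 5,
      K.pi {b} n = spread 1 (fun m => ct m ((P.q : ℚ) ^ K.deg b)) (K.deg b) n)
    (hC : ∀ n, 2 ≤ n → n ≤ 5 → (K.atoms 1).card ≤ (K.atoms n).card) {n : ℕ} (h2 : 2 ≤ n)
    (h5 : n ≤ 5) :
    IntMul (K.pi Finset.univ n * (P.q : ℚ) ^ (n.choose 2 * K.N Finset.univ n))
      (∏ v with P.deg v = n, P.D v) := by
  classical
  have hm := Count.match_atoms P.count K P.q (fun n hn => P.q_pow_ne hn)
    (fun n hn => by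
      change (P.Wn (P.under Finset.univ) n).card = _
      rw [Wn_univ, hN n hn])
    (fun n hn => by
      change ∑ v ∈ P.Wn (P.under Finset.univ) n, _ = _
      rw [Wn_univ, hE n hn])
    hKE (fun a => P.δ a.1) (fun a => δ_pos_of_isAtom a.2)
    (fun a => by
      change _ * ∑ v ∈ P.Wn (P.under {a}) (P.deg a.1), _ = _
      rw [under_singleton, a.2.Wn_self, Finset.sum_singleton, ← mul_assoc, mul_comm (_ - _),
        mul_assoc]
      change _ * (((P.q : ℚ) ^ P.deg a.1 - 1) * _) = _
      rw [a.2.dim, sq])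
    (fun a ha n hn => by
      change ∑ v ∈ P.Wn (P.under {a}) n, _ = _
      rw [under_singleton]
      exact (a.2.loc hn ha).sum)
  obtain ⟨φ, hφ⟩ := Count.exists_equiv P.count K fun n => (hm n).1
  have hq0 : ((P.q : ℤ) : ℚ) ≠ 0 := by
    have := P.two_le_q
    exact_mod_cast (by omega : P.q ≠ 0)
  obtain ⟨b, hb0, hb⟩ := Count.exists_ratio P.count K P.q
    (fun n hn => by exact_mod_cast P.q_pow_ne hn) hq0 φ hφ
    (fun a n hn => by
      change ∏ v ∈ P.Wn (P.under {a}) n, _ = _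
      rw [under_singleton]
      exact (a.2.loc hn ((hm _).2 a rfl)).prod)
    (fun b n hn => by exact_mod_cast hKpi b n hn) Finset.univ
  obtain ⟨h6, h7, -, h8⟩ := hb n h5
  have hu : Finset.univ.map φ.toEmbedding = Finset.univ := by simp
  rw [hu] at h6 h7
  have h9 := h8 h2
  simp only [← Finset.card_filter] at h9
  have h10 : b n ≤ n.choose 2 * K.N Finset.univ n := by
    have e1 : ∀ d, (P.count.atoms d).card =
        (Finset.univ.filter fun a => P.count.deg a = d).card := fun d => rfl
    rw [← e1, ← e1, (hm n).1, (hm 1).1] at h9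
    rw [h6]
    have h11 : dft n * (K.atoms 1).card ≤ n.choose 2 * (K.atoms n).card := by
      refine Nat.mul_le_mul ?_ (hC n h2 h5)
      interval_cases n <;> simp [dft] <;> decide
    omega
  obtain ⟨z, hz⟩ := h7
  refine ⟨P.q ^ (n.choose 2 * K.N Finset.univ n - b n) * z, ?_⟩
  have h12 : ∏ v with P.deg v = n, P.D v = P.count.pi Finset.univ n := by
    change _ = ∏ v ∈ P.Wn (P.under Finset.univ) n, _
    rw [Wn_univ]
  rw [h12]
  push_cast at hz ⊢
  rw [mul_assoc, ← hz, mul_left_comm, ← pow_add, Nat.sub_add_cancel h10]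

end Psh

end GLSmall

namespace GLSmall

open scoped BigOperators
open Matrix

section Degrees

variable {k : Type} [Field k] [Fintype k] [DecidableEq k]

theorem pe_zero_left {n : ℕ} (h : 0 + n = n) (t : Par k (Fin 0) (Fin n)) : pe (sumE h) t = t.d := by
  have h1 : ∀ j : Fin n, (sumE h).symm j = .inr j := fun j => by
    rw [Equiv.symm_apply_eq]
    ext
    simp [sumE]
  rw [pe_apply]
  refine Units.ext (Matrix.ext fun p q => ?_)
  change t.emb.1 ((sumE h).symm p) ((sumE h).symm q) = _
  rw [h1, h1]
  rfl

theorem pe_zero_right {n : ℕ} (h : n + 0 = n) (t : Par k (Fin n) (Fin 0)) :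
    pe (sumE h) t = t.a := by
  have h1 : ∀ j : Fin n, (sumE h).symm j = .inl j := fun j => by
    rw [Equiv.symm_apply_eq]
    ext
    simp [sumE]
    rfl
  rw [pe_apply]
  refine Units.ext (Matrix.ext fun p q => ?_)
  change t.emb.1 ((sumE h).symm p) ((sumE h).symm q) = _
  rw [h1, h1]
  rfl

theorem pair_par {ι κ : Type} [Fintype ι] [DecidableEq ι] [Fintype κ] [DecidableEq κ]
    (f σ : GL ι k → ℂ) (g τ : GL κ k → ℂ) :
    pair (fun t : Par k ι κ => f t.a * g t.d) (fun t => σ t.a * τ t.d) = pair f σ * pair g τ := by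
  rw [pair_eq_expect, pair_eq_expect, pair_eq_expect, expect_par, Finset.expect_mul]
  refine Finset.expect_congr rfl fun a _ => ?_
  rw [Finset.mul_expect]
  refine Finset.expect_congr rfl fun d _ => ?_
  simp only [Par.inv_a, Par.inv_d]
  rw [Fintype.expect_const]
  ring

theorem eq_one_of_fin_zero (g : GL (Fin 0) k) : g = 1 := Units.ext (Subsingleton.elim _ _)

theorem pair_fin_zero (f h : GL (Fin 0) k → ℂ) : pair f h = f 1 * h 1 := by
  rw [pair_eq_expect]
  have : ∀ g : GL (Fin 0) k, f g * h g⁻¹ = f 1 * h 1 := fun g => by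
    rw [eq_one_of_fin_zero g, inv_one]
  simp only [this, Fintype.expect_const]

theorem irr_fin_zero (χ : irr (GL (Fin 0) k)) : (χ : GL (Fin 0) k → ℂ) = fun _ => 1 := by
  have h := pair_irr χ χ
  rw [if_pos rfl, pair_fin_zero] at h
  obtain ⟨n, hn, h1⟩ := irr_one_nat χ
  rw [h1] at h
  have h2 : n * n = 1 := by exact_mod_cast h
  have h3 : n = 1 := Nat.eq_one_of_mul_eq_one_left h2
  funext g
  rw [eq_one_of_fin_zero g, h1, h3, Nat.cast_one]

theorem cc_zero_left {n : ℕ} (h : 0 + n = n) (σ : irr (GL (Fin 0) k)) (τ v : GL (Fin n) k → ℂ) :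
    cc (sumE h) (σ : GL (Fin 0) k → ℂ) τ v = pair v τ := by
  unfold cc
  simp only [pe_zero_left, irr_fin_zero]
  have := pair_par (fun _ : GL (Fin 0) k => 1) (fun _ => 1) v τ
  rw [pair_fin_zero, one_mul, one_mul] at this
  simpa only [one_mul] using this

theorem cc_zero_right {n : ℕ} (h : n + 0 = n) (σ : irr (GL (Fin 0) k)) (τ v : GL (Fin n) k → ℂ) :
    cc (sumE h) τ (σ : GL (Fin 0) k → ℂ) v = pair v τ := by
  unfold cc
  simp only [pe_zero_right, irr_fin_zero]
  have := pair_par v τ (fun _ : GL (Fin 0) k => 1) (fun _ => 1)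
  rw [pair_fin_zero, one_mul, mul_one] at this
  simpa only [mul_one] using this

theorem card_par (i j : ℕ) : Nat.card (Par k (Fin i) (Fin j)) =
    Nat.card (GL (Fin i) k) * Nat.card (GL (Fin j) k) * Fintype.card k ^ (i * j) := by
  rw [Nat.card_congr Par.equivProd, Nat.card_prod, Nat.card_prod,
    Nat.card_congr (Matrix.of (m := Fin i) (n := Fin j) (α := k)).symm]
  simp only [Nat.card_fun, Nat.card_eq_fintype_card (α := k), Nat.card_eq_fintype_card (α := Fin _),
    Fintype.card_fin]
  ring

theorem card_GL_eq (n : ℕ) : (Nat.card (GL (Fin n) k) : ℂ) =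
    (Fintype.card k : ℂ) ^ (n.choose 2) * gnum (Fintype.card k) n := by
  rw [Matrix.card_GL_field, gnum, Nat.choose_two_right, ← Finset.sum_range_id,
    ← Finset.prod_pow_eq_pow_sum,
    ← Finset.prod_range_reflect (fun j => ((Fintype.card k : ℂ) ^ (j + 1) - 1)),
    ← Finset.prod_mul_distrib, Finset.prod_range]
  push_cast
  refine Finset.prod_congr rfl fun i _ => ?_
  have hi := i.2
  rw [Nat.cast_sub (Nat.pow_le_pow_right Fintype.card_pos hi.le)]
  push_cast
  rw [mul_sub, mul_one, ← pow_add]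
  congr 2
  omega

theorem sum_cc_mul_one {ι κ ν : Type} [Fintype ι] [DecidableEq ι] [Fintype κ] [DecidableEq κ]
    [Fintype ν] [DecidableEq ν] (e : ι ⊕ κ ≃ ν) (σ : GL ι k → ℂ) (τ : GL κ k → ℂ) :
    ∑ χ : irr (GL ν k), cc e σ τ χ * (χ : GL ν k → ℂ) 1 =
      (Nat.card (Par k ι κ) : ℂ)⁻¹ * Nat.card (GL ν k) * (σ 1 * τ 1) := by
  unfold cc pair
  simp only [mul_assoc, Finset.sum_mul, ← Finset.mul_sum]
  congr 1
  rw [Finset.sum_comm, Finset.sum_eq_single 1]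
  · have h1 : ∀ x : irr (GL ν k), (x : GL ν k → ℂ) (pe e 1) *
        (σ (1⁻¹ : Par k ι κ).a * τ (1⁻¹ : Par k ι κ).d * (x : GL ν k → ℂ) 1) =
        (σ 1 * τ 1) * ((x : GL ν k → ℂ) 1 * (x : GL ν k → ℂ) 1⁻¹) := fun x => by
      rw [map_one, inv_one, inv_one]
      simp only [Par.one_a, Par.one_d]
      ring
    simp only [mul_assoc] at h1 ⊢
    rw [Finset.sum_congr rfl fun x _ => h1 x]
    simp only [← Finset.mul_sum, sum_irr_mul]
    simp [Nat.card_eq_fintype_card]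
    ring
  · intro t _ ht
    have h1 : ∀ x : irr (GL ν k), (x : GL ν k → ℂ) (pe e t) *
        (σ (t⁻¹).a * τ (t⁻¹).d * (x : GL ν k → ℂ) 1) =
        (σ (t⁻¹).a * τ (t⁻¹).d) * ((x : GL ν k → ℂ) (pe e t) * (x : GL ν k → ℂ) 1⁻¹) := fun x => by
      rw [inv_one]
      ring
    simp only [mul_assoc] at h1 ⊢
    rw [Finset.sum_congr rfl fun x _ => h1 x]
    simp only [← Finset.mul_sum, sum_irr_mul]
    rw [Finset.sum_eq_zero, mul_zero, mul_zero]
    intro x _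
    rw [if_neg]
    intro hx
    apply ht
    apply pe_injective e
    rw [map_one]
    exact (conj_eq_one_iff).1 hx
  · exact fun h => absurd (Finset.mem_univ _) h

/-- The linear character of `GL ν k` attached to a character of the multiplicative group. -/
noncomputable def detChar (ν : Type) [Fintype ν] [DecidableEq ν] (φ : kˣ →* ℂˣ) : GL ν k →* ℂ :=
  (Units.coeHom ℂ).comp (φ.comp Matrix.GeneralLinearGroup.det)

theorem detChar_mem_irr (ν : Type) [Fintype ν] [DecidableEq ν] (φ : kˣ →* ℂˣ) :
    (detChar ν φ : GL ν k → ℂ) ∈ irr (GL ν k) := by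
  refine (isChar_hom _).mem_irr_of_pair ?_
  rw [pair_eq_expect]
  have : ∀ g : GL ν k, detChar ν φ g * detChar ν φ g⁻¹ = 1 := fun g => by
    rw [← map_mul, mul_inv_cancel, map_one]
  simp only [this, Fintype.expect_const]

theorem det_pe {ι κ ν : Type} [Fintype ι] [DecidableEq ι] [Fintype κ] [DecidableEq κ]
    [Fintype ν] [DecidableEq ν] (e : ι ⊕ κ ≃ ν) (t : Par k ι κ) :
    Matrix.GeneralLinearGroup.det (pe e t) =
      Matrix.GeneralLinearGroup.det t.a * Matrix.GeneralLinearGroup.det t.d := by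
  refine Units.ext ?_
  change ((Matrix.fromBlocks t.a.1 t.u 0 t.d.1).submatrix e.symm e.symm).det = _
  rw [Matrix.det_submatrix_equiv_self, Matrix.det_fromBlocks_zero₂₁]
  rfl

theorem cc_detChar {ι κ ν : Type} [Fintype ι] [DecidableEq ι] [Fintype κ] [DecidableEq κ]
    [Fintype ν] [DecidableEq ν] (e : ι ⊕ κ ≃ ν) (φ : kˣ →* ℂˣ) (α : irr (GL ι k))
    (β : irr (GL κ k)) : cc e (α : GL ι k → ℂ) (β : GL κ k → ℂ) (detChar ν φ) =
      if (detChar ι φ : GL ι k → ℂ) = α ∧ (detChar κ φ : GL κ k → ℂ) = β then 1 else 0 := by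
  have h1 : cc e (α : GL ι k → ℂ) (β : GL κ k → ℂ) (detChar ν φ) =
      pair (fun t : Par k ι κ => detChar ι φ t.a * detChar κ φ t.d)
        (fun t => α.1 t.a * β.1 t.d) := by
    unfold cc
    congr 1
    funext t
    simp only [detChar, MonoidHom.comp_apply, det_pe, map_mul]
  rw [h1, pair_par]
  have h2 := pair_irr ⟨_, detChar_mem_irr ι φ⟩ α
  have h3 := pair_irr ⟨_, detChar_mem_irr κ φ⟩ β
  rw [h2, h3]
  simp only [Subtype.ext_iff]
  split_ifs <;> simp_all

theorem exists_detChar (χ : irr (GL (Fin 1) k)) :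
    ∃ φ : kˣ →* ℂˣ, (detChar (Fin 1) φ : GL (Fin 1) k → ℂ) = χ := by
  have hcomm : ∀ g h : GL (Fin 1) k, g * h = h * g := fun g h => by
    refine Units.ext (Matrix.ext fun i j => ?_)
    simp [Matrix.mul_apply, Subsingleton.elim i 0, Subsingleton.elim j 0, mul_comm]
  have hdet : Function.Bijective (Matrix.GeneralLinearGroup.det : GL (Fin 1) k →* kˣ) := by
    constructor
    · intro g h hgh
      have := congrArg Units.val hgh
      refine Units.ext (Matrix.ext fun i j => ?_)
      simpa [Subsingleton.elim i 0, Subsingleton.elim j 0] using this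
    · intro u
      refine ⟨Matrix.GeneralLinearGroup.mkOfDetNeZero (Matrix.of fun _ _ => (u : k)) (by simp), ?_⟩
      refine Units.ext ?_
      simp [Matrix.GeneralLinearGroup.mkOfDetNeZero]
  have hconj : Function.Bijective (ConjClasses.mk : GL (Fin 1) k → _) := by
    refine ⟨fun g h hgh => ?_, ConjClasses.mk_surjective⟩
    obtain ⟨c, hc⟩ := isConj_iff.1 (ConjClasses.mk_eq_mk_iff_isConj.1 hgh)
    rw [← hc, hcomm c g, mul_inv_cancel_right]
  have hcard : Nat.card (kˣ →* ℂˣ) = Nat.card (irr (GL (Fin 1) k)) := by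
    rw [CommGroup.card_monoidHom_of_hasEnoughRootsOfUnity, Nat.card_eq_fintype_card (α := irr _),
      card_irr, ← Nat.card_eq_of_bijective _ hconj, Nat.card_eq_of_bijective _ hdet]
  have : Finite (kˣ →* ℂˣ) := Nat.finite_of_card_ne_zero (by
    rw [hcard]
    exact Nat.card_ne_zero.2 ⟨⟨χ⟩, inferInstance⟩)
  have hinj : Function.Injective fun φ : kˣ →* ℂˣ =>
      (⟨detChar (Fin 1) φ, detChar_mem_irr (Fin 1) φ⟩ : irr (GL (Fin 1) k)) := by
    intro φ φ' h
    refine MonoidHom.ext fun u => Units.ext ?_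
    obtain ⟨g, rfl⟩ := hdet.2 u
    exact congrFun (congrArg Subtype.val h) g
  obtain ⟨φ, hφ⟩ := (hinj.bijective_of_nat_card_le hcard.ge).2 χ
  exact ⟨φ, congrArg Subtype.val hφ⟩

end Degrees

section Instance

variable (k : Type) [Field k] [Fintype k] [DecidableEq k]

/-- The irreducible characters of the groups `GL (Fin n) k` for `n ≤ 5`. -/
abbrev Irr : Type := Σ n : Fin 6, irr (GL (Fin n.1) k)

variable {k}

noncomputable instance : DecidableEq (Irr k) := Classical.decEq _

/-- The degree of a character divided by the prime to `p` part of the order of the group. -/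
noncomputable def relDeg (q : ℕ) {n : ℕ} (χ : irr (GL (Fin n) k)) : ℚ :=
  ((irr_one_nat χ).choose : ℚ) / ∏ j ∈ Finset.range n, ((q : ℚ) ^ (j + 1) - 1)

theorem relDeg_cast {n : ℕ} (χ : irr (GL (Fin n) k)) :
    (relDeg (Fintype.card k) χ : ℂ) = (χ : GL (Fin n) k → ℂ) 1 / gnum (Fintype.card k) n := by
  have h := (irr_one_nat χ).choose_spec.2
  rw [relDeg, gnum]
  push_cast
  rw [← h]

/-- Structure constants of parabolic induction as natural numbers. -/
noncomputable def cI (a b v : Irr k) : ℕ :=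
  if h : a.1.1 + b.1.1 = v.1.1 then (cc_nat (sumE h) a.2 b.2 v.2).choose else 0

theorem cI_of {a b v : Irr k} (h : a.1.1 + b.1.1 = v.1.1) :
    (cI a b v : ℂ) = cc (sumE h) a.2.1 b.2.1 v.2.1 := by
  rw [cI, dif_pos h]
  exact (cc_nat (sumE h) a.2 b.2 v.2).choose_spec.symm

theorem cI_ne {a b v : Irr k} (h : a.1.1 + b.1.1 ≠ v.1.1) : cI a b v = 0 := dif_neg h

theorem sum_Irr {M : Type} [AddCommMonoid M] (n : Fin 6) (F : Irr k → M)
    (h : ∀ v : Irr k, v.1 ≠ n → F v = 0) : ∑ v, F v = ∑ χ : irr (GL (Fin n.1) k), F ⟨n, χ⟩ := by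
  rw [Fintype.sum_sigma, Finset.sum_eq_single n]
  · exact fun m _ hm => Finset.sum_eq_zero fun χ _ => h ⟨m, χ⟩ hm
  · exact fun h => absurd (Finset.mem_univ _) h

theorem sum_Irr_four {M : Type} [AddCommMonoid M] (F : Irr k → Irr k → Irr k → Irr k → M) :
    ∑ p, ∑ q, ∑ r, ∑ s, F p q r s = ∑ x : Fin 6 × Fin 6 × Fin 6 × Fin 6,
      ∑ p : irr (GL (Fin x.1.1) k), ∑ q : irr (GL (Fin x.2.1.1) k),
      ∑ r : irr (GL (Fin x.2.2.1.1) k), ∑ s : irr (GL (Fin x.2.2.2.1) k),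
        F ⟨x.1, p⟩ ⟨x.2.1, q⟩ ⟨x.2.2.1, r⟩ ⟨x.2.2.2, s⟩ := by
  simp only [Fintype.sum_sigma, Fintype.sum_prod_type]
  refine Finset.sum_congr rfl fun x1 _ => ?_
  rw [Finset.sum_comm]
  refine Finset.sum_congr rfl fun x2 _ => ?_
  rw [Finset.sum_congr rfl fun p _ => Finset.sum_comm, Finset.sum_comm]
  refine Finset.sum_congr rfl fun x3 _ => ?_
  rw [Finset.sum_congr rfl fun p _ => Finset.sum_congr rfl fun q _ => Finset.sum_comm,
    Finset.sum_congr rfl fun p _ => Finset.sum_comm, Finset.sum_comm]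

theorem cI_assoc (a b g v : Irr k) : ∑ m, cI a b m * cI m g v = ∑ m, cI b g m * cI a m v := by
  by_cases h : a.1.1 + b.1.1 + g.1.1 = v.1.1
  · have hv := v.1.2
    rw [sum_Irr ⟨a.1.1 + b.1.1, by omega⟩, sum_Irr ⟨b.1.1 + g.1.1, by omega⟩]
    · rw [← Nat.cast_inj (R := ℂ)]
      push_cast
      have := assoc_fun (sumE (rfl : a.1.1 + b.1.1 = _)) (sumE h)
        (sumE ((add_assoc _ _ _).symm.trans h)) (sumE rfl) a.2.1 b.2.1
        g.2.1 (irr_isClass v.2)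
      convert this using 1
      · refine Finset.sum_congr rfl fun m _ => ?_
        rw [cI_of (v := ⟨⟨a.1.1 + b.1.1, by omega⟩, m⟩) rfl,
          cI_of (a := ⟨⟨a.1.1 + b.1.1, by omega⟩, m⟩) h]
      · refine Finset.sum_congr rfl fun m _ => ?_
        rw [cI_of (v := ⟨⟨b.1.1 + g.1.1, by omega⟩, m⟩) rfl,
          cI_of (b := ⟨⟨b.1.1 + g.1.1, by omega⟩, m⟩) ((add_assoc _ _ _).symm.trans h)]
    · intro m hm
      rw [cI_ne, zero_mul]
      exact fun h' => hm (Fin.ext h'.symm)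
    · intro m hm
      rw [cI_ne, zero_mul]
      exact fun h' => hm (Fin.ext h'.symm)
  · rw [Finset.sum_eq_zero, Finset.sum_eq_zero]
    · intro m _
      by_cases h1 : b.1.1 + g.1.1 = m.1.1
      · rw [cI_ne (a := a), mul_zero]
        omega
      · rw [cI_ne h1, zero_mul]
    · intro m _
      by_cases h1 : a.1.1 + b.1.1 = m.1.1
      · rw [cI_ne (a := m), mul_zero]
        omega
      · rw [cI_ne h1, zero_mul]

theorem cI_hopf (a b g d : Irr k) (hab : a.1.1 + b.1.1 ≤ 5) : ∑ v, cI a b v * cI g d v =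
    ∑ p, ∑ q, ∑ r, ∑ s, cI p q a * cI r s b * (cI p r g * cI q s d) := by
  by_cases h : g.1.1 + d.1.1 = a.1.1 + b.1.1
  · rw [sum_Irr ⟨a.1.1 + b.1.1, by omega⟩]
    · rw [← Nat.cast_inj (R := ℂ)]
      push_cast
      have := hopf_fun (rfl : a.1.1 + b.1.1 = _) h hab (irr_isClass a.2) (irr_isClass b.2)
        (irr_isClass g.2) (irr_isClass d.2)
      have h1 : ∀ x : irr (GL (Fin (a.1.1 + b.1.1)) k),
          (cI a b ⟨⟨a.1.1 + b.1.1, by omega⟩, x⟩ : ℂ) * cI g d ⟨⟨a.1.1 + b.1.1, by omega⟩, x⟩ =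
          cc (sumE (rfl : a.1.1 + b.1.1 = _)) a.2.1 b.2.1 x.1 *
            cc (sumE h) g.2.1 d.2.1 x.1 := fun x => by
        rw [cI_of (a := a) (v := ⟨⟨a.1.1 + b.1.1, by omega⟩, x⟩) rfl,
          cI_of (a := g) (v := ⟨⟨a.1.1 + b.1.1, by omega⟩, x⟩) h]
      rw [Finset.sum_congr rfl fun x _ => h1 x, this]
      have h2 : ∑ p : Irr k, ∑ q : Irr k, ∑ r : Irr k, ∑ s : Irr k,
          (cI p q a : ℂ) * cI r s b * (cI p r g * cI q s d) =
          ∑ x : Fin 6 × Fin 6 × Fin 6 × Fin 6, ∑ p : irr (GL (Fin x.1.1) k),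
          ∑ q : irr (GL (Fin x.2.1.1) k), ∑ r : irr (GL (Fin x.2.2.1.1) k),
          ∑ s : irr (GL (Fin x.2.2.2.1) k), (cI ⟨x.1, p⟩ ⟨x.2.1, q⟩ a : ℂ) *
            cI ⟨x.2.2.1, r⟩ ⟨x.2.2.2, s⟩ b *
            (cI ⟨x.1, p⟩ ⟨x.2.2.1, r⟩ g * cI ⟨x.2.1, q⟩ ⟨x.2.2.2, s⟩ d) := by
        exact sum_Irr_four _
      rw [h2]
      refine Eq.trans ?_ (Finset.sum_subset_zero_on_sdiff (Finset.subset_univ (Finset.univ.filter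
        fun x : Fin 6 × Fin 6 × Fin 6 × Fin 6 => x.1.1 + x.2.1.1 = a.1.1 ∧
          x.2.2.1.1 + x.2.2.2.1 = b.1.1 ∧ x.1.1 + x.2.2.1.1 = g.1.1 ∧
          x.2.1.1 + x.2.2.2.1 = d.1.1)) ?_ fun _ _ => rfl)
      swap
      · intro x hx
        simp only [Finset.mem_sdiff, Finset.mem_univ, Finset.mem_filter, true_and] at hx
        refine Finset.sum_eq_zero fun p _ => Finset.sum_eq_zero fun q _ =>
          Finset.sum_eq_zero fun r _ => Finset.sum_eq_zero fun s _ => ?_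
        by_contra h0
        simp only [mul_ne_zero_iff, ← ne_eq, Nat.cast_ne_zero] at h0
        obtain ⟨⟨h1, h2⟩, h3, h4⟩ := h0
        exact hx ⟨by_contra fun h => h1 (cI_ne h), by_contra fun h => h2 (cI_ne h),
          by_contra fun h => h3 (cI_ne h), by_contra fun h => h4 (cI_ne h)⟩
      · rw [← Finset.sum_subtype_eq_sum_filter, Finset.subtype_univ]
        refine Finset.sum_congr rfl fun x _ => Finset.sum_congr rfl fun p _ =>
          Finset.sum_congr rfl fun q _ => Finset.sum_congr rfl fun r _ =>
          Finset.sum_congr rfl fun s _ => ?_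
        rw [cI_of (v := a) x.2.1, cI_of (v := b) x.2.2.1, cI_of (v := g) x.2.2.2.1,
          cI_of (v := d) x.2.2.2.2]
        rfl
    · intro m hm
      rw [cI_ne, zero_mul]
      exact fun h' => hm (Fin.ext h'.symm)
  · rw [Finset.sum_eq_zero, Finset.sum_eq_zero]
    · intro p _
      refine Finset.sum_eq_zero fun q _ => Finset.sum_eq_zero fun r _ =>
        Finset.sum_eq_zero fun s _ => ?_
      by_contra h0
      simp only [mul_ne_zero_iff, ← ne_eq] at h0
      obtain ⟨⟨h1, h2⟩, h3, h4⟩ := h0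
      have h1 := not_imp_comm.1 cI_ne h1
      have h2 := not_imp_comm.1 cI_ne h2
      have h3 := not_imp_comm.1 cI_ne h3
      have h4 := not_imp_comm.1 cI_ne h4
      omega
    · intro m _
      by_cases h1 : a.1.1 + b.1.1 = m.1.1
      · rw [cI_ne (a := g), mul_zero]
        omega
      · rw [cI_ne h1, zero_mul]

theorem card_pos_rat (j : ℕ) : (0 : ℚ) < (Fintype.card k : ℚ) ^ (j + 1) - 1 := by
  have : (1 : ℚ) < Fintype.card k := by exact_mod_cast Fintype.one_lt_card
  exact sub_pos.2 (one_lt_pow₀ this (Nat.succ_ne_zero j))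

theorem relDeg_pos {n : ℕ} (χ : irr (GL (Fin n) k)) : 0 < relDeg (Fintype.card k) χ :=
  div_pos (by exact_mod_cast (irr_one_nat χ).choose_spec.1)
    (Finset.prod_pos fun j _ => card_pos_rat j)

theorem cI_zero_left (z a v : Irr k) (hz : z.1.1 = 0) : cI z a v = if a = v then 1 else 0 := by
  obtain ⟨⟨z, _⟩, σ⟩ := z
  obtain rfl : z = 0 := hz
  obtain ⟨n, τ⟩ := a
  obtain ⟨m, χ⟩ := v
  by_cases h : n = m
  · subst h
    rw [← Nat.cast_inj (R := ℂ), cI_of (zero_add n.1), cc_zero_left, pair_irr]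
    simp [eq_comm]
  · rw [cI_ne, if_neg]
    · exact fun h' => h (congrArg Sigma.fst h')
    · exact fun h' => h (Fin.ext ((zero_add _).symm.trans h'))

theorem cI_zero_right (z a v : Irr k) (hz : z.1.1 = 0) : cI a z v = if a = v then 1 else 0 := by
  obtain ⟨⟨z, _⟩, σ⟩ := z
  obtain rfl : z = 0 := hz
  obtain ⟨n, τ⟩ := a
  obtain ⟨m, χ⟩ := v
  by_cases h : n = m
  · subst h
    rw [← Nat.cast_inj (R := ℂ), cI_of (add_zero n.1), cc_zero_right, pair_irr]
    simp [eq_comm]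
  · rw [cI_ne, if_neg]
    · exact fun h' => h (congrArg Sigma.fst h')
    · exact fun h' => h (Fin.ext ((add_zero _).symm.trans h'))

theorem one_mem_irr_zero : (fun _ => 1 : GL (Fin 0) k → ℂ) ∈ irr (GL (Fin 0) k) := by
  have := detChar_mem_irr (k := k) (Fin 0) 1
  convert this using 1
  exact (irr_fin_zero ⟨_, this⟩).symm

/-- The trivial character of the trivial group. -/
noncomputable def oneI : Irr k := ⟨0, ⟨fun _ => 1, one_mem_irr_zero⟩⟩

theorem eq_oneI_iff (a : Irr k) : a.1.1 = 0 ↔ a = oneI := by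
  constructor
  · intro h
    obtain ⟨⟨z, _⟩, σ⟩ := a
    obtain rfl : z = 0 := h
    exact congrArg (Sigma.mk _) (Subtype.ext (irr_fin_zero σ))
  · rintro rfl
    rfl

theorem relDeg_mul (a b : Irr k) (h : a.1.1 + b.1.1 ≤ 5) :
    relDeg (Fintype.card k) a.2 * relDeg (Fintype.card k) b.2 =
      ∑ v : Irr k, cI a b v * relDeg (Fintype.card k) v.2 := by
  obtain ⟨⟨i, hi⟩, σ⟩ := a
  obtain ⟨⟨j, hj⟩, τ⟩ := b
  dsimp only at h
  rw [sum_Irr ⟨i + j, by omega⟩]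
  · have h1 : ∀ χ : irr (GL (Fin (i + j)) k),
        (cI ⟨⟨i, hi⟩, σ⟩ ⟨⟨j, hj⟩, τ⟩ ⟨⟨i + j, by omega⟩, χ⟩ : ℂ) = cc (sumE rfl) σ.1 τ.1 χ.1 :=
      fun χ => cI_of (a := ⟨⟨i, hi⟩, σ⟩) (b := ⟨⟨j, hj⟩, τ⟩) (v := ⟨⟨i + j, by omega⟩, χ⟩) rfl
    rw [← Rat.cast_inj (α := ℂ)]
    push_cast
    simp only [relDeg_cast, h1, mul_div_assoc', ← Finset.sum_div]
    rw [sum_cc_mul_one, card_par]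
    push_cast
    rw [card_GL_eq, card_GL_eq, card_GL_eq]
    have hq : (Fintype.card k : ℂ) ≠ 0 := by exact_mod_cast Fintype.card_ne_zero
    have h2 := gnum_ne_zero (k := k) i
    have h3 := gnum_ne_zero (k := k) j
    have h4 := gnum_ne_zero (k := k) (i + j)
    have h5 : (i + j).choose 2 = i.choose 2 + j.choose 2 + i * j := by
      rw [Nat.add_choose_eq]
      simp [Finset.Nat.antidiagonal_succ]
      ring
    rw [h5, pow_add, pow_add]
    field_simp
  · intro v hv
    rw [cI_ne, Nat.cast_zero, zero_mul]
    exact fun h' => hv (Fin.ext h'.symm)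

/-- The multiplicity of the Gelfand-Graev representation. -/
noncomputable def whitN (ψ : AddChar k ℂ) {n : ℕ} (χ : irr (GL (Fin n) k)) : ℕ :=
  (whit_nat ψ n (irr_subset_isChar χ.2)).choose

theorem whitN_cast (ψ : AddChar k ℂ) {n : ℕ} (χ : irr (GL (Fin n) k)) :
    (whitN ψ χ : ℂ) = whit ψ n χ.1 := (whit_nat ψ n (irr_subset_isChar χ.2)).choose_spec.symm

theorem whit_del (ψ : AddChar k ℂ) {i l n : ℕ} (h : i + l = n) {f : GL (Fin n) k → ℂ}
    (hf : IsClass f) : whit ψ l (fun d => del (sumE h) f 1 d) =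
      ∑ σ : irr (GL (Fin i) k), ∑ τ : irr (GL (Fin l) k),
        cc (sumE h) σ.1 τ.1 f * (σ.1 1 * whit ψ l τ.1) := by
  simp only [del_eq_sum _ hf]
  unfold whit
  simp only [Finset.mul_sum]
  rw [Finset.expect_sum_comm]
  refine Finset.sum_congr rfl fun σ _ => ?_
  rw [Finset.expect_sum_comm]
  refine Finset.sum_congr rfl fun τ _ => ?_
  rw [Finset.mul_expect, Finset.mul_expect]
  refine Finset.expect_congr rfl fun d _ => ?_
  ring

theorem relDeg_dim {ψ : AddChar k ℂ} (hψ : ψ ≠ 0) (v : Irr k) :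
    (Fintype.card k : ℚ) ^ v.1.1 * relDeg (Fintype.card k) v.2 =
      ∑ a : Irr k, ∑ b : Irr k, (cI a b v * (relDeg (Fintype.card k) a.2 * whitN ψ b.2) : ℚ) := by
  have hv := v.1.2
  let g : ℕ → ℂ := fun j =>
    if h : j ≤ v.1.1 then whit ψ (v.1.1 - j) fun d => del (sumE (Nat.add_sub_cancel' h)) v.2.1 1 d
    else 0
  rw [← Rat.cast_inj (α := ℂ)]
  push_cast
  rw [relDeg_cast, degree_formula hψ (irr_isClass v.2) g, Fintype.sum_sigma,
    Finset.sum_subset (s₂ := Finset.range 6), Finset.sum_range]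
  · refine Finset.sum_congr rfl fun i _ => ?_
    by_cases h : i.1 ≤ v.1.1
    · have h0 : i.1 + (v.1.1 - i.1) = v.1.1 := Nat.add_sub_cancel' h
      simp only [g, dif_pos h]
      rw [whit_del ψ h0 (irr_isClass v.2), Finset.sum_div]
      refine Finset.sum_congr rfl fun σ _ => ?_
      rw [sum_Irr ⟨v.1.1 - i.1, by omega⟩, Finset.sum_div]
      · refine Finset.sum_congr rfl fun τ _ => ?_
        rw [cI_of (a := ⟨i, σ⟩) (b := ⟨⟨v.1.1 - i.1, by omega⟩, τ⟩) h0, relDeg_cast, whitN_cast]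
        ring
      · intro b hb
        rw [cI_ne, Nat.cast_zero, zero_mul]
        intro h'
        apply hb
        apply Fin.ext
        dsimp only at h' ⊢
        omega
    · simp only [g, dif_neg h, zero_div]
      refine (Finset.sum_eq_zero fun σ _ => Finset.sum_eq_zero fun b _ => ?_).symm
      rw [cI_ne, Nat.cast_zero, zero_mul]
      dsimp only
      omega
  · intro j hj
    simp only [Finset.mem_range] at hj ⊢
    omega
  · intro j _ hj
    simp only [Finset.mem_range] at hj
    simp only [g, dif_neg (show ¬ j ≤ v.1.1 by omega), zero_div]
  · intro j l h
    obtain rfl : l = v.1.1 - j := by omega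
    exact dif_pos (by omega)

theorem relDeg_lin (a : Irr k) (ha : a.1.1 = 1) : ∃ x : ℕ → Irr k, x 1 = a ∧ ∀ m ≤ 5,
    (x m).1.1 = m ∧ relDeg (Fintype.card k) (x m).2 =
      (∏ j ∈ Finset.range m, ((Fintype.card k : ℚ) ^ (j + 1) - 1))⁻¹ ∧
    ∀ α β, cI α β (x m) =
      if α.1.1 + β.1.1 = m ∧ α = x α.1.1 ∧ β = x β.1.1 then 1 else 0 := by
  obtain ⟨⟨n, hn⟩, χ⟩ := a
  obtain rfl : n = 1 := ha
  obtain ⟨φ, hφ⟩ := exists_detChar χ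
  let x : ℕ → Irr k := fun m =>
    if h : m < 6 then ⟨⟨m, h⟩, ⟨_, detChar_mem_irr (Fin m) φ⟩⟩ else oneI
  have hx : ∀ m (h : m < 6), x m = ⟨⟨m, h⟩, ⟨_, detChar_mem_irr (Fin m) φ⟩⟩ := fun m h => dif_pos h
  refine ⟨x, ?_, fun m hm => ?_⟩
  · rw [hx 1 hn]
    exact congrArg (Sigma.mk _) (Subtype.ext hφ)
  · rw [hx m (by omega)]
    refine ⟨rfl, ?_, fun α β => ?_⟩
    · rw [← Rat.cast_inj (α := ℂ), relDeg_cast]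
      change detChar (Fin m) φ 1 / gnum _ m = _
      rw [map_one, one_div, gnum]
      push_cast
      rfl
    · rw [hx _ α.1.2, hx _ β.1.2]
      obtain ⟨⟨i, hi⟩, σ⟩ := α
      obtain ⟨⟨j, hj⟩, τ⟩ := β
      by_cases h : i + j = m
      · rw [← Nat.cast_inj (R := ℂ), cI_of (a := ⟨⟨i, hi⟩, σ⟩) (b := ⟨⟨j, hj⟩, τ⟩) h, cc_detChar]
        simp only [h, true_and, Sigma.mk.injEq, heq_eq_eq, Subtype.ext_iff, eq_comm (a := σ.1),
          eq_comm (a := τ.1)]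
        push_cast
        rfl
      · rw [cI_ne h, if_neg fun h' => h h'.1]

variable (k) in
theorem exists_addChar : ∃ ψ : AddChar k ℂ, ψ ≠ 0 := by
  obtain ⟨ψ, hψ⟩ := AddChar.exists_apply_ne_zero.2 (one_ne_zero (α := k))
  exact ⟨ψ, fun h => hψ (by rw [h]; rfl)⟩

/-- The positive self-dual structure on the characters of the groups `GL n k`. -/
noncomputable def glPsh {ψ : AddChar k ℂ} (hψ : ψ ≠ 0) : Psh (Irr k) where
  q := Fintype.card k
  two_le_q := Fintype.one_lt_card
  deg a := a.1.1
  c := cI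
  one := oneI
  D a := relDeg (Fintype.card k) a.2
  δ a := whitN ψ a.2
  deg_le a := Nat.le_of_lt_succ a.1.2
  c_deg _ _ _ h := by_contra fun h' => h (cI_ne h')
  deg_one := eq_oneI_iff
  one_c a v := cI_zero_left _ a v rfl
  c_one a v := cI_zero_right _ a v rfl
  assoc := cI_assoc
  hopf := fun a b g d => cI_hopf a b g d
  D_pos a := relDeg_pos a.2
  D_mul := relDeg_mul
  dim := relDeg_dim hψ
  lin := relDeg_lin

end Instance

theorem finprod_irr {G : Type} [Group G] [Fintype G] :
    ∏ᶠ p ∈ {p : (G → ℂ) × ℕ | ∃ V : FDRep ℂ G, CategoryTheory.Simple V ∧ p.1 = V.character ∧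
      p.2 = Module.finrank ℂ V}, (p.2 : ℚ) = ∏ χ : irr G, ((irr_one_nat χ).choose : ℚ) := by
  rw [← finprod_eq_prod_of_fintype, ← finprod_set_coe_eq_finprod_mem]
  let e : {p : (G → ℂ) × ℕ | ∃ V : FDRep ℂ G, CategoryTheory.Simple V ∧ p.1 = V.character ∧
      p.2 = Module.finrank ℂ V} → irr G :=
    fun p => ⟨p.1.1, by obtain ⟨V, h1, h2, _⟩ := p.2; exact ⟨V, h1, h2.symm⟩⟩
  have hone : ∀ p, (e p).1 1 = (p.1.2 : ℂ) := by
    rintro ⟨p, V, h1, h2, h3⟩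
    change p.1 1 = (p.2 : ℂ)
    rw [h2, h3, FDRep.char_one]
  have he : Function.Bijective e := by
    constructor
    · intro p p' h
      have h1 : p.1.1 = p'.1.1 := congrArg Subtype.val h
      have h2 := hone p
      rw [h, hone p'] at h2
      exact Subtype.ext (Prod.ext h1 (by exact_mod_cast h2.symm))
    · rintro ⟨χ, V, h1, h2⟩
      exact ⟨⟨(χ, Module.finrank ℂ V), V, h1, h2.symm, rfl⟩, rfl⟩
  refine finprod_eq_of_bijective e he fun p => ?_
  have := (irr_one_nat (e p)).choose_spec.2
  exact_mod_cast (hone p).symm.trans this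

section Final

variable {k : Type} [Field k] [Fintype k] [DecidableEq k]

theorem prod_Irr_deg {M : Type} [CommMonoid M] (n : ℕ) (hn : n < 6) (F : Irr k → M) :
    ∏ v with v.1.1 = n, F v = ∏ χ : irr (GL (Fin n) k), F ⟨⟨n, hn⟩, χ⟩ := by
  rw [Finset.prod_filter, Fintype.prod_sigma, Finset.prod_eq_single ⟨n, hn⟩]
  · exact Finset.prod_congr rfl fun χ _ => if_pos rfl
  · exact fun m _ hm => Finset.prod_eq_one fun χ _ => if_neg fun h => hm (Fin.ext h)
  · exact fun h => absurd (Finset.mem_univ _) h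

theorem card_Irr_deg (n : ℕ) (hn : n ≤ 5) :
    (Finset.univ.filter fun v : Irr k => v.1.1 = n).card =
      Nat.card (ConjClasses (GL (Fin n) k)) := by
  have := prod_Irr_deg (k := k) n (by omega) fun _ => Multiplicative.ofAdd 1
  rw [Finset.prod_const, Finset.prod_const, ← ofAdd_nsmul, ← ofAdd_nsmul,
    Multiplicative.ofAdd.apply_eq_iff_eq, Finset.card_univ, card_irr] at this
  simpa using this

theorem sum_whit_relDeg (ψ : AddChar k ℂ) (n : ℕ) (hn : n ≤ 5) :
    ∑ v : Irr k with v.1.1 = n, (whitN ψ v.2 : ℚ) * relDeg (Fintype.card k) v.2 = 1 := by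
  have := prod_Irr_deg (k := k) n (by omega) fun v =>
    Multiplicative.ofAdd ((whitN ψ v.2 : ℚ) * relDeg (Fintype.card k) v.2)
  rw [← ofAdd_sum, ← ofAdd_sum, Multiplicative.ofAdd.apply_eq_iff_eq] at this
  rw [this, ← Rat.cast_inj (α := ℂ)]
  push_cast
  simp only [relDeg_cast, whitN_cast, mul_div_assoc', ← Finset.sum_div]
  rw [sum_whit, card_GL_eq]
  have hq : (Fintype.card k : ℂ) ≠ 0 := by exact_mod_cast Fintype.card_ne_zero
  have h2 := gnum_ne_zero (k := k) n
  field_simp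

/-- The reciprocal of the order of the centralizer. -/
noncomputable def cw {G : Type} [Group G] (c : ConjClasses G) : ℚ :=
  (c.carrier.ncard : ℚ) / Nat.card G

theorem sum_cw {G : Type} [Group G] [Fintype G] [Fintype (ConjClasses G)] :
    ∑ c : ConjClasses G, cw c = 1 := by
  simp only [cw, ← Finset.sum_div]
  rw [div_eq_one_iff_eq (by exact_mod_cast Nat.card_pos.ne')]
  have := Group.sum_card_conj_classes_eq_card G
  rw [finsum_eq_sum_of_fintype] at this
  exact_mod_cast this

theorem isInt_of_intMul (n : ℕ) (hn : n ≤ 5) [Fintype (ConjClasses (GL (Fin n) k))]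
    (h : IntMul ((∏ c : ConjClasses (GL (Fin n) k), cw c) *
      (Fintype.card k : ℚ) ^ (n.choose 2 * Fintype.card (ConjClasses (GL (Fin n) k))))
      (∏ v : Irr k with v.1.1 = n, relDeg (Fintype.card k) v.2)) :
    ∃ z : ℤ, (∏ᶠ c : ConjClasses (GL (Fin n) k), (c.carrier.ncard : ℚ)) /
      (∏ᶠ p ∈ {p : (GL (Fin n) k → ℂ) × ℕ | ∃ V : FDRep ℂ (GL (Fin n) k),
        CategoryTheory.Simple V ∧ p.1 = V.character ∧ p.2 = Module.finrank ℂ V},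
        (p.2 : ℚ)) = z := by
  obtain ⟨z, hz⟩ := h
  refine ⟨z, ?_⟩
  rw [finprod_irr, finprod_eq_prod_of_fintype, div_eq_iff]
  · rw [prod_Irr_deg n (by omega)] at hz
    simp only [cw, relDeg, Finset.prod_div_distrib, Finset.prod_const, Finset.card_univ] at hz
    rw [card_irr, Nat.card_eq_fintype_card (α := ConjClasses _), pow_mul, div_mul_eq_mul_div,
      mul_div_assoc', div_eq_div_iff] at hz
    · have h1 : (Nat.card (GL (Fin n) k) : ℚ) = (Fintype.card k : ℚ) ^ (n.choose 2) *
          ∏ j ∈ Finset.range n, ((Fintype.card k : ℚ) ^ (j + 1) - 1) := by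
        have := card_GL_eq (k := k) n
        rw [gnum] at this
        exact_mod_cast this
      rw [h1, mul_pow] at hz
      have h2 : ∏ j ∈ Finset.range n, ((Fintype.card k : ℚ) ^ (j + 1) - 1) ≠ 0 :=
        (Finset.prod_pos fun j _ => card_pos_rat j).ne'
      have h3 : (Fintype.card k : ℚ) ≠ 0 := by exact_mod_cast Fintype.card_ne_zero
      have h4 : (((Fintype.card k : ℚ) ^ (n.choose 2)) ^ Fintype.card (ConjClasses (GL (Fin n) k)) *
        (∏ j ∈ Finset.range n, ((Fintype.card k : ℚ) ^ (j + 1) - 1)) ^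
          Fintype.card (ConjClasses (GL (Fin n) k))) ≠ 0 := by positivity
      refine mul_right_cancel₀ h4 ?_
      linear_combination hz
    · exact pow_ne_zero _ (by exact_mod_cast Nat.card_pos.ne')
    · exact pow_ne_zero _ (Finset.prod_pos fun j _ => card_pos_rat j).ne'
  · exact Finset.prod_ne_zero_iff.2 fun χ _ =>
      Nat.cast_ne_zero.2 (irr_one_nat χ).choose_spec.1.ne'

end Final

end GLSmall

namespace GLSmall

open scoped BigOperators

section Frames

variable {R : Type} [CommRing R] [IsDomain R] [IsPrincipalIdealRing R] {f : R}
  {M : Type} [AddCommGroup M] [Module R M]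

/-- Tuples annihilated by prescribed powers of `f` whose multiples in the socle are linearly
independent modulo `f`. -/
def IsFrame (f : R) {r : ℕ} (e : Fin r → ℕ) (m : Fin r → M) : Prop :=
  (∀ i, f ^ e i • m i = 0) ∧
    ∀ c : Fin r → R, ∑ i, c i • f ^ (e i - 1) • m i = 0 → ∀ i, f ∣ c i

/-- Elements whose multiple in the socle depends on those of a given tuple. -/
def Bad (f : R) {r : ℕ} (e : Fin r → ℕ) (m : Fin r → M) (a : ℕ) (x : M) : Prop :=
  ∃ c : Fin r → R, f ^ (a - 1) • x = ∑ i, c i • f ^ (e i - 1) • m i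

theorem Bad.torsion {r : ℕ} {e : Fin r → ℕ} {m : Fin r → M} (hm : ∀ i, f ^ e i • m i = 0)
    (he : ∀ i, 1 ≤ e i) {a : ℕ} (ha : 1 ≤ a) {x : M} (h : Bad f e m a x) : f ^ a • x = 0 := by
  obtain ⟨c, hc⟩ := h
  obtain ⟨a, rfl⟩ := Nat.exists_eq_add_of_le' ha
  rw [pow_succ', mul_smul]
  rw [Nat.add_sub_cancel] at hc
  rw [hc, Finset.smul_sum]
  refine Finset.sum_eq_zero fun i _ => ?_
  rw [smul_comm, smul_smul f, ← pow_succ', Nat.sub_add_cancel (he i), hm, smul_zero]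

theorem isFrame_snoc (hf : Irreducible f) {r : ℕ} (e : Fin r → ℕ) (a : ℕ) (m : Fin r → M) (x : M)
    (ha : 1 ≤ a) : IsFrame f (Fin.snoc e a : Fin (r + 1) → ℕ) (Fin.snoc m x : Fin (r + 1) → M) ↔
      IsFrame f e m ∧ f ^ a • x = 0 ∧ ¬ Bad f e m a x := by
  unfold IsFrame
  simp only [Fin.forall_fin_succ', Fin.sum_univ_castSucc, Fin.snoc_castSucc, Fin.snoc_last]
  constructor
  · rintro ⟨⟨h1, h2⟩, h3⟩
    refine ⟨⟨h1, fun c hc => ?_⟩, h2, ?_⟩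
    · have := (h3 (Fin.snoc c 0) (by simpa using hc)).1
      simpa using this
    · rintro ⟨c, hc⟩
      have := (h3 (Fin.snoc c (-1)) (by simp [hc])).2
      rw [Fin.snoc_last] at this
      exact hf.not_isUnit (isUnit_of_dvd_unit this (by simp))
  · rintro ⟨⟨h1, h3⟩, h2, h4⟩
    refine ⟨⟨h1, h2⟩, fun c hc => ?_⟩
    have hd : f ∣ c (Fin.last r) := by
      by_contra hd
      obtain ⟨u, w, huw⟩ := (hf.coprime_iff_not_dvd.2 hd)
      apply h4
      refine ⟨fun i => -(w * c i.castSucc), ?_⟩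
      have h5 : f ^ (a - 1) • x = (u * f + w * c (Fin.last r)) • f ^ (a - 1) • x := by
        rw [huw, one_smul]
      rw [h5, add_smul, mul_smul, smul_smul f, ← pow_succ', Nat.sub_add_cancel ha, h2, smul_zero,
        zero_add, mul_smul, eq_neg_of_add_eq_zero_right hc]
      simp only [neg_smul, Finset.sum_neg_distrib, smul_neg, Finset.smul_sum, mul_smul]
    refine ⟨h3 (fun i => c i.castSucc) ?_, hd⟩
    obtain ⟨d, hd⟩ := hd
    rw [hd, mul_comm, mul_smul, smul_smul f, ← pow_succ', Nat.sub_add_cancel ha, h2, smul_zero,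
      add_zero] at hc
    exact hc

variable [Finite M]

theorem card_bad {r : ℕ} {e : Fin r → ℕ} {m : Fin r → M} (hm : IsFrame f e m)
    {a : ℕ} (ha : 1 ≤ a) (hea : ∀ i, a ≤ e i) :
    Nat.card {x : M // Bad f e m a x} =
      Nat.card (R ⧸ Ideal.span {f}) ^ r * Nat.card {x : M // f ^ (a - 1) • x = 0} := by
  have hmk : ∀ c : R ⧸ Ideal.span {f}, Ideal.Quotient.mk _ (Quotient.out c) = c := fun c =>
    Quotient.out_eq c
  have hpow : ∀ i, f ^ (a - 1) * f ^ (e i - a) = f ^ (e i - 1) := fun i => by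
    rw [← pow_add]
    congr 1
    have := hea i
    omega
  let Ψ : (Fin r → R ⧸ Ideal.span {f}) × {x : M // f ^ (a - 1) • x = 0} →
      {x : M // Bad f e m a x} :=
    fun p => ⟨p.2.1 + ∑ i, Quotient.out (p.1 i) • f ^ (e i - a) • m i,
      fun i => Quotient.out (p.1 i), by
        rw [smul_add, p.2.2, zero_add, Finset.smul_sum]
        refine Finset.sum_congr rfl fun i _ => ?_
        rw [smul_comm, smul_smul (f ^ (a - 1)), hpow]⟩
  have hΨ : Function.Bijective Ψ := by
    constructor
    · rintro ⟨c, y, hy⟩ ⟨c', y', hy'⟩ h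
      have h := congrArg Subtype.val h
      dsimp only [Ψ] at h
      have h1 : c = c' := by
        have h2 := congrArg (f ^ (a - 1) • ·) h
        simp only [smul_add, hy, hy', zero_add, Finset.smul_sum] at h2
        rw [← sub_eq_zero, ← Finset.sum_sub_distrib] at h2
        have h3 := hm.2 (fun i => Quotient.out (c i) - Quotient.out (c' i)) (by
          rw [← h2]
          refine Finset.sum_congr rfl fun i _ => ?_
          rw [sub_smul, smul_comm (f ^ (a - 1)), smul_smul (f ^ (a - 1)), hpow,
            smul_comm (f ^ (a - 1)), smul_smul (f ^ (a - 1)), hpow])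
        funext i
        rw [← hmk (c i), ← hmk (c' i)]
        exact Ideal.Quotient.eq.2 (Ideal.mem_span_singleton.2 (h3 i))
      subst h1
      exact Prod.ext rfl (Subtype.ext (add_right_cancel h))
    · rintro ⟨x, c, hc⟩
      have h1 : ∀ i, Quotient.out (Ideal.Quotient.mk (Ideal.span {f}) (c i)) • f ^ (e i - 1) • m i =
          c i • f ^ (e i - 1) • m i := fun i => by
        have := Ideal.Quotient.eq.1 (hmk (Ideal.Quotient.mk (Ideal.span {f}) (c i)))
        obtain ⟨d, hd⟩ := Ideal.mem_span_singleton.1 this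
        rw [← sub_eq_zero, ← sub_smul, hd, mul_comm, mul_smul, smul_smul f, ← pow_succ',
          Nat.sub_add_cancel (ha.trans (hea i)), hm.1, smul_zero]
      refine ⟨⟨fun i => Ideal.Quotient.mk _ (c i), x - ∑ i, Quotient.out
        (Ideal.Quotient.mk (Ideal.span {f}) (c i)) • f ^ (e i - a) • m i, ?_⟩, ?_⟩
      · rw [smul_sub, hc, Finset.smul_sum, ← Finset.sum_sub_distrib]
        refine Finset.sum_eq_zero fun i _ => ?_
        rw [smul_comm (f ^ (a - 1)), smul_smul (f ^ (a - 1)), hpow, h1, sub_self]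
      · exact Subtype.ext (sub_add_cancel _ _)
  rw [← Nat.card_congr (Equiv.ofBijective Ψ hΨ), Nat.card_prod, Nat.card_fun,
    Nat.card_eq_fintype_card (α := Fin r),
    Fintype.card_fin]

theorem card_frame_snoc (hf : Irreducible f) {r : ℕ} (e : Fin r → ℕ) (a : ℕ)
    (ha : 1 ≤ a) (hea : ∀ i, a ≤ e i) :
    (Nat.card {m : Fin (r + 1) → M // IsFrame f (Fin.snoc e a : Fin (r + 1) → ℕ) m} : ℚ) =
      Nat.card {m : Fin r → M // IsFrame f e m} * (Nat.card {x : M // f ^ a • x = 0} -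
        (Nat.card (R ⧸ Ideal.span {f}) : ℚ) ^ r * Nat.card {x : M // f ^ (a - 1) • x = 0}) := by
  classical
  have := Fintype.ofFinite M
  let Φ : {m : Fin (r + 1) → M // IsFrame f (Fin.snoc e a : Fin (r + 1) → ℕ) m} ≃
      Σ m : {m : Fin r → M // IsFrame f e m}, {x : M // f ^ a • x = 0 ∧ ¬ Bad f e m.1 a x} :=
    { toFun := fun m =>
        have h := (isFrame_snoc hf e a (Fin.init m.1) (m.1 (Fin.last r)) ha).1
          (by rw [Fin.snoc_init_self]; exact m.2)
        ⟨⟨Fin.init m.1, h.1⟩, ⟨m.1 (Fin.last r), h.2⟩⟩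
      invFun := fun p =>
        ⟨Fin.snoc p.1.1 p.2.1, (isFrame_snoc hf e a p.1.1 p.2.1 ha).2 ⟨p.1.2, p.2.2⟩⟩
      left_inv := fun m => Subtype.ext (Fin.snoc_init_self _)
      right_inv := by
        rintro ⟨⟨m, hm⟩, ⟨x, hx⟩⟩
        exact Sigma.subtype_ext (Subtype.ext (Fin.init_snoc (α := fun _ => M) x m))
          (Fin.snoc_last (α := fun _ => M) x m) }
  rw [Nat.card_congr Φ, Nat.card_sigma, Nat.cast_sum,
    Nat.card_eq_fintype_card (α := {m : Fin r → M // IsFrame f e m}), ← Finset.card_univ,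
    ← nsmul_eq_mul, ← Finset.sum_const]
  refine Finset.sum_congr rfl fun m _ => ?_
  rw [eq_sub_iff_add_eq]
  have h1 := card_bad m.2 ha hea
  have h2 : Nat.card {x : M // f ^ a • x = 0} =
      Nat.card {x : M // f ^ a • x = 0 ∧ ¬ Bad f e m.1 a x} +
      Nat.card {x : M // Bad f e m.1 a x} := by
    simp only [Nat.card_eq_fintype_card, Fintype.card_subtype]
    rw [← Finset.card_union_of_disjoint]
    · congr 1
      ext x
      simp only [Finset.mem_filter, Finset.mem_univ, true_and, Finset.mem_union]
      have := Bad.torsion (x := x) m.2.1 (fun i => ha.trans (hea i)) ha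
      tauto
    · rw [Finset.disjoint_filter]
      tauto
  rw [h2, h1]
  push_cast
  ring

theorem card_frame_zero (e : Fin 0 → ℕ) : Nat.card {m : Fin 0 → M // IsFrame f e m} = 1 := by
  rw [Nat.card_eq_one_iff_unique]
  exact ⟨inferInstance, ⟨⟨Fin.elim0, fun i => i.elim0, fun _ _ i => i.elim0⟩⟩⟩

end Frames

section Local

variable {R : Type} [CommRing R] [IsDomain R] [IsPrincipalIdealRing R]

/-- The finite direct sum of cyclic modules with annihilators given by powers of `f`. -/
abbrev LM (f : R) {ι : Type} (e : ι → ℕ) : Type := ∀ i : ι, R ⧸ Ideal.span {f ^ e i}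

variable {f : R}

theorem card_quot_torsion (hf : Irreducible f) (a j : ℕ) (h : j ≤ a) :
    Nat.card {x : R ⧸ Ideal.span {f ^ a} // f ^ j • x = 0} = Nat.card (R ⧸ Ideal.span {f ^ j}) := by
  have hf0 : f ≠ 0 := hf.ne_zero
  have hpow : f ^ a = f ^ (a - j) * f ^ j := by rw [← pow_add, Nat.sub_add_cancel h]
  let g : R →ₗ[R] R ⧸ Ideal.span {f ^ a} :=
    (Ideal.span {f ^ a}).mkQ.comp (LinearMap.mulLeft R (f ^ (a - j)))
  have hk : LinearMap.ker g = Ideal.span {f ^ j} := by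
    ext x
    rw [LinearMap.mem_ker, Ideal.mem_span_singleton]
    change Ideal.Quotient.mk _ (f ^ (a - j) * x) = 0 ↔ _
    rw [Ideal.Quotient.eq_zero_iff_mem, Ideal.mem_span_singleton, hpow,
      mul_dvd_mul_iff_left (pow_ne_zero _ hf0)]
  have hr : ∀ x, x ∈ LinearMap.range g ↔ f ^ j • x = 0 := by
    intro x
    constructor
    · rintro ⟨y, rfl⟩
      change Ideal.Quotient.mk _ (f ^ j * (f ^ (a - j) * y)) = 0
      rw [Ideal.Quotient.eq_zero_iff_mem, Ideal.mem_span_singleton, hpow]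
      exact ⟨y, by ring⟩
    · obtain ⟨y, rfl⟩ := Ideal.Quotient.mk_surjective x
      intro hx
      change Ideal.Quotient.mk _ (f ^ j * y) = 0 at hx
      rw [Ideal.Quotient.eq_zero_iff_mem, Ideal.mem_span_singleton, hpow, mul_comm,
        mul_dvd_mul_iff_left (pow_ne_zero _ hf0)] at hx
      obtain ⟨z, rfl⟩ := hx
      exact ⟨z, rfl⟩
  rw [← Nat.card_congr (Equiv.subtypeEquivRight hr),
    ← Nat.card_congr (Submodule.quotEquivOfEq _ _ hk).toEquiv]
  exact (Nat.card_congr g.quotKerEquivRange.toEquiv).symm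

theorem card_quot_torsion_min (hf : Irreducible f) {Q : ℕ}
    (hQ : ∀ a, Nat.card (R ⧸ Ideal.span {f ^ a}) = Q ^ a) (a j : ℕ) :
    Nat.card {x : R ⧸ Ideal.span {f ^ a} // f ^ j • x = 0} = Q ^ min a j := by
  rcases le_total j a with h | h
  · rw [card_quot_torsion hf a j h, hQ, min_eq_right h]
  · rw [min_eq_left h, ← hQ]
    refine Nat.card_congr (Equiv.subtypeUnivEquiv fun x => ?_)
    obtain ⟨y, rfl⟩ := Ideal.Quotient.mk_surjective x
    change Ideal.Quotient.mk _ (f ^ j * y) = 0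
    rw [Ideal.Quotient.eq_zero_iff_mem, Ideal.mem_span_singleton]
    exact (pow_dvd_pow f h).mul_right y

theorem card_LM_torsion (hf : Irreducible f) {Q : ℕ}
    (hQ : ∀ a, Nat.card (R ⧸ Ideal.span {f ^ a}) = Q ^ a) {ι : Type} [Fintype ι] (e : ι → ℕ)
    (j : ℕ) : Nat.card {x : LM f e // f ^ j • x = 0} = Q ^ ∑ i, min (e i) j := by
  let Φ : {x : LM f e // f ^ j • x = 0} ≃ ∀ i, {x : R ⧸ Ideal.span {f ^ e i} // f ^ j • x = 0} :=
    { toFun := fun x i => ⟨x.1 i, congrFun x.2 i⟩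
      invFun := fun y => ⟨fun i => (y i).1, funext fun i => (y i).2⟩
      left_inv := fun _ => rfl
      right_inv := fun _ => rfl }
  rw [Nat.card_congr Φ, Nat.card_pi, ← Finset.prod_pow_eq_pow_sum]
  exact Finset.prod_congr rfl fun i _ => card_quot_torsion_min hf hQ _ _

theorem card_LM {Q : ℕ}
    (hQ : ∀ a, Nat.card (R ⧸ Ideal.span {f ^ a}) = Q ^ a) {ι : Type} [Fintype ι] (e : ι → ℕ) :
    Nat.card (LM f e) = Q ^ ∑ i, e i := by
  rw [Nat.card_pi, ← Finset.prod_pow_eq_pow_sum]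
  exact Finset.prod_congr rfl fun i _ => hQ _

theorem finite_LM {Q : ℕ} (hQ0 : Q ≠ 0)
    (hQ : ∀ a, Nat.card (R ⧸ Ideal.span {f ^ a}) = Q ^ a) {ι : Type} [Fintype ι] (e : ι → ℕ) :
    Finite (LM f e) := by
  have : ∀ i, Finite (R ⧸ Ideal.span {f ^ e i}) := fun i =>
    Nat.finite_of_card_ne_zero (by rw [hQ]; exact pow_ne_zero _ hQ0)
  infer_instance

/-- The generator of a summand. -/
def LM.gen (f : R) {ι : Type} [DecidableEq ι] (e : ι → ℕ) (i : ι) : LM f e :=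
  Pi.single i 1

theorem LM.sum_smul_gen {ι : Type} [Fintype ι] [DecidableEq ι] (e : ι → ℕ) (c : ι → R) :
    ∑ i, c i • LM.gen f e i = fun i => Ideal.Quotient.mk _ (c i) := by
  funext i
  rw [Finset.sum_apply, Finset.sum_eq_single i]
  · simp only [gen, Pi.smul_apply, Pi.single_eq_same]
    change Ideal.Quotient.mk _ (c i * 1) = _
    rw [mul_one]
  · intro j _ hj
    simp [gen, Pi.single_eq_of_ne hj.symm]
  · exact fun h => absurd (Finset.mem_univ _) h

theorem LM.exists_eq_sum {ι : Type} [Fintype ι] [DecidableEq ι] {e : ι → ℕ} (x : LM f e) :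
    ∃ c : ι → R, x = ∑ i, c i • LM.gen f e i := by
  choose c hc using fun i => Ideal.Quotient.mk_surjective (x i)
  exact ⟨c, by rw [LM.sum_smul_gen]; exact funext fun i => (hc i).symm⟩

/-- The homomorphism with prescribed values on the generators. -/
noncomputable def LM.lift {ι : Type} [Fintype ι] [DecidableEq ι]
    {e : ι → ℕ} {M : Type} [AddCommGroup M]
    [Module R M] (m : ι → M) (hm : ∀ i, f ^ e i • m i = 0) : LM f e →ₗ[R] M :=
  LinearMap.lsum R (fun i => R ⧸ Ideal.span {f ^ e i}) R fun i =>
    (Ideal.span {f ^ e i}).liftQ (LinearMap.toSpanSingleton R M (m i)) (by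
      rw [Ideal.span, Submodule.span_singleton_le_iff_mem, LinearMap.mem_ker,
        LinearMap.toSpanSingleton_apply, hm])

theorem LM.lift_gen {ι : Type} [Fintype ι] [DecidableEq ι] {e : ι → ℕ} {M : Type} [AddCommGroup M]
    [Module R M] (m : ι → M) (hm : ∀ i, f ^ e i • m i = 0) (i : ι) :
    LM.lift m hm (LM.gen f e i) = m i := by
  unfold lift gen
  rw [LinearMap.lsum_piSingle]
  change (1 : R) • m i = m i
  rw [one_smul]

theorem LM.torsion_gen {ι : Type} [DecidableEq ι] (e : ι → ℕ) (i : ι) :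
    f ^ e i • LM.gen f e i = 0 := by
  unfold gen
  rw [← Pi.single_smul, Pi.single_eq_zero_iff]
  change Ideal.Quotient.mk _ (f ^ e i * 1) = 0
  rw [mul_one]
  exact Ideal.Quotient.mk_singleton_self _

theorem LM.isFrame_gen {r : ℕ} {e : Fin r → ℕ} (hf : Irreducible f) (he : ∀ i, 1 ≤ e i) :
    IsFrame f e (LM.gen f e) := by
  refine ⟨LM.torsion_gen e, fun c hc i => ?_⟩
  simp only [smul_smul] at hc
  rw [LM.sum_smul_gen] at hc
  have := Ideal.mem_span_singleton.1 (Ideal.Quotient.eq_zero_iff_mem.1 (congrFun hc i))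
  obtain ⟨a, ha⟩ := Nat.exists_eq_add_of_le' (he i)
  rw [ha, Nat.add_sub_cancel, pow_succ', mul_dvd_mul_iff_right (pow_ne_zero _ hf.ne_zero)] at this
  exact this

theorem IsFrame.map {r : ℕ} {e : Fin r → ℕ} {M N : Type} [AddCommGroup M] [Module R M]
    [AddCommGroup N] [Module R N] {m : Fin r → M} (hm : IsFrame f e m) (φ : M →ₗ[R] N)
    (hφ : Function.Injective φ) : IsFrame f e fun i => φ (m i) := by
  refine ⟨fun i => by rw [← map_smul, hm.1, map_zero], fun c hc => hm.2 c (hφ ?_)⟩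
  rw [map_zero, ← hc, map_sum]
  simp only [map_smul]

theorem LM.lift_injective {r : ℕ} {e : Fin r → ℕ} (hf : Irreducible f) (he : ∀ i, 1 ≤ e i)
    {M : Type} [AddCommGroup M] [Module R M] {m : Fin r → M} (hm : IsFrame f e m) :
    Function.Injective (LM.lift m hm.1) := by
  have hsoc : ∀ y : LM f e, f • y = 0 → LM.lift m hm.1 y = 0 → y = 0 := by
    intro y hy h0
    obtain ⟨c, rfl⟩ := LM.exists_eq_sum y
    have h1 : ∀ i, ∃ d, c i = d * f ^ (e i - 1) := fun i => by
      rw [Finset.smul_sum] at hy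
      simp only [smul_smul] at hy
      rw [LM.sum_smul_gen] at hy
      have := Ideal.mem_span_singleton.1 (Ideal.Quotient.eq_zero_iff_mem.1 (congrFun hy i))
      obtain ⟨a, ha⟩ := Nat.exists_eq_add_of_le' (he i)
      rw [ha, pow_succ', mul_dvd_mul_iff_left hf.ne_zero] at this
      obtain ⟨d, hd⟩ := this
      exact ⟨d, by rw [hd, ha, Nat.add_sub_cancel, mul_comm]⟩
    choose d hd using h1
    simp only [map_sum, map_smul, LM.lift_gen, hd, mul_smul] at h0
    refine Finset.sum_eq_zero fun i _ => ?_
    obtain ⟨u, hu⟩ := hm.2 d h0 i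
    obtain ⟨a, ha⟩ := Nat.exists_eq_add_of_le' (he i)
    rw [hd, hu, mul_comm f u, mul_assoc, ← pow_succ', Nat.sub_add_cancel (he i), mul_smul,
      LM.torsion_gen, smul_zero]
  rw [injective_iff_map_eq_zero]
  intro x hx
  have key : ∀ j, f ^ j • x = 0 → x = 0 := by
    intro j
    induction j with
    | zero => intro h; simpa using h
    | succ j ih =>
      intro h
      refine ih (hsoc _ ?_ ?_)
      · rw [smul_smul, ← pow_succ', h]
      · rw [map_smul, hx, smul_zero]
  refine key (∑ i, e i) ?_
  obtain ⟨c, rfl⟩ := LM.exists_eq_sum x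
  rw [Finset.smul_sum]
  refine Finset.sum_eq_zero fun i _ => ?_
  obtain ⟨t, ht⟩ := Nat.exists_eq_add_of_le
    (Finset.single_le_sum (f := e) (fun _ _ => Nat.zero_le _) (Finset.mem_univ i))
  rw [smul_comm, ht, add_comm, pow_add, mul_smul, LM.torsion_gen, smul_zero, smul_zero]

theorem card_aut_LM {r : ℕ} {e : Fin r → ℕ} (hf : Irreducible f) (he : ∀ i, 1 ≤ e i)
    [Finite (LM f e)] :
    Nat.card (LM f e ≃ₗ[R] LM f e) = Nat.card {m : Fin r → LM f e // IsFrame f e m} := by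
  let Φ : (LM f e ≃ₗ[R] LM f e) → {m : Fin r → LM f e // IsFrame f e m} := fun φ =>
    ⟨fun i => φ (LM.gen f e i), (LM.isFrame_gen hf he).map φ.toLinearMap φ.injective⟩
  refine Nat.card_congr (Equiv.ofBijective Φ ⟨?_, ?_⟩)
  · intro φ φ' h
    have h := congrFun (congrArg Subtype.val h)
    ext1 x
    obtain ⟨c, rfl⟩ := LM.exists_eq_sum x
    simp only [map_sum, map_smul]
    exact Finset.sum_congr rfl fun i _ => congrArg _ (h i)
  · rintro ⟨m, hm⟩
    refine ⟨LinearEquiv.ofBijective (LM.lift m hm.1)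
      (Finite.injective_iff_bijective.1 (LM.lift_injective hf he hm)), Subtype.ext ?_⟩
    exact funext fun i => LM.lift_gen m hm.1 i

theorem card_frame (hf : Irreducible f) {M : Type} [AddCommGroup M] [Module R M] [Finite M] {r : ℕ}
    (e : Fin r → ℕ) (he : ∀ i, 1 ≤ e i) (ha : Antitone e) :
    (Nat.card {m : Fin r → M // IsFrame f e m} : ℚ) =
      ∏ i : Fin r, ((Nat.card {x : M // f ^ e i • x = 0} : ℚ) -
        (Nat.card (R ⧸ Ideal.span {f}) : ℚ) ^ i.1 * Nat.card {x : M // f ^ (e i - 1) • x = 0}) := by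
  induction r with
  | zero => rw [card_frame_zero]; simp
  | succ r ih =>
    have h1 : (Fin.snoc (Fin.init e) (e (Fin.last r)) : Fin (r + 1) → ℕ) = e := Fin.snoc_init_self _
    have := card_frame_snoc (M := M) hf (Fin.init e) (e (Fin.last r)) (he _) fun i =>
      ha (Fin.le_last _)
    rw [h1] at this
    rw [this, ih (Fin.init e) (fun i => he _) fun i j h => ha (Fin.castSucc_le_castSucc_iff.2 h),
      Fin.prod_univ_castSucc]
    rfl

/-- The order of the automorphism group of a finite primary module. -/
def autQ {r : ℕ} (e : Fin r → ℕ) (Q : ℚ) : ℚ :=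
  ∏ i : Fin r, (Q ^ (∑ t, min (e t) (e i)) - Q ^ (i.1 + ∑ t, min (e t) (e i - 1)))

theorem card_aut_eq (hf : Irreducible f) {Q : ℕ} (hQ0 : Q ≠ 0)
    (hQ : ∀ a, Nat.card (R ⧸ Ideal.span {f ^ a}) = Q ^ a) {r : ℕ}
    (e : Fin r → ℕ) (he : ∀ i, 1 ≤ e i) (ha : Antitone e) :
    (Nat.card (LM f e ≃ₗ[R] LM f e) : ℚ) = autQ e Q := by
  have := finite_LM hQ0 hQ e
  rw [card_aut_LM hf he, card_frame hf e he ha, autQ]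
  refine Finset.prod_congr rfl fun i _ => ?_
  have h1 := hQ 1
  rw [pow_one, pow_one] at h1
  rw [card_LM_torsion hf hQ, card_LM_torsion hf hQ, h1, pow_add]
  push_cast
  rfl

end Local

section LocalClass

variable {R : Type} [CommRing R] [IsDomain R] [IsPrincipalIdealRing R] {f : R}

/-- Reindexing the summands. -/
noncomputable def LM.reindex (f : R) {ι ι' : Type} (e : ι → ℕ) (σ : ι' ≃ ι) :
    LM f (e ∘ σ) ≃ₗ[R] LM f e :=
  LinearEquiv.piCongrLeft R (fun i => R ⧸ Ideal.span {f ^ e i}) σ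

/-- Summands with exponent zero can be dropped. -/
noncomputable def LM.dropZero (f : R) {ι : Type} [DecidableEq ι] (e : ι → ℕ) :
    LM f e ≃ₗ[R] LM f fun i : {i // e i ≠ 0} => e i.1 :=
  LinearEquiv.ofBijective
    (LinearMap.pi fun i : {i // e i ≠ 0} => LinearMap.proj i.1) (by
      have hs : ∀ i, e i = 0 → Subsingleton (R ⧸ Ideal.span {f ^ e i}) := fun i hi => by
        rw [hi, pow_zero, Ideal.span_singleton_one]
        exact Ideal.Quotient.subsingleton_iff.2 rfl
      constructor
      · intro x y h
        funext i
        by_cases hi : e i = 0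
        · exact (hs i hi).elim _ _
        · exact congrFun h ⟨i, hi⟩
      · intro y
        exact ⟨fun i => if hi : e i ≠ 0 then y ⟨i, hi⟩ else 0, funext fun i => dif_pos i.2⟩)

theorem exists_equiv_LM (hf : Irreducible f) {M : Type} [AddCommGroup M] [Module R M] [Finite M]
    (hM : ∃ N, ∀ x : M, f ^ N • x = 0) :
    ∃ l : List ℕ, (∀ i, 1 ≤ l.get i) ∧ Antitone l.get ∧ Nonempty (M ≃ₗ[R] LM f l.get) := by
  classical
  obtain ⟨N, hN⟩ := hM
  obtain ⟨d, k, ⟨φ⟩⟩ := Module.torsion_by_prime_power_decomposition (M := M) hf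
    (fun x => ⟨⟨f ^ N, N, rfl⟩, hN x⟩)
  let e : {i // k i ≠ 0} → ℕ := fun i => k i.1
  let σ := (Fintype.equivFin {i // k i ≠ 0}).symm
  let τ := Tuple.sort fun i => OrderDual.toDual (e (σ i))
  let g := (e ∘ σ) ∘ τ
  have hg : Antitone g := fun i j h =>
    OrderDual.toDual_le_toDual.1 (Tuple.monotone_sort (fun i => OrderDual.toDual (e (σ i))) h)
  have hget : (List.ofFn g).get = g ∘ finCongr (List.length_ofFn (f := g)) := by
    funext i
    simp only [List.get_eq_getElem, List.getElem_ofFn]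
    rfl
  refine ⟨List.ofFn g, ?_, ?_, ?_⟩
  · intro i
    rw [hget]
    exact Nat.one_le_iff_ne_zero.2 (σ (τ (finCongr (List.length_ofFn (f := g)) i))).2
  · rw [hget]
    exact fun i j h => hg h
  · rw [hget]
    exact ⟨((φ.trans (DirectSum.linearEquivFunOnFintype R _ _)).trans (LM.dropZero f k)).trans
      (((LM.reindex f g _).trans (LM.reindex f (e ∘ σ) τ)).trans (LM.reindex f e σ)).symm⟩

end LocalClass

/-- The partitions of `m ≤ 5`, as weakly decreasing lists. -/
def parts : ℕ → Finset (List ℕ)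
  | 0 => {[]}
  | 1 => {[1]}
  | 2 => {[2], [1, 1]}
  | 3 => {[3], [2, 1], [1, 1, 1]}
  | 4 => {[4], [3, 1], [2, 2], [2, 1, 1], [1, 1, 1, 1]}
  | 5 => {[5], [4, 1], [3, 2], [3, 1, 1], [2, 2, 1], [2, 1, 1, 1], [1, 1, 1, 1, 1]}
  | _ => ∅

theorem card_parts {m : ℕ} (hm : m ≤ 5) : (parts m).card = nt m := by
  interval_cases m <;> rfl

theorem parts_spec {m : ℕ} (hm : m ≤ 5) :
    ∀ l ∈ parts m, (∀ i, 1 ≤ l.get i) ∧ (∀ i j : Fin l.length, i ≤ j → l.get j ≤ l.get i) ∧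
      ∑ i, l.get i = m := by
  interval_cases m <;> decide

theorem parts_inj {m : ℕ} (hm : m ≤ 5) : ∀ l ∈ parts m, ∀ l' ∈ parts m,
    (∀ j < 6, ∑ i, min (l.get i) j = ∑ i, min (l'.get i) j) → l = l' := by
  interval_cases m <;> decide

theorem mem_parts {m : ℕ} (hm : m ≤ 5) (l : List ℕ) (h1 : ∀ i, 1 ≤ l.get i) (h2 : Antitone l.get)
    (h3 : ∑ i, l.get i = m) : l ∈ parts m := by
  have h1' : ∀ a ∈ l, 1 ≤ a := by
    intro a ha
    obtain ⟨i, rfl⟩ := List.get_of_mem ha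
    exact h1 i
  have h2' : l.Pairwise (· ≥ ·) := by
    rw [List.pairwise_iff_get]
    exact fun i j h => h2 h.le
  have h3' : l.sum = m := by
    rw [← h3, ← List.sum_ofFn, List.ofFn_get]
  clear h1 h2 h3
  rcases l with _ | ⟨a, _ | ⟨b, _ | ⟨c, _ | ⟨d, _ | ⟨e, _ | ⟨x, l⟩⟩⟩⟩⟩⟩
  all_goals simp only [List.pairwise_cons, List.sum_cons, List.sum_nil, List.mem_cons,
    List.not_mem_nil, or_false, forall_eq_or_imp, forall_eq, ge_iff_le, false_implies, implies_true,
    true_and] at h1' h2' h3'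
  · subst h3'; decide
  · have ha : a = m := h3'
    subst ha
    interval_cases a <;> decide
  · have ha : a ≤ 4 := by omega
    have hb : b ≤ 2 := by omega
    interval_cases b <;> interval_cases a <;> first | omega | (subst h3'; decide)
  · have ha : a ≤ 3 := by omega
    have hb : b ≤ 2 := by omega
    have hc : c = 1 := by omega
    subst hc
    interval_cases b <;> interval_cases a <;> first | omega | (subst h3'; decide)
  · obtain rfl : d = 1 := by omega
    obtain rfl : c = 1 := by omega
    obtain rfl : b = 1 := by omega
    have ha : a ≤ 2 := by omega
    interval_cases a <;> first | omega | (subst h3'; decide)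
  · obtain rfl : e = 1 := by omega
    obtain rfl : d = 1 := by omega
    obtain rfl : c = 1 := by omega
    obtain rfl : b = 1 := by omega
    obtain rfl : a = 1 := by omega
    subst h3'; decide
  · omega

theorem autQ_parts_one (Q : ℚ) :
    autQ [1].get Q = (Q - 1) := by
  simp [autQ]

theorem autQ_parts_two (Q : ℚ) :
    autQ [2].get Q = Q * (Q - 1) ∧
    autQ [1, 1].get Q = Q * (Q - 1) * (Q ^ 2 - 1) := by
  refine ⟨?_, ?_⟩ <;>
  · simp [autQ, Fin.sum_univ_succ, Fin.prod_univ_succ]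
    try ring

theorem autQ_parts_three (Q : ℚ) :
    autQ [3].get Q = Q ^ 2 * (Q - 1) ∧
    autQ [2, 1].get Q = Q ^ 3 * (Q - 1) ^ 2 ∧
    autQ [1, 1, 1].get Q = Q ^ 3 * (Q - 1) * (Q ^ 2 - 1) * (Q ^ 3 - 1) := by
  refine ⟨?_, ?_, ?_⟩ <;>
  · simp [autQ, Fin.sum_univ_succ, Fin.prod_univ_succ]
    try ring

theorem autQ_parts_four (Q : ℚ) :
    autQ [4].get Q = Q ^ 3 * (Q - 1) ∧
    autQ [3, 1].get Q = Q ^ 4 * (Q - 1) ^ 2 ∧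
    autQ [2, 2].get Q = Q ^ 5 * (Q - 1) * (Q ^ 2 - 1) ∧
    autQ [2, 1, 1].get Q = Q ^ 6 * (Q - 1) ^ 2 * (Q ^ 2 - 1) ∧
    autQ [1, 1, 1, 1].get Q = Q ^ 6 * (Q - 1) * (Q ^ 2 - 1) * (Q ^ 3 - 1) * (Q ^ 4 - 1) := by
  refine ⟨?_, ?_, ?_, ?_, ?_⟩ <;>
  · simp [autQ, Fin.sum_univ_succ, Fin.prod_univ_succ]
    try ring

theorem autQ_parts_five (Q : ℚ) :
    autQ [5].get Q = Q ^ 4 * (Q - 1) ∧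
    autQ [4, 1].get Q = Q ^ 5 * (Q - 1) ^ 2 ∧
    autQ [3, 2].get Q = Q ^ 7 * (Q - 1) ^ 2 ∧
    autQ [3, 1, 1].get Q = Q ^ 7 * (Q - 1) ^ 2 * (Q ^ 2 - 1) ∧
    autQ [2, 2, 1].get Q = Q ^ 9 * (Q - 1) ^ 2 * (Q ^ 2 - 1) ∧
    autQ [2, 1, 1, 1].get Q = Q ^ 10 * (Q - 1) ^ 2 * (Q ^ 2 - 1) * (Q ^ 3 - 1) ∧
    autQ [1, 1, 1, 1, 1].get Q = Q ^ 10 * (Q - 1) * (Q ^ 2 - 1) * (Q ^ 3 - 1) * (Q ^ 4 - 1) *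
      (Q ^ 5 - 1) := by
  refine ⟨?_, ?_, ?_, ?_, ?_, ?_, ?_⟩ <;>
  · simp [autQ, Fin.sum_univ_succ, Fin.prod_univ_succ]
    try ring

theorem prod_parts {m : ℕ} (hm : m ≤ 5) {Q : ℚ} (hQ : 1 < Q) :
    ∏ l ∈ parts m, (autQ l.get Q)⁻¹ = ct m Q := by
  have h0 : Q ≠ 0 := by positivity
  have hj : ∀ j ≠ 0, Q ^ j - 1 ≠ 0 := fun j hj => (sub_pos.2 (one_lt_pow₀ hQ hj)).ne'
  have h1 : Q - 1 ≠ 0 := (sub_pos.2 hQ).ne'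
  have h2 := hj 2 two_ne_zero
  have h3 := hj 3 three_ne_zero
  have h4 := hj 4 four_ne_zero
  have h5 := hj 5 (by decide)
  clear hj
  interval_cases m
  · simp [parts, autQ, ct]
  · rw [parts, Finset.prod_singleton, autQ_parts_one]
    simp [ct]
  · obtain ⟨e1, e2⟩ := autQ_parts_two Q
    rw [parts, Finset.prod_insert (by decide), Finset.prod_singleton,
      e1, e2, ct]
    field_simp
  · obtain ⟨e1, e2, e3⟩ := autQ_parts_three Q
    rw [parts, Finset.prod_insert (by decide), Finset.prod_insert (by decide),
      Finset.prod_singleton,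
      e1, e2, e3, ct]
    field_simp
  · obtain ⟨e1, e2, e3, e4, e5⟩ := autQ_parts_four Q
    rw [parts, Finset.prod_insert (by decide), Finset.prod_insert (by decide),
      Finset.prod_insert (by decide), Finset.prod_insert (by decide), Finset.prod_singleton,
      e1, e2, e3, e4, e5, ct]
    field_simp
  · obtain ⟨e1, e2, e3, e4, e5, e6, e7⟩ := autQ_parts_five Q
    rw [parts, Finset.prod_insert (by decide), Finset.prod_insert (by decide),
      Finset.prod_insert (by decide), Finset.prod_insert (by decide),
      Finset.prod_insert (by decide), Finset.prod_insert (by decide), Finset.prod_singleton,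
      e1, e2, e3, e4, e5, e6, e7, ct]
    field_simp

theorem sum_parts {m : ℕ} (hm : m ≤ 5) {Q : ℚ} (hQ : 1 < Q) :
    ∑ l ∈ parts m, (autQ l.get Q)⁻¹ = et m Q := by
  have h0 : Q ≠ 0 := by positivity
  have hj : ∀ j ≠ 0, Q ^ j - 1 ≠ 0 := fun j hj => (sub_pos.2 (one_lt_pow₀ hQ hj)).ne'
  have h1 : Q - 1 ≠ 0 := (sub_pos.2 hQ).ne'
  have h2 := hj 2 two_ne_zero
  have h3 := hj 3 three_ne_zero
  have h4 := hj 4 four_ne_zero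
  have h5 := hj 5 (by decide)
  clear hj
  interval_cases m
  · simp [parts, autQ, et]
  · rw [parts, Finset.sum_singleton, autQ_parts_one]
    simp [et]
  · obtain ⟨e1, e2⟩ := autQ_parts_two Q
    rw [parts, Finset.sum_insert (by decide), Finset.sum_singleton,
      e1, e2, et]
    simp only [Finset.prod_range_succ, Finset.prod_range_zero, Nat.choose, zero_add, pow_one]
    field_simp
    ring
  · obtain ⟨e1, e2, e3⟩ := autQ_parts_three Q
    rw [parts, Finset.sum_insert (by decide), Finset.sum_insert (by decide), Finset.sum_singleton,
      e1, e2, e3, et]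
    simp only [Finset.prod_range_succ, Finset.prod_range_zero, Nat.choose, zero_add, pow_one]
    field_simp
    ring
  · obtain ⟨e1, e2, e3, e4, e5⟩ := autQ_parts_four Q
    rw [parts, Finset.sum_insert (by decide), Finset.sum_insert (by decide),
      Finset.sum_insert (by decide), Finset.sum_insert (by decide), Finset.sum_singleton,
      e1, e2, e3, e4, e5, et]
    simp only [Finset.prod_range_succ, Finset.prod_range_zero, Nat.choose, zero_add, pow_one]
    field_simp
    ring
  · obtain ⟨e1, e2, e3, e4, e5, e6, e7⟩ := autQ_parts_five Q
    rw [parts, Finset.sum_insert (by decide), Finset.sum_insert (by decide),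
      Finset.sum_insert (by decide), Finset.sum_insert (by decide), Finset.sum_insert (by decide),
      Finset.sum_insert (by decide), Finset.sum_singleton,
      e1, e2, e3, e4, e5, e6, e7, et]
    simp only [Finset.prod_range_succ, Finset.prod_range_zero, Nat.choose, zero_add, pow_one]
    field_simp
    ring

end GLSmall

namespace GLSmall

open scoped BigOperators
open Polynomial

section ModClass

variable {k : Type} [Field k]

/-- A `k`-linear isomorphism commuting with `X` is `k[X]`-linear. -/
noncomputable def polyEquiv {M N : Type} [AddCommGroup M] [AddCommGroup N] [Module k M] [Module k N]
    [Module k[X] M] [Module k[X] N] [IsScalarTower k k[X] M] [IsScalarTower k k[X] N]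
    (φ : M ≃ₗ[k] N) (h : ∀ x, φ ((X : k[X]) • x) = (X : k[X]) • φ x) : M ≃ₗ[k[X]] N :=
  { φ with
    map_smul' := fun p x => by
      change φ (p • x) = p • φ x
      have hX : ∀ (n : ℕ) x, φ ((X : k[X]) ^ n • x) = (X : k[X]) ^ n • φ x := by
        intro n
        induction n with
        | zero => intro x; simp
        | succ n ih => intro x; rw [pow_succ, mul_smul, ih, h, mul_smul]
      induction p using Polynomial.induction_on' with
      | add p q hp hq => rw [add_smul, map_add, hp, hq, add_smul]
      | monomial n a =>
        rw [← C_mul_X_pow_eq_monomial, mul_smul, mul_smul, ← hX, C_eq_algebraMap,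
          algebraMap_smul, algebraMap_smul, map_smul] }

theorem polyEquiv_apply {M N : Type} [AddCommGroup M] [AddCommGroup N] [Module k M] [Module k N]
    [Module k[X] M] [Module k[X] N] [IsScalarTower k k[X] M] [IsScalarTower k k[X] N]
    (φ : M ≃ₗ[k] N) (h : ∀ x, φ ((X : k[X]) • x) = (X : k[X]) • φ x) (x : M) :
    polyEquiv φ h x = φ x := rfl

/-- Invertible matrices as linear automorphisms. -/
noncomputable def glEquiv (n : ℕ) : GL (Fin n) k ≃* ((Fin n → k) ≃ₗ[k] (Fin n → k)) :=
  Matrix.GeneralLinearGroup.toLin.trans (LinearMap.GeneralLinearGroup.generalLinearEquiv k _)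

/-- The `k[X]`-module of an invertible matrix. -/
abbrev Md {n : ℕ} (g : GL (Fin n) k) : Type :=
  Module.AEval' ((glEquiv n g : (Fin n → k) ≃ₗ[k] (Fin n → k)) : (Fin n → k) →ₗ[k] (Fin n → k))

/-- The underlying vector space of `Md g`. -/
noncomputable def Md.of {n : ℕ} (g : GL (Fin n) k) : (Fin n → k) ≃ₗ[k] Md g :=
  Module.AEval'.of _

theorem Md.X_smul {n : ℕ} (g : GL (Fin n) k) (v : Fin n → k) :
    (X : k[X]) • Md.of g v = Md.of g (glEquiv n g v) :=
  Module.AEval'.X_smul_of _ v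

theorem Md.symm_X_smul {n : ℕ} (g : GL (Fin n) k) (x : Md g) :
    (Md.of g).symm ((X : k[X]) • x) = glEquiv n g ((Md.of g).symm x) :=
  Module.AEval'.of_symm_X_smul _ x

/-- Isomorphisms of modules are intertwining matrices. -/
noncomputable def Md.intertwine {n : ℕ} (g h : GL (Fin n) k) :
    (Md g ≃ₗ[k[X]] Md h) ≃ {x : GL (Fin n) k // x * g = h * x} where
  toFun φ := ⟨(glEquiv n).symm (((Md.of g).trans (φ.restrictScalars k)).trans (Md.of h).symm), by
    apply (glEquiv n).injective
    rw [map_mul, map_mul, MulEquiv.apply_symm_apply]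
    ext1 v
    change (Md.of h).symm (φ (Md.of g (glEquiv n g v))) =
      glEquiv n h ((Md.of h).symm (φ (Md.of g v)))
    rw [← Md.X_smul, map_smul, Md.symm_X_smul]⟩
  invFun x := polyEquiv (((Md.of g).symm.trans (glEquiv n x.1)).trans (Md.of h)) (by
    intro v
    change Md.of h (glEquiv n x.1 ((Md.of g).symm (X • v))) =
      X • Md.of h (glEquiv n x.1 ((Md.of g).symm v))
    rw [Md.symm_X_smul, Md.X_smul]
    have := congrArg (glEquiv n) x.2
    rw [map_mul, map_mul] at this
    exact congrArg (Md.of h) (LinearEquiv.congr_fun this ((Md.of g).symm v)))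
  left_inv φ := by
    ext1 v
    rw [polyEquiv_apply]
    change Md.of h (glEquiv n ((glEquiv n).symm _) ((Md.of g).symm v)) = _
    rw [MulEquiv.apply_symm_apply]
    change Md.of h ((Md.of h).symm (φ (Md.of g ((Md.of g).symm v)))) = _
    rw [LinearEquiv.apply_symm_apply, LinearEquiv.apply_symm_apply]
  right_inv x := by
    apply Subtype.ext
    apply (glEquiv n).injective
    change glEquiv n ((glEquiv n).symm _) = _
    rw [MulEquiv.apply_symm_apply]
    ext1 v
    change (Md.of h).symm (Md.of h (glEquiv n x.1 ((Md.of g).symm (Md.of g v)))) = _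
    rw [LinearEquiv.symm_apply_apply, LinearEquiv.symm_apply_apply]

theorem Md.card {n : ℕ} (g : GL (Fin n) k) : Nat.card (Md g) = Nat.card k ^ n := by
  rw [← Nat.card_congr (Md.of g).toEquiv, Nat.card_fun, Nat.card_eq_fintype_card (α := Fin n),
    Fintype.card_fin]

instance Md.finite [Finite k] {n : ℕ} (g : GL (Fin n) k) : Finite (Md g) :=
  Finite.of_equiv _ (Md.of g).toEquiv

theorem exists_equiv_Md [Finite k] {M : Type} [AddCommGroup M] [Module k M] [Module k[X] M]
    [IsScalarTower k k[X] M] [Finite M] (hX : Function.Injective fun x : M => (X : k[X]) • x)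
    {n : ℕ}
    (hn : Nat.card M = Nat.card k ^ n) : ∃ g : GL (Fin n) k, Nonempty (M ≃ₗ[k[X]] Md g) := by
  have hk : 1 < Nat.card k := Finite.one_lt_card
  have : Module.Finite k M := Module.Finite.of_finite
  have hr : Module.finrank k M = n := by
    have h := Module.natCard_eq_pow_finrank (K := k) (V := M)
    rw [hn] at h
    exact (Nat.pow_right_injective hk h).symm
  let b : M ≃ₗ[k] (Fin n → k) := LinearEquiv.ofFinrankEq _ _ (by rw [hr, Module.finrank_fin_fun])
  let ψ : M ≃ₗ[k] M := LinearEquiv.ofBijective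
    ((LinearMap.lsmul k[X] M (X : k[X])).restrictScalars k) (Finite.injective_iff_bijective.1 hX)
  let g := (glEquiv n).symm ((b.symm.trans ψ).trans b)
  refine ⟨g, ⟨polyEquiv (b.trans (Md.of g)) fun x => ?_⟩⟩
  change Md.of g (b (X • x)) = X • Md.of g (b x)
  rw [Md.X_smul, MulEquiv.apply_symm_apply]
  change _ = Md.of g (b (ψ (b.symm (b x))))
  rw [LinearEquiv.symm_apply_apply]
  rfl

variable [Fintype k] [DecidableEq k]

theorem cw_mk {n : ℕ} (g : GL (Fin n) k) :
    cw (ConjClasses.mk g) = (Nat.card (Md g ≃ₗ[k[X]] Md g) : ℚ)⁻¹ := by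
  classical
  have h1 : Nat.card (Md g ≃ₗ[k[X]] Md g) =
      Fintype.card (MulAction.stabilizer (ConjAct (GL (Fin n) k)) g) := by
    rw [← Nat.card_eq_fintype_card]
    refine Nat.card_congr ((Md.intertwine g g).trans
      (Equiv.subtypeEquiv ConjAct.toConjAct.toEquiv ?_))
    intro x
    rw [MulAction.mem_stabilizer_iff]
    change _ ↔ x * g * x⁻¹ = g
    rw [mul_inv_eq_iff_eq_mul]
  have h2 := ConjClasses.card_carrier g
  have h3 : Fintype.card (MulAction.stabilizer (ConjAct (GL (Fin n) k)) g) ∣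
      Fintype.card (GL (Fin n) k) := by
    rw [← Nat.card_eq_fintype_card, ← Nat.card_eq_fintype_card]
    exact Subgroup.card_subgroup_dvd_card _
  rw [cw, Set.ncard_eq_toFinset_card', Set.toFinset_card, h2, h1, Nat.cast_div h3 (by positivity),
    Nat.card_eq_fintype_card]
  have : (Fintype.card (GL (Fin n) k) : ℚ) ≠ 0 := by positivity
  field_simp

/-- The conjugacy classes of the groups of size at most five. -/
abbrev Cls (k : Type) [Field k] : Type := Σ n : Fin 6, ConjClasses (GL (Fin n.1) k)

/-- The module of a class. -/
abbrev Cls.Mod (v : Cls k) : Type := Md (Quotient.out v.2)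

theorem Cls.card_mod (v : Cls k) : Nat.card v.Mod = Nat.card k ^ v.1.1 := Md.card _

theorem Cls.cw_eq (v : Cls k) : cw v.2 = (Nat.card (v.Mod ≃ₗ[k[X]] v.Mod) : ℚ)⁻¹ := by
  rw [← cw_mk]
  exact congrArg cw (Quotient.out_eq v.2).symm

theorem Cls.eq_of_equiv {u v : Cls k} (φ : u.Mod ≃ₗ[k[X]] v.Mod) : u = v := by
  have hk : 1 < Nat.card k := Finite.one_lt_card
  obtain ⟨⟨n, hn⟩, c⟩ := u
  obtain ⟨⟨m, hm⟩, d⟩ := v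
  have h := Nat.card_congr φ.toEquiv
  rw [Cls.card_mod, Cls.card_mod] at h
  obtain rfl : n = m := Nat.pow_right_injective hk h
  refine congrArg (Sigma.mk _) ?_
  let x := Md.intertwine _ _ φ
  have hx := x.2
  rw [← Quotient.out_eq c, ← Quotient.out_eq d]
  refine ConjClasses.mk_eq_mk_iff_isConj.2 (isConj_iff.2 ⟨x.1, ?_⟩)
  rw [mul_inv_eq_iff_eq_mul]
  exact hx

theorem Cls.exists_equiv {M : Type} [AddCommGroup M] [Module k M] [Module k[X] M]
    [IsScalarTower k k[X] M] [Finite M] (hX : Function.Injective fun x : M => (X : k[X]) • x)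
    {n : ℕ}
    (hn : Nat.card M = Nat.card k ^ n) (h5 : n ≤ 5) :
    ∃ v : Cls k, v.1.1 = n ∧ Nonempty (M ≃ₗ[k[X]] v.Mod) := by
  obtain ⟨g, ⟨φ⟩⟩ := exists_equiv_Md hX hn
  let c : ConjClasses (GL (Fin n) k) := ConjClasses.mk g
  refine ⟨⟨⟨n, by omega⟩, c⟩, rfl, ?_⟩
  have hc : IsConj g (Quotient.out c) := ConjClasses.mk_eq_mk_iff_isConj.1 (Quotient.out_eq c).symm
  obtain ⟨x, hx⟩ := isConj_iff.1 hc
  rw [mul_inv_eq_iff_eq_mul] at hx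
  exact ⟨φ.trans ((Md.intertwine g (Quotient.out c)).symm ⟨x, hx⟩)⟩

end ModClass

section Coprime

variable {R : Type} [CommRing R]

theorem eq_zero_of_isCoprime {M : Type} [AddCommGroup M] [Module R M] {p a : R}
    (h : IsCoprime p a) {x : M} (hp : p • x = 0) (ha : a • x = 0) : x = 0 := by
  obtain ⟨u, v, huv⟩ := h
  rw [← one_smul R x, ← huv, add_smul, mul_smul, mul_smul, hp, ha, smul_zero, smul_zero, add_zero]

variable {M N M' N' : Type} [AddCommGroup M] [AddCommGroup N] [AddCommGroup M'] [AddCommGroup N']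
  [Module R M] [Module R N] [Module R M'] [Module R N'] {p a : R}

theorem map_inl_snd (h : IsCoprime p a) (hM : ∀ x : M, p • x = 0) (hN' : ∀ x : N', a • x = 0)
    (φ : (M × N) →ₗ[R] (M' × N')) (x : M) : (φ (x, 0)).2 = 0 := by
  refine eq_zero_of_isCoprime h ?_ (hN' _)
  rw [← Prod.smul_snd, ← map_smul, Prod.smul_mk, hM, smul_zero, ← Prod.zero_eq_mk, map_zero]
  rfl

/-- The first component of an isomorphism of products with coprime annihilators. -/
noncomputable def prodFst (h : IsCoprime p a) (hM : ∀ x : M, p • x = 0) (hN : ∀ x : N, a • x = 0)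
    (hM' : ∀ x : M', p • x = 0) (hN' : ∀ x : N', a • x = 0)
    (φ : (M × N) ≃ₗ[R] (M' × N')) : M ≃ₗ[R] M' :=
  LinearEquiv.ofLinearMap
    (LinearMap.fst R M' N' ∘ₗ φ.toLinearMap ∘ₗ LinearMap.inl R M N)
    (LinearMap.fst R M N ∘ₗ φ.symm.toLinearMap ∘ₗ LinearMap.inl R M' N')
    (by
      ext x
      change (φ ((φ.symm (x, 0)).1, 0)).1 = x
      have := map_inl_snd h hM' hN φ.symm.toLinearMap x
      have e : ((φ.symm (x, 0)).1, (0 : N)) = φ.symm (x, 0) := Prod.ext rfl this.symm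
      rw [e, LinearEquiv.apply_symm_apply])
    (by
      ext x
      change (φ.symm ((φ (x, 0)).1, 0)).1 = x
      have := map_inl_snd h hM hN' φ.toLinearMap x
      have e : ((φ (x, 0)).1, (0 : N')) = φ (x, 0) := Prod.ext rfl this.symm
      rw [e, LinearEquiv.symm_apply_apply])

/-- The second component of an isomorphism of products with coprime annihilators. -/
noncomputable def prodSnd (h : IsCoprime p a) (hM : ∀ x : M, p • x = 0) (hN : ∀ x : N, a • x = 0)
    (hM' : ∀ x : M', p • x = 0) (hN' : ∀ x : N', a • x = 0)
    (φ : (M × N) ≃ₗ[R] (M' × N')) : N ≃ₗ[R] N' :=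
  prodFst h.symm hN hM hN' hM'
    (((LinearEquiv.prodComm R N M).trans φ).trans (LinearEquiv.prodComm R M' N'))

theorem card_prod_aut (h : IsCoprime p a) (hM : ∀ x : M, p • x = 0) (hN : ∀ x : N, a • x = 0) :
    Nat.card ((M × N) ≃ₗ[R] (M × N)) = Nat.card (M ≃ₗ[R] M) * Nat.card (N ≃ₗ[R] N) := by
  rw [← Nat.card_prod]
  refine Nat.card_congr
    { toFun := fun φ => (prodFst h hM hN hM hN φ, prodSnd h hM hN hM hN φ)
      invFun := fun α => α.1.prodCongr α.2
      left_inv := fun φ => ?_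
      right_inv := fun α => ?_ }
  · ext1 x
    have h1 : (φ (x.1, 0)).2 = 0 := map_inl_snd h hM hN φ.toLinearMap x.1
    have h2 : (φ (0, x.2)).1 = 0 := map_inl_snd h.symm hN hM
      (((LinearEquiv.prodComm R N M).trans φ).trans (LinearEquiv.prodComm R M N)).toLinearMap x.2
    have hx : x = (x.1, 0) + (0, x.2) := by ext <;> simp
    conv_rhs => rw [hx, map_add]
    refine Prod.ext ?_ ?_
    · rw [Prod.fst_add, h2, add_zero]
      rfl
    · rw [Prod.snd_add, h1, zero_add]
      rfl
  · refine Prod.ext ?_ ?_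
    · ext1 x
      rfl
    · ext1 x
      rfl

/-- The splitting of a module whose annihilator contains a product of coprime elements. -/
theorem exists_equiv_torsionBy (h : IsCoprime p a) (hM : ∀ x : M, (p * a) • x = 0) :
    Nonempty (M ≃ₗ[R] (Submodule.torsionBy R M p × Submodule.torsionBy R M a)) := by
  have hc : IsCompl (Submodule.torsionBy R M p) (Submodule.torsionBy R M a) := by
    constructor
    · rw [Submodule.disjoint_def]
      exact fun x hp ha => eq_zero_of_isCoprime h hp ha
    · rw [codisjoint_iff, eq_top_iff]
      rintro x -
      obtain ⟨u, v, huv⟩ := h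
      rw [Submodule.mem_sup]
      refine ⟨(v * a) • x, ?_, (u * p) • x, ?_, ?_⟩
      · rw [Submodule.mem_torsionBy_iff, smul_smul, show p * (v * a) = v * (p * a) by ring,
          mul_smul,
          hM, smul_zero]
      · rw [Submodule.mem_torsionBy_iff, smul_smul, show a * (u * p) = u * (p * a) by ring,
          mul_smul,
          hM, smul_zero]
      · rw [← add_smul, add_comm, huv, one_smul]
  exact ⟨(Submodule.prodEquivOfIsCompl _ _ hc).symm⟩

end Coprime

section ClassOf

variable {k : Type} [Field k]

open Classical in
/-- The class of a module. -/
noncomputable def clsOf (k : Type) [Field k] (M : Type) [AddCommGroup M] [Module k[X] M] : Cls k :=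
  if h : ∃ v : Cls k, Nonempty (M ≃ₗ[k[X]] v.Mod) then h.choose else ⟨0, ConjClasses.mk 1⟩

theorem clsOf_spec {M : Type} [AddCommGroup M] [Module k[X] M]
    (h : ∃ v : Cls k, Nonempty (M ≃ₗ[k[X]] v.Mod)) : Nonempty (M ≃ₗ[k[X]] (clsOf k M).Mod) := by
  rw [clsOf, dif_pos h]
  exact h.choose_spec

variable [Fintype k] [DecidableEq k]

theorem clsOf_eq {M : Type} [AddCommGroup M] [Module k[X] M] {v : Cls k} (φ : M ≃ₗ[k[X]] v.Mod) :
    clsOf k M = v := by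
  obtain ⟨ψ⟩ := clsOf_spec (k := k) ⟨v, ⟨φ⟩⟩
  exact Cls.eq_of_equiv (ψ.symm.trans φ)

theorem card_aut_congr {R M N : Type} [CommRing R] [AddCommGroup M] [AddCommGroup N] [Module R M]
    [Module R N] (φ : M ≃ₗ[R] N) : Nat.card (M ≃ₗ[R] M) = Nat.card (N ≃ₗ[R] N) :=
  Nat.card_congr
    { toFun := fun α => (φ.symm.trans α).trans φ
      invFun := fun α => (φ.trans α).trans φ.symm
      left_inv := fun α => by ext1 x; simp
      right_inv := fun α => by ext1 x; simp }

theorem Cls.cw_of_equiv {M : Type} [AddCommGroup M] [Module k[X] M] {v : Cls k}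
    (φ : M ≃ₗ[k[X]] v.Mod) : cw v.2 = (Nat.card (M ≃ₗ[k[X]] M) : ℚ)⁻¹ := by
  rw [Cls.cw_eq, card_aut_congr φ]

theorem clsOf_deg {M : Type} [AddCommGroup M] [Module k M] [Module k[X] M]
    [IsScalarTower k k[X] M] [Finite M] (hX : Function.Injective fun x : M => (X : k[X]) • x)
    {n : ℕ}
    (hn : Nat.card M = Nat.card k ^ n) (h5 : n ≤ 5) :
    (clsOf k M).1.1 = n ∧ Nonempty (M ≃ₗ[k[X]] (clsOf k M).Mod) := by
  obtain ⟨v, hv, ⟨φ⟩⟩ := Cls.exists_equiv hX hn h5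
  rw [clsOf_eq φ]
  exact ⟨hv, ⟨φ⟩⟩

/-- The monic irreducible polynomials other than `X` of degree at most five. -/
structure Atom (k : Type) [Field k] where
  poly : k[X]
  monic : poly.Monic
  irr : Irreducible poly
  ne_X : poly ≠ X
  deg_le : poly.natDegree ≤ 5

theorem Atom.ext' {a b : Atom k} (h : a.poly = b.poly) : a = b := by
  cases a; cases b; cases h; rfl

theorem isCoprime_of_monic {p r : k[X]} (hp : p.Monic) (hr : r.Monic) (hpi : Irreducible p)
    (hri : Irreducible r) (h : p ≠ r) : IsCoprime p r := by
  rcases EuclideanDomain.dvd_or_coprime p r hpi with hd | hc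
  · exact absurd (eq_of_monic_of_associated hp hr (hpi.associated_of_dvd hri hd)) h
  · exact hc

theorem Atom.coprime_X (a : Atom k) : IsCoprime X a.poly :=
  isCoprime_of_monic monic_X a.monic irreducible_X a.irr a.ne_X.symm

theorem Atom.coprime {a b : Atom k} (h : a ≠ b) : IsCoprime a.poly b.poly :=
  isCoprime_of_monic a.monic b.monic a.irr b.irr fun e => h (Atom.ext' e)

instance Atom.finite : Finite (Atom k) := by
  let F : Atom k → degreeLT k 6 := fun a => ⟨a.poly, by
    rw [mem_degreeLT]
    exact (degree_le_of_natDegree_le a.deg_le).trans_lt (by norm_cast)⟩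
  have : Finite (degreeLT k 6) := Finite.of_equiv _ (degreeLTEquiv k 6).symm.toEquiv
  exact Finite.of_injective F fun a b h => Atom.ext' (congrArg Subtype.val h)

/-- The product of a set of atoms. -/
noncomputable def aprod (S : Finset (Atom k)) : k[X] := ∏ a ∈ S, a.poly

/-- The modules supported on a set of atoms. -/
def Supp (S : Finset (Atom k)) (M : Type) [AddCommGroup M] [Module k[X] M] : Prop :=
  ∃ N, ∀ x : M, aprod S ^ N • x = 0

theorem Supp.congr {S : Finset (Atom k)} {M N : Type} [AddCommGroup M] [Module k[X] M]
    [AddCommGroup N] [Module k[X] N] (φ : M ≃ₗ[k[X]] N) (h : Supp S M) : Supp S N := by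
  obtain ⟨n, hn⟩ := h
  refine ⟨n, fun x => φ.symm.injective ?_⟩
  rw [map_smul, hn, map_zero]

theorem smul_eq_zero_of_dvd {R M : Type} [CommRing R] [AddCommGroup M] [Module R M] {p r : R}
    (h : p ∣ r) {x : M} (hx : p • x = 0) : r • x = 0 := by
  obtain ⟨c, rfl⟩ := h
  rw [mul_comm, mul_smul, hx, smul_zero]

theorem Supp.of_dvd {S T : Finset (Atom k)} (hST : aprod S ∣ aprod T) {M : Type} [AddCommGroup M]
    [Module k[X] M] (h : Supp S M) : Supp T M := by
  obtain ⟨n, hn⟩ := h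
  exact ⟨n, fun x => smul_eq_zero_of_dvd (pow_dvd_pow_of_dvd hST n) (hn x)⟩

theorem Supp.prod {S : Finset (Atom k)} {M N : Type} [AddCommGroup M] [Module k[X] M]
    [AddCommGroup N] [Module k[X] N] (hM : Supp S M) (hN : Supp S N) : Supp S (M × N) := by
  obtain ⟨n, hn⟩ := hM
  obtain ⟨m, hm⟩ := hN
  exact ⟨n + m, fun x => Prod.ext
    (smul_eq_zero_of_dvd (pow_dvd_pow _ (Nat.le_add_right _ _)) (hn _))
    (smul_eq_zero_of_dvd (pow_dvd_pow _ (Nat.le_add_left _ _)) (hm _))⟩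

theorem coprime_X_aprod (S : Finset (Atom k)) : IsCoprime X (aprod S) :=
  IsCoprime.prod_right fun a _ => a.coprime_X

theorem coprime_aprod {S : Finset (Atom k)} {a : Atom k} (ha : a ∉ S) :
    IsCoprime (aprod S) (aprod {a}) := by
  rw [aprod, aprod, Finset.prod_singleton]
  exact IsCoprime.prod_left fun b hb => Atom.coprime fun e => ha (e ▸ hb)

theorem Supp.X_injective {S : Finset (Atom k)} {M : Type} [AddCommGroup M] [Module k[X] M]
    (h : Supp S M) : Function.Injective fun x : M => (X : k[X]) • x := by
  obtain ⟨n, hn⟩ := h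
  intro x y hxy
  rw [← sub_eq_zero]
  refine eq_zero_of_isCoprime ((coprime_X_aprod S).pow_right (n := n)) ?_ (hn _)
  rw [smul_sub]
  exact sub_eq_zero.2 hxy

end ClassOf

end GLSmall

namespace GLSmall

open scoped BigOperators
open Polynomial
open Finset.HasAntidiagonal (antidiagonal)

section ClassCount

variable {k : Type} [Field k] [Fintype k] [DecidableEq k]

instance Cls.finite : Finite (Cls k) := by
  have : ∀ n : Fin 6, Finite (ConjClasses (GL (Fin n.1) k)) := fun n =>
    Finite.of_surjective ConjClasses.mk Quotient.mk_surjective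
  infer_instance

/-- The classes of a given size supported on a set of atoms. -/
noncomputable def clsWn (S : Finset (Atom k)) (n : ℕ) : Finset (Cls k) :=
  (Set.toFinite {v : Cls k | v.1.1 = n ∧ Supp S v.Mod}).toFinset

theorem mem_clsWn {S : Finset (Atom k)} {n : ℕ} {v : Cls k} :
    v ∈ clsWn S n ↔ v.1.1 = n ∧ Supp S v.Mod := by
  rw [clsWn, Set.Finite.mem_toFinset]
  rfl

/-- The class of a product. -/
noncomputable def clsProd (u v : Cls k) : Cls k := clsOf k (u.Mod × v.Mod)

theorem aprod_insert [DecidableEq (Atom k)] {S : Finset (Atom k)} {a : Atom k} (ha : a ∉ S) :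
    aprod (insert a S) = aprod {a} * aprod S := by
  rw [aprod, Finset.prod_insert ha, aprod, aprod, Finset.prod_singleton]

theorem clsProd_spec [DecidableEq (Atom k)] {S : Finset (Atom k)} {a : Atom k} (ha : a ∉ S)
    {u v : Cls k} (hu : Supp S u.Mod) (hv : Supp {a} v.Mod) (h5 : u.1.1 + v.1.1 ≤ 5) :
    (clsProd u v).1.1 = u.1.1 + v.1.1 ∧ Supp (insert a S) (clsProd u v).Mod ∧
      Nonempty ((u.Mod × v.Mod) ≃ₗ[k[X]] (clsProd u v).Mod) := by
  have hs : Supp (insert a S) (u.Mod × v.Mod) :=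
    (hu.of_dvd (by rw [aprod_insert ha]; exact dvd_mul_left _ _)).prod
      (hv.of_dvd (by rw [aprod_insert ha]; exact dvd_mul_right _ _))
  obtain ⟨h1, ⟨φ⟩⟩ := clsOf_deg (k := k) (M := u.Mod × v.Mod) hs.X_injective
    (n := u.1.1 + v.1.1) (by rw [Nat.card_prod, Cls.card_mod, Cls.card_mod, pow_add]) h5
  exact ⟨h1, hs.congr φ, ⟨φ⟩⟩

theorem Supp.exists_common {S : Finset (Atom k)} {M N : Type} [AddCommGroup M] [Module k[X] M]
    [AddCommGroup N] [Module k[X] N] (hM : Supp S M) (hN : Supp S N) :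
    ∃ n, (∀ x : M, aprod S ^ n • x = 0) ∧ ∀ x : N, aprod S ^ n • x = 0 := by
  obtain ⟨n, hn⟩ := hM.prod hN
  exact ⟨n, fun x => congrArg Prod.fst (hn (x, 0)), fun x => congrArg Prod.snd (hn (0, x))⟩

theorem clsProd_inj [DecidableEq (Atom k)] {S : Finset (Atom k)} {a : Atom k} (ha : a ∉ S)
    {u v u' v' : Cls k} (hu : Supp S u.Mod) (hv : Supp {a} v.Mod) (hu' : Supp S u'.Mod)
    (hv' : Supp {a} v'.Mod) (h5 : u.1.1 + v.1.1 ≤ 5) (h5' : u'.1.1 + v'.1.1 ≤ 5)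
    (h : clsProd u v = clsProd u' v') : u = u' ∧ v = v' := by
  obtain ⟨-, -, ⟨φ⟩⟩ := clsProd_spec ha hu hv h5
  obtain ⟨-, -, ⟨φ'⟩⟩ := clsProd_spec ha hu' hv' h5'
  rw [← h] at φ'
  obtain ⟨n, hn, hn'⟩ := hu.exists_common hu'
  obtain ⟨m, hm, hm'⟩ := hv.exists_common hv'
  have hc := (coprime_aprod ha).pow (m := n) (n := m)
  exact ⟨Cls.eq_of_equiv (prodFst hc hn hm hn' hm' (φ.trans φ'.symm)),
    Cls.eq_of_equiv (prodSnd hc hn hm hn' hm' (φ.trans φ'.symm))⟩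

theorem clsProd_cw [DecidableEq (Atom k)] {S : Finset (Atom k)} {a : Atom k} (ha : a ∉ S)
    {u v : Cls k} (hu : Supp S u.Mod) (hv : Supp {a} v.Mod) (h5 : u.1.1 + v.1.1 ≤ 5) :
    cw (clsProd u v).2 = cw u.2 * cw v.2 := by
  obtain ⟨-, -, ⟨φ⟩⟩ := clsProd_spec ha hu hv h5
  obtain ⟨n, hn⟩ := hu
  obtain ⟨m, hm⟩ := hv
  rw [Cls.cw_of_equiv φ, card_prod_aut ((coprime_aprod ha).pow (m := n) (n := m)) hn hm,
    Cls.cw_eq, Cls.cw_eq, Nat.cast_mul, mul_inv]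

theorem exists_card_eq_pow (k : Type) [Field k] [Fintype k]
    (M : Type) [AddCommGroup M] [Module k M] [Finite M] :
    ∃ n, Nat.card M = Nat.card k ^ n :=
  ⟨_, Module.natCard_eq_pow_finrank⟩

theorem exists_clsProd_eq [DecidableEq (Atom k)] {S : Finset (Atom k)} {a : Atom k} (ha : a ∉ S)
    {w : Cls k} (hw : Supp (insert a S) w.Mod) :
    ∃ u v : Cls k, u.1.1 + v.1.1 = w.1.1 ∧ Supp S u.Mod ∧ Supp {a} v.Mod ∧ clsProd u v = w := by
  obtain ⟨n, hn⟩ := id hw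
  have hc := (coprime_aprod ha).pow (m := n) (n := n)
  obtain ⟨φ⟩ := exists_equiv_torsionBy (M := w.Mod) hc (by
    intro x
    rw [← mul_pow, mul_comm, ← aprod_insert ha]
    exact hn x)
  obtain ⟨i, hi⟩ := exists_card_eq_pow k (Submodule.torsionBy k[X] w.Mod (aprod S ^ n))
  obtain ⟨j, hj⟩ := exists_card_eq_pow k (Submodule.torsionBy k[X] w.Mod (aprod {a} ^ n))
  have hij : i + j = w.1.1 := by
    have h := Nat.card_congr φ.toEquiv
    rw [Cls.card_mod, Nat.card_prod, hi, hj, ← pow_add] at h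
    exact (Nat.pow_right_injective (Finite.one_lt_card (α := k)) h).symm
  have hs : Supp S (Submodule.torsionBy k[X] w.Mod (aprod S ^ n)) :=
    ⟨n, fun x => Submodule.smul_torsionBy _ x⟩
  have ht : Supp {a} (Submodule.torsionBy k[X] w.Mod (aprod {a} ^ n)) :=
    ⟨n, fun x => Submodule.smul_torsionBy _ x⟩
  have hw5 := w.1.2
  obtain ⟨u, hu, ⟨α⟩⟩ := Cls.exists_equiv (k := k) hs.X_injective hi (by omega)
  obtain ⟨v, hv, ⟨β⟩⟩ := Cls.exists_equiv (k := k) ht.X_injective hj (by omega)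
  exact ⟨u, v, by rw [hu, hv, hij], hs.congr α, ht.congr β,
    clsOf_eq ((φ.trans (α.prodCongr β)).symm)⟩

theorem prod_clsWn_insert [DecidableEq (Atom k)] {S : Finset (Atom k)} {a : Atom k} (ha : a ∉ S)
    {n : ℕ} (hn : n ≤ 5) {M : Type} [CommMonoid M] (F : Cls k → M) :
    ∏ v ∈ clsWn (insert a S) n, F v =
      ∏ x ∈ antidiagonal n, ∏ u ∈ clsWn S x.1, ∏ v ∈ clsWn {a} x.2, F (clsProd u v) := by
  simp_rw [← Finset.prod_product' (f := fun u v => F (clsProd u v))]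
  rw [Finset.prod_sigma']
  symm
  have hmem : ∀ t : (_ : ℕ × ℕ) × Cls k × Cls k,
      t ∈ (antidiagonal n).sigma (fun x => clsWn S x.1 ×ˢ clsWn {a} x.2) ↔
      t.1.1 + t.1.2 = n ∧ (t.2.1.1.1 = t.1.1 ∧ Supp S t.2.1.Mod) ∧
        (t.2.2.1.1 = t.1.2 ∧ Supp {a} t.2.2.Mod) := by
    intro t
    rw [Finset.mem_sigma, Finset.mem_product, mem_clsWn, mem_clsWn,
      Finset.HasAntidiagonal.mem_antidiagonal]
  refine Finset.prod_bij (fun t _ => clsProd t.2.1 t.2.2) ?_ ?_ ?_ fun _ _ => rfl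
  · intro t ht
    obtain ⟨h, ⟨hu, hu'⟩, hv, hv'⟩ := (hmem t).1 ht
    obtain ⟨h1, h2, -⟩ := clsProd_spec ha hu' hv' (by omega)
    exact mem_clsWn.2 ⟨by omega, h2⟩
  · rintro ⟨⟨i, j⟩, u, v⟩ ht ⟨⟨i', j'⟩, u', v'⟩ ht' e
    obtain ⟨h, ⟨hu, hu'⟩, hv, hv'⟩ := (hmem _).1 ht
    obtain ⟨g, ⟨gu, gu'⟩, gv, gv'⟩ := (hmem _).1 ht'
    dsimp only at *
    obtain ⟨rfl, rfl⟩ := clsProd_inj ha hu' hv' gu' gv' (by omega) (by omega) e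
    obtain rfl : i = i' := by omega
    obtain rfl : j = j' := by omega
    rfl
  · intro w hw
    obtain ⟨h1, h2⟩ := mem_clsWn.1 hw
    obtain ⟨u, v, h, hu, hv, e⟩ := exists_clsProd_eq ha h2
    exact ⟨⟨(u.1.1, v.1.1), u, v⟩, (hmem _).2 ⟨by dsimp only; omega, ⟨rfl, hu⟩, rfl, hv⟩, e⟩

theorem clsWn_empty_of_ne {n : ℕ} (hn : n ≠ 0) : clsWn (∅ : Finset (Atom k)) n = ∅ := by
  refine Finset.eq_empty_of_forall_notMem fun v hv => ?_
  obtain ⟨rfl, N, hN⟩ := mem_clsWn.1 hv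
  have : Subsingleton v.Mod := ⟨fun x y => by
    have hx := hN x
    have hy := hN y
    rw [aprod, Finset.prod_empty, one_pow, one_smul] at hx hy
    rw [hx, hy]⟩
  have h := Cls.card_mod v
  rw [Nat.card_of_subsingleton (0 : v.Mod)] at h
  exact (Nat.one_lt_pow hn (Finite.one_lt_card (α := k))).ne h

theorem clsWn_zero (S : Finset (Atom k)) : ∃ v : Cls k, clsWn S 0 = {v} ∧ cw v.2 = 1 := by
  have hs : ∀ v : Cls k, v.1.1 = 0 → Subsingleton v.Mod := by
    intro v hv
    have h := Cls.card_mod v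
    rw [hv, pow_zero] at h
    exact (Nat.card_eq_one_iff_unique.1 h).1
  let v : Cls k := ⟨0, ConjClasses.mk 1⟩
  have hv := hs v rfl
  refine ⟨v, ?_, ?_⟩
  · ext u
    rw [mem_clsWn, Finset.mem_singleton]
    constructor
    · rintro ⟨hu, -⟩
      have := hs u hu
      exact Cls.eq_of_equiv (LinearEquiv.ofBijective (0 : u.Mod →ₗ[k[X]] v.Mod)
        ⟨fun _ _ _ => Subsingleton.elim _ _, fun y => ⟨0, Subsingleton.elim _ _⟩⟩)
    · rintro rfl
      exact ⟨rfl, 0, fun x => hv.elim _ _⟩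
  · have : Subsingleton (v.Mod ≃ₗ[k[X]] v.Mod) :=
      ⟨fun α β => LinearEquiv.ext fun x => hv.elim _ _⟩
    rw [Cls.cw_eq, Nat.card_of_subsingleton (LinearEquiv.refl _ _), Nat.cast_one, inv_one]

/-! ### Modules supported at one atom -/

theorem card_quot_pow {f : k[X]} (hf : f ≠ 0) (a : ℕ) :
    Nat.card (k[X] ⧸ Ideal.span {f ^ a}) = (Nat.card k ^ f.natDegree) ^ a := by
  have : Module.Finite k (k[X] ⧸ Ideal.span {f ^ a}) :=
    (AdjoinRoot.powerBasis (pow_ne_zero a hf)).finite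
  rw [Module.natCard_eq_pow_finrank (K := k), finrank_quotient_span_eq_natDegree, natDegree_pow,
    ← pow_mul, mul_comm]

theorem Atom.natDegree_pos (a : Atom k) : 0 < a.poly.natDegree := a.irr.natDegree_pos

theorem LM_supp (a : Atom k) {ι : Type} [Fintype ι] (e : ι → ℕ) : Supp {a} (LM a.poly e) := by
  refine ⟨∑ i, e i, fun x => funext fun i => ?_⟩
  rw [aprod, Finset.prod_singleton]
  obtain ⟨y, hy⟩ := Ideal.Quotient.mk_surjective (x i)
  change a.poly ^ _ • x i = 0
  rw [← hy]
  change Ideal.Quotient.mk _ (a.poly ^ _ * y) = 0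
  rw [Ideal.Quotient.eq_zero_iff_mem, Ideal.mem_span_singleton]
  exact (pow_dvd_pow _ (Finset.single_le_sum (f := e) (fun _ _ => Nat.zero_le _)
    (Finset.mem_univ i))).mul_right y

/-- The class of the module with a given list of exponents. -/
noncomputable def clsLM (a : Atom k) (l : List ℕ) : Cls k := clsOf k (LM a.poly l.get)

theorem card_LM_atom (a : Atom k) {ι : Type} [Fintype ι] (e : ι → ℕ) :
    Nat.card (LM a.poly e) = Nat.card k ^ (a.poly.natDegree * ∑ i, e i) := by
  rw [card_LM (card_quot_pow a.irr.ne_zero), pow_mul]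

theorem atom_pow_ne_zero (a : Atom k) : Nat.card k ^ a.poly.natDegree ≠ 0 :=
  pow_ne_zero _ Nat.card_pos.ne'

theorem finite_LM_atom (a : Atom k) {ι : Type} [Fintype ι] (e : ι → ℕ) :
    Finite (LM a.poly e) :=
  finite_LM (atom_pow_ne_zero a) (card_quot_pow a.irr.ne_zero) e

theorem clsLM_spec (a : Atom k) {m : ℕ} (hm : a.poly.natDegree * m ≤ 5) {l : List ℕ}
    (hl : l ∈ parts m) : (clsLM a l).1.1 = a.poly.natDegree * m ∧
      Nonempty (LM a.poly l.get ≃ₗ[k[X]] (clsLM a l).Mod) := by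
  have hm5 : m ≤ 5 := le_trans (Nat.le_mul_of_pos_left m a.natDegree_pos) hm
  have := finite_LM_atom a l.get
  refine clsOf_deg (LM_supp a l.get).X_injective ?_ hm
  rw [card_LM_atom, (parts_spec hm5 l hl).2.2]

theorem clsLM_cw (a : Atom k) {m : ℕ} (hm : a.poly.natDegree * m ≤ 5) {l : List ℕ}
    (hl : l ∈ parts m) :
    cw (clsLM a l).2 = (autQ l.get ((Nat.card k : ℚ) ^ a.poly.natDegree))⁻¹ := by
  have hm5 : m ≤ 5 := le_trans (Nat.le_mul_of_pos_left m a.natDegree_pos) hm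
  obtain ⟨-, ⟨φ⟩⟩ := clsLM_spec a hm hl
  obtain ⟨h1, h2, -⟩ := parts_spec hm5 l hl
  rw [Cls.cw_of_equiv φ, card_aut_eq a.irr (atom_pow_ne_zero a) (card_quot_pow a.irr.ne_zero)
    l.get h1 h2, Nat.cast_pow]

theorem clsLM_inj (a : Atom k) {m : ℕ} (hm : a.poly.natDegree * m ≤ 5) {l l' : List ℕ}
    (hl : l ∈ parts m) (hl' : l' ∈ parts m) (h : clsLM a l = clsLM a l') : l = l' := by
  have hm5 : m ≤ 5 := le_trans (Nat.le_mul_of_pos_left m a.natDegree_pos) hm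
  obtain ⟨-, ⟨φ⟩⟩ := clsLM_spec a hm hl
  obtain ⟨-, ⟨φ'⟩⟩ := clsLM_spec a hm hl'
  rw [← h] at φ'
  let ψ := φ.trans φ'.symm
  refine parts_inj hm5 l hl l' hl' fun j _ => ?_
  have hQ := card_quot_pow a.irr.ne_zero
  have hc : Nat.card {x : LM a.poly l.get // a.poly ^ j • x = 0} =
      Nat.card {x : LM a.poly l'.get // a.poly ^ j • x = 0} :=
    Nat.card_congr (Equiv.subtypeEquiv ψ.toEquiv fun x => by
      change _ ↔ a.poly ^ j • ψ x = 0
      rw [← map_smul, LinearEquiv.map_eq_zero_iff])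
  rw [card_LM_torsion a.irr hQ, card_LM_torsion a.irr hQ] at hc
  exact Nat.pow_right_injective
    (Nat.one_lt_pow a.natDegree_pos.ne' (Finite.one_lt_card (α := k))) hc

theorem clsWn_singleton_of_not_dvd (a : Atom k) {n : ℕ} (h : ¬ a.poly.natDegree ∣ n) :
    clsWn {a} n = ∅ := by
  refine Finset.eq_empty_of_forall_notMem fun v hv => h ?_
  obtain ⟨rfl, N, hN⟩ := mem_clsWn.1 hv
  rw [aprod, Finset.prod_singleton] at hN
  obtain ⟨l, -, -, ⟨φ⟩⟩ := exists_equiv_LM a.irr ⟨N, hN⟩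
  have hc := Nat.card_congr φ.toEquiv
  rw [Cls.card_mod, card_LM_atom] at hc
  exact ⟨_, Nat.pow_right_injective (Finite.one_lt_card (α := k)) hc⟩

theorem prod_clsWn_singleton (a : Atom k) {m : ℕ} (hm : a.poly.natDegree * m ≤ 5) {M : Type}
    [CommMonoid M] (F : Cls k → M) :
    ∏ v ∈ clsWn {a} (a.poly.natDegree * m), F v = ∏ l ∈ parts m, F (clsLM a l) := by
  have hm5 : m ≤ 5 := le_trans (Nat.le_mul_of_pos_left m a.natDegree_pos) hm
  symm
  refine Finset.prod_bij (fun l _ => clsLM a l) ?_ ?_ ?_ fun _ _ => rfl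
  · intro l hl
    obtain ⟨h, ⟨φ⟩⟩ := clsLM_spec a hm hl
    exact mem_clsWn.2 ⟨h, (LM_supp a l.get).congr φ⟩
  · exact fun l hl l' hl' h => clsLM_inj a hm hl hl' h
  · intro v hv
    obtain ⟨hn, N, hN⟩ := mem_clsWn.1 hv
    rw [aprod, Finset.prod_singleton] at hN
    obtain ⟨l, h1, h2, ⟨φ⟩⟩ := exists_equiv_LM a.irr ⟨N, hN⟩
    have hc := Nat.card_congr φ.toEquiv
    rw [Cls.card_mod, card_LM_atom, hn] at hc
    have h3 := Nat.eq_of_mul_eq_mul_left a.natDegree_pos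
      (Nat.pow_right_injective (Finite.one_lt_card (α := k)) hc)
    exact ⟨l, mem_parts hm5 l h1 h2 h3.symm, clsOf_eq φ.symm⟩

theorem one_lt_atom_pow (a : Atom k) : 1 < (Nat.card k : ℚ) ^ a.poly.natDegree :=
  one_lt_pow₀ (by exact_mod_cast Finite.one_lt_card (α := k)) a.natDegree_pos.ne'

theorem card_clsWn_singleton (a : Atom k) {n : ℕ} (hn : n ≤ 5) :
    (clsWn {a} n).card = spread 0 nt a.poly.natDegree n := by
  unfold spread
  split_ifs with h
  · obtain ⟨m, rfl⟩ := h
    have hm5 : m ≤ 5 := le_trans (Nat.le_mul_of_pos_left m a.natDegree_pos) hn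
    have := congrArg Multiplicative.toAdd
      (prod_clsWn_singleton a hn fun _ => Multiplicative.ofAdd 1)
    simp only [toAdd_prod, toAdd_ofAdd, Finset.sum_const, smul_eq_mul, mul_one] at this
    rw [this, Nat.mul_div_cancel_left _ a.natDegree_pos, card_parts hm5]
  · rw [clsWn_singleton_of_not_dvd a h, Finset.card_empty]

theorem prod_cw_singleton (a : Atom k) {n : ℕ} (hn : n ≤ 5) :
    ∏ v ∈ clsWn {a} n, cw v.2 =
      spread 1 (fun m => ct m ((Nat.card k : ℚ) ^ a.poly.natDegree)) a.poly.natDegree n := by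
  unfold spread
  split_ifs with h
  · obtain ⟨m, rfl⟩ := h
    have hm5 : m ≤ 5 := le_trans (Nat.le_mul_of_pos_left m a.natDegree_pos) hn
    rw [prod_clsWn_singleton a hn fun v => cw v.2, Nat.mul_div_cancel_left _ a.natDegree_pos]
    exact (Finset.prod_congr rfl fun l hl => clsLM_cw a hn hl).trans
      (prod_parts hm5 (one_lt_atom_pow a))
  · rw [clsWn_singleton_of_not_dvd a h, Finset.prod_empty]

theorem sum_cw_singleton (a : Atom k) {n : ℕ} (hn : n ≤ 5) :
    ∑ v ∈ clsWn {a} n, cw v.2 =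
      spread 0 (fun m => et m ((Nat.card k : ℚ) ^ a.poly.natDegree)) a.poly.natDegree n := by
  unfold spread
  split_ifs with h
  · obtain ⟨m, rfl⟩ := h
    have hm5 : m ≤ 5 := le_trans (Nat.le_mul_of_pos_left m a.natDegree_pos) hn
    have := congrArg Multiplicative.toAdd
      (prod_clsWn_singleton a hn fun v => Multiplicative.ofAdd (cw v.2))
    simp only [toAdd_prod, toAdd_ofAdd] at this
    rw [this, Nat.mul_div_cancel_left _ a.natDegree_pos]
    exact (Finset.sum_congr rfl fun l hl => clsLM_cw a hn hl).trans
      (sum_parts hm5 (one_lt_atom_pow a))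
  · rw [clsWn_singleton_of_not_dvd a h, Finset.sum_empty]

/-- The counting data of conjugacy classes. -/
noncomputable def clsCount (k : Type) [Field k] [Fintype k] [DecidableEq k]
    [DecidableEq (Atom k)] : Count (Atom k) :=
  Count.ofWn (fun a => a.poly.natDegree) clsWn (fun v => cw v.2) (fun v => cw v.2)
    (fun a => a.natDegree_pos) (fun a => a.deg_le)
    (by
      obtain ⟨v, h, h'⟩ := clsWn_zero (∅ : Finset (Atom k))
      exact ⟨v, h, h', h'⟩)
    (fun n hn => clsWn_empty_of_ne hn)
    (fun a S n hn ha => ⟨clsProd, fun F => prod_clsWn_insert ha hn F, fun i j hij u hu v hv => by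
      obtain ⟨h1, h2⟩ := mem_clsWn.1 hu
      obtain ⟨h3, h4⟩ := mem_clsWn.1 hv
      have := clsProd_cw ha h2 h4 (by omega)
      exact ⟨this, this⟩⟩)
    (fun a n hn => card_clsWn_singleton a hn)
    (fun a n hn => by
      split_ifs with h
      · obtain ⟨v, hv, hw⟩ := clsWn_zero ({a} : Finset (Atom k))
        rw [h, hv, Finset.sum_singleton, hw]
      · rw [clsWn_singleton_of_not_dvd a fun hd => absurd (Nat.le_of_dvd (Nat.pos_of_ne_zero h) hd)
          (by omega), Finset.sum_empty])

end ClassCount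

end GLSmall

namespace GLSmall

open scoped BigOperators
open Polynomial

section ClassUniv

variable {k : Type} [Field k] [Fintype k] [DecidableEq k]

theorem exists_dvd_aprod_pow [Fintype (Atom k)] : ∀ (n : ℕ) (χ : k[X]), χ.Monic → χ.natDegree ≤ n →
    n ≤ 5 → ¬ X ∣ χ → ∃ N, χ ∣ aprod (Finset.univ : Finset (Atom k)) ^ N := by
  intro n
  induction n with
  | zero =>
    intro χ hm h0 _ _
    rw [hm.natDegree_eq_zero.1 (by omega)]
    exact ⟨0, one_dvd _⟩
  | succ n ih =>
    intro χ hm hd hn hX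
    by_cases h0 : χ.natDegree = 0
    · rw [hm.natDegree_eq_zero.1 h0]
      exact ⟨0, one_dvd _⟩
    · obtain ⟨p, hpm, hpi, r, rfl⟩ := exists_monic_irreducible_factor χ
        (not_isUnit_of_natDegree_pos χ (Nat.pos_of_ne_zero h0))
      have hrm : r.Monic := hpm.of_mul_monic_left hm
      rw [hpm.natDegree_mul hrm] at hd
      have hp := hpi.natDegree_pos
      obtain ⟨N, hN⟩ := ih r hrm (by omega) (by omega) fun h => hX (h.mul_left p)
      let a : Atom k := ⟨p, hpm, hpi, fun h => hX (h ▸ dvd_mul_right _ _), by omega⟩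
      refine ⟨N + 1, ?_⟩
      rw [pow_succ']
      exact mul_dvd_mul (Finset.dvd_prod_of_mem (fun a : Atom k => a.poly) (Finset.mem_univ a)) hN

theorem Md.supp_univ [Fintype (Atom k)] {n : ℕ} (hn : n ≤ 5) (g : GL (Fin n) k) :
    Supp (Finset.univ : Finset (Atom k)) (Md g) := by
  let φ : (Fin n → k) →ₗ[k] (Fin n → k) := (glEquiv n g).toLinearMap
  have hd : φ.charpoly.natDegree = n := by rw [LinearMap.charpoly_natDegree, Module.finrank_fin_fun]
  have hX : ¬ X ∣ φ.charpoly := by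
    rw [X_dvd_iff]
    intro h
    have hu : IsUnit (LinearMap.det φ) := LinearEquiv.isUnit_det' (glEquiv n g)
    rw [LinearMap.det_eq_sign_charpoly_coeff, h, mul_zero] at hu
    exact not_isUnit_zero hu
  obtain ⟨N, hN⟩ := exists_dvd_aprod_pow n φ.charpoly φ.charpoly_monic hd.le hn hX
  refine ⟨N, fun x => smul_eq_zero_of_dvd hN ?_⟩
  apply (Module.AEval'.of φ).symm.injective
  rw [Module.AEval.of_symm_smul, φ.aeval_self_charpoly, map_zero, zero_smul]

theorem prod_clsWn_univ [Fintype (Atom k)] {n : ℕ} (hn : n ≤ 5)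
    [Fintype (ConjClasses (GL (Fin n) k))] {M : Type} [CommMonoid M] (F : Cls k → M) :
    ∏ v ∈ clsWn (Finset.univ : Finset (Atom k)) n, F v =
      ∏ c : ConjClasses (GL (Fin n) k), F ⟨⟨n, by omega⟩, c⟩ := by
  symm
  refine Finset.prod_bij (fun c _ => (⟨⟨n, by omega⟩, c⟩ : Cls k)) ?_ ?_ ?_ fun _ _ => rfl
  · exact fun c _ => mem_clsWn.2 ⟨rfl, Md.supp_univ hn _⟩
  · intro c _ d _ h
    exact eq_of_heq (Sigma.mk.inj h).2
  · rintro ⟨⟨m, hm⟩, c⟩ hv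
    obtain ⟨rfl, -⟩ := mem_clsWn.1 hv
    exact ⟨c, Finset.mem_univ _, rfl⟩

theorem card_clsWn_univ [Fintype (Atom k)] {n : ℕ} (hn : n ≤ 5) :
    (clsWn (Finset.univ : Finset (Atom k)) n).card = Nat.card (ConjClasses (GL (Fin n) k)) := by
  classical
  have : Fintype (ConjClasses (GL (Fin n) k)) :=
    @Fintype.ofFinite _ (Finite.of_surjective ConjClasses.mk Quotient.mk_surjective)
  have h := congrArg Multiplicative.toAdd
    (prod_clsWn_univ (k := k) hn fun _ => Multiplicative.ofAdd 1)
  simp only [toAdd_prod, toAdd_ofAdd, Finset.sum_const, smul_eq_mul, mul_one] at h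
  rw [h, Finset.card_univ, Nat.card_eq_fintype_card]

theorem sum_cw_univ [Fintype (Atom k)] {n : ℕ} (hn : n ≤ 5) :
    ∑ v ∈ clsWn (Finset.univ : Finset (Atom k)) n, cw v.2 = 1 := by
  classical
  have : Fintype (ConjClasses (GL (Fin n) k)) :=
    @Fintype.ofFinite _ (Finite.of_surjective ConjClasses.mk Quotient.mk_surjective)
  have h := congrArg Multiplicative.toAdd
    (prod_clsWn_univ (k := k) hn fun v => Multiplicative.ofAdd (cw v.2))
  simp only [toAdd_prod, toAdd_ofAdd] at h
  rw [h, sum_cw]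

/-! ### The number of irreducible polynomials -/

variable [Fintype (Atom k)]

theorem card_linear_atoms_le :
    (Finset.univ.filter fun a : Atom k => a.poly.natDegree = 1).card ≤ Fintype.card k - 1 := by
  rw [← Finset.card_univ, ← Finset.card_erase_of_mem (Finset.mem_univ (0 : k))]
  have hp : ∀ a : Atom k, a.poly.natDegree = 1 → a.poly = X + C (a.poly.coeff 0) := fun a ha => by
    have h1 : a.poly.coeff 1 = 1 := by rw [← ha]; exact a.monic
    conv_lhs => rw [eq_X_add_C_of_natDegree_le_one ha.le, h1, C_1, one_mul]
  refine Finset.card_le_card_of_injOn (fun a => a.poly.coeff 0) ?_ ?_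
  · intro a ha
    have ha := (Finset.mem_filter.1 (Finset.mem_coe.1 ha)).2
    refine Finset.mem_coe.2 (Finset.mem_erase.2 ⟨fun h0 => a.ne_X ?_, Finset.mem_univ _⟩)
    rw [hp a ha]
    dsimp only at h0
    rw [h0, C_0, add_zero]
  · intro a ha b hb h
    have ha := (Finset.mem_filter.1 (Finset.mem_coe.1 ha)).2
    have hb := (Finset.mem_filter.1 (Finset.mem_coe.1 hb)).2
    dsimp only at h
    exact Atom.ext' (by rw [hp a ha, hp b hb, h])

theorem le_mul_card_atoms {n m : ℕ} (h2 : 2 ≤ n) (h5 : n ≤ 5) (hm : m ≠ 0)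
    (hd : ∀ d, d ∣ n → d ≠ n → d ∣ m) : Fintype.card k ^ n ≤ Fintype.card k ^ m +
      n * (Finset.univ.filter fun a : Atom k => a.poly.natDegree = n).card := by
  classical
  obtain ⟨p, hp⟩ := CharP.exists k
  have : Fact p.Prime := ⟨CharP.char_is_prime k p⟩
  have : NeZero n := ⟨by omega⟩
  let L := FiniteField.Extension k p n
  have : Fintype L := Fintype.ofFinite L
  have hL : Fintype.card L = Fintype.card k ^ n := by
    rw [← Nat.card_eq_fintype_card, ← Nat.card_eq_fintype_card]
    exact FiniteField.natCard_extension k p n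
  have h_int : ∀ x : L, IsIntegral k x := fun x => Algebra.IsIntegral.isIntegral x
  have hdeg : ∀ x : L, x ^ Nat.card k ^ m ≠ x → (minpoly k x).natDegree = n := by
    intro x hx
    by_contra h
    refine hx ?_
    have h1 : (minpoly k x).natDegree ∣ n := by
      have := minpoly.degree_dvd (h_int x)
      rwa [FiniteField.finrank_extension] at this
    have h3 :=
      (minpoly.irreducible (h_int x)).natDegree_dvd_iff_dvd_X_pow_card_pow_sub_X.1 (hd _ h1 h)
    have h4 := (minpoly.dvd_iff).1 h3
    simpa [sub_eq_zero] using h4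
  rw [← hL, ← Finset.card_univ,
    ← Finset.card_filter_add_card_filter_not (s := Finset.univ) fun x : L => x ^ Nat.card k ^ m = x]
  refine Nat.add_le_add ?_ ?_
  · have hne : (X ^ Nat.card k ^ m - X : L[X]) ≠ 0 :=
      FiniteField.X_pow_card_pow_sub_X_ne_zero L hm Finite.one_lt_card
    have hsub : (Finset.univ.filter fun x : L => x ^ Nat.card k ^ m = x) ⊆
        (X ^ Nat.card k ^ m - X : L[X]).roots.toFinset := by
      intro x hx
      rw [Multiset.mem_toFinset, mem_roots hne, IsRoot, eval_sub, eval_pow, eval_X,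
        (Finset.mem_filter.1 hx).2, sub_self]
    refine (Finset.card_le_card hsub).trans ((Multiset.toFinset_card_le _).trans
      ((card_roots' _).trans ?_))
    rw [FiniteField.X_pow_card_pow_sub_X_natDegree_eq L hm Finite.one_lt_card,
      Nat.card_eq_fintype_card]
  · let F : L → k[X] := fun x => minpoly k x
    have hfib := Finset.card_le_mul_card_image (f := F)
      (Finset.univ.filter fun x : L => ¬ x ^ Nat.card k ^ m = x) n (by
        intro b hb
        obtain ⟨y, hy, rfl⟩ := Finset.mem_image.1 hb
        have hdy := hdeg y (Finset.mem_filter.1 hy).2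
        have hsub : ((Finset.univ.filter fun x : L => ¬ x ^ Nat.card k ^ m = x).filter
            fun x => F x = F y) ⊆ ((F y).aroots L).toFinset := by
          intro x hx
          rw [Multiset.mem_toFinset, mem_aroots]
          refine ⟨minpoly.ne_zero (h_int y), ?_⟩
          rw [← (Finset.mem_filter.1 hx).2]
          exact minpoly.aeval k x
        refine (Finset.card_le_card hsub).trans ((Multiset.toFinset_card_le _).trans
          ((card_roots' _).trans ?_))
        rw [natDegree_map]
        exact hdy.le)
    refine hfib.trans (Nat.mul_le_mul_left n ?_)
    refine (Finset.card_le_card (t := (Finset.univ.filter fun a : Atom k =>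
      a.poly.natDegree = n).image fun a => a.poly) ?_).trans Finset.card_image_le
    intro b hb
    obtain ⟨y, hy, rfl⟩ := Finset.mem_image.1 hb
    have hdy := hdeg y (Finset.mem_filter.1 hy).2
    refine Finset.mem_image.2 ⟨⟨F y, minpoly.monic (h_int y), minpoly.irreducible (h_int y),
      fun h => ?_, hdy.le.trans h5⟩, Finset.mem_filter.2 ⟨Finset.mem_univ _, hdy⟩, rfl⟩
    have h' : (F y).natDegree = n := hdy
    rw [h, natDegree_X] at h'
    omega

theorem card_linear_atoms_le_card_atoms {n : ℕ} (h2 : 2 ≤ n) (h5 : n ≤ 5) :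
    (Finset.univ.filter fun a : Atom k => a.poly.natDegree = 1).card ≤
      (Finset.univ.filter fun a : Atom k => a.poly.natDegree = n).card := by
  refine card_linear_atoms_le.trans ?_
  obtain ⟨r, hr⟩ : ∃ r, Fintype.card k = r + 2 :=
    Nat.exists_eq_add_of_le' (Fintype.one_lt_card (α := k))
  have key : ∀ m, n * (r + 1) + (r + 2) ^ m ≤ (r + 2) ^ n →
      (Fintype.card k ^ n ≤ Fintype.card k ^ m +
      n * (Finset.univ.filter fun a : Atom k => a.poly.natDegree = n).card) →
      Fintype.card k - 1 ≤ (Finset.univ.filter fun a : Atom k => a.poly.natDegree = n).card := by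
    intro m h h'
    rw [hr] at h' ⊢
    refine Nat.le_of_mul_le_mul_left (?_ : n * (r + 2 - 1) ≤ n * _) (by omega : 0 < n)
    rw [show r + 2 - 1 = r + 1 from rfl]
    omega
  obtain rfl | rfl | rfl | rfl : n = 2 ∨ n = 3 ∨ n = 4 ∨ n = 5 := by omega
  · refine key 1 ?_ (le_mul_card_atoms h2 h5 one_ne_zero ?_)
    · exact Nat.le.intro (k := r ^ 2 + r) (by ring)
    · intro d hd h
      have := Nat.le_of_dvd (by omega) hd
      interval_cases d <;> omega
  · refine key 1 ?_ (le_mul_card_atoms h2 h5 one_ne_zero ?_)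
    · exact Nat.le.intro (k := r ^ 3 + 6 * r ^ 2 + 8 * r + 3) (by ring)
    · intro d hd h
      have := Nat.le_of_dvd (by omega) hd
      interval_cases d <;> omega
  · refine key 2 ?_ (le_mul_card_atoms h2 h5 two_ne_zero ?_)
    · exact Nat.le.intro (k := r ^ 4 + 8 * r ^ 3 + 23 * r ^ 2 + 24 * r + 8) (by ring)
    · intro d hd h
      have := Nat.le_of_dvd (by omega) hd
      interval_cases d <;> omega
  · refine key 1 ?_ (le_mul_card_atoms h2 h5 one_ne_zero ?_)
    · exact Nat.le.intro (k := r ^ 5 + 10 * r ^ 4 + 40 * r ^ 3 + 80 * r ^ 2 + 74 * r + 25) (by ring)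
    · intro d hd h
      have := Nat.le_of_dvd (by omega) hd
      interval_cases d <;> omega

end ClassUniv

end GLSmall

open GLSmall in
/-- For every finite field `k` and every `2 ≤ n ≤ 5`, `h(GL_n(k))` is an integer. -/
theorem harada_GL_small_n (k : Type) [Field k] [Fintype k] (n : ℕ)
    (h2 : 2 ≤ n) (h5 : n ≤ 5) :
    ∃ z : ℤ, groupH (GL (Fin n) k) = (z : ℚ) := by
  classical
  obtain ⟨ψ, hψ⟩ := exists_addChar k
  have : Fintype (Atom k) := @Fintype.ofFinite _ Atom.finite
  have : Fintype (ConjClasses (GL (Fin n) k)) :=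
    @Fintype.ofFinite _ (Finite.of_surjective ConjClasses.mk Quotient.mk_surjective)
  have h := (glPsh hψ).exists_intMul (clsCount k)
    (fun m hm => (card_Irr_deg m hm).trans (card_clsWn_univ hm).symm)
    (fun m hm => (sum_whit_relDeg ψ m hm).trans (sum_cw_univ hm).symm)
    (fun b m hm => by
      have := sum_cw_singleton b hm
      rwa [Nat.card_eq_fintype_card] at this)
    (fun b m hm => by
      have := prod_cw_singleton b hm
      rwa [Nat.card_eq_fintype_card] at this)
    (fun m h2 h5 => card_linear_atoms_le_card_atoms h2 h5) h2 h5
  have hpi : (clsCount k).pi Finset.univ n = ∏ c : ConjClasses (GL (Fin n) k), cw c :=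
    prod_clsWn_univ h5 fun v => cw v.2
  have hN : (clsCount k).N Finset.univ n = Fintype.card (ConjClasses (GL (Fin n) k)) :=
    (card_clsWn_univ h5).trans Nat.card_eq_fintype_card
  rw [hpi, hN] at h
  exact isInt_of_intMul n h5 h
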